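/- Let B₁, …, B_r be pairwise commuting diagonalizable invertible g×g matrices over ℂ, let u, v ∈ ℂ^g, and let W ⊆ ℂ^g be a linear subspace. Then the set of tuples (n₁,…,n_r) ∈ ℕ^r for which B₁^{n₁}⋯B_r^{n_r}·u ∈ v + W belongs to the class 𝒞. -/

import Mathlib

/-- The set of points of `ℕ^r` lying in the subgroup `H` of `ℤ^r`. -/
def natPart {r : ℕ} (H : AddSubgroup (Fin r → ℤ)) : Set (Fin r → ℕ) :=
  {n | (fun i => (n i : ℤ)) ∈ H}

/-- The class `𝒞` of finite unions of sets `γ + (H ∩ ℕ^r)` with `γ ∈ ℕ^r`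
and `H` a subgroup of `ℤ^r`. -/
def inC {r : ℕ} (E : Set (Fin r → ℕ)) : Prop :=
  ∃ (ℓ : ℕ) (γ : Fin ℓ → (Fin r → ℕ)) (H : Fin ℓ → AddSubgroup (Fin r → ℤ)),
    E = ⋃ i, (fun s => γ i + s) '' natPart (H i)

/-- A square matrix over a field is diagonalizable if it is conjugate, by an
invertible matrix, to a diagonal matrix. -/
def Matrix.IsDiagonalizable {n : Type*} [Fintype n] [DecidableEq n]
    {F : Type*} [Field F] (M : Matrix n n F) : Prop :=
  ∃ P : (Matrix n n F)ˣ,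
    ((P : Matrix n n F) * M * ((P⁻¹ : (Matrix n n F)ˣ) : Matrix n n F)).IsDiag

section Wron

open MvPolynomial in
/-- The diagonal operator multiplying the monomial `z ^ a` by `∏ i, (a i).choose (μ i)`;
it equals `z ^ μ` times the Hasse derivative of order `μ`. -/
noncomputable def binOp {K : Type*} [Field K] {n : ℕ} (μ : Fin n → ℕ) :
    MvPolynomial (Fin n) K →ₗ[K] MvPolynomial (Fin n) K :=
  (basisMonomials (Fin n) K).constr K
    (fun a => monomial a ((∏ i, (a i).choose (μ i) : ℕ) : K))

open MvPolynomial in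
lemma binOp_monomial {K : Type*} [Field K] {n : ℕ} (μ : Fin n → ℕ) (a : Fin n →₀ ℕ) (c : K) :
    binOp μ (monomial a c) = monomial a (((∏ i, (a i).choose (μ i) : ℕ) : K) * c) := by
  have h : (monomial a c : MvPolynomial (Fin n) K) = c • basisMonomials (Fin n) K a := by
    simp [smul_monomial]
  rw [h, map_smul, binOp, Module.Basis.constr_basis, smul_monomial, smul_eq_mul, mul_comm]

open MvPolynomial in
lemma coeff_binOp {K : Type*} [Field K] {n : ℕ} (μ : Fin n → ℕ) (P : MvPolynomial (Fin n) K)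
    (a : Fin n →₀ ℕ) :
    coeff a (binOp μ P) = ((∏ i, (a i).choose (μ i) : ℕ) : K) * coeff a P := by
  classical
  induction P using MvPolynomial.induction_on' with
  | monomial b c =>
    rw [binOp_monomial, coeff_monomial, coeff_monomial]
    split_ifs with h
    · rw [h]
    · simp
  | add p q hp hq => rw [map_add, coeff_add, coeff_add, hp, hq, mul_add]

/-- Functions on a finite family of points of `ℕ ^ n` spanned by binomials of degree `≤ e`. -/
def binSpan {K : Type*} [Field K] {n s : ℕ} (a : Fin s → Fin n →₀ ℕ) (e : ℕ) :
    Submodule K (Fin s → K) :=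
  Submodule.span K {f | ∃ μ : Fin n → ℕ, ∑ i, μ i ≤ e ∧
    f = fun k => ((∏ i, (a k i).choose (μ i) : ℕ) : K)}

lemma mul_coord_mem_binSpan {K : Type*} [Field K] {n s : ℕ} (a : Fin s → Fin n →₀ ℕ) (e : ℕ)
    (i : Fin n) (f : Fin s → K) (hf : f ∈ binSpan a e) :
    (fun k => (a k i : K) * f k) ∈ binSpan (K := K) a (e + 1) := by
  classical
  induction hf using Submodule.span_induction with
  | mem x hx =>
    obtain ⟨μ, hμ, rfl⟩ := hx
    have key : (fun k => (a k i : K) * ((∏ i, (a k i).choose (μ i) : ℕ) : K)) =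
        ((μ i + 1 : ℕ) : K) • (fun k => ((∏ j, (a k j).choose
          ((Function.update μ i (μ i + 1)) j) : ℕ) : K)) +
        ((μ i : ℕ) : K) • (fun k => ((∏ i, (a k i).choose (μ i) : ℕ) : K)) := by
      funext k
      simp only [Pi.add_apply, Pi.smul_apply, smul_eq_mul]
      norm_cast
      rw [← Finset.mul_prod_erase Finset.univ (fun j => (a k j).choose (μ j)) (Finset.mem_univ i),
        ← Finset.mul_prod_erase Finset.univ
          (fun j => (a k j).choose (Function.update μ i (μ i + 1) j)) (Finset.mem_univ i)]
      have : ∏ j ∈ Finset.univ.erase i, (a k j).choose (Function.update μ i (μ i + 1) j)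
          = ∏ j ∈ Finset.univ.erase i, (a k j).choose (μ j) := by
        apply Finset.prod_congr rfl
        intro j hj
        rw [Function.update_of_ne (Finset.ne_of_mem_erase hj)]
      rw [this, Function.update_self]
      have h2 : a k i * (a k i).choose (μ i) =
          (μ i + 1) * (a k i).choose (μ i + 1) + μ i * (a k i).choose (μ i) := by
        have := Nat.choose_succ_right_eq (a k i) (μ i)
        rcases le_total (μ i) (a k i) with h | h
        · zify [h] at this ⊢
          linarith
        · rcases h.eq_or_lt with h | h
          · simp [h]
          · simp [Nat.choose_eq_zero_of_lt h, Nat.choose_eq_zero_of_lt (h.trans (Nat.lt_succ_self _))]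
      rw [← mul_assoc, h2, add_mul, mul_assoc, mul_assoc]
    rw [key]
    refine Submodule.add_mem _ (Submodule.smul_mem _ _ (Submodule.subset_span ⟨_, ?_, rfl⟩))
      (Submodule.smul_mem _ _ (Submodule.subset_span ⟨μ, by omega, rfl⟩))
    rw [Finset.sum_update_of_mem (Finset.mem_univ i)]
    have := Finset.add_sum_erase Finset.univ μ (Finset.mem_univ i)
    rw [← Finset.erase_eq]
    omega
  | zero =>
    convert Submodule.zero_mem (binSpan (K := K) a (e + 1)) using 1
    funext k
    simp
  | add x y _ _ hx hy =>
    convert Submodule.add_mem _ hx hy using 1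
    funext k
    simp [mul_add]
  | smul c x _ hx =>
    convert Submodule.smul_mem _ c hx using 1
    funext k
    simp only [Pi.smul_apply, smul_eq_mul]
    ring

lemma binSpan_mono {K : Type*} [Field K] {n s : ℕ} (a : Fin s → Fin n →₀ ℕ) {e e' : ℕ}
    (h : e ≤ e') : binSpan (K := K) a e ≤ binSpan a e' :=
  Submodule.span_mono fun _ ⟨μ, hμ, hf⟩ => ⟨μ, hμ.trans h, hf⟩

lemma binSpan_eq_top {K : Type*} [Field K] [CharZero K] {n s : ℕ} (a : Fin s → Fin n →₀ ℕ)
    (ha : Function.Injective a) : binSpan (K := K) a (s - 1) = ⊤ := by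
  classical
  have key : ∀ (j : Fin s) (T : Finset (Fin s)), j ∉ T →
      ∃ f ∈ binSpan (K := K) a T.card, f j ≠ 0 ∧ ∀ k ∈ T, f k = 0 := by
    intro j T
    induction T using Finset.induction_on with
    | empty =>
      intro _
      exact ⟨fun _ => 1, Submodule.subset_span ⟨0, by simp, by simp⟩, by simp, by simp⟩
    | insert t T ht ih =>
      intro hj
      simp only [Finset.mem_insert, not_or] at hj
      obtain ⟨f, hf, hfj, hfT⟩ := ih hj.2
      have hne : a j ≠ a t := fun h => hj.1 (ha h)
      obtain ⟨i, hi⟩ := Finsupp.ne_iff.mp hne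
      refine ⟨(fun k => (a k i : K) * f k) - (a t i : K) • f, ?_, ?_, ?_⟩
      · rw [Finset.card_insert_of_notMem ht]
        exact Submodule.sub_mem _ (mul_coord_mem_binSpan a _ i f hf)
          (Submodule.smul_mem _ _ (binSpan_mono a (Nat.le_succ _) hf))
      · simp only [Pi.sub_apply, Pi.smul_apply, smul_eq_mul, ← sub_mul]
        refine mul_ne_zero (sub_ne_zero.mpr ?_) hfj
        exact_mod_cast hi
      · intro k hk
        simp only [Pi.sub_apply, Pi.smul_apply, smul_eq_mul, ← sub_mul]
        rcases Finset.mem_insert.mp hk with rfl | hk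
        · simp
        · simp [hfT k hk]
  rw [eq_top_iff, ← (Pi.basisFun K (Fin s)).span_eq, Submodule.span_le]
  rintro _ ⟨j, rfl⟩
  obtain ⟨f, hf, hfj, hfT⟩ := key j (Finset.univ.erase j) (by simp)
  have hc : (Finset.univ.erase j).card = s - 1 := by simp
  rw [hc] at hf
  have : Pi.basisFun K (Fin s) j = (f j)⁻¹ • f := by
    funext k
    by_cases hk : k = j
    · subst hk; simp [hfj]
    · simp [hk, hfT k (by simp [hk])]
  rw [this]
  exact Submodule.smul_mem _ _ hf

lemma exists_det_choose_ne_zero {K : Type*} [Field K] [CharZero K] {n s : ℕ}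
    (a : Fin s → Fin n →₀ ℕ) (ha : Function.Injective a) :
    ∃ μ : Fin s → Fin n → ℕ, (∀ i, ∑ j, μ i j ≤ s - 1) ∧
      (Matrix.of fun i k => ((∏ j, (a k j).choose (μ i j) : ℕ) : K)).det ≠ 0 := by
  classical
  have htop := binSpan_eq_top (K := K) a ha
  obtain ⟨b, hbs, hb, hli⟩ := exists_linearIndependent K {f | ∃ μ : Fin n → ℕ, ∑ i, μ i ≤ s - 1 ∧
    f = fun k => ((∏ i, (a k i).choose (μ i) : ℕ) : K)}
  rw [← binSpan, htop] at hb
  let B := Module.Basis.mk hli (by simp [hb])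
  have : Fintype b := FiniteDimensional.fintypeBasisIndex B
  have hcard : Fintype.card b = s := by
    rw [← Module.finrank_eq_card_basis B]; simp
  let e := (Fintype.equivFinOfCardEq hcard).symm
  choose μ hμ hf using fun i : Fin s => hbs (e i).2
  refine ⟨μ, hμ, ?_⟩
  have hli2 : LinearIndependent K (fun i : Fin s => ((e i : b) : Fin s → K)) :=
    hli.comp e e.injective
  have : (Matrix.of fun i k => ((∏ j, (a k j).choose (μ i j) : ℕ) : K)).row =
      (fun i : Fin s => ((e i : b) : Fin s → K)) := by
    funext i
    rw [hf i]
    rfl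
  rw [← this, Matrix.linearIndependent_rows_iff_isUnit, Matrix.isUnit_iff_isUnit_det] at hli2
  exact hli2.ne_zero

open MvPolynomial in
/-- A finite-dimensional space of polynomials contains `finrank` many elements with pairwise
distinct leading exponents. -/
lemma exists_injective_degree {K : Type*} [Field K] {n s : ℕ} (m : MonomialOrder (Fin n))
    (f : Fin s → MvPolynomial (Fin n) K) (hf : LinearIndependent K f) :
    ∃ A : Matrix (Fin s) (Fin s) K,
      (∀ k, ∑ j, A k j • f j ≠ 0) ∧ Function.Injective fun k => m.degree (∑ j, A k j • f j) := by
  classical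
  let W := Submodule.span K (Set.range f)
  have hW : Module.finrank K W = s := by
    rw [finrank_span_eq_card hf]; simp
  have : FiniteDimensional K W := FiniteDimensional.span_of_finite K (Set.finite_range f)
  let T : Finset (Fin n →₀ ℕ) := Finset.univ.biUnion fun j => (f j).support
  have hT : ∀ p ∈ W, p.support ⊆ T := by
    intro p hp
    induction hp using Submodule.span_induction with
    | mem x hx =>
      obtain ⟨j, rfl⟩ := hx
      exact Finset.subset_biUnion_of_mem (fun j => (f j).support) (Finset.mem_univ j)
    | zero => simp
    | add x y _ _ hx hy => exact support_add.trans (Finset.union_subset hx hy)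
    | smul c x _ hx => exact support_smul.trans hx
  let D := T.filter fun a => ∃ p ∈ W, p ≠ 0 ∧ m.degree p = a
  let φ : W →ₗ[K] (D → K) :=
    { toFun := fun p a => coeff a.1 p.1
      map_add' := by intros; funext; simp
      map_smul' := by intros; funext; simp }
  have hφ : Function.Injective φ := by
    rw [← LinearMap.ker_eq_bot, LinearMap.ker_eq_bot']
    rintro ⟨p, hp⟩ h
    by_contra hne
    have hne' : p ≠ 0 := fun h => hne (by simp [h])
    have hmem : m.degree p ∈ D := by
      simp only [D, Finset.mem_filter]
      exact ⟨hT p hp (m.degree_mem_support hne'), p, hp, hne', rfl⟩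
    have := congrFun h ⟨_, hmem⟩
    exact (m.coeff_degree_ne_zero_iff.mpr hne') this
  have hcard : s ≤ Fintype.card D := by
    have := LinearMap.finrank_le_finrank_of_injective hφ
    rwa [hW, Module.finrank_fintype_fun_eq_card] at this
  obtain ⟨g⟩ : Nonempty (Fin s ↪ D) := by
    rw [Function.Embedding.nonempty_iff_card_le]; simpa using hcard
  have h1 : ∀ k, ∃ A : Fin s → K, ∑ j, A j • f j ≠ 0 ∧ m.degree (∑ j, A j • f j) = (g k).1 := by
    intro k
    obtain ⟨_, p, hp, h0, hd⟩ := Finset.mem_filter.mp (g k).2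
    obtain ⟨A, hA⟩ := (Submodule.mem_span_range_iff_exists_fun K).mp hp
    exact ⟨A, hA ▸ h0, hA ▸ hd⟩
  choose A hA0 hA using h1
  refine ⟨A, hA0, fun k l h => ?_⟩
  apply g.injective
  apply Subtype.ext
  rw [← hA, ← hA]
  exact h

open MvPolynomial in
/-- Generalized Wronskian criterion for polynomials over a field of characteristic zero. -/
theorem exists_wronskian_ne_zero {K : Type*} [Field K] [CharZero K] {n s : ℕ}
    (f : Fin s → MvPolynomial (Fin n) K) (hf : LinearIndependent K f) :
    ∃ μ : Fin s → Fin n → ℕ, (∀ i, ∑ j, μ i j ≤ s - 1) ∧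
      (Matrix.of fun i k => binOp (μ i) (f k)).det ≠ 0 := by
  classical
  let m : MonomialOrder (Fin n) := MonomialOrder.lex
  obtain ⟨A, hA0, hA⟩ := exists_injective_degree m f hf
  set b : Fin s → MvPolynomial (Fin n) K := fun k => ∑ j, A k j • f j with hb
  obtain ⟨μ, hμ, hdet⟩ := exists_det_choose_ne_zero (K := K) (fun k => m.degree (b k)) hA
  refine ⟨μ, hμ, fun h0 => ?_⟩
  have hmul : (Matrix.of fun i k => binOp (μ i) (b k)) =
      (Matrix.of fun i k => binOp (μ i) (f k)) * (A.map C).transpose := by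
    ext1 i k
    simp only [Matrix.mul_apply, Matrix.of_apply, hb, map_sum, map_smul, Matrix.transpose_apply,
      Matrix.map_apply]
    exact Finset.sum_congr rfl fun j _ => by rw [smul_eq_C_mul, mul_comm]
  have h1 : (Matrix.of fun i k => binOp (μ i) (b k)).det = 0 := by
    rw [hmul, Matrix.det_mul, h0, zero_mul]
  apply hdet
  have h2 : coeff (∑ k, m.degree (b k)) (Matrix.of fun i k => binOp (μ i) (b k)).det =
      (Matrix.of fun i k => ((∏ j, (m.degree (b k) j).choose (μ i j) : ℕ) : K)).det *
        ∏ k, m.leadingCoeff (b k) := by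
    rw [Matrix.det_apply, Matrix.det_apply, coeff_sum, Finset.sum_mul]
    refine Finset.sum_congr rfl fun σ _ => ?_
    have : coeff (∑ k, m.degree (b k)) (∏ i, binOp (μ (σ i)) (b i)) =
        ∏ i, coeff (m.degree (b i)) (binOp (μ (σ i)) (b i)) := by
      have : ∀ t : Finset (Fin s), coeff (∑ k ∈ t, m.degree (b k)) (∏ i ∈ t, binOp (μ (σ i)) (b i)) =
        ∏ i ∈ t, coeff (m.degree (b i)) (binOp (μ (σ i)) (b i)) ∧
          m.toSyn (m.degree (∏ i ∈ t, binOp (μ (σ i)) (b i))) ≤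
            m.toSyn (∑ k ∈ t, m.degree (b k)) := by
        have hle : ∀ i, m.toSyn (m.degree (binOp (μ (σ i)) (b i))) ≤ m.toSyn (m.degree (b i)) := by
          intro i
          rw [m.degree_le_iff]
          intro c hc
          apply m.le_degree
          rw [mem_support_iff, coeff_binOp] at hc
          exact mem_support_iff.mpr (right_ne_zero_of_mul hc)
        intro t
        induction t using Finset.induction_on with
        | empty =>
          refine ⟨by simp, ?_⟩
          simp only [Finset.prod_empty, Finset.sum_empty]
          rw [← C_1, m.degree_C]
        | insert x t hx ih =>
          rw [Finset.sum_insert hx, Finset.prod_insert hx, Finset.prod_insert hx]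
          refine ⟨?_, ?_⟩
          · rw [m.coeff_mul_of_add_of_degree_le (hle x) ih.2, ih.1]
          · refine m.degree_mul_le.trans ?_
            rw [map_add, map_add]
            exact add_le_add (hle x) ih.2
      exact (this Finset.univ).1
    simp only [Matrix.of_apply]
    rw [smul_mul_assoc, ← Finset.prod_mul_distrib, Units.smul_def, Units.smul_def, coeff_smul, this]
    simp only [coeff_binOp, MonomialOrder.leadingCoeff]
  rw [h1, coeff_zero] at h2
  have h3 : ∏ k, m.leadingCoeff (b k) ≠ 0 :=
    Finset.prod_ne_zero_iff.mpr fun k _ => m.leadingCoeff_ne_zero_iff.mpr (hA0 k)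
  exact (mul_eq_zero.mp h2.symm).resolve_right h3

end Wron

section Wl1

open MvPolynomial in
/-- Weighted `ℓ¹`-norm of a polynomial with respect to an absolute value. -/
noncomputable def wl1 {K σ : Type*} [Field K] (v : AbsoluteValue K ℝ) (r : σ → ℝ)
    (P : MvPolynomial σ K) : ℝ :=
  ∑ a ∈ P.support, v (coeff a P) * a.prod fun i e => r i ^ e

section WeightedNorm

open MvPolynomial

variable {K σ τ : Type*} [Field K] (v : AbsoluteValue K ℝ)

lemma finsuppProd_pow_nonneg {r : σ → ℝ} (hr : ∀ i, 0 ≤ r i) (a : σ →₀ ℕ) :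
    0 ≤ a.prod fun i e => r i ^ e :=
  Finset.prod_nonneg fun i _ => pow_nonneg (hr i) _

lemma wl1_nonneg {r : σ → ℝ} (hr : ∀ i, 0 ≤ r i) (P : MvPolynomial σ K) : 0 ≤ wl1 v r P :=
  Finset.sum_nonneg fun a _ => mul_nonneg (v.nonneg _) (finsuppProd_pow_nonneg hr a)

lemma wl1_eq_sum (r : σ → ℝ) (P : MvPolynomial σ K) {T : Finset (σ →₀ ℕ)} (hT : P.support ⊆ T) :
    wl1 v r P = ∑ a ∈ T, v (coeff a P) * a.prod fun i e => r i ^ e := by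
  refine Finset.sum_subset hT fun a _ ha => ?_
  rw [notMem_support_iff.mp ha, map_zero, zero_mul]

lemma coeff_le_wl1 {r : σ → ℝ} (hr : ∀ i, 0 ≤ r i) (P : MvPolynomial σ K) (a : σ →₀ ℕ) :
    v (coeff a P) * (a.prod fun i e => r i ^ e) ≤ wl1 v r P := by
  by_cases ha : a ∈ P.support
  · exact Finset.single_le_sum (f := fun a => v (coeff a P) * (a.prod fun i e => r i ^ e))
      (fun a _ => mul_nonneg (v.nonneg _) (finsuppProd_pow_nonneg hr a)) ha
  · rw [notMem_support_iff.mp ha, map_zero, zero_mul]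
    exact wl1_nonneg v hr P

lemma coeff_le_wl1_one (P : MvPolynomial σ K) (a : σ →₀ ℕ) :
    v (coeff a P) ≤ wl1 v (fun _ => 1) P := by
  simpa using coeff_le_wl1 v (r := fun _ => 1) (fun _ => zero_le_one) P a

lemma wl1_zero (r : σ → ℝ) : wl1 v r 0 = 0 := by simp [wl1]

lemma wl1_monomial (r : σ → ℝ) (a : σ →₀ ℕ) (c : K) :
    wl1 v r (monomial a c) = v c * a.prod fun i e => r i ^ e := by
  classical
  rw [wl1_eq_sum v r _ (T := {a}) (by simpa using support_monomial_subset)]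
  simp

lemma wl1_C (r : σ → ℝ) (c : K) : wl1 v r (C c) = v c := by
  rw [← monomial_zero', wl1_monomial]; simp

lemma wl1_X (r : σ → ℝ) (i : σ) : wl1 v r (X i) = r i := by
  rw [X, wl1_monomial]; simp

lemma wl1_add_le {r : σ → ℝ} (hr : ∀ i, 0 ≤ r i) (P Q : MvPolynomial σ K) :
    wl1 v r (P + Q) ≤ wl1 v r P + wl1 v r Q := by
  classical
  rw [wl1_eq_sum v r _ (support_add (p := P) (q := Q)),
    wl1_eq_sum v r P (T := P.support ∪ Q.support) Finset.subset_union_left,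
    wl1_eq_sum v r Q (T := P.support ∪ Q.support) Finset.subset_union_right,
    ← Finset.sum_add_distrib]
  refine Finset.sum_le_sum fun a _ => ?_
  rw [← add_mul, coeff_add]
  exact mul_le_mul_of_nonneg_right (v.add_le _ _) (finsuppProd_pow_nonneg hr a)

lemma wl1_sum_le {ι : Type*} {r : σ → ℝ} (hr : ∀ i, 0 ≤ r i) (s : Finset ι)
    (P : ι → MvPolynomial σ K) : wl1 v r (∑ i ∈ s, P i) ≤ ∑ i ∈ s, wl1 v r (P i) := by
  classical
  induction s using Finset.induction_on with
  | empty => simp [wl1_zero]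
  | insert x s hx ih =>
    rw [Finset.sum_insert hx, Finset.sum_insert hx]
    exact (wl1_add_le v hr _ _).trans (add_le_add le_rfl ih)

lemma wl1_mul_le {r : σ → ℝ} (hr : ∀ i, 0 ≤ r i) (P Q : MvPolynomial σ K) :
    wl1 v r (P * Q) ≤ wl1 v r P * wl1 v r Q := by
  classical
  conv_lhs => rw [P.as_sum, Q.as_sum, Finset.sum_mul_sum]
  refine (wl1_sum_le v hr _ _).trans ?_
  conv_rhs => rw [wl1, wl1, Finset.sum_mul_sum]
  refine Finset.sum_le_sum fun a _ => (wl1_sum_le v hr _ _).trans (Finset.sum_le_sum fun b _ => ?_)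
  rw [monomial_mul, wl1_monomial, v.map_mul,
    Finsupp.prod_add_index' (fun _ => pow_zero _) (fun _ _ _ => pow_add _ _ _)]
  exact le_of_eq (by ring)

lemma wl1_prod_le {ι : Type*} {r : σ → ℝ} (hr : ∀ i, 0 ≤ r i) (s : Finset ι)
    (P : ι → MvPolynomial σ K) : wl1 v r (∏ i ∈ s, P i) ≤ ∏ i ∈ s, wl1 v r (P i) := by
  classical
  induction s using Finset.induction_on with
  | empty => simpa using (wl1_C v r 1).le
  | insert x s hx ih =>
    rw [Finset.prod_insert hx, Finset.prod_insert hx]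
    exact (wl1_mul_le v hr _ _).trans (mul_le_mul_of_nonneg_left ih (wl1_nonneg v hr _))

lemma wl1_pow_le {r : σ → ℝ} (hr : ∀ i, 0 ≤ r i) (P : MvPolynomial σ K) (n : ℕ) :
    wl1 v r (P ^ n) ≤ wl1 v r P ^ n := by
  simpa using wl1_prod_le v hr (Finset.range n) fun _ => P

lemma wl1_neg (r : σ → ℝ) (P : MvPolynomial σ K) : wl1 v r (-P) = wl1 v r P := by
  simp [wl1]

lemma wl1_mono {r r' : σ → ℝ} (hr : ∀ i, 0 ≤ r i) (h : ∀ i, r i ≤ r' i) (P : MvPolynomial σ K) :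
    wl1 v r P ≤ wl1 v r' P :=
  Finset.sum_le_sum fun _ _ => mul_le_mul_of_nonneg_left
    (Finset.prod_le_prod (fun i _ => pow_nonneg (hr i) _)
      fun i _ => pow_le_pow_left₀ (hr i) (h i) _) (v.nonneg _)

lemma wl1_det_le {s : ℕ} {r : σ → ℝ} (hr : ∀ i, 0 ≤ r i)
    (M : Matrix (Fin s) (Fin s) (MvPolynomial σ K)) {B : ℝ} (h : ∀ i j, wl1 v r (M i j) ≤ B) :
    wl1 v r M.det ≤ s.factorial * B ^ s := by
  rw [Matrix.det_apply]
  refine (wl1_sum_le v hr _ _).trans ?_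
  have : ∀ g : Equiv.Perm (Fin s), wl1 v r (Equiv.Perm.sign g • ∏ i, M (g i) i) ≤ B ^ s := by
    intro g
    have h1 : wl1 v r (Equiv.Perm.sign g • ∏ i, M (g i) i) = wl1 v r (∏ i, M (g i) i) := by
      rcases Int.units_eq_one_or (Equiv.Perm.sign g) with h | h <;> rw [h]
      · rw [one_smul]
      · rw [Units.neg_smul, one_smul, wl1_neg]
    rw [h1]
    refine (wl1_prod_le v hr _ _).trans ?_
    refine (Finset.prod_le_prod (fun i _ => wl1_nonneg v hr _) fun i _ => h _ _).trans ?_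
    simp
  refine (Finset.sum_le_sum fun g _ => this g).trans ?_
  simp [Finset.card_univ, Fintype.card_perm]

lemma coeff_mul_le_of_nonarch (hv : IsNonarchimedean v) {P Q : MvPolynomial σ K} {A B : ℝ}
    (hP : ∀ a, v (coeff a P) ≤ A) (hQ : ∀ a, v (coeff a Q) ≤ B) (a : σ →₀ ℕ) :
    v (coeff a (P * Q)) ≤ A * B := by
  classical
  have hA : 0 ≤ A := (v.nonneg _).trans (hP 0)
  have hB : 0 ≤ B := (v.nonneg _).trans (hQ 0)
  rw [coeff_mul]
  refine Finset.sum_induction _ (fun x => v x ≤ A * B)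
    (fun x y hx hy => (hv x y).trans (max_le hx hy)) (by simpa using mul_nonneg hA hB) ?_
  intro x _
  rw [v.map_mul]
  exact mul_le_mul (hP _) (hQ _) (v.nonneg _) hA

lemma coeff_det_le_of_nonarch (hv : IsNonarchimedean v) {s : ℕ}
    (M : Matrix (Fin s) (Fin s) (MvPolynomial σ K)) {B : ℝ} (hB : 0 ≤ B)
    (h : ∀ i j a, v (coeff a (M i j)) ≤ B) (a : σ →₀ ℕ) : v (coeff a M.det) ≤ B ^ s := by
  classical
  have hprod : ∀ (g : Equiv.Perm (Fin s)) (t : Finset (Fin s)) (a : σ →₀ ℕ),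
      v (coeff a (∏ i ∈ t, M (g i) i)) ≤ B ^ t.card := by
    intro g t
    induction t using Finset.induction_on with
    | empty =>
      intro a
      rw [Finset.prod_empty, coeff_one]
      split_ifs <;> simp
    | insert x t hx ih =>
      intro a
      rw [Finset.prod_insert hx, Finset.card_insert_of_notMem hx, pow_succ']
      exact coeff_mul_le_of_nonarch v hv (h _ _) ih a
  rw [Matrix.det_apply, coeff_sum]
  refine Finset.sum_induction _ (fun x => v x ≤ B ^ s)
    (fun x y hx hy => (hv x y).trans (max_le hx hy)) (by simpa using pow_nonneg hB s) ?_
  intro g _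
  have := hprod g Finset.univ a
  rw [Finset.card_univ, Fintype.card_fin] at this
  rcases Int.units_eq_one_or (Equiv.Perm.sign g) with h | h <;> rw [h]
  · rwa [one_smul]
  · rwa [Units.neg_smul, one_smul, coeff_neg, v.map_neg]

end WeightedNorm

end Wl1

section Idx

open MvPolynomial in
/-- Translation of the variables by the point `ξ`. -/
noncomputable def shiftAt {K : Type*} [Field K] {n : ℕ} (ξ : Fin n → K) :
    MvPolynomial (Fin n) K →ₐ[K] MvPolynomial (Fin n) K :=
  aeval fun i => X i + C (ξ i)

open MvPolynomial in
/-- The index of `P` at `ξ` with respect to the degrees `d` is at least `θ`. -/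
def IdxGE {K : Type*} [Field K] {n : ℕ} (P : MvPolynomial (Fin n) K) (d : Fin n → ℕ)
    (ξ : Fin n → K) (θ : ℝ) : Prop :=
  ∀ κ ∈ (shiftAt ξ P).support, θ ≤ ∑ i, (κ i : ℝ) / d i

section Index

open MvPolynomial

variable {K : Type*} [Field K] {n : ℕ}

lemma shiftAt_injective (ξ : Fin n → K) : Function.Injective (shiftAt ξ) := by
  have : Function.LeftInverse (shiftAt fun i => -ξ i) (shiftAt ξ) := by
    intro P
    rw [← AlgHom.comp_apply]
    have h : (shiftAt fun i => -ξ i).comp (shiftAt ξ) = AlgHom.id K _ := by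
      apply MvPolynomial.algHom_ext
      intro i
      simp [shiftAt, algebraMap_eq]
    rw [h, AlgHom.id_apply]
  exact this.injective

lemma IdxGE.mono {P : MvPolynomial (Fin n) K} {d : Fin n → ℕ} {ξ : Fin n → K} {θ θ' : ℝ}
    (h : IdxGE P d ξ θ) (hθ : θ' ≤ θ) : IdxGE P d ξ θ' := fun κ hκ => hθ.trans (h κ hκ)

lemma IdxGE.of_nonpos {P : MvPolynomial (Fin n) K} {d : Fin n → ℕ} {ξ : Fin n → K} {θ : ℝ}
    (hθ : θ ≤ 0) : IdxGE P d ξ θ := fun κ _ =>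
  hθ.trans (Finset.sum_nonneg fun i _ => by positivity)

lemma IdxGE.zero {d : Fin n → ℕ} {ξ : Fin n → K} {θ : ℝ} :
    IdxGE (0 : MvPolynomial (Fin n) K) d ξ θ := by
  intro κ hκ
  simp at hκ

lemma IdxGE.add {P Q : MvPolynomial (Fin n) K} {d : Fin n → ℕ} {ξ : Fin n → K} {θ : ℝ}
    (hP : IdxGE P d ξ θ) (hQ : IdxGE Q d ξ θ) : IdxGE (P + Q) d ξ θ := by
  classical
  intro κ hκ
  rw [map_add] at hκ
  rcases Finset.mem_union.mp (support_add hκ) with h | h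
  exacts [hP κ h, hQ κ h]

lemma IdxGE.sum {ι : Type*} {s : Finset ι} {P : ι → MvPolynomial (Fin n) K} {d : Fin n → ℕ}
    {ξ : Fin n → K} {θ : ℝ} (h : ∀ i ∈ s, IdxGE (P i) d ξ θ) : IdxGE (∑ i ∈ s, P i) d ξ θ :=
  Finset.sum_induction _ (IdxGE · d ξ θ) (fun _ _ => IdxGE.add) IdxGE.zero h

lemma IdxGE.mul {P Q : MvPolynomial (Fin n) K} {d : Fin n → ℕ} {ξ : Fin n → K} {θ θ' : ℝ}
    (hP : IdxGE P d ξ θ) (hQ : IdxGE Q d ξ θ') : IdxGE (P * Q) d ξ (θ + θ') := by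
  classical
  intro κ hκ
  rw [map_mul] at hκ
  obtain ⟨a, ha, b, hb, rfl⟩ := Finset.mem_add.mp (support_mul _ _ hκ)
  have h : ∑ i, ((a + b) i : ℝ) / d i = ∑ i, (a i : ℝ) / d i + ∑ i, (b i : ℝ) / d i := by
    rw [← Finset.sum_add_distrib]
    exact Finset.sum_congr rfl fun i _ => by simp [add_div]
  rw [h]
  exact add_le_add (hP a ha) (hQ b hb)

lemma IdxGE.smul {P : MvPolynomial (Fin n) K} {d : Fin n → ℕ} {ξ : Fin n → K} {θ : ℝ}
    (hP : IdxGE P d ξ θ) (c : K) : IdxGE (c • P) d ξ θ := by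
  intro κ hκ
  rw [map_smul] at hκ
  exact hP κ (support_smul hκ)

lemma IdxGE.prod {ι : Type*} {s : Finset ι} {P : ι → MvPolynomial (Fin n) K} {d : Fin n → ℕ}
    {ξ : Fin n → K} {θ : ι → ℝ} (h : ∀ i ∈ s, IdxGE (P i) d ξ (θ i)) :
    IdxGE (∏ i ∈ s, P i) d ξ (∑ i ∈ s, θ i) := by
  classical
  induction s using Finset.induction_on with
  | empty => exact IdxGE.of_nonpos (by simp)
  | insert x s hx ih =>
    rw [Finset.prod_insert hx, Finset.sum_insert hx]
    exact (h x (Finset.mem_insert_self _ _)).mul (ih fun i hi => h i (Finset.mem_insert_of_mem hi))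

lemma IdxGE.neg {P : MvPolynomial (Fin n) K} {d : Fin n → ℕ} {ξ : Fin n → K} {θ : ℝ}
    (hP : IdxGE P d ξ θ) : IdxGE (-P) d ξ θ := by
  simpa using hP.smul (-1)

lemma IdxGE.det {s : ℕ} {M : Matrix (Fin s) (Fin s) (MvPolynomial (Fin n) K)} {d : Fin n → ℕ}
    {ξ : Fin n → K} {θ : Fin s → ℝ} (h : ∀ i j, IdxGE (M i j) d ξ (θ j)) :
    IdxGE M.det d ξ (∑ j, θ j) := by
  rw [Matrix.det_apply]
  refine IdxGE.sum fun g _ => ?_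
  have := IdxGE.prod (s := Finset.univ) fun j _ => h (g j) j
  rcases Int.units_eq_one_or (Equiv.Perm.sign g) with h | h <;> rw [h]
  · rwa [one_smul]
  · rw [Units.neg_smul, one_smul]; exact this.neg

lemma shiftAt_pderiv (ξ : Fin n → K) (i : Fin n) (P : MvPolynomial (Fin n) K) :
    shiftAt ξ (pderiv i P) = pderiv i (shiftAt ξ P) := by
  induction P using MvPolynomial.induction_on with
  | C a => simp [shiftAt, algebraMap_eq]
  | add p q hp hq => simp only [map_add, hp, hq]
  | mul_X p j hp =>
    rw [Derivation.leibniz, map_add, map_mul (shiftAt ξ) p, Derivation.leibniz]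
    simp only [smul_eq_mul, map_mul, hp]
    congr 2
    by_cases h : j = i
    · subst h; simp [shiftAt]
    · simp [shiftAt, pderiv_X_of_ne h]

lemma IdxGE.pderiv {P : MvPolynomial (Fin n) K} {d : Fin n → ℕ}
    {ξ : Fin n → K} {θ : ℝ} (hP : IdxGE P d ξ θ) (i : Fin n) :
    IdxGE (pderiv i P) d ξ (θ - 1 / d i) := by
  classical
  intro κ hκ
  rw [shiftAt_pderiv] at hκ
  have h1 : κ + Finsupp.single i 1 ∈ (shiftAt ξ P).support := by
    rw [mem_support_iff] at hκ ⊢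
    intro h0
    apply hκ
    rw [coeff_pderiv, h0, zero_mul]
  have h2 := hP _ h1
  have h3 : ∑ j, ((κ + Finsupp.single i 1 : Fin n →₀ ℕ) j : ℝ) / d j = ∑ j, (κ j : ℝ) / d j + 1 / d i := by
    simp only [Finsupp.add_apply, Nat.cast_add, add_div, Finset.sum_add_distrib]
    congr 1
    rw [Finset.sum_eq_single i] <;> simp +contextual [eq_comm]
  linarith

lemma binOp_zero (P : MvPolynomial (Fin n) K) : binOp 0 P = P := by
  ext a; simp [coeff_binOp]

lemma binOp_succ (μ : Fin n → ℕ) (i : Fin n) (P : MvPolynomial (Fin n) K) :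
    ((μ i + 1 : ℕ) : K) • binOp (Function.update μ i (μ i + 1)) P =
      X i * pderiv i (binOp μ P) - (μ i : K) • binOp μ P := by
  classical
  ext a
  rw [coeff_smul, coeff_sub, coeff_smul, coeff_binOp, coeff_binOp]
  have hx : coeff a (X i * pderiv i (binOp μ P)) = (a i : K) * coeff a (binOp μ P) := by
    rw [coeff_X_mul']
    split_ifs with h
    · have hi : a i ≠ 0 := by simpa using h
      rw [coeff_pderiv]
      have : a - Finsupp.single i 1 + Finsupp.single i 1 = a := by
        apply tsub_add_cancel_of_le
        rw [Finsupp.single_le_iff]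
        omega
      rw [this, mul_comm]
      congr 1
      simp only [Finsupp.tsub_apply, Finsupp.single_eq_same]
      rw [Nat.cast_sub (by omega)]
      simp
    · have hi : a i = 0 := by simpa using h
      simp [hi]
  rw [hx, coeff_binOp, smul_eq_mul, smul_eq_mul, ← mul_assoc, ← mul_assoc, ← mul_assoc, ← sub_mul]
  congr 1
  rw [← Finset.mul_prod_erase Finset.univ (fun j => (a j).choose (μ j)) (Finset.mem_univ i),
    ← Finset.mul_prod_erase Finset.univ
      (fun j => (a j).choose (Function.update μ i (μ i + 1) j)) (Finset.mem_univ i)]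
  have : ∏ j ∈ Finset.univ.erase i, (a j).choose (Function.update μ i (μ i + 1) j)
      = ∏ j ∈ Finset.univ.erase i, (a j).choose (μ j) := by
    apply Finset.prod_congr rfl
    intro j hj
    rw [Function.update_of_ne (Finset.ne_of_mem_erase hj)]
  rw [this, Function.update_self]
  have h2 : a i * (a i).choose (μ i) =
      (μ i + 1) * (a i).choose (μ i + 1) + μ i * (a i).choose (μ i) := by
    have := Nat.choose_succ_right_eq (a i) (μ i)
    rcases le_total (μ i) (a i) with h | h
    · zify [h] at this ⊢
      linarith
    · rcases h.eq_or_lt with h | h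
      · simp [h]
      · simp [Nat.choose_eq_zero_of_lt h, Nat.choose_eq_zero_of_lt (h.trans (Nat.lt_succ_self _))]
  have h3 : ((a i : K)) * ((a i).choose (μ i) : K) =
      ((μ i : K) + 1) * ((a i).choose (μ i + 1) : K) + μ i * ((a i).choose (μ i) : K) := by
    have := congrArg (Nat.cast : ℕ → K) h2
    push_cast at this
    exact this
  push_cast
  linear_combination -(∏ x ∈ Finset.univ.erase i, ((a x).choose (μ x) : K)) * h3

lemma IdxGE.X_mul {P : MvPolynomial (Fin n) K} {d : Fin n → ℕ}
    {ξ : Fin n → K} {θ : ℝ} (hP : IdxGE P d ξ θ) (i : Fin n) : IdxGE (X i * P) d ξ θ := by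
  simpa using (IdxGE.of_nonpos (P := X i) (d := d) (ξ := ξ) le_rfl).mul hP

lemma IdxGE.binOp [CharZero K] {P : MvPolynomial (Fin n) K} {d : Fin n → ℕ}
    {ξ : Fin n → K} {θ : ℝ} (hP : IdxGE P d ξ θ) (μ : Fin n → ℕ) :
    IdxGE (binOp μ P) d ξ (θ - ∑ i, (μ i : ℝ) / d i) := by
  classical
  generalize hN : ∑ i, μ i = N
  induction N generalizing μ with
  | zero =>
    have : μ = 0 := by
      funext i
      exact (Finset.sum_eq_zero_iff.mp hN) i (Finset.mem_univ i)
    subst this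
    simpa [binOp_zero] using hP
  | succ N ih =>
    obtain ⟨i, hi⟩ : ∃ i, μ i ≠ 0 := by
      by_contra! h
      simp [h] at hN
    let ν := Function.update μ i (μ i - 1)
    have hμ : μ = Function.update ν i (ν i + 1) := by
      funext j
      by_cases hj : j = i
      · subst hj; simp [ν]; omega
      · simp [ν, hj]
    have hν : ∑ j, ν j = N := by
      have h1 := Finset.add_sum_erase Finset.univ μ (Finset.mem_univ i)
      simp only [ν]
      rw [Finset.sum_update_of_mem (Finset.mem_univ i), ← Finset.erase_eq]
      omega
    have h := ih ν hν
    have hs : ∑ j, (μ j : ℝ) / d j = ∑ j, (ν j : ℝ) / d j + 1 / d i := by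
      rw [← Finset.add_sum_erase Finset.univ _ (Finset.mem_univ i),
        ← Finset.add_sum_erase Finset.univ (fun j => (ν j : ℝ) / d j) (Finset.mem_univ i)]
      have : ∑ j ∈ Finset.univ.erase i, (ν j : ℝ) / d j
          = ∑ j ∈ Finset.univ.erase i, (μ j : ℝ) / d j :=
        Finset.sum_congr rfl fun j hj => by simp [ν, Finset.ne_of_mem_erase hj]
      rw [this, hμ]
      simp only [Function.update_self, Nat.cast_add, Nat.cast_one, add_div]
      ring
    have hd : (0:ℝ) ≤ 1 / d i := by positivity
    have h1 : IdxGE (X i * MvPolynomial.pderiv i (_root_.binOp ν P) - (ν i : K) • _root_.binOp ν P)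
        d ξ (θ - ∑ j, (μ j : ℝ) / d j) := by
      rw [sub_eq_add_neg]
      refine IdxGE.add ?_ ?_
      · exact ((h.pderiv i).X_mul i).mono (by linarith)
      · exact ((h.smul _).neg).mono (by linarith)
    rw [← binOp_succ, ← hμ] at h1
    have h2 := h1.smul (((ν i + 1 : ℕ) : K)⁻¹)
    rwa [smul_smul, inv_mul_cancel₀ (Nat.cast_ne_zero.mpr (Nat.succ_ne_zero _)), one_smul] at h2

end Index

end Idx

section LocalHeight

open Height AdmissibleAbsValues

lemma abv_nat_le_one_of_nonarch {K : Type*} [Field K] {v : AbsoluteValue K ℝ} (hv : IsNonarchimedean v) (n : ℕ) :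
    v (n : K) ≤ 1 := by
  induction n with
  | zero => simp
  | succ n ih =>
    push_cast
    exact (hv _ _).trans (by simp [ih])

lemma abv_nat_le {K : Type*} [Field K] (v : AbsoluteValue K ℝ) (n : ℕ) : v (n : K) ≤ n := by
  induction n with
  | zero => simp
  | succ n ih =>
    push_cast
    exact (v.add_le _ _).trans (by simpa using ih)

variable {K : Type*} [Field K] [AdmissibleAbsValues K]

lemma mulHeight_le_of_local {ι ι' : Type*} [Finite ι] [Finite ι'] {x : ι → K} {y : ι' → K}
    (hx : x ≠ 0) {C : ℝ} (hC : 1 ≤ C) (s : ℕ)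
    (harch : ∀ v ∈ archAbsVal (K := K), ∀ B : ℝ, (∀ i, v (x i) ≤ B) → ∀ j, v (y j) ≤ C * B ^ s)
    (hna : ∀ v ∈ nonarchAbsVal (K := K), ∀ B : ℝ, (∀ i, v (x i) ≤ B) → ∀ j, v (y j) ≤ B ^ s) :
    mulHeight y ≤ C ^ totalWeight K * mulHeight x ^ s := by
  rcases eq_or_ne y 0 with rfl | hy
  · rw [mulHeight_zero]
    exact one_le_mul_of_one_le_of_one_le (one_le_pow₀ hC) (one_le_pow₀ (one_le_mulHeight x))
  have : Nonempty ι' := by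
    by_contra h
    exact hy (funext fun j => (h ⟨j⟩).elim)
  have hsup (v : AbsoluteValue K ℝ) (i : ι) : v (x i) ≤ ⨆ i, v (x i) :=
    le_ciSup (f := fun i => v (x i)) (Finite.bddAbove_range _) i
  rw [mulHeight_eq hx, mulHeight_eq hy, mul_pow, ← mul_assoc]
  gcongr
  · exact finprod_nonneg fun v ↦ Real.iSup_nonneg_of_nonnegHomClass v.val _
  · exact mul_nonneg (by positivity) (pow_nonneg (Multiset.prod_map_nonneg
      fun v _ ↦ Real.iSup_nonneg_of_nonnegHomClass v _) _)
  · rw [← Multiset.prod_map_pow, ← Multiset.prod_replicate, totalWeight, ← Multiset.map_const',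
      ← Multiset.prod_map_mul]
    refine Multiset.prod_map_le_prod_map₀ _ _
      (fun v _ ↦ Real.iSup_nonneg_of_nonnegHomClass v _) fun v hv ↦ ?_
    exact ciSup_le (harch v hv _ (hsup v))
  · have hfin0 : Function.HasFiniteMulSupport
      (fun v : nonarchAbsVal (K := K) => ⨆ i, v.val (x i)) := by fun_prop
    rw [finprod_pow hfin0]
    have hfin : Function.HasFiniteMulSupport
      (fun v : nonarchAbsVal (K := K) => (⨆ i, v.val (x i)) ^ s) := by fun_prop
    refine finprod_le_finprod (by fun_prop)
      (fun v ↦ Real.iSup_nonneg_of_nonnegHomClass v.val _) hfin fun v ↦ ?_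
    exact ciSup_le (hna v.1 v.2 _ (hsup v.1))

end LocalHeight

section PolynomialHeight

open Height AdmissibleAbsValues MvPolynomial

lemma coeff_support_ne_zero {K σ : Type*} [Field K] {P : MvPolynomial σ K} (hP : P ≠ 0) :
    (fun a : P.support => coeff a.1 P) ≠ 0 := by
  obtain ⟨a, ha⟩ := MvPolynomial.ne_zero_iff.mp hP
  intro h
  exact ha (congrFun h ⟨a, mem_support_iff.mpr ha⟩)

variable {K : Type*} [Field K] [AdmissibleAbsValues K]

/-- The height of the tuple of coefficients of a polynomial. -/
noncomputable def polH {σ : Type*} (P : MvPolynomial σ K) : ℝ :=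
  mulHeight fun a : P.support => coeff a.1 P

lemma one_le_polH {σ : Type*} (P : MvPolynomial σ K) : 1 ≤ polH P := one_le_mulHeight _

lemma polH_pos {σ : Type*} (P : MvPolynomial σ K) : 0 < polH P := mulHeight_pos _

lemma polH_le_of_local {σ τ : Type*} {P : MvPolynomial σ K} {R : MvPolynomial τ K}
    (hP : P ≠ 0) {C : ℝ} (hC : 1 ≤ C) (s : ℕ)
    (harch : ∀ v ∈ archAbsVal (K := K), ∀ B : ℝ, (∀ a, v (coeff a P) ≤ B) →
      ∀ b, v (coeff b R) ≤ C * B ^ s)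
    (hna : ∀ v ∈ nonarchAbsVal (K := K), ∀ B : ℝ, (∀ a, v (coeff a P) ≤ B) →
      ∀ b, v (coeff b R) ≤ B ^ s) :
    polH R ≤ C ^ totalWeight K * polH P ^ s := by
  have key (v : AbsoluteValue K ℝ) (B : ℝ) (h : ∀ i : P.support, v (coeff i.1 P) ≤ B)
      (a : σ →₀ ℕ) : v (coeff a P) ≤ B := by
    by_cases ha : a ∈ P.support
    · exact h ⟨a, ha⟩
    · obtain ⟨b, hb⟩ := MvPolynomial.ne_zero_iff.mp hP
      rw [notMem_support_iff.mp ha, map_zero]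
      exact (v.nonneg _).trans (h ⟨b, mem_support_iff.mpr hb⟩)
  exact mulHeight_le_of_local (coeff_support_ne_zero hP) hC s
    (fun v hv B h j => harch v hv B (key v B h) _) (fun v hv B h j => hna v hv B (key v B h) _)

end PolynomialHeight

section Separated

open Height AdmissibleAbsValues MvPolynomial

variable {K : Type*} [Field K] {m : ℕ}

/-- The product of a polynomial in the last `m` variables with one in the first variable. -/
noncomputable def sep (U : MvPolynomial (Fin m) K) (V : MvPolynomial (Fin 1) K) :
    MvPolynomial (Fin (m + 1)) K :=
  rename Fin.succ U * rename (fun _ => 0) V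

lemma rename_succ_monomial (a : Fin m →₀ ℕ) (c : K) :
    rename Fin.succ (monomial a c) = monomial (Finsupp.cons 0 a) c := by
  rw [rename_monomial]
  refine congrArg (fun e => monomial e _) (Finsupp.ext fun i => ?_)
  refine Fin.cases ?_ (fun j => ?_) i
  · rw [Finsupp.cons_zero, Finsupp.mapDomain_of_notMem_range]
    rintro ⟨j, hj⟩
    exact Fin.succ_ne_zero j hj
  · rw [Finsupp.cons_succ, Finsupp.mapDomain_apply (Fin.succ_injective m)]

lemma rename_zero_monomial (b : Fin 1 →₀ ℕ) (c : K) :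
    rename (fun _ => (0 : Fin (m + 1))) (monomial b c) = monomial (Finsupp.cons (b 0) 0) c := by
  rw [rename_monomial]
  refine congrArg (fun e => monomial e _) (Finsupp.ext fun i => ?_)
  refine Fin.cases ?_ (fun j => ?_) i
  · rw [Finsupp.cons_zero]
    exact Finsupp.mapDomain_apply (f := fun _ : Fin 1 => (0 : Fin (m + 1)))
      (Function.injective_of_subsingleton _) b 0
  · rw [Finsupp.cons_succ, Finsupp.mapDomain_of_notMem_range]
    · rfl
    rintro ⟨j, hj⟩
    exact Fin.succ_ne_zero _ hj.symm

lemma sep_monomial (a : Fin m →₀ ℕ) (b : Fin 1 →₀ ℕ) (c d : K) :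
    sep (monomial a c) (monomial b d) = monomial (Finsupp.cons (b 0) a) (c * d) := by
  rw [sep, rename_succ_monomial, rename_zero_monomial, monomial_mul]
  refine congrArg (fun e => monomial e _) (Finsupp.ext fun i => ?_)
  refine Fin.cases ?_ (fun j => ?_) i <;> simp

lemma sep_add_left (U U' : MvPolynomial (Fin m) K) (V : MvPolynomial (Fin 1) K) :
    sep (U + U') V = sep U V + sep U' V := by simp [sep, add_mul]

lemma sep_add_right (U : MvPolynomial (Fin m) K) (V V' : MvPolynomial (Fin 1) K) :
    sep U (V + V') = sep U V + sep U V' := by simp [sep, mul_add]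

lemma coeff_sep (U : MvPolynomial (Fin m) K) (V : MvPolynomial (Fin 1) K)
    (a : Fin m →₀ ℕ) (b : Fin 1 →₀ ℕ) :
    coeff (Finsupp.cons (b 0) a) (sep U V) = coeff a U * coeff b V := by
  classical
  induction U using MvPolynomial.induction_on' with
  | add p q hp hq => rw [sep_add_left, coeff_add, hp, hq, coeff_add, add_mul]
  | monomial a' c =>
    induction V using MvPolynomial.induction_on' with
    | add p q hp hq => rw [sep_add_right, coeff_add, hp, hq, coeff_add, mul_add]
    | monomial b' d =>
      rw [sep_monomial, coeff_monomial, coeff_monomial, coeff_monomial]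
      have h : Finsupp.cons (b' 0) a' = Finsupp.cons (b 0) a ↔ a' = a ∧ b' = b := by
        rw [Finsupp.cons_injective2.eq_iff, and_comm]
        refine and_congr_right fun _ => ⟨fun h => Finsupp.ext fun i => ?_, fun h => by rw [h]⟩
        rw [Subsingleton.elim i 0, h]
      simp only [h]
      by_cases h1 : a' = a <;> by_cases h2 : b' = b <;> simp [h1, h2]

lemma exists_cons_eq (e : Fin (m + 1) →₀ ℕ) :
    e = Finsupp.cons ((Finsupp.single (0 : Fin 1) (e 0)) 0) e.tail := by
  simp [Finsupp.cons_tail]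

lemma binOp_sep (μ : Fin m → ℕ) (ν : Fin 1 → ℕ) (U : MvPolynomial (Fin m) K)
    (V : MvPolynomial (Fin 1) K) :
    binOp (Fin.cons (ν 0) μ) (sep U V) = sep (binOp μ U) (binOp ν V) := by
  ext e
  rw [exists_cons_eq e, coeff_binOp, coeff_sep, coeff_sep, coeff_binOp, coeff_binOp,
    Fin.prod_univ_succ]
  simp only [Finsupp.cons_zero, Finsupp.cons_succ, Fin.cons_zero, Fin.cons_succ,
    Fin.prod_univ_one]
  push_cast
  ring

lemma shiftAt_sep (ξ : Fin (m + 1) → K) (U : MvPolynomial (Fin m) K)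
    (V : MvPolynomial (Fin 1) K) :
    shiftAt ξ (sep U V) = sep (shiftAt (fun i => ξ i.succ) U) (shiftAt (fun _ => ξ 0) V) := by
  rw [sep, sep, map_mul]
  congr 1
  · rw [← AlgHom.comp_apply, ← AlgHom.comp_apply]
    refine congrArg (fun F : _ →ₐ[K] _ => F _) ?_
    apply MvPolynomial.algHom_ext
    intro i
    simp [shiftAt, algebraMap_eq]
  · rw [← AlgHom.comp_apply, ← AlgHom.comp_apply]
    refine congrArg (fun F : _ →ₐ[K] _ => F _) ?_
    apply MvPolynomial.algHom_ext
    intro i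
    simp [shiftAt, algebraMap_eq]

lemma idxGE_sep {ξ : Fin (m + 1) → K} {U : MvPolynomial (Fin m) K}
    {V : MvPolynomial (Fin 1) K} {d : Fin (m + 1) → ℕ} {θ θ' : ℝ}
    (h : IdxGE (sep U V) d ξ (θ + θ')) :
    IdxGE U (fun i => d i.succ) (fun i => ξ i.succ) θ ∨
      IdxGE V (fun _ => d 0) (fun _ => ξ 0) θ' := by
  by_contra! hc
  obtain ⟨h1, h2⟩ := hc
  simp only [IdxGE, not_forall, not_le] at h1 h2
  obtain ⟨a, ha, ha'⟩ := h1
  obtain ⟨b, hb, hb'⟩ := h2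
  have := h (Finsupp.cons (b 0) a) (by
    rw [mem_support_iff, shiftAt_sep, coeff_sep]
    exact mul_ne_zero (mem_support_iff.mp ha) (mem_support_iff.mp hb))
  rw [Fin.sum_univ_succ] at this
  simp only [Finsupp.cons_zero, Finsupp.cons_succ] at this
  simp only [Fin.sum_univ_one] at hb'
  linarith

lemma polH_mul_polH_le [AdmissibleAbsValues K] {U : MvPolynomial (Fin m) K}
    {V : MvPolynomial (Fin 1) K} (hU : U ≠ 0) (hV : V ≠ 0) : polH U * polH V ≤ polH (sep U V) := by
  rw [polH, polH, polH, ← mulHeight_fun_mul_eq (coeff_support_ne_zero hU) (coeff_support_ne_zero hV)]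
  let f : U.support × V.support → (sep U V).support := fun p =>
    ⟨Finsupp.cons (p.2.1 0) p.1.1, by
      rw [mem_support_iff, coeff_sep]
      exact mul_ne_zero (mem_support_iff.mp p.1.2) (mem_support_iff.mp p.2.2)⟩
  convert mulHeight_comp_le f fun a : (sep U V).support => coeff a.1 (sep U V) using 2
  funext p
  simp [f, coeff_sep]

end Separated

section TensorDecomposition

open MvPolynomial

variable {K : Type*} [Field K] {m : ℕ}

lemma sep_smul_left (c : K) (U : MvPolynomial (Fin m) K) (V : MvPolynomial (Fin 1) K) :
    sep (c • U) V = c • sep U V := by simp [sep]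

lemma sep_smul_right (c : K) (U : MvPolynomial (Fin m) K) (V : MvPolynomial (Fin 1) K) :
    sep U (c • V) = c • sep U V := by simp [sep]

lemma sep_sum_left {ι : Type*} (s : Finset ι) (U : ι → MvPolynomial (Fin m) K)
    (V : MvPolynomial (Fin 1) K) : sep (∑ i ∈ s, U i) V = ∑ i ∈ s, sep (U i) V := by
  simp [sep, Finset.sum_mul]

lemma sep_sum_right {ι : Type*} (s : Finset ι) (U : MvPolynomial (Fin m) K)
    (V : ι → MvPolynomial (Fin 1) K) : sep U (∑ i ∈ s, V i) = ∑ i ∈ s, sep U (V i) := by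
  simp [sep, Finset.mul_sum]

lemma sep_decomp_reduce_left {s : ℕ} {f : Fin (s + 1) → MvPolynomial (Fin m) K}
    {g : Fin (s + 1) → MvPolynomial (Fin 1) K} (hf : ¬ LinearIndependent K f) :
    ∃ (f' : Fin s → MvPolynomial (Fin m) K) (g' : Fin s → MvPolynomial (Fin 1) K),
      ∑ k, sep (f k) (g k) = ∑ k, sep (f' k) (g' k) := by
  obtain ⟨c, hc, i, hi⟩ := Fintype.not_linearIndependent_iff.mp hf
  rw [Fin.sum_univ_succAbove _ i] at hc
  have h1 : f i = ∑ j, (-(c i)⁻¹ * c (i.succAbove j)) • f (i.succAbove j) := by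
    have h2 : c i • f i = -∑ j, c (i.succAbove j) • f (i.succAbove j) := eq_neg_of_add_eq_zero_left hc
    calc f i = (c i)⁻¹ • (c i • f i) := by rw [smul_smul, inv_mul_cancel₀ hi, one_smul]
      _ = _ := by
        rw [h2, smul_neg, Finset.smul_sum, ← Finset.sum_neg_distrib]
        refine Finset.sum_congr rfl fun j _ => ?_
        rw [smul_smul, neg_mul, neg_smul]
  refine ⟨fun j => f (i.succAbove j),
    fun j => g (i.succAbove j) + (-(c i)⁻¹ * c (i.succAbove j)) • g i, ?_⟩
  rw [Fin.sum_univ_succAbove _ i, h1, sep_sum_left, ← Finset.sum_add_distrib]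
  refine Finset.sum_congr rfl fun j _ => ?_
  rw [sep_add_right, sep_smul_left, sep_smul_right]
  exact add_comm _ _

lemma sep_decomp_reduce_right {s : ℕ} {f : Fin (s + 1) → MvPolynomial (Fin m) K}
    {g : Fin (s + 1) → MvPolynomial (Fin 1) K} (hg : ¬ LinearIndependent K g) :
    ∃ (f' : Fin s → MvPolynomial (Fin m) K) (g' : Fin s → MvPolynomial (Fin 1) K),
      ∑ k, sep (f k) (g k) = ∑ k, sep (f' k) (g' k) := by
  obtain ⟨c, hc, i, hi⟩ := Fintype.not_linearIndependent_iff.mp hg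
  rw [Fin.sum_univ_succAbove _ i] at hc
  have h1 : g i = ∑ j, (-(c i)⁻¹ * c (i.succAbove j)) • g (i.succAbove j) := by
    have h2 : c i • g i = -∑ j, c (i.succAbove j) • g (i.succAbove j) := eq_neg_of_add_eq_zero_left hc
    calc g i = (c i)⁻¹ • (c i • g i) := by rw [smul_smul, inv_mul_cancel₀ hi, one_smul]
      _ = _ := by
        rw [h2, smul_neg, Finset.smul_sum, ← Finset.sum_neg_distrib]
        refine Finset.sum_congr rfl fun j _ => ?_
        rw [smul_smul, neg_mul, neg_smul]
  refine ⟨fun j => f (i.succAbove j) + (-(c i)⁻¹ * c (i.succAbove j)) • f i,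
    fun j => g (i.succAbove j), ?_⟩
  rw [Fin.sum_univ_succAbove _ i, h1, sep_sum_right, ← Finset.sum_add_distrib]
  refine Finset.sum_congr rfl fun j _ => ?_
  rw [sep_add_left, sep_smul_left, sep_smul_right]
  exact add_comm _ _

lemma sum_sep_coeff (P : MvPolynomial (Fin (m + 1)) K) {d : ℕ} (hd : P.degreeOf 0 ≤ d) :
    P = ∑ k : Fin (d + 1), sep ((finSuccEquiv K m P).coeff k)
      (monomial (Finsupp.single 0 (k : ℕ)) 1) := by
  classical
  ext e
  rw [coeff_sum]
  conv_rhs => 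
    enter [2, k]
    rw [exists_cons_eq e, coeff_sep, finSuccEquiv_coeff_coeff, coeff_monomial]
  have h1 (k : ℕ) : (Finsupp.single (0 : Fin 1) k = Finsupp.single 0 (e 0)) ↔ k = e 0 :=
    (Finsupp.single_injective _).eq_iff
  simp only [h1, mul_ite, mul_one, mul_zero]
  by_cases he : e 0 ≤ d
  · rw [Finset.sum_eq_single (⟨e 0, by omega⟩ : Fin (d + 1))]
    · simp [Finsupp.cons_tail]
    · intro k _ hk
      rw [if_neg]
      intro h
      exact hk (Fin.ext h)
    · simp
  · rw [Finset.sum_eq_zero]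
    · by_contra h
      exact he ((monomial_le_degreeOf 0 (mem_support_iff.mpr h)).trans hd)
    · intro k _
      rw [if_neg]
      intro h
      have := k.2
      omega

lemma exists_sep_decomp {P : MvPolynomial (Fin (m + 1)) K} (hP : P ≠ 0) {d : ℕ}
    (hd : P.degreeOf 0 ≤ d) :
    ∃ (s : ℕ) (f : Fin s → MvPolynomial (Fin m) K) (g : Fin s → MvPolynomial (Fin 1) K),
      1 ≤ s ∧ s ≤ d + 1 ∧ LinearIndependent K f ∧ LinearIndependent K g ∧
        P = ∑ k, sep (f k) (g k) := by
  classical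
  let S : ℕ → Prop := fun s => ∃ (f : Fin s → MvPolynomial (Fin m) K)
    (g : Fin s → MvPolynomial (Fin 1) K), P = ∑ k, sep (f k) (g k)
  have hS : S (d + 1) := ⟨_, _, sum_sep_coeff P hd⟩
  have hex : ∃ s, S s := ⟨_, hS⟩
  obtain ⟨f, g, h⟩ := Nat.find_spec hex
  have hle := Nat.find_le (h := hex) hS
  have hmin := fun k => Nat.find_min (H := hex) (m := k)
  generalize Nat.find hex = s at f g h hle hmin
  cases s with
  | zero => simp at h; exact absurd h hP
  | succ s =>
    refine ⟨s + 1, f, g, by omega, hle, ?_, ?_, h⟩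
    · by_contra hf
      obtain ⟨f', g', h'⟩ := sep_decomp_reduce_left (g := g) hf
      exact hmin s (Nat.lt_succ_self s) ⟨f', g', h.trans h'⟩
    · by_contra hg
      obtain ⟨f', g', h'⟩ := sep_decomp_reduce_right (f := f) hg
      exact hmin s (Nat.lt_succ_self s) ⟨f', g', h.trans h'⟩

end TensorDecomposition

section WronskianBounds

open MvPolynomial Height AdmissibleAbsValues

variable {K : Type*} [Field K] {n : ℕ}

lemma card_support_le_two_pow {P : MvPolynomial (Fin n) K} {d : Fin n → ℕ}
    (hP : ∀ i, P.degreeOf i ≤ d i) : P.support.card ≤ 2 ^ ∑ i, d i := by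
  classical
  have h1 : P.support.card ≤ (Fintype.piFinset fun i => Finset.range (d i + 1)).card := by
    refine Finset.card_le_card_of_injOn (fun a : Fin n →₀ ℕ => (a : Fin n → ℕ)) ?_
      DFunLike.coe_injective.injOn
    intro a ha
    simp only [Finset.mem_coe, Fintype.mem_piFinset, Finset.mem_range]
    intro i
    exact Nat.lt_succ_of_le ((monomial_le_degreeOf i ha).trans (hP i))
  refine h1.trans ?_
  rw [Fintype.card_piFinset, ← Finset.prod_pow_eq_pow_sum]
  refine Finset.prod_le_prod' fun i _ => ?_
  rw [Finset.card_range]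
  exact Nat.lt_two_pow_self

lemma wl1_binOp_le (v : AbsoluteValue K ℝ) {P : MvPolynomial (Fin n) K} {d : Fin n → ℕ}
    (hP : ∀ i, P.degreeOf i ≤ d i) (μ : Fin n → ℕ) {B : ℝ} (hB : ∀ a, v (coeff a P) ≤ B) :
    wl1 v (fun _ => 1) (binOp μ P) ≤ 4 ^ (∑ i, d i) * B := by
  classical
  have hB0 : 0 ≤ B := (v.nonneg _).trans (hB 0)
  have hsub : (binOp μ P).support ⊆ P.support := by
    intro a ha
    rw [mem_support_iff] at ha ⊢
    intro h
    rw [coeff_binOp, h, mul_zero] at ha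
    exact ha rfl
  rw [wl1_eq_sum v _ _ hsub]
  have h1 : ∀ a ∈ P.support, v (coeff a (binOp μ P)) * (a.prod fun _ e => (1 : ℝ) ^ e)
      ≤ 2 ^ (∑ i, d i) * B := by
    intro a ha
    rw [coeff_binOp, map_mul]
    simp only [one_pow, Finsupp.prod, Finset.prod_const_one, mul_one]
    refine mul_le_mul ?_ (hB a) (v.nonneg _) (by positivity)
    refine (abv_nat_le v _).trans ?_
    norm_cast
    rw [← Finset.prod_pow_eq_pow_sum]
    refine Finset.prod_le_prod' fun i _ => (Nat.choose_le_two_pow _ _).trans ?_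
    exact Nat.pow_le_pow_right (by norm_num) ((monomial_le_degreeOf i ha).trans (hP i))
  refine (Finset.sum_le_sum h1).trans ?_
  rw [Finset.sum_const, nsmul_eq_mul, ← mul_assoc]
  refine mul_le_mul_of_nonneg_right ?_ hB0
  rw [show (4 : ℝ) = 2 * 2 by norm_num, mul_pow]
  refine mul_le_mul_of_nonneg_right ?_ (by positivity)
  exact_mod_cast card_support_le_two_pow hP

lemma polH_det_binOp_le [AdmissibleAbsValues K] {P : MvPolynomial (Fin n) K} (hP0 : P ≠ 0)
    {d : Fin n → ℕ} (hP : ∀ i, P.degreeOf i ≤ d i) {s : ℕ} (hs : s ≤ (∑ i, d i) + 1)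
    (μ : Fin s → Fin s → Fin n → ℕ) :
    polH (Matrix.of fun i j => binOp (μ i j) P).det ≤
      ((8 : ℝ) ^ ((∑ i, d i) * s)) ^ totalWeight K * polH P ^ s := by
  refine polH_le_of_local hP0 (one_le_pow₀ (by norm_num)) s ?_ ?_
  · intro v _ B hB b
    have hB0 : 0 ≤ B := (v.nonneg _).trans (hB 0)
    refine (coeff_le_wl1_one v _ b).trans ?_
    refine (wl1_det_le v (fun _ => zero_le_one) _ fun i j => wl1_binOp_le v hP (μ i j) hB).trans ?_
    rw [mul_pow, ← mul_assoc, ← pow_mul]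
    refine mul_le_mul_of_nonneg_right ?_ (pow_nonneg hB0 _)
    rw [show (8 : ℝ) = 2 * 4 by norm_num, mul_pow]
    refine mul_le_mul_of_nonneg_right ?_ (by positivity)
    have : s.factorial ≤ 2 ^ ((∑ i, d i) * s) := by
      rw [pow_mul]
      refine (Nat.factorial_le_pow s).trans (Nat.pow_le_pow_left (hs.trans ?_) s)
      exact Nat.lt_two_pow_self
    exact_mod_cast this
  · intro v hv B hB b
    have hB0 : 0 ≤ B := (v.nonneg _).trans (hB 0)
    refine coeff_det_le_of_nonarch v (isNonarchimedean v hv) _ hB0 (fun i j a => ?_) b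
    rw [Matrix.of_apply, coeff_binOp, map_mul]
    exact (mul_le_of_le_one_left (v.nonneg _)
      (abv_nat_le_one_of_nonarch (isNonarchimedean v hv) _)).trans (hB a)

end WronskianBounds

section LinearFactor

open MvPolynomial Height AdmissibleAbsValues

variable {K : Type*} [Field K]

lemma wl1_X_mul {σ : Type*} (v : AbsoluteValue K ℝ) (r : σ → ℝ) (i : σ) (P : MvPolynomial σ K) :
    wl1 v r (X i * P) = r i * wl1 v r P := by
  classical
  rw [wl1, support_X_mul, Finset.sum_map, wl1, Finset.mul_sum]
  refine Finset.sum_congr rfl fun a _ => ?_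
  simp only [addLeftEmbedding_apply, coeff_X_mul]
  have h1 : (Finsupp.single i 1 : σ →₀ ℕ).prod (fun x e => r x ^ e) = r i := by simp
  have h2 : (Finsupp.single i 1 + a).prod (fun x e => r x ^ e) =
      (Finsupp.single i 1 : σ →₀ ℕ).prod (fun x e => r x ^ e) * a.prod fun x e => r x ^ e :=
    Finsupp.prod_add_index' (fun _ => pow_zero _) (fun _ _ _ => pow_add _ _ _)
  rw [h2, h1]
  ring

lemma wl1_C_mul {σ : Type*} (v : AbsoluteValue K ℝ) (r : σ → ℝ) (c : K) (P : MvPolynomial σ K) :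
    wl1 v r (C c * P) = v c * wl1 v r P := by
  classical
  have hs : (C c * P).support ⊆ P.support := by
    rw [C_mul']
    exact support_smul
  rw [wl1_eq_sum v r _ hs, wl1, Finset.mul_sum]
  refine Finset.sum_congr rfl fun a _ => ?_
  rw [coeff_C_mul, map_mul, mul_assoc]

lemma wl1_linear_factor_mul (v : AbsoluteValue K ℝ) {r : ℝ} (hr : 0 ≤ r) (ξ : K)
    (h : max (v ξ) 1 / 2 ≤ |r - v ξ|) (Q : MvPolynomial (Fin 1) K) :
    max (v ξ) 1 / 2 * wl1 v (fun _ => r) Q ≤ wl1 v (fun _ => r) ((X 0 - C ξ) * Q) := by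
  have hQ := wl1_nonneg v (r := fun _ : Fin 1 => r) (fun _ => hr) Q
  refine (mul_le_mul_of_nonneg_right h hQ).trans ?_
  have h1 := wl1_X_mul v (fun _ : Fin 1 => r) 0 Q
  have h2 := wl1_C_mul v (fun _ : Fin 1 => r) ξ Q
  have h3 := wl1_add_le v (r := fun _ : Fin 1 => r) (fun _ => hr) ((X 0 - C ξ) * Q) (C ξ * Q)
  have h4 := wl1_add_le v (r := fun _ : Fin 1 => r) (fun _ => hr) (-((X 0 - C ξ) * Q)) (X 0 * Q)
  rw [show (X 0 - C ξ) * Q + C ξ * Q = X 0 * Q by ring] at h3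
  rw [show -((X 0 - C ξ) * Q) + X 0 * Q = C ξ * Q by ring, wl1_neg] at h4
  rcases abs_cases (r - v ξ) with ⟨h5, _⟩ | ⟨h5, _⟩ <;> rw [h5] <;> nlinarith

lemma wl1_linear_factor_pow_mul (v : AbsoluteValue K ℝ) {r : ℝ} (hr : 0 ≤ r) (ξ : K)
    (h : max (v ξ) 1 / 2 ≤ |r - v ξ|) (Q : MvPolynomial (Fin 1) K) (k : ℕ) :
    (max (v ξ) 1 / 2) ^ k * wl1 v (fun _ => r) Q ≤ wl1 v (fun _ => r) ((X 0 - C ξ) ^ k * Q) := by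
  induction k with
  | zero => simp
  | succ k ih =>
    rw [pow_succ', pow_succ', mul_assoc, mul_assoc]
    exact (mul_le_mul_of_nonneg_left ih (by positivity)).trans
      (wl1_linear_factor_mul v hr ξ h _)

lemma coeff_le_of_linear_factor_pow (v : AbsoluteValue K ℝ) (ξ : K) {Q : MvPolynomial (Fin 1) K}
    {k D : ℕ} (hk : k ≤ D) (hD : ((X 0 - C ξ) ^ k * Q).degreeOf 0 ≤ D) {B : ℝ}
    (hB : ∀ a, v (coeff a ((X 0 - C ξ) ^ k * Q)) ≤ B) (b : Fin 1 →₀ ℕ) :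
    v (coeff b Q) * max (v ξ) 1 ^ k ≤ 16 ^ D * B := by
  have hB0 : 0 ≤ B := (v.nonneg _).trans (hB 0)
  obtain ⟨r, hr1, hr4, hr⟩ : ∃ r : ℝ, 1 ≤ r ∧ r ≤ 4 ∧ max (v ξ) 1 / 2 ≤ |r - v ξ| := by
    by_cases h : 2 ≤ v ξ
    · refine ⟨1, le_rfl, by norm_num, ?_⟩
      rw [max_eq_left (by linarith), abs_of_nonpos (by linarith)]
      linarith
    · push Not at h
      refine ⟨4, by norm_num, le_rfl, ?_⟩
      rw [abs_of_nonneg (by linarith)]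
      have : max (v ξ) 1 ≤ 2 := max_le h.le (by norm_num)
      linarith
  have h1 := wl1_linear_factor_pow_mul v (by linarith) ξ hr Q k
  set W := (X 0 - C ξ) ^ k * Q with hW
  have h2 : wl1 v (fun _ => r) W ≤ 2 ^ D * (4 ^ D * B) := by
    rw [wl1]
    have : ∀ a ∈ W.support, v (coeff a W) * (a.prod fun _ e => r ^ e) ≤ 4 ^ D * B := by
      intro a ha
      rw [mul_comm]
      refine mul_le_mul ?_ (hB a) (v.nonneg _) (by positivity)
      rw [Finsupp.prod_fintype _ _ (fun _ => pow_zero _), Fin.prod_univ_one]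
      calc r ^ a 0 ≤ 4 ^ a 0 := pow_le_pow_left₀ (by linarith) hr4 _
        _ ≤ 4 ^ D := pow_le_pow_right₀ (by norm_num) ((monomial_le_degreeOf 0 ha).trans hD)
    refine (Finset.sum_le_sum this).trans ?_
    rw [Finset.sum_const, nsmul_eq_mul]
    refine mul_le_mul_of_nonneg_right ?_ (by positivity)
    have := card_support_le_two_pow (P := W) (d := fun _ => D) (fun i => by
      rwa [Subsingleton.elim i 0])
    simp only [Fin.sum_univ_one] at this
    exact_mod_cast this
  have h3 : v (coeff b Q) ≤ wl1 v (fun _ => r) Q :=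
    (coeff_le_wl1_one v Q b).trans (wl1_mono v (fun _ => zero_le_one) (fun _ => hr1) Q)
  have h4 : v (coeff b Q) * max (v ξ) 1 ^ k = 2 ^ k * ((max (v ξ) 1 / 2) ^ k * v (coeff b Q)) := by
    rw [div_pow]; field_simp
  rw [h4, show (16 : ℝ) = 2 * (2 * 4) by norm_num, mul_pow, mul_pow, mul_assoc, mul_assoc]
  refine mul_le_mul (pow_le_pow_right₀ (by norm_num) hk) ?_ (by positivity) (by positivity)
  exact (mul_le_mul_of_nonneg_left h3 (by positivity)).trans (h1.trans h2)

lemma coeff_le_of_linear_factor_nonarch {v : AbsoluteValue K ℝ} (hv : IsNonarchimedean v) (ξ : K)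
    {Q : MvPolynomial (Fin 1) K} {B : ℝ} (hB : ∀ a, v (coeff a ((X 0 - C ξ) * Q)) ≤ B)
    (b : Fin 1 →₀ ℕ) : v (coeff b Q) * max (v ξ) 1 ≤ B := by
  classical
  have hB0 : 0 ≤ B := (v.nonneg _).trans (hB 0)
  have hrec (j : ℕ) : coeff (Finsupp.single 0 (j + 1)) ((X 0 - C ξ) * Q) =
      coeff (Finsupp.single 0 j) Q - ξ * coeff (Finsupp.single 0 (j + 1)) Q := by
    rw [sub_mul, coeff_sub, coeff_C_mul, Finsupp.single_add, add_comm (Finsupp.single 0 j),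
      coeff_X_mul]
  have hrec0 : coeff (Finsupp.single 0 0) ((X 0 - C ξ) * Q) =
      - (ξ * coeff (Finsupp.single 0 0) Q) := by
    rw [sub_mul, coeff_sub, coeff_C_mul, Finsupp.single_zero, coeff_X_mul']
    simp
  have hb : b = Finsupp.single 0 (b 0) := by
    refine Finsupp.ext fun i => ?_
    rw [Subsingleton.elim i 0]; simp
  rw [hb]
  generalize b 0 = j
  rcases le_or_gt 1 (v ξ) with h1 | h1
  · rw [max_eq_left h1]
    have hstep (x : K) (hx : v (ξ * x) ≤ B) : v x ≤ B := by
      rw [map_mul] at hx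
      exact (le_mul_of_one_le_left (v.nonneg _) h1).trans hx
    have : ∀ j, v (ξ * coeff (Finsupp.single 0 j) Q) ≤ B := by
      intro j
      induction j with
      | zero => rw [← v.map_neg, ← hrec0]; exact hB _
      | succ j ih =>
        have : ξ * coeff (Finsupp.single 0 (j + 1)) Q = coeff (Finsupp.single 0 j) Q +
            -coeff (Finsupp.single 0 (j + 1)) ((X 0 - C ξ) * Q) := by
          rw [hrec]; ring
        rw [this]
        refine (hv _ _).trans (max_le (hstep _ ih) ?_)
        rw [v.map_neg]
        exact hB _
    rw [mul_comm, ← map_mul]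
    exact this j
  · rw [max_eq_right h1.le, mul_one]
    by_contra hc
    push Not at hc
    have hmono : ∀ i, B < v (coeff (Finsupp.single 0 (j + i)) Q) := by
      intro i
      induction i with
      | zero => exact hc
      | succ i ih =>
        by_contra hn
        push Not at hn
        have h2 : coeff (Finsupp.single 0 (j + i)) Q =
            coeff (Finsupp.single 0 (j + i + 1)) ((X 0 - C ξ) * Q) +
              ξ * coeff (Finsupp.single 0 (j + i + 1)) Q := by rw [hrec]; ring
        rw [h2] at ih
        refine absurd (hv _ _) (not_le.mpr (lt_of_le_of_lt (max_le (hB _) ?_) ih))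
        rw [map_mul]
        exact (mul_le_of_le_one_left (v.nonneg _) h1.le).trans hn
    have hinj : Function.Injective fun i : ℕ => Finsupp.single (0 : Fin 1) (j + i) := by
      intro x y hxy
      have := Finsupp.single_injective _ hxy
      omega
    refine Set.infinite_range_of_injective hinj (Q.support.finite_toSet.subset ?_)
    rintro _ ⟨i, rfl⟩
    simp only [Finset.mem_coe, mem_support_iff]
    intro h0
    have := hmono i
    rw [h0, map_zero] at this
    linarith

lemma coeff_le_of_linear_factor_pow_nonarch {v : AbsoluteValue K ℝ} (hv : IsNonarchimedean v)
    (ξ : K) (k : ℕ) {Q : MvPolynomial (Fin 1) K} {B : ℝ}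
    (hB : ∀ a, v (coeff a ((X 0 - C ξ) ^ k * Q)) ≤ B)
    (b : Fin 1 →₀ ℕ) : v (coeff b Q) * max (v ξ) 1 ^ k ≤ B := by
  have hpos : 0 < max (v ξ) 1 := lt_max_of_lt_right one_pos
  induction k generalizing B with
  | zero => simpa using hB b
  | succ k ih =>
    have h1 : ∀ a, v (coeff a ((X 0 - C ξ) ^ k * Q)) ≤ B / max (v ξ) 1 := by
      intro a
      rw [le_div_iff₀ hpos]
      refine coeff_le_of_linear_factor_nonarch hv ξ (fun a => ?_) a
      rw [← mul_assoc, ← pow_succ']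
      exact hB a
    have := ih h1
    rwa [le_div_iff₀ hpos, mul_assoc, ← pow_succ] at this

lemma mulHeight₁_pow_le_of_linear_factor_pow [AdmissibleAbsValues K] (ξ : K)
    {Q : MvPolynomial (Fin 1) K} (hQ : Q ≠ 0) {k D : ℕ} (hk : k ≤ D)
    (hD : ((X 0 - C ξ) ^ k * Q).degreeOf 0 ≤ D) :
    mulHeight₁ ξ ^ k ≤ ((16 : ℝ) ^ D) ^ totalWeight K * polH ((X 0 - C ξ) ^ k * Q) := by
  have hX : (X 0 - C ξ : MvPolynomial (Fin 1) K) ≠ 0 := by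
    intro h
    have := congrArg (coeff (Finsupp.single 0 1)) h
    simp [coeff_C, eq_comm] at this
  have hne : (X 0 - C ξ) ^ k * Q ≠ 0 := mul_ne_zero (pow_ne_zero _ hX) hQ
  have h1 : (![ξ ^ k, 1] : Fin 2 → K) ≠ 0 := by
    intro h
    simpa using congrFun h 1
  have h2 := mulHeight_fun_mul_eq h1 (coeff_support_ne_zero hQ)
  rw [← mulHeight₁_eq_mulHeight, mulHeight₁_pow] at h2
  have h3 : mulHeight₁ ξ ^ k ≤ mulHeight₁ ξ ^ k * mulHeight fun a : Q.support => coeff a.1 Q :=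
    le_mul_of_one_le_right (pow_nonneg (mulHeight₁_nonneg _) _) (one_le_mulHeight _)
  refine h3.trans ?_
  rw [← h2, ← pow_one (polH _), polH]
  have key (v : AbsoluteValue K ℝ) (A : ℝ) (h : ∀ b, v (coeff b Q) * max (v ξ) 1 ^ k ≤ A)
      (j : Fin 2 × Q.support) : v (![ξ ^ k, 1] j.1 * coeff j.2.1 Q) ≤ A := by
    refine le_trans ?_ (h j.2.1)
    rw [map_mul, mul_comm]
    refine mul_le_mul_of_nonneg_left ?_ (v.nonneg _)
    obtain ⟨i, _⟩ := j
    fin_cases i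
    · simpa using pow_le_pow_left₀ (v.nonneg _) (le_max_left (v ξ) 1) k
    · simpa using one_le_pow₀ (le_max_right (v ξ) 1)
  have key2 (v : AbsoluteValue K ℝ) (B : ℝ)
      (h : ∀ i : ((X 0 - C ξ) ^ k * Q).support, v (coeff i.1 ((X 0 - C ξ) ^ k * Q)) ≤ B)
      (a : Fin 1 →₀ ℕ) : v (coeff a ((X 0 - C ξ) ^ k * Q)) ≤ B := by
    by_cases ha : a ∈ ((X 0 - C ξ) ^ k * Q).support
    · exact h ⟨a, ha⟩
    · obtain ⟨b, hb⟩ := MvPolynomial.ne_zero_iff.mp hne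
      rw [notMem_support_iff.mp ha, map_zero]
      exact (v.nonneg _).trans (h ⟨b, mem_support_iff.mpr hb⟩)
  refine mulHeight_le_of_local (coeff_support_ne_zero hne) (one_le_pow₀ (by norm_num)) 1
    (fun v _ B hB j => ?_) (fun v hv B hB j => ?_)
  · rw [pow_one]
    exact key v _ (coeff_le_of_linear_factor_pow v ξ hk hD (key2 v B hB)) j
  · rw [pow_one]
    exact key v _ (coeff_le_of_linear_factor_pow_nonarch (isNonarchimedean v hv) ξ k
      (key2 v B hB)) j

lemma exists_linear_factor_pow {V : MvPolynomial (Fin 1) K} {ξ : K} {k : ℕ}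
    (h : ∀ κ ∈ (shiftAt (fun _ => ξ) V).support, k ≤ κ 0) :
    ∃ Q, V = (X 0 - C ξ) ^ k * Q := by
  classical
  have h1 : ∃ R, shiftAt (fun _ => ξ) V = X 0 ^ k * R := by
    have : (monomial (Finsupp.single (0 : Fin 1) k) (1 : K)) ∣ shiftAt (fun _ => ξ) V := by
      rw [monomial_one_dvd_iff_modMonomial_eq_zero]
      ext a
      by_cases ha : Finsupp.single 0 k ≤ a
      · rw [coeff_modMonomial_of_le _ ha, coeff_zero]
      · rw [coeff_modMonomial_of_not_le _ ha, coeff_zero]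
        by_contra hc
        apply ha
        rw [Finsupp.single_le_iff]
        exact h a (mem_support_iff.mpr hc)
    rw [← X_pow_eq_monomial] at this
    exact this
  obtain ⟨R, hR⟩ := h1
  refine ⟨shiftAt (fun _ => -ξ) R, ?_⟩
  apply shiftAt_injective (fun _ => ξ)
  rw [hR, map_mul, map_pow]
  congr 1
  · simp [shiftAt, algebraMap_eq]
  · rw [← AlgHom.comp_apply]
    have : (shiftAt fun _ : Fin 1 => ξ).comp (shiftAt fun _ => -ξ) = AlgHom.id K _ := by
      apply MvPolynomial.algHom_ext
      intro i
      simp [shiftAt, algebraMap_eq]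
    rw [this, AlgHom.id_apply]

end LinearFactor

section RothLemma

open MvPolynomial Height AdmissibleAbsValues

variable {K : Type*} [Field K]

lemma sum_max_sub_injective {s d : ℕ} (hs : 1 ≤ s) (hsd : s ≤ d + 1) (hd : 0 < d) {ε : ℝ}
    (h0 : 0 < ε) (h1 : ε ≤ 1) (ν : Fin s → ℕ) (hν : Function.Injective ν)
    (hle : ∀ j, ν j ≤ s - 1) :
    s * ε ^ 2 / 32 ≤ ∑ j, max (ε / 2 - (ν j : ℝ) / d) 0 := by
  have hd' : (0 : ℝ) < d := by exact_mod_cast hd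
  let τ : Fin s → Fin s := fun j => ⟨ν j, by have := hle j; omega⟩
  have hτ : Function.Bijective τ := by
    rw [Finite.injective_iff_bijective.symm]
    intro a b hab
    exact hν (congrArg Fin.val hab)
  have hsum : ∑ j, max (ε / 2 - (ν j : ℝ) / d) 0 =
      ∑ j : Fin s, max (ε / 2 - ((j : ℕ) : ℝ) / d) 0 :=
    Function.Bijective.sum_comp hτ (fun j : Fin s => max (ε / 2 - ((j : ℕ) : ℝ) / d) 0)
  rw [hsum, Fin.sum_univ_eq_sum_range (fun j : ℕ => max (ε / 2 - (j : ℝ) / d) 0)]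
  let t := min (⌊ε * d / 4⌋₊ + 1) s
  have hts : Finset.range t ⊆ Finset.range s := Finset.range_mono (min_le_right _ _)
  refine le_trans ?_ (Finset.sum_le_sum_of_subset_of_nonneg hts fun _ _ _ => le_max_right _ _)
  have hj : ∀ j ∈ Finset.range t, ε / 4 ≤ max (ε / 2 - (j : ℝ) / d) 0 := by
    intro j hj
    refine le_max_of_le_left ?_
    have : j ≤ ⌊ε * d / 4⌋₊ := by
      have := (Finset.mem_range.mp hj).trans_le (min_le_left _ _)
      omega
    have h2 : (j : ℝ) ≤ ε * d / 4 := (Nat.le_floor_iff (by positivity)).mp this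
    have h3 : (j : ℝ) / d ≤ ε / 4 := by
      rw [div_le_iff₀ hd']; linarith
    linarith
  refine le_trans ?_ (Finset.sum_le_sum hj)
  rw [Finset.sum_const, Finset.card_range, nsmul_eq_mul]
  have hsd' : (s : ℝ) ≤ d + 1 := by exact_mod_cast hsd
  have ht : s * ε / 8 ≤ (t : ℝ) := by
    rcases min_cases (⌊ε * d / 4⌋₊ + 1) s with ⟨h, _⟩ | ⟨h, _⟩
    · have : (t : ℝ) = ⌊ε * d / 4⌋₊ + 1 := by simp only [t, h]; push_cast; rfl
      rw [this]
      have := Nat.lt_floor_add_one (ε * d / 4)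
      nlinarith
    · have : (t : ℝ) = s := by simp only [t, h]
      rw [this]
      have : (0 : ℝ) ≤ s := by positivity
      nlinarith
  nlinarith

lemma degreeOf_binOp_le {n : ℕ} (μ : Fin n → ℕ) (P : MvPolynomial (Fin n) K) (i : Fin n) :
    degreeOf i (binOp μ P) ≤ degreeOf i P := by
  classical
  rw [degreeOf_le_iff]
  intro a ha
  refine monomial_le_degreeOf i ?_
  rw [mem_support_iff] at ha ⊢
  intro h
  rw [coeff_binOp, h, mul_zero] at ha
  exact ha rfl

lemma degreeOf_det_le {σ : Type*} {s : ℕ} (M : Matrix (Fin s) (Fin s) (MvPolynomial σ K)) (i : σ)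
    {D : ℕ} (h : ∀ k l, degreeOf i (M k l) ≤ D) : degreeOf i M.det ≤ s * D := by
  classical
  rw [Matrix.det_apply]
  refine (degreeOf_sum_le i Finset.univ _).trans (Finset.sup_le fun g _ => ?_)
  have h1 : degreeOf i (∏ j, M (g j) j) ≤ s * D := by
    refine (degreeOf_prod_le i Finset.univ _).trans ?_
    refine (Finset.sum_le_sum fun j _ => h (g j) j).trans ?_
    simp
  rcases Int.units_eq_one_or (Equiv.Perm.sign g) with hg | hg <;> rw [hg]
  · rwa [one_smul]
  · rw [Units.neg_smul, one_smul, degreeOf_neg]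
    exact h1

lemma det_binOp_sep {m s : ℕ} (f : Fin s → MvPolynomial (Fin m) K)
    (g : Fin s → MvPolynomial (Fin 1) K) (μ : Fin s → Fin m → ℕ) (ν : Fin s → Fin 1 → ℕ) :
    (Matrix.of fun i j => binOp (Fin.cons (ν j 0) (μ i)) (∑ k, sep (f k) (g k))).det =
      sep (Matrix.of fun i k => binOp (μ i) (f k)).det
        (Matrix.of fun j k => binOp (ν j) (g k)).det := by
  rw [sep, AlgHom.map_det, AlgHom.map_det, ← Matrix.det_transpose (M := (rename _).mapMatrix
    (Matrix.of fun j k => binOp (ν j) (g k))), ← Matrix.det_mul]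
  congr 1
  ext1 i j
  rw [Matrix.mul_apply, Matrix.of_apply, map_sum]
  refine Finset.sum_congr rfl fun k _ => ?_
  rw [binOp_sep]
  rfl

lemma degreeOf_succ_le_of_sep {m : ℕ} {U : MvPolynomial (Fin m) K} {V : MvPolynomial (Fin 1) K}
    (hV : V ≠ 0) (i : Fin m) : degreeOf i U ≤ degreeOf i.succ (sep U V) := by
  classical
  rw [degreeOf_le_iff]
  intro a ha
  obtain ⟨b, hb⟩ := MvPolynomial.ne_zero_iff.mp hV
  have := monomial_le_degreeOf i.succ (f := sep U V) (m := Finsupp.cons (b 0) a) (by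
    rw [mem_support_iff, coeff_sep]
    exact mul_ne_zero (mem_support_iff.mp ha) hb)
  simpa using this

lemma degreeOf_zero_le_of_sep {m : ℕ} {U : MvPolynomial (Fin m) K} {V : MvPolynomial (Fin 1) K}
    (hU : U ≠ 0) : degreeOf 0 V ≤ degreeOf 0 (sep U V) := by
  classical
  rw [degreeOf_le_iff]
  intro b hb
  obtain ⟨a, ha⟩ := MvPolynomial.ne_zero_iff.mp hU
  have := monomial_le_degreeOf 0 (f := sep U V) (m := Finsupp.cons (b 0) a) (by
    rw [mem_support_iff, coeff_sep]
    exact mul_ne_zero ha (mem_support_iff.mp hb))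
  simpa using this

lemma IdxGE.scale {n : ℕ} {P : MvPolynomial (Fin n) K} {d : Fin n → ℕ} {ξ : Fin n → K} {θ : ℝ}
    {s : ℕ} (hs : 0 < s) (h : IdxGE P d ξ (s * θ)) : IdxGE P (fun i => s * d i) ξ θ := by
  intro κ hκ
  have h1 := h κ hκ
  have hs' : (0 : ℝ) < s := by exact_mod_cast hs
  have h2 : ∑ i, (κ i : ℝ) / ((s * d i : ℕ) : ℝ) = (∑ i, (κ i : ℝ) / d i) / s := by
    rw [Finset.sum_div]
    refine Finset.sum_congr rfl fun i _ => ?_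
    push_cast
    rw [div_div, mul_comm]
  rw [h2, le_div_iff₀ hs']
  linarith

set_option maxHeartbeats 1000000 in
theorem not_idxGE_of_roth [CharZero K] [AdmissibleAbsValues K] (m : ℕ) :
    ∃ C : ℝ, 1 ≤ C ∧ ∀ ε : ℝ, 0 < ε → ∃ ω : ℝ, 0 < ω ∧ ∀ d : Fin m → ℕ, (∀ j, 0 < d j) →
      (∀ i j, i < j → (d i : ℝ) ≤ ω * d j) → ∀ (ξ : Fin m → K) (D : ℝ),
      (∀ j, D ≤ d j * logHeight₁ (ξ j)) → ∀ P : MvPolynomial (Fin m) K, P ≠ 0 →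
      (∀ j, degreeOf j P ≤ d j) → Real.log (polH P) + C * ∑ j, (d j : ℝ) ≤ ω * D →
      ¬ IdxGE P d ξ ε := by
  classical
  induction m with
  | zero =>
    refine ⟨1, le_rfl, fun ε hε => ⟨1, one_pos, ?_⟩⟩
    intro d _ _ ξ D _ P hP _ _ hidx
    have hne : shiftAt ξ P ≠ 0 := by
      rw [← map_zero (shiftAt ξ)]
      exact fun h => hP (shiftAt_injective ξ h)
    obtain ⟨κ, hκ⟩ := MvPolynomial.ne_zero_iff.mp hne
    have := hidx κ (mem_support_iff.mpr hκ)
    simp at this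
    linarith
  | succ m ih =>
    obtain ⟨C, hC, hCω⟩ := ih
    set tw : ℝ := (totalWeight K : ℝ) with htw
    have htw0 : 0 ≤ tw := by positivity
    have hl8 : 0 ≤ Real.log 8 := Real.log_nonneg (by norm_num)
    have hl16 : 0 ≤ Real.log 16 := Real.log_nonneg (by norm_num)
    refine ⟨C + tw * Real.log 8 + tw * Real.log 16, by nlinarith [mul_nonneg htw0 hl8, mul_nonneg htw0 hl16], fun ε₀ hε₀ => ?_⟩
    obtain ⟨ε, hε, hε1, hεε⟩ : ∃ ε : ℝ, 0 < ε ∧ ε ≤ 1 ∧ ε ≤ ε₀ :=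
      ⟨min ε₀ 1, lt_min hε₀ one_pos, min_le_right _ _, min_le_left _ _⟩
    set δ : ℝ := ε ^ 2 / 64 with hδ
    have hδ0 : 0 < δ := by positivity
    have hδ1 : δ ≤ 1 := by rw [hδ]; nlinarith
    obtain ⟨ω', hω', hroth⟩ := hCω δ hδ0
    set ω : ℝ := min ω' (min (ε / 2) (δ / 2)) with hω
    have hω0 : 0 < ω := lt_min hω' (lt_min (by linarith) (by linarith))
    have hωω' : ω ≤ ω' := min_le_left _ _
    have hωε : ω ≤ ε / 2 := (min_le_right _ _).trans (min_le_left _ _)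
    have hωδ : ω ≤ δ / 2 := (min_le_right _ _).trans (min_le_right _ _)
    refine ⟨ω, hω0, ?_⟩
    intro d hd hchain ξ D hD P hP hdeg hH hidx0
    have hidx := hidx0.mono hεε
    set Sd : ℝ := ∑ j, (d j : ℝ) with hSd
    have hd0 : (1 : ℝ) ≤ d 0 := by exact_mod_cast hd 0
    have hSsplit : Sd = d 0 + ∑ j : Fin m, (d j.succ : ℝ) := Fin.sum_univ_succ _
    have hrest : (0 : ℝ) ≤ ∑ j : Fin m, (d j.succ : ℝ) := by positivity
    have hlogP : 0 ≤ Real.log (polH P) := Real.log_nonneg (one_le_polH P)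
    have hωD : 0 < ω * D := by
      nlinarith [mul_nonneg htw0 hl8, mul_nonneg htw0 hl16]
    have hDpos : 0 < D := (mul_pos_iff_of_pos_left hω0).mp hωD
    obtain ⟨s, f, g, hs1, hsd, hf, hg, hPsum⟩ := exists_sep_decomp hP (hdeg 0)
    obtain ⟨μ, hμ, hμdet⟩ := exists_wronskian_ne_zero f hf
    obtain ⟨ν, hν, hνdet⟩ := exists_wronskian_ne_zero g hg
    set U := (Matrix.of fun i k => binOp (μ i) (f k)).det with hU
    set V := (Matrix.of fun j k => binOp (ν j) (g k)).det with hV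
    have hW : (Matrix.of fun i j => binOp (Fin.cons (ν j 0) (μ i)) P).det = sep U V := by
      rw [hPsum]
      exact det_binOp_sep f g μ ν
    have hνinj : Function.Injective fun j => ν j 0 := by
      intro a b hab
      by_contra hne
      refine hνdet (Matrix.det_zero_of_row_eq hne ?_)
      funext k
      have : ν a = ν b := by
        funext i
        rw [Subsingleton.elim i 0]
        exact hab
      simp [this]
    have hνle : ∀ j, ν j 0 ≤ s - 1 := fun j => by simpa using hν j
    have hidxW : IdxGE (sep U V) d ξ (s * δ + s * δ) := by
      rw [← hW]
      refine (IdxGE.det (θ := fun j => max (ε / 2 - (ν j 0 : ℝ) / d 0) 0) fun i j => ?_).mono ?_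
      · rcases le_total (ε / 2 - (ν j 0 : ℝ) / d 0) 0 with h | h
        · rw [max_eq_right h]
          exact IdxGE.of_nonpos le_rfl
        · rw [max_eq_left h]
          refine (hidx.binOp _).mono ?_
          rw [Fin.sum_univ_succ]
          simp only [Fin.cons_zero, Fin.cons_succ]
          have h1 : ∀ l : Fin m, (μ i l : ℝ) / d l.succ ≤ μ i l * (ω / d 0) := by
            intro l
            rw [div_eq_mul_inv]
            refine mul_le_mul_of_nonneg_left ?_ (by positivity)
            have h2 := hchain 0 l.succ (Fin.succ_pos l)
            have h3 : (0 : ℝ) < d l.succ := by exact_mod_cast hd _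
            rw [inv_le_iff_one_le_mul₀ h3, div_mul_eq_mul_div, le_div_iff₀ (by linarith)]
            linarith
          have h2 : ∑ l, (μ i l : ℝ) / d l.succ ≤ ω := by
            refine (Finset.sum_le_sum fun l _ => h1 l).trans ?_
            rw [← Finset.sum_mul]
            have h3 : (∑ l, (μ i l : ℝ)) ≤ d 0 := by
              have := hμ i
              have : ∑ l, μ i l ≤ d 0 := by omega
              exact_mod_cast this
            calc (∑ l, (μ i l : ℝ)) * (ω / d 0) ≤ d 0 * (ω / d 0) :=
                  mul_le_mul_of_nonneg_right h3 (by positivity)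
              _ = ω := by field_simp
          linarith
      · have := sum_max_sub_injective hs1 hsd (hd 0) hε hε1 _ hνinj hνle
        rw [hδ]
        linarith
    have hWdeg : ∀ i, degreeOf i (sep U V) ≤ s * d i := by
      intro i
      rw [← hW]
      exact degreeOf_det_le _ i fun k l => (degreeOf_binOp_le _ _ i).trans (hdeg i)
    have hWH : Real.log (polH (sep U V)) ≤ s * (tw * Real.log 8 * Sd + Real.log (polH P)) := by
      have h1 := polH_det_binOp_le hP hdeg (s := s) (by
        refine hsd.trans (Nat.succ_le_succ ?_)
        exact Finset.single_le_sum (f := d) (fun _ _ => Nat.zero_le _) (Finset.mem_univ 0))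
        (fun i j => Fin.cons (ν j 0) (μ i))
      rw [hW] at h1
      have h2 := Real.log_le_log (polH_pos _) h1
      rw [Real.log_mul (by positivity) (pow_ne_zero _ (polH_pos _).ne'), Real.log_pow,
        Real.log_pow, Real.log_pow] at h2
      push_cast at h2
      refine h2.trans (le_of_eq ?_)
      rw [hSd]
      ring
    have hUV := polH_mul_polH_le hμdet hνdet
    have hlogUV : Real.log (polH U) + Real.log (polH V) ≤ Real.log (polH (sep U V)) := by
      rw [← Real.log_mul (polH_pos _).ne' (polH_pos _).ne']
      exact Real.log_le_log (mul_pos (polH_pos _) (polH_pos _)) hUV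
    have hlogU : 0 ≤ Real.log (polH U) := Real.log_nonneg (one_le_polH U)
    have hlogV : 0 ≤ Real.log (polH V) := Real.log_nonneg (one_le_polH V)
    rcases idxGE_sep hidxW with hidxU | hidxV
    · refine hroth (fun i => s * d i.succ) (fun j => Nat.mul_pos hs1 (hd _)) ?_
        (fun i => ξ i.succ) (s * D) ?_ U hμdet ?_ ?_ (IdxGE.scale hs1 hidxU)
      · intro i j hij
        have h1 := hchain i.succ j.succ (Fin.succ_lt_succ_iff.mpr hij)
        have h2 : ω * (d j.succ : ℝ) ≤ ω' * d j.succ :=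
          mul_le_mul_of_nonneg_right hωω' (by positivity)
        push_cast
        nlinarith
      · intro j
        push_cast
        rw [mul_assoc]
        exact mul_le_mul_of_nonneg_left (hD j.succ) (by positivity)
      · intro j
        exact (degreeOf_succ_le_of_sep hνdet j).trans (hWdeg _)
      · have h1 : ∑ j : Fin m, ((s * d j.succ : ℕ) : ℝ) = s * ∑ j : Fin m, (d j.succ : ℝ) := by
          rw [Finset.mul_sum]
          push_cast
          rfl
        rw [h1]
        have h2 : Real.log (polH U) + C * (s * ∑ j : Fin m, (d j.succ : ℝ)) ≤
            s * (tw * Real.log 8 * Sd + Real.log (polH P) + C * Sd) := by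
          have : C * (s * ∑ j : Fin m, (d j.succ : ℝ)) ≤ s * (C * Sd) := by
            rw [hSsplit]
            have : 0 ≤ s * (C * (d 0 : ℝ)) := by positivity
            linarith
          linarith
        have h3 : tw * Real.log 8 * Sd + Real.log (polH P) + C * Sd ≤ ω * D := by
          have : 0 ≤ tw * Real.log 16 * Sd := by positivity
          linarith
        have h4 : ω * D ≤ ω' * D := mul_le_mul_of_nonneg_right hωω' hDpos.le
        calc _ ≤ s * (ω' * D) := h2.trans (mul_le_mul_of_nonneg_left (h3.trans h4) (by positivity))
          _ = ω' * (s * D) := by ring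
    · set k := ⌈s * δ * d 0⌉₊ with hk
      have hk1 : ∀ κ ∈ (shiftAt (fun _ => ξ 0) V).support, k ≤ κ 0 := by
        intro κ hκ
        have := hidxV κ hκ
        rw [Fin.sum_univ_one, le_div_iff₀ (by linarith)] at this
        exact Nat.ceil_le.mpr this
      obtain ⟨Q, hQ⟩ := exists_linear_factor_pow hk1
      have hQ0 : Q ≠ 0 := by
        rintro rfl
        rw [mul_zero] at hQ
        exact hνdet hQ
      have hkD : k ≤ s * d 0 := by
        refine Nat.ceil_le.mpr ?_
        push_cast
        have : (0 : ℝ) ≤ s * d 0 := by positivity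
        nlinarith
      have h1 := mulHeight₁_pow_le_of_linear_factor_pow (ξ 0) hQ0 hkD (by
        rw [← hQ]
        exact (degreeOf_zero_le_of_sep hμdet).trans (hWdeg 0))
      rw [← hQ] at h1
      have h2 := Real.log_le_log (pow_pos (mulHeight₁_pos _) _) h1
      rw [Real.log_mul (by positivity) (polH_pos _).ne', Real.log_pow, Real.log_pow,
        Real.log_pow, ← logHeight₁_eq_log_mulHeight₁] at h2
      push_cast at h2
      have hh0 : 0 ≤ logHeight₁ (ξ 0) := zero_le_logHeight₁ _
      have h3 : s * δ * D ≤ k * logHeight₁ (ξ 0) := by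
        have h4 : s * δ * d 0 ≤ (k : ℝ) := Nat.le_ceil _
        have h5 : s * δ * D ≤ s * δ * (d 0 * logHeight₁ (ξ 0)) :=
          mul_le_mul_of_nonneg_left (hD 0) (by positivity)
        nlinarith
      have h6 : s * δ * D ≤ s * (ω * D) := by
        refine h3.trans (h2.trans ?_)
        have h7 : tw * (s * d 0 * Real.log 16) + Real.log (polH V) ≤
            s * (tw * Real.log 16 * Sd + tw * Real.log 8 * Sd + Real.log (polH P)) := by
          have : tw * (s * d 0 * Real.log 16) ≤ s * (tw * Real.log 16 * Sd) := by
            rw [hSsplit]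
            have : 0 ≤ s * (tw * Real.log 16 * ∑ j : Fin m, (d j.succ : ℝ)) := by positivity
            linarith
          linarith
        refine h7.trans (mul_le_mul_of_nonneg_left ?_ (by positivity))
        have : 0 ≤ C * Sd := by positivity
        linarith
      have h8 : s * (ω * D) ≤ s * (δ / 2 * D) :=
        mul_le_mul_of_nonneg_left (mul_le_mul_of_nonneg_right hωδ hDpos.le) (by positivity)
      have h9 : 0 < s * (δ * D) := by positivity
      linarith

end RothLemma

section Sys

open Real

section TwistedNorm

variable {K : Type*} [Field K] {ι : Type*} [Fintype ι]

/-- The weighted `ℓ¹` size of `L x` with respect to an absolute value. -/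
noncomputable def twNorm (a : AbsoluteValue K ℝ) (L : Matrix ι ι K) (c : ι → ℝ) (x : ι → K) : ℝ :=
  ∑ i, a (L.mulVec x i) * exp (-c i)

lemma twNorm_nonneg (a : AbsoluteValue K ℝ) (L : Matrix ι ι K) (c : ι → ℝ) (x : ι → K) :
    0 ≤ twNorm a L c x :=
  Finset.sum_nonneg fun _ _ => mul_nonneg (a.nonneg _) (exp_pos _).le

lemma abv_le_twNorm (a : AbsoluteValue K ℝ) (L : Matrix ι ι K) (c : ι → ℝ) (x : ι → K) (i : ι) :
    a (L.mulVec x i) ≤ exp (c i) * twNorm a L c x := by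
  have h : a (L.mulVec x i) * exp (-c i) ≤ twNorm a L c x :=
    Finset.single_le_sum (f := fun i => a (L.mulVec x i) * exp (-c i))
      (fun _ _ => mul_nonneg (a.nonneg _) (exp_pos _).le) (Finset.mem_univ i)
  rw [exp_neg] at h
  rwa [mul_comm, ← div_le_iff₀ (exp_pos _), div_eq_mul_inv]

lemma twNorm_le (a : AbsoluteValue K ℝ) (L : Matrix ι ι K) (c : ι → ℝ) (x : ι → K) {C : ℝ}
    (h : ∀ i, a (L.mulVec x i) ≤ C * exp (c i)) : twNorm a L c x ≤ Fintype.card ι * C := by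
  refine (Finset.sum_le_sum (g := fun _ => C) fun i _ => ?_).trans (by simp)
  rw [exp_neg, ← div_eq_mul_inv, div_le_iff₀ (exp_pos _)]
  exact h i

variable [DecidableEq ι]

lemma abv_le_sum_twNorm (a : AbsoluteValue K ℝ) {L : Matrix ι ι K} (hL : IsUnit L.det)
    {c : ι → ℝ} {b : ℝ} (hc : ∀ i, c i ≤ b) (x : ι → K) (i : ι) :
    a (x i) ≤ (∑ k, ∑ j, a (L⁻¹ k j)) * exp b * twNorm a L c x := by
  have hx : x i = ∑ j, L⁻¹ i j * L.mulVec x j := by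
    have : L⁻¹.mulVec (L.mulVec x) = x := by
      rw [Matrix.mulVec_mulVec, Matrix.nonsing_inv_mul _ hL, Matrix.one_mulVec]
    conv_lhs => rw [← this]
    rfl
  rw [hx]
  have hn := twNorm_nonneg a L c x
  calc a (∑ j, L⁻¹ i j * L.mulVec x j) ≤ ∑ j, a (L⁻¹ i j * L.mulVec x j) := a.sum_le _ _
    _ ≤ ∑ j, a (L⁻¹ i j) * (exp b * twNorm a L c x) := by
        refine Finset.sum_le_sum fun j _ => ?_
        rw [map_mul]
        refine mul_le_mul_of_nonneg_left ((abv_le_twNorm a L c x j).trans ?_) (a.nonneg _)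
        exact mul_le_mul_of_nonneg_right (exp_le_exp.mpr (hc j)) hn
    _ = (∑ j, a (L⁻¹ i j)) * (exp b * twNorm a L c x) := by rw [Finset.sum_mul]
    _ ≤ (∑ k, ∑ j, a (L⁻¹ k j)) * (exp b * twNorm a L c x) := by
        refine mul_le_mul_of_nonneg_right ?_ (mul_nonneg (exp_pos _).le hn)
        exact Finset.single_le_sum (f := fun k => ∑ j, a (L⁻¹ k j))
          (fun _ _ => Finset.sum_nonneg fun _ _ => a.nonneg _) (Finset.mem_univ i)
    _ = _ := by ring

lemma twNorm_pos (a : AbsoluteValue K ℝ) {L : Matrix ι ι K} (hL : IsUnit L.det)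
    (c : ι → ℝ) {x : ι → K} (hx : x ≠ 0) : 0 < twNorm a L c x := by
  refine (twNorm_nonneg _ _ _ _).lt_of_ne fun h => hx (funext fun i => ?_)
  obtain ⟨b, hb⟩ : ∃ b, ∀ i, c i ≤ b :=
    ⟨∑ i, |c i|, fun i => (le_abs_self _).trans
      (Finset.single_le_sum (f := fun i => |c i|) (fun _ _ => abs_nonneg _) (Finset.mem_univ i))⟩
  have := abv_le_sum_twNorm a hL hb x i
  rw [← h, mul_zero] at this
  exact a.eq_zero.mp (this.antisymm (a.nonneg _))

lemma abv_det_mul_le (a : AbsoluteValue K ℝ) (L : Matrix ι ι K) (c : ι → ℝ) (x : ι → ι → K) :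
    a L.det * a (Matrix.of x).det ≤
      (Fintype.card ι).factorial * exp (∑ i, c i) * ∏ j, twNorm a L c (x j) := by
  have h1 : L.det * (Matrix.of x).det = (Matrix.of fun j i => L.mulVec (x j) i).det := by
    rw [mul_comm, ← Matrix.det_transpose L, ← Matrix.det_mul]
    congr 1
    ext j i
    simp [Matrix.mul_apply, Matrix.mulVec, dotProduct, mul_comm]
  rw [← map_mul, h1, Matrix.det_apply]
  refine (a.sum_le _ _).trans ?_
  have h2 : ∀ σ : Equiv.Perm ι, a (Equiv.Perm.sign σ •
      ∏ i, (Matrix.of fun j i => L.mulVec (x j) i) (σ i) i) ≤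
      exp (∑ i, c i) * ∏ j, twNorm a L c (x j) := by
    intro σ
    have h3 : a (Equiv.Perm.sign σ • ∏ i, (Matrix.of fun j i => L.mulVec (x j) i) (σ i) i) =
        ∏ i, a (L.mulVec (x (σ i)) i) := by
      rw [Units.smul_def, zsmul_eq_mul, map_mul, map_prod]
      rcases Int.units_eq_one_or (Equiv.Perm.sign σ) with h | h <;> simp [h]
    rw [h3, exp_sum, ← Equiv.prod_comp σ (fun j => twNorm a L c (x j)), ← Finset.prod_mul_distrib]
    exact Finset.prod_le_prod (fun _ _ => a.nonneg _) fun i _ => abv_le_twNorm a L c _ i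
  refine (Finset.sum_le_sum fun σ _ => h2 σ).trans ?_
  simp [Fintype.card_perm, mul_assoc]

end TwistedNorm

section Davenport

variable {K : Type*} [Field K] {ι : Type*} [Fintype ι] [DecidableEq ι]

lemma exists_dominated_form (a : AbsoluteValue K ℝ) (L : Matrix ι ι K) (c : ι → ℝ)
    (F : Submodule K (ι → K)) (T : Finset ι) (hT : Module.finrank K F < T.card) :
    ∃ p ∈ T, ∀ x ∈ F, a (L.mulVec x p) * exp (-c p) ≤
      ∑ l ∈ T.erase p, a (L.mulVec x l) * exp (-c l) := by
  let f : T → Module.Dual K F := fun l =>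
    (LinearMap.proj (l : ι) ∘ₗ L.mulVecLin) ∘ₗ F.subtype
  have hdep : ¬ LinearIndependent K f := by
    intro h
    have := h.fintype_card_le_finrank
    rw [Subspace.dual_finrank_eq, Fintype.card_coe] at this
    omega
  obtain ⟨g, hg, l₀, hl₀⟩ := Fintype.not_linearIndependent_iff.mp hdep
  obtain ⟨p, -, hp⟩ := Finset.exists_max_image Finset.univ
    (fun l : T => a (g l) * exp (c l)) ⟨l₀, Finset.mem_univ _⟩
  have hgp : 0 < a (g p) * exp (c p) :=
    lt_of_lt_of_le (mul_pos (a.pos hl₀) (exp_pos _)) (hp l₀ (Finset.mem_univ _))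
  refine ⟨p, p.2, fun x hx => ?_⟩
  have h1 : ∑ l : T, g l * L.mulVec x l = 0 := by
    have := congrArg (fun φ : Module.Dual K F => φ ⟨x, hx⟩) hg
    simpa [f] using this
  rw [Finset.univ_eq_attach, ← Finset.add_sum_erase _ _ (Finset.mem_attach T p)] at h1
  have h2 : a (g p) * a (L.mulVec x p) ≤
      ∑ l ∈ T.attach.erase p, a (g l) * a (L.mulVec x l) := by
    rw [← map_mul, eq_neg_of_add_eq_zero_left h1, map_neg_eq_map]
    exact (a.sum_le _ _).trans (le_of_eq (by simp))
  have h3 : (a (g p) * exp (c p)) * (a (L.mulVec x p) * exp (-c p)) ≤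
      (a (g p) * exp (c p)) * ∑ l ∈ T.attach.erase p, a (L.mulVec x l) * exp (-c l) := by
    have e : (a (g p) * exp (c p)) * (a (L.mulVec x p) * exp (-c p)) =
        a (g p) * a (L.mulVec x p) * (exp (c p) * exp (-c p)) := by ring
    rw [e, ← exp_add, add_neg_cancel, exp_zero, mul_one, Finset.mul_sum]
    refine h2.trans (Finset.sum_le_sum fun l _ => ?_)
    have e2 : a (g l) * a (L.mulVec x l) =
        (a (g l) * exp (c l)) * (a (L.mulVec x l) * exp (-c l)) := by
      have : exp (c l) * exp (-c l) = 1 := by rw [← exp_add, add_neg_cancel, exp_zero]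
      linear_combination (-(a (g l) * a (L.mulVec x l))) * this
    rw [e2]
    exact mul_le_mul_of_nonneg_right (hp l (Finset.mem_univ _))
      (mul_nonneg (a.nonneg _) (exp_pos _).le)
  refine (le_of_mul_le_mul_left h3 hgp).trans (le_of_eq ?_)
  have := Finset.sum_attach (T.erase p) (fun l => a (L.mulVec x l) * exp (-c l))
  rw [← this]
  refine Finset.sum_bij' (fun l hl => ⟨l.1, ?_⟩) (fun l hl => ⟨l.1, ?_⟩) ?_ ?_ ?_ ?_ ?_
  · exact Finset.mem_erase.mpr ⟨fun h => (Finset.mem_erase.mp hl).1 (Subtype.ext h), l.2⟩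
  · exact (Finset.mem_erase.mp l.2).2
  · intro l hl
    exact Finset.mem_attach _ _
  · intro l hl
    refine Finset.mem_erase.mpr ⟨fun h => (Finset.mem_erase.mp l.2).1 (congrArg Subtype.val h),
      Finset.mem_attach _ _⟩
  · intro l hl
    rfl
  · intro l hl
    rfl
  · intro l hl
    rfl

lemma exists_flag_adapted_order (a : AbsoluteValue K ℝ) (L : Matrix ι ι K) (c : ι → ℝ) (k : ℕ)
    (w : Fin k → ι → K) (T : Finset ι) (hT : T.card = k) :
    ∃ τ : Fin k → ι, Function.Injective τ ∧ Finset.univ.image τ = T ∧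
      ∀ i, ∀ x ∈ Submodule.span K (w '' Set.Iic i),
        ∑ l ∈ T, a (L.mulVec x l) * exp (-c l) ≤
          2 ^ k * ∑ l ∈ Finset.Iic i, a (L.mulVec x (τ l)) * exp (-c (τ l)) := by
  induction k generalizing T with
  | zero =>
    refine ⟨Fin.elim0, fun i => i.elim0, ?_, fun i => i.elim0⟩
    rw [Finset.card_eq_zero.mp hT]
    rfl
  | succ k ih =>
    have hfin : Module.finrank K (Submodule.span K (Set.range (w ∘ Fin.castSucc))) < T.card := by
      have := finrank_range_le_card (R := K) (w ∘ Fin.castSucc)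
      rw [Fintype.card_fin] at this
      exact lt_of_le_of_lt this (by omega)
    obtain ⟨p, hpT, hp⟩ := exists_dominated_form a L c _ T hfin
    obtain ⟨τ, hinj, himg, hτ⟩ := ih (w ∘ Fin.castSucc) (T.erase p)
      (by rw [Finset.card_erase_of_mem hpT, hT]; rfl)
    have hτp : ∀ l, τ l ≠ p := by
      intro l h
      have : τ l ∈ T.erase p := himg ▸ Finset.mem_image_of_mem _ (Finset.mem_univ l)
      exact (Finset.mem_erase.mp this).1 h
    have hsnocinj : Function.Injective (Fin.snoc τ p : Fin (k + 1) → ι) := by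
      rw [Fin.snoc_injective_iff]
      exact ⟨hinj, fun ⟨l, hl⟩ => hτp l hl⟩
    have hsnocimg : Finset.univ.image (Fin.snoc τ p : Fin (k + 1) → ι) = T := by
      rw [← Finset.insert_erase hpT, ← himg]
      ext y
      simp only [Finset.mem_image, Finset.mem_univ, true_and, Finset.mem_insert]
      constructor
      · rintro ⟨l, rfl⟩
        induction l using Fin.lastCases with
        | last => simp
        | cast l => exact Or.inr ⟨l, by simp⟩
      · rintro (rfl | ⟨l, rfl⟩)
        · exact ⟨Fin.last k, by simp⟩
        · exact ⟨l.castSucc, by simp⟩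
    have hnn : ∀ (x : ι → K) l, 0 ≤ a (L.mulVec x l) * exp (-c l) :=
      fun x l => mul_nonneg (a.nonneg _) (exp_pos _).le
    refine ⟨Fin.snoc τ p, hsnocinj, hsnocimg, fun i => ?_⟩
    induction i using Fin.lastCases with
    | last =>
      intro x _
      have h1 : (Finset.Iic (Fin.last k)) = Finset.univ := by
        ext l
        simp [Fin.le_last]
      rw [h1, ← hsnocimg, Finset.sum_image fun _ _ _ _ h => hsnocinj h]
      refine le_mul_of_one_le_left (Finset.sum_nonneg fun _ _ => hnn _ _) ?_
      exact one_le_pow₀ (by norm_num)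
    | cast i =>
      intro x hx
      have hset : w '' Set.Iic i.castSucc = (w ∘ Fin.castSucc) '' Set.Iic i := by
        ext y
        constructor
        · rintro ⟨l, hl, rfl⟩
          have hl2 : l < Fin.last k := lt_of_le_of_lt hl (Fin.castSucc_lt_last i)
          refine ⟨l.castPred hl2.ne, ?_, by simp⟩
          rw [Set.mem_Iic, ← Fin.castSucc_le_castSucc_iff]
          simpa using hl
        · rintro ⟨l, hl, rfl⟩
          exact ⟨l.castSucc, by simpa using hl, rfl⟩
      rw [hset] at hx
      have h1 := hp x (Submodule.span_mono (Set.image_subset_range _ _) hx)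
      have h2 := hτ i x hx
      have h3 : ∑ l ∈ Finset.Iic i.castSucc,
          a (L.mulVec x ((Fin.snoc τ p : Fin (k + 1) → ι) l)) *
            exp (-c ((Fin.snoc τ p : Fin (k + 1) → ι) l)) =
          ∑ l ∈ Finset.Iic i, a (L.mulVec x (τ l)) * exp (-c (τ l)) := by
        have : Finset.Iic i.castSucc = (Finset.Iic i).map Fin.castSuccEmb := by
          ext l
          simp only [Finset.mem_Iic, Finset.mem_map, Fin.coe_castSuccEmb]
          constructor
          · intro hl
            have hl2 : l < Fin.last k := lt_of_le_of_lt hl (Fin.castSucc_lt_last i)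
            refine ⟨l.castPred hl2.ne, ?_, by simp⟩
            rw [← Fin.castSucc_le_castSucc_iff]
            simpa using hl
          · rintro ⟨l, hl, rfl⟩
            simpa using hl
        rw [this, Finset.sum_map]
        simp
      rw [h3, ← Finset.add_sum_erase _ _ hpT, pow_succ]
      linarith

/-- Davenport's lemma: weights may be rescaled along a flag. -/
lemma exists_davenport_order (a : AbsoluteValue K ℝ) (L : Matrix ι ι K) (c : ι → ℝ)
    (w : Fin (Fintype.card ι) → ι → K) :
    ∃ τ : Fin (Fintype.card ι) ≃ ι, ∀ ρ : Fin (Fintype.card ι) → ℝ, (∀ i, 0 < ρ i) →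
      Antitone ρ → ∀ i, ∀ x ∈ Submodule.span K (w '' Set.Iic i),
        ρ i * twNorm a L c x ≤ 2 ^ Fintype.card ι *
          twNorm a L (fun l => c l - log (ρ (τ.symm l))) x := by
  obtain ⟨τ, hinj, himg, hτ⟩ := exists_flag_adapted_order a L c _ w Finset.univ rfl
  have hbij : Function.Bijective τ :=
    (Fintype.bijective_iff_injective_and_card τ).mpr ⟨hinj, by simp⟩
  refine ⟨Equiv.ofBijective τ hbij, fun ρ hρ hanti i x hx => ?_⟩
  have h1 := hτ i x hx
  have h2 : twNorm a L (fun l => c l - log (ρ ((Equiv.ofBijective τ hbij).symm l))) x =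
      ∑ l, ρ l * (a (L.mulVec x (τ l)) * exp (-c (τ l))) := by
    unfold twNorm
    rw [← Equiv.sum_comp (Equiv.ofBijective τ hbij)]
    refine Finset.sum_congr rfl fun l _ => ?_
    beta_reduce
    rw [Equiv.symm_apply_apply, neg_sub, sub_eq_add_neg, exp_add, exp_log (hρ l)]
    simp only [Equiv.ofBijective_apply]
    ring
  have hnn : ∀ l, 0 ≤ a (L.mulVec x (τ l)) * exp (-c (τ l)) :=
      fun l => mul_nonneg (a.nonneg _) (exp_pos _).le
  have h3 : ρ i * ∑ l ∈ Finset.Iic i, a (L.mulVec x (τ l)) * exp (-c (τ l)) ≤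
      ∑ l, ρ l * (a (L.mulVec x (τ l)) * exp (-c (τ l))) := by
    rw [Finset.mul_sum]
    refine (Finset.sum_le_sum fun l hl => ?_).trans
      (Finset.sum_le_sum_of_subset_of_nonneg (Finset.subset_univ _) fun l _ _ =>
        mul_nonneg (hρ l).le (hnn l))
    exact mul_le_mul_of_nonneg_right (hanti (Finset.mem_Iic.mp hl)) (hnn l)
  rw [h2]
  unfold twNorm
  calc _ ≤ ρ i * (2 ^ Fintype.card ι *
        ∑ l ∈ Finset.Iic i, a (L.mulVec x (τ l)) * exp (-c (τ l))) :=
        mul_le_mul_of_nonneg_left h1 (hρ i).le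
    _ = 2 ^ Fintype.card ι *
        (ρ i * ∑ l ∈ Finset.Iic i, a (L.mulVec x (τ l)) * exp (-c (τ l))) := by ring
    _ ≤ _ := mul_le_mul_of_nonneg_left h3 (by positivity)

end Davenport

end Sys

section Sys2

open Real Height

/-- A field with a finite set of places and rings of integral elements, with the properties needed
in the geometry of numbers. -/
structure PlaceSys (K : Type) [Field K] [AdmissibleAbsValues K] where
  V : Type
  fintypeV : Fintype V
  decEqV : DecidableEq V
  v₀ : V
  R : Subring K
  O : Subring K
  R_le : R ≤ O
  abv : V → AbsoluteValue K ℝ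
  one_le_prod : ∀ x ∈ O, x ≠ 0 → 1 ≤ ∏ v, abv v x
  exists_mul_mem : ∀ x : K, ∃ n ∈ R, n ≠ 0 ∧ n * x ∈ R
  minkowski : ∀ (ι : Type) [Fintype ι] [Nonempty ι] (L : V → Matrix ι ι K), ∃ C : ℝ, 0 < C ∧
    ∀ c : V → ι → ℝ, ∑ v, ∑ i, c v i = 0 → ∃ x : ι → K, x ≠ 0 ∧ (∀ i, x i ∈ O) ∧
      ∀ v i, abv v ((L v).mulVec x i) ≤ C * exp (c v i)
  siegel : ∃ C : ℝ, 1 ≤ C ∧ ∀ (α β : Type) [Fintype α] [Fintype β] (a : Matrix α β K) (B : ℝ),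
    1 ≤ B → (∀ i j, a i j ∈ R) → (∀ v i j, abv v (a i j) ≤ B) →
    2 * Fintype.card α ≤ Fintype.card β → 0 < Fintype.card β →
    ∃ x : β → K, x ≠ 0 ∧ (∀ j, x j ∈ R) ∧ a.mulVec x = 0 ∧
      ∀ v j, abv v (x j) ≤ C * Fintype.card β * B
  mulHeight_le : ∀ (ι : Type) [Fintype ι] (x : ι → K), (∀ i, x i ∈ O) → x ≠ 0 →
    mulHeight x ≤ (∏ v, ∑ i, abv v (x i)) ^ 2
  abv_le : ∀ v x, abv v x ≤ mulHeight₁ x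

attribute [instance] PlaceSys.fintypeV PlaceSys.decEqV

namespace PlaceSys

variable {K : Type} [Field K] [AdmissibleAbsValues K] (S : PlaceSys K)
variable {ι : Type} [Fintype ι] [DecidableEq ι]

/-- The twisted height attached to forms `L` and weights `c`. -/
noncomputable def twH (L : S.V → Matrix ι ι K) (c : S.V → ι → ℝ) (x : ι → K) : ℝ :=
  ∏ v, twNorm (S.abv v) (L v) (c v) x

lemma exists_le_prod_twH {L : S.V → Matrix ι ι K} (hL : ∀ v, IsUnit (L v).det) :
    ∃ C : ℝ, 0 < C ∧ ∀ c : S.V → ι → ℝ, ∑ v, ∑ i, c v i = 0 → ∀ x : ι → ι → K,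
      (∀ j i, x j i ∈ S.O) → LinearIndependent K x → 1 ≤ C * ∏ j, S.twH L c (x j) := by
  have hpos : 0 < ∏ v, S.abv v (L v).det :=
    Finset.prod_pos fun v _ => (S.abv v).pos (hL v).ne_zero
  refine ⟨((Fintype.card ι).factorial : ℝ) ^ Fintype.card S.V / ∏ v, S.abv v (L v).det,
    div_pos (by positivity) hpos, fun c hc x hx hli => ?_⟩
  have hdet : (Matrix.of x).det ≠ 0 := by
    have : IsUnit (Matrix.of x) := Matrix.linearIndependent_rows_iff_isUnit.mp hli
    exact ((Matrix.isUnit_iff_isUnit_det _).mp this).ne_zero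
  have hdetO : (Matrix.of x).det ∈ S.O := by
    rw [Matrix.det_apply]
    refine S.O.sum_mem fun σ _ => ?_
    rw [Units.smul_def]
    exact S.O.zsmul_mem (S.O.prod_mem fun i _ => hx _ _) _
  have h1 := S.one_le_prod _ hdetO hdet
  have h2 : (∏ v, S.abv v (L v).det) * ∏ v, S.abv v (Matrix.of x).det ≤
      ((Fintype.card ι).factorial : ℝ) ^ Fintype.card S.V * ∏ j, S.twH L c (x j) := by
    rw [← Finset.prod_mul_distrib]
    refine (Finset.prod_le_prod (fun v _ => mul_nonneg ((S.abv v).nonneg _) ((S.abv v).nonneg _))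
      fun v _ => abv_det_mul_le (S.abv v) (L v) (c v) x).trans (le_of_eq ?_)
    rw [Finset.prod_mul_distrib, Finset.prod_mul_distrib, ← exp_sum, hc, exp_zero, mul_one,
      Finset.prod_const, Finset.card_univ]
    congr 1
    rw [Finset.prod_comm]
    rfl
  rw [div_mul_eq_mul_div, le_div_iff₀ hpos, one_mul]
  exact le_trans (le_mul_of_one_le_right hpos.le h1) h2

lemma exists_le_twH {L : S.V → Matrix ι ι K} (hL : ∀ v, IsUnit (L v).det) :
    ∃ C : ℝ, 0 < C ∧ ∀ (c : S.V → ι → ℝ) (b : ℝ), (∀ v i, c v i ≤ b) → ∀ x : ι → K, x ≠ 0 →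
      (∀ i, x i ∈ S.O) → 1 ≤ C * exp (Fintype.card S.V * b) * S.twH L c x := by
  set M : S.V → ℝ := fun v => (∑ k, ∑ j, S.abv v ((L v)⁻¹ k j)) + 1 with hM
  have hM0 : ∀ v, 0 < M v := fun v => by
    have : 0 ≤ ∑ k, ∑ j, S.abv v ((L v)⁻¹ k j) :=
      Finset.sum_nonneg fun _ _ => Finset.sum_nonneg fun _ _ => (S.abv v).nonneg _
    simp only [hM]
    linarith
  refine ⟨∏ v, M v, Finset.prod_pos fun v _ => hM0 v, fun c b hb x hx hxO => ?_⟩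
  obtain ⟨i, hi⟩ := Function.ne_iff.mp hx
  refine (S.one_le_prod _ (hxO i) hi).trans ?_
  have : exp (Fintype.card S.V * b) = ∏ _v : S.V, exp b := by
    rw [Finset.prod_const, ← exp_nat_mul, Finset.card_univ]
  rw [this, twH, ← Finset.prod_mul_distrib, ← Finset.prod_mul_distrib]
  refine Finset.prod_le_prod (fun v _ => (S.abv v).nonneg _) fun v _ => ?_
  refine (abv_le_sum_twNorm (S.abv v) (hL v) (hb v) x i).trans ?_
  refine mul_le_mul_of_nonneg_right ?_ (twNorm_nonneg _ _ _ _)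
  refine mul_le_mul_of_nonneg_right ?_ (exp_pos _).le
  simp only [hM]
  linarith

/-- Successive minima, up to a factor `2`, of a function on integral vectors. -/
structure IsMinima (h : (ι → K) → ℝ) (w : Fin (Fintype.card ι) → ι → K)
    (lam : Fin (Fintype.card ι) → ℝ) : Prop where
  li : LinearIndependent K w
  mem : ∀ i α, w i α ∈ S.O
  pos : ∀ i, 0 < lam i
  mono : Monotone lam
  le : ∀ i, lam i ≤ h (w i)
  le_two : ∀ i, h (w i) ≤ 2 * lam i
  min : ∀ i (x : ι → K), (∀ α, x α ∈ S.O) → x ∉ Submodule.span K (w '' Set.Iio i) → lam i ≤ h x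

lemma exists_isMinima (h : (ι → K) → ℝ) {b : ℝ} (hb : 0 < b)
    (hh : ∀ x : ι → K, x ≠ 0 → (∀ i, x i ∈ S.O) → b ≤ h x) :
    ∃ w lam, S.IsMinima h w lam := by
  classical
  let A : Set (ι → K) → Set (ι → K) := fun s =>
    {x | (∀ α, x α ∈ S.O) ∧ x ∉ Submodule.span K s}
  let lam' : Set (ι → K) → ℝ := fun s => sInf (h '' A s)
  have hA0 : ∀ s, ∀ x ∈ A s, x ≠ 0 := fun s x hx h0 => hx.2 (h0 ▸ zero_mem _)
  have hbdd : ∀ s, BddBelow (h '' A s) := fun s =>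
    ⟨b, by rintro _ ⟨x, hx, rfl⟩; exact hh x (hA0 s x hx) hx.1⟩
  have hne : ∀ s, Submodule.span K s ≠ ⊤ → (A s).Nonempty := by
    intro s hs
    by_contra hemp
    rw [Set.not_nonempty_iff_eq_empty] at hemp
    refine hs (top_le_iff.mp ?_)
    rw [← (Pi.basisFun K ι).span_eq, Submodule.span_le]
    rintro _ ⟨i, rfl⟩
    by_contra hi
    have : (Pi.basisFun K ι) i ∈ A s := by
      refine ⟨fun α => ?_, hi⟩
      rw [Pi.basisFun_apply, Pi.single_apply]
      split_ifs
      · exact S.O.one_mem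
      · exact S.O.zero_mem
    rw [hemp] at this
    exact this
  have hlb : ∀ s, Submodule.span K s ≠ ⊤ → b ≤ lam' s := fun s hs =>
    le_csInf ((hne s hs).image h) (by rintro _ ⟨x, hx, rfl⟩; exact hh x (hA0 s x hx) hx.1)
  have hG : ∀ s, ∃ y, Submodule.span K s ≠ ⊤ → y ∈ A s ∧ h y ≤ 2 * lam' s := by
    intro s
    by_cases hs : Submodule.span K s = ⊤
    · exact ⟨0, fun h => absurd hs h⟩
    · have h1 := hlb s hs
      obtain ⟨_, ⟨y, hy, rfl⟩, hlt⟩ := exists_lt_of_csInf_lt ((hne s hs).image h)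
        (show lam' s < 2 * lam' s by linarith)
      exact ⟨y, fun _ => ⟨hy, hlt.le⟩⟩
  choose G hGs using hG
  let P : ℕ → Set (ι → K) := fun n => Nat.rec ∅ (fun _ s => insert (G s) s) n
  let w : ℕ → ι → K := fun n => G (P n)
  have hP : ∀ n, P n = w '' Set.Iio n := by
    intro n
    induction n with
    | zero => simp [P]
    | succ n ih =>
      have : Set.Iio (n + 1) = insert n (Set.Iio n) := by
        ext k
        simp only [Set.mem_Iio, Set.mem_insert_iff]
        omega
      rw [this, Set.image_insert_eq, ← ih]
  have hPtop : ∀ n < Fintype.card ι, Submodule.span K (P n) ≠ ⊤ := by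
    intro n hn htop
    rw [hP] at htop
    have h1 : Set.finrank K (w '' Set.Iio n) ≤ n := by
      have h2 : w '' Set.Iio n = ((Finset.Iio n).image w : Finset (ι → K)) := by simp
      rw [h2]
      refine (finrank_span_finset_le_card _).trans (Finset.card_image_le.trans ?_)
      simp
    rw [Set.finrank, htop, finrank_top, Module.finrank_fintype_fun_eq_card] at h1
    omega
  have himg : ∀ i : Fin (Fintype.card ι),
      (fun j : Fin (Fintype.card ι) => w j) '' Set.Iio i = P i := by
    intro i
    rw [hP]
    ext y
    constructor
    · rintro ⟨j, hj, rfl⟩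
      exact ⟨j, hj, rfl⟩
    · rintro ⟨j, hj, rfl⟩
      exact ⟨⟨j, lt_trans hj i.2⟩, hj, rfl⟩
  refine ⟨fun i => w i, fun i => lam' (P i), ?_, ?_, ?_, ?_, ?_, ?_, ?_⟩
  · have : ∀ n ≤ Fintype.card ι, LinearIndependent K fun i : Fin n => w i := by
      intro n
      induction n with
      | zero => exact fun _ => linearIndependent_empty_type
      | succ n ih =>
        intro hn
        rw [linearIndependent_finSucc']
        refine ⟨ih (by omega), ?_⟩
        have h1 := (hGs (P n) (hPtop n (by omega))).1.2
        have h2 : Set.range (Fin.init fun i : Fin (n + 1) => w i) = P n := by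
          rw [hP]
          ext y
          constructor
          · rintro ⟨j, rfl⟩
            exact ⟨j, j.2, rfl⟩
          · rintro ⟨j, hj, rfl⟩
            exact ⟨⟨j, hj⟩, rfl⟩
        rw [h2]
        exact h1
    exact this _ le_rfl
  · exact fun i => (hGs (P i) (hPtop i i.2)).1.1
  · exact fun i => lt_of_lt_of_le hb (hlb _ (hPtop i i.2))
  · intro i j hij
    refine csInf_le_csInf (hbdd _) ((hne _ (hPtop j j.2)).image h) (Set.image_mono ?_)
    intro x hx
    refine ⟨hx.1, fun hx2 => hx.2 (Submodule.span_mono ?_ hx2)⟩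
    rw [hP, hP]
    exact Set.image_mono (Set.Iio_subset_Iio hij)
  · exact fun i => csInf_le (hbdd _) ⟨_, (hGs (P i) (hPtop i i.2)).1, rfl⟩
  · exact fun i => (hGs (P i) (hPtop i i.2)).2
  · intro i x hx hxs
    rw [himg] at hxs
    exact csInf_le (hbdd _) ⟨x, ⟨hx, hxs⟩, rfl⟩

lemma exists_isMinima_twH {L : S.V → Matrix ι ι K} (hL : ∀ v, IsUnit (L v).det)
    (c : S.V → ι → ℝ) : ∃ w lam, S.IsMinima (S.twH L c) w lam := by
  obtain ⟨C, hC, hle⟩ := S.exists_le_twH hL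
  set b := ∑ v, ∑ i, |c v i| with hb
  have hcb : ∀ v i, c v i ≤ b := fun v i => (le_abs_self _).trans
    ((Finset.single_le_sum (f := fun i => |c v i|) (fun _ _ => abs_nonneg _)
      (Finset.mem_univ i)).trans
      (Finset.single_le_sum (f := fun v => ∑ i, |c v i|)
        (fun _ _ => Finset.sum_nonneg fun _ _ => abs_nonneg _) (Finset.mem_univ v)))
  have hpos : 0 < C * exp (Fintype.card S.V * b) := mul_pos hC (exp_pos _)
  refine S.exists_isMinima _ (inv_pos.mpr hpos) fun x hx hxO => ?_
  rw [inv_le_iff_one_le_mul₀ hpos]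
  rw [mul_comm]
  exact hle c b hcb x hx hxO

variable {S}

lemma IsMinima.exists_index {h : (ι → K) → ℝ} {w : Fin (Fintype.card ι) → ι → K}
    {lam : Fin (Fintype.card ι) → ℝ} (H : S.IsMinima h w lam) {x : ι → K} (hx : x ≠ 0) :
    ∃ i, x ∈ Submodule.span K (w '' Set.Iic i) ∧ x ∉ Submodule.span K (w '' Set.Iio i) := by
  classical
  have hspan : Submodule.span K (Set.range w) = ⊤ :=
    H.li.span_eq_top_of_card_eq_finrank' (by simp)
  rcases isEmpty_or_nonempty (Fin (Fintype.card ι)) with he | hne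
  · exfalso
    rw [Set.range_eq_empty, Submodule.span_empty] at hspan
    have : x ∈ (⊤ : Submodule K (ι → K)) := trivial
    rw [← hspan] at this
    exact hx this
  let T : Finset (Fin (Fintype.card ι)) :=
    Finset.univ.filter fun i => x ∈ Submodule.span K (w '' Set.Iic i)
  have hT : T.Nonempty := by
    obtain ⟨i, hi⟩ := Finite.exists_max (id : Fin (Fintype.card ι) → _)
    refine ⟨i, Finset.mem_filter.mpr ⟨Finset.mem_univ _, ?_⟩⟩
    have : (Set.Iic i) = Set.univ := Set.eq_univ_of_forall fun j => hi j
    rw [this, Set.image_univ, hspan]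
    trivial
  obtain ⟨i, hi, hmin⟩ := T.exists_min_image id hT
  refine ⟨i, (Finset.mem_filter.mp hi).2, fun hx2 => ?_⟩
  by_cases h0 : (i : ℕ) = 0
  · have : Set.Iio i = ∅ := by
      ext j
      simp only [Set.mem_Iio, Set.mem_empty_iff_false, iff_false, not_lt, Fin.le_def]
      omega
    rw [this, Set.image_empty, Submodule.span_empty] at hx2
    exact hx hx2
  · let j : Fin (Fintype.card ι) := ⟨i - 1, by omega⟩
    have hj : Set.Iio i = Set.Iic j := by
      ext l
      simp only [Set.mem_Iio, Set.mem_Iic, Fin.lt_def, Fin.le_def, j]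
      omega
    rw [hj] at hx2
    have := hmin j (Finset.mem_filter.mpr ⟨Finset.mem_univ _, hx2⟩)
    simp only [id, Fin.le_def, j] at this
    omega

variable (S)

/-- The weights `c` modified at the distinguished place by a factor `ρ` along the order `τ`. -/
noncomputable def rescale (c : S.V → ι → ℝ) (τ : Fin (Fintype.card ι) ≃ ι)
    (ρ : Fin (Fintype.card ι) → ℝ) : S.V → ι → ℝ :=
  Function.update c S.v₀ fun l => c S.v₀ l - log (ρ (τ.symm l))

lemma sum_rescale (c : S.V → ι → ℝ) (τ : Fin (Fintype.card ι) ≃ ι)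
    {ρ : Fin (Fintype.card ι) → ℝ} (hρ : ∀ i, 0 < ρ i) :
    ∑ v, ∑ i, S.rescale c τ ρ v i = (∑ v, ∑ i, c v i) - log (∏ i, ρ i) := by
  rw [← Finset.add_sum_erase _ _ (Finset.mem_univ S.v₀),
    ← Finset.add_sum_erase _ _ (Finset.mem_univ S.v₀)]
  have h1 : ∑ v ∈ Finset.univ.erase S.v₀, ∑ i, S.rescale c τ ρ v i =
      ∑ v ∈ Finset.univ.erase S.v₀, ∑ i, c v i := by
    refine Finset.sum_congr rfl fun v hv => ?_
    rw [rescale, Function.update_of_ne (Finset.mem_erase.mp hv).1]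
  rw [h1, rescale, Function.update_self, Finset.sum_sub_distrib,
    log_prod fun i _ => (hρ i).ne', Equiv.sum_comp τ.symm fun i => log (ρ i)]
  ring

lemma exists_rescale (L : S.V → Matrix ι ι K) (c : S.V → ι → ℝ)
    (w : Fin (Fintype.card ι) → ι → K) :
    ∃ τ : Fin (Fintype.card ι) ≃ ι, ∀ ρ : Fin (Fintype.card ι) → ℝ, (∀ i, 0 < ρ i) →
      Antitone ρ → ∀ i, ∀ x ∈ Submodule.span K (w '' Set.Iic i),
        ρ i * S.twH L c x ≤ 2 ^ Fintype.card ι * S.twH L (S.rescale c τ ρ) x := by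
  obtain ⟨τ, hτ⟩ := exists_davenport_order (S.abv S.v₀) (L S.v₀) (c S.v₀) w
  refine ⟨τ, fun ρ hρ hanti i x hx => ?_⟩
  have h1 := hτ ρ hρ hanti i x hx
  unfold twH
  rw [← Finset.mul_prod_erase _ _ (Finset.mem_univ S.v₀),
    ← Finset.mul_prod_erase _ _ (Finset.mem_univ S.v₀)]
  have h2 : ∏ v ∈ Finset.univ.erase S.v₀, twNorm (S.abv v) (L v) (S.rescale c τ ρ v) x =
      ∏ v ∈ Finset.univ.erase S.v₀, twNorm (S.abv v) (L v) (c v) x := by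
    refine Finset.prod_congr rfl fun v hv => ?_
    rw [rescale, Function.update_of_ne (Finset.mem_erase.mp hv).1]
  have h3 : S.rescale c τ ρ S.v₀ = fun l => c S.v₀ l - log (ρ (τ.symm l)) := by
    rw [rescale, Function.update_self]
  rw [h2, h3, ← mul_assoc, ← mul_assoc]
  exact mul_le_mul_of_nonneg_right h1 (Finset.prod_nonneg fun _ _ => twNorm_nonneg _ _ _ _)

/-- Minkowski's second theorem for twisted heights (upper bound). -/
theorem exists_prod_minima_le [Nonempty ι] (L : S.V → Matrix ι ι K) :
    ∃ C : ℝ, 0 < C ∧ ∀ c : S.V → ι → ℝ, ∑ v, ∑ i, c v i = 0 → ∀ w lam,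
      S.IsMinima (S.twH L c) w lam → ∏ i, lam i ≤ C := by
  obtain ⟨C, hC, hmink⟩ := S.minkowski ι L
  set N := Fintype.card ι with hN
  have hN0 : 0 < N := Fintype.card_pos
  refine ⟨(2 ^ N * (N * C) ^ Fintype.card S.V) ^ N, by positivity, fun c hc w lam H => ?_⟩
  obtain ⟨τ, hτ⟩ := S.exists_rescale L c w
  have hprod : 0 < ∏ i, lam i := Finset.prod_pos fun i _ => H.pos i
  set Λ : ℝ := (∏ i, lam i) ^ ((N : ℝ)⁻¹) with hΛ
  have hΛ0 : 0 < Λ := rpow_pos_of_pos hprod _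
  have hΛN : Λ ^ N = ∏ i, lam i := rpow_inv_natCast_pow hprod.le hN0.ne'
  have hρ : ∀ i, 0 < Λ / lam i := fun i => div_pos hΛ0 (H.pos i)
  have hanti : Antitone fun i => Λ / lam i := fun i j hij =>
    div_le_div_of_nonneg_left hΛ0.le (H.pos i) (H.mono hij)
  have hprodρ : ∏ i, (Λ / lam i) = 1 := by
    rw [Finset.prod_div_distrib, Finset.prod_const, Finset.card_univ, Fintype.card_fin, hΛN]
    exact div_self hprod.ne'
  obtain ⟨x, hx0, hxO, hx⟩ := hmink (S.rescale c τ fun i => Λ / lam i) (by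
    rw [S.sum_rescale c τ hρ, hprodρ, hc, log_one, sub_zero])
  obtain ⟨i, hi1, hi2⟩ := H.exists_index hx0
  have h1 := hτ _ hρ hanti i x hi1
  have h2 := H.min i x hxO hi2
  have h3 : S.twH L (S.rescale c τ fun i => Λ / lam i) x ≤ (N * C) ^ Fintype.card S.V := by
    unfold twH
    refine (Finset.prod_le_prod (fun _ _ => twNorm_nonneg _ _ _ _)
      fun v _ => twNorm_le _ _ _ _ (hx v)).trans (by simp [hN])
  have h4 : Λ ≤ Λ / lam i * S.twH L c x := by
    calc Λ = Λ / lam i * lam i := (div_mul_cancel₀ _ (H.pos i).ne').symm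
      _ ≤ _ := mul_le_mul_of_nonneg_left h2 (hρ i).le
  rw [← hΛN]
  refine pow_le_pow_left₀ hΛ0.le ?_ N
  exact h4.trans (h1.trans (mul_le_mul_of_nonneg_left h3 (by positivity)))

end PlaceSys

end Sys2

section SubA1

open Real Height

section Cross

variable {K : Type*} [Field K] {n : ℕ}

/-- The linear functional `x ↦ det (x, w₁, …, wₙ)`. -/
noncomputable def crossLin (w : Fin n → Fin (n + 1) → K) : (Fin (n + 1) → K) →ₗ[K] K :=
  (Matrix.detRowAlternating (R := K) (n := Fin (n + 1))).toMultilinearMap.toLinearMap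
    (Fin.cons 0 w) 0

lemma crossLin_apply (w : Fin n → Fin (n + 1) → K) (x : Fin (n + 1) → K) :
    crossLin w x = (Matrix.of (Fin.cons x w : Fin (n + 1) → Fin (n + 1) → K)).det := by
  rw [crossLin, MultilinearMap.toLinearMap_apply, Fin.update_cons_zero]
  rfl

lemma crossLin_self (w : Fin n → Fin (n + 1) → K) (k : Fin n) : crossLin w (w k) = 0 := by
  rw [crossLin_apply]
  exact Matrix.det_zero_of_row_eq (i := 0) (j := k.succ) (Fin.succ_ne_zero k).symm rfl

lemma crossLin_ne_zero {w : Fin n → Fin (n + 1) → K} (hw : LinearIndependent K w) :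
    crossLin w ≠ 0 := by
  have hlt : Submodule.span K (Set.range w) ≠ ⊤ := by
    intro h
    have h1 := finrank_span_eq_card hw
    rw [h, finrank_top] at h1
    simp at h1
  obtain ⟨x, hx⟩ : ∃ x, x ∉ Submodule.span K (Set.range w) := by
    by_contra! h
    exact hlt (eq_top_iff.mpr fun x _ => h x)
  have hli : LinearIndependent K (Fin.cons x w : Fin (n + 1) → Fin (n + 1) → K) :=
    linearIndependent_finCons.mpr ⟨hw, hx⟩
  intro h0
  have h1 : crossLin w x = 0 := by rw [h0]; rfl
  rw [crossLin_apply] at h1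
  have h2 : IsUnit (Matrix.of (Fin.cons x w : Fin (n + 1) → Fin (n + 1) → K)) :=
    Matrix.linearIndependent_rows_iff_isUnit.mp hli
  exact ((Matrix.isUnit_iff_isUnit_det _).mp h2).ne_zero h1

lemma ker_crossLin {w : Fin n → Fin (n + 1) → K} (hw : LinearIndependent K w) :
    LinearMap.ker (crossLin w) = Submodule.span K (Set.range w) := by
  symm
  refine Submodule.eq_of_le_of_finrank_eq ?_ ?_
  · rw [Submodule.span_le]
    rintro _ ⟨k, rfl⟩
    exact crossLin_self w k
  · have h1 := Module.Dual.finrank_ker_add_one_of_ne_zero (crossLin_ne_zero hw)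
    rw [Module.finrank_fintype_fun_eq_card, Fintype.card_fin] at h1
    rw [finrank_span_eq_card hw, Fintype.card_fin]
    omega

/-- The coordinates of `crossLin`. -/
noncomputable def crossVec (w : Fin n → Fin (n + 1) → K) : Fin (n + 1) → K :=
  fun α => crossLin w (Pi.single α 1)

lemma crossLin_eq_sum (w : Fin n → Fin (n + 1) → K) (x : Fin (n + 1) → K) :
    crossLin w x = ∑ α, x α * crossVec w α := by
  rw [LinearMap.pi_apply_eq_sum_univ (crossLin w) x]
  refine Finset.sum_congr rfl fun α _ => ?_
  rw [smul_eq_mul, crossVec]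
  congr 2
  ext i
  simp [Pi.single_apply, eq_comm]

lemma crossVec_ne_zero {w : Fin n → Fin (n + 1) → K} (hw : LinearIndependent K w) :
    crossVec w ≠ 0 := by
  intro h
  refine crossLin_ne_zero hw (LinearMap.ext fun x => ?_)
  rw [crossLin_eq_sum, h]
  simp

lemma crossLin_mem {O : Subring K} {w : Fin n → Fin (n + 1) → K} (hw : ∀ k i, w k i ∈ O)
    {x : Fin (n + 1) → K} (hx : ∀ i, x i ∈ O) : crossLin w x ∈ O := by
  rw [crossLin_apply, Matrix.det_apply]
  refine O.sum_mem fun σ _ => ?_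
  rw [Units.smul_def]
  refine O.zsmul_mem (O.prod_mem fun i _ => ?_) _
  rw [Matrix.of_apply]
  generalize σ i = j
  induction j using Fin.cases with
  | zero => exact hx i
  | succ j => exact hw j i

lemma crossVec_mem {O : Subring K} {w : Fin n → Fin (n + 1) → K} (hw : ∀ k i, w k i ∈ O)
    (α : Fin (n + 1)) : crossVec w α ∈ O := by
  refine crossLin_mem hw fun i => ?_
  rw [Pi.single_apply]
  split_ifs
  · exact O.one_mem
  · exact O.zero_mem

lemma abv_crossLin_le (a : AbsoluteValue K ℝ) (L : Matrix (Fin (n + 1)) (Fin (n + 1)) K)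
    (c : Fin (n + 1) → ℝ) (w : Fin n → Fin (n + 1) → K) (x : Fin (n + 1) → K) :
    a L.det * a (crossLin w x) ≤ (n + 1).factorial * exp (∑ i, c i) *
      (twNorm a L c x * ∏ k, twNorm a L c (w k)) := by
  have := abv_det_mul_le a L c (Fin.cons x w : Fin (n + 1) → Fin (n + 1) → K)
  rw [Fin.prod_univ_succ, Fintype.card_fin] at this
  rw [crossLin_apply]
  simpa using this

end Cross

namespace PlaceSys

variable {K : Type} [Field K] [AdmissibleAbsValues K] (S : PlaceSys K) {n : ℕ}

lemma twH_nonneg {ι : Type} [Fintype ι] (L : S.V → Matrix ι ι K) (c : S.V → ι → ℝ) (x : ι → K) :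
    0 ≤ S.twH L c x := Finset.prod_nonneg fun _ _ => twNorm_nonneg _ _ _ _

lemma mulHeight₁_pos_inv_le (v : S.V) {y : K} (hy : y ≠ 0) : (mulHeight₁ y)⁻¹ ≤ S.abv v y := by
  have h := S.abv_le v y⁻¹
  rw [mulHeight₁_inv, map_inv₀] at h
  exact inv_le_of_inv_le₀ ((S.abv v).pos hy) h

lemma exists_abv_crossLin_ge (u : Fin (n + 1) → K) : ∃ C : ℝ, 0 < C ∧
    ∀ w : Fin n → Fin (n + 1) → K, ∀ α, crossVec w α ≠ 0 → crossLin w u ≠ 0 → ∀ v,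
      S.abv v (crossVec w α) ≤ C * mulHeight (crossVec w) * S.abv v (crossLin w u) := by
  let A : Fin (n + 1) → Fin 2 × Fin (n + 1) → K := fun α p => if p.1 = 0 then u p.2 else
    if p.2 = α then 1 else 0
  set C : ℝ := ∑ α, Nat.card (Fin (n + 1)) ^ totalWeight K * mulHeight (A α) with hC
  have hterm : ∀ α, 0 < Nat.card (Fin (n + 1)) ^ totalWeight K * mulHeight (A α) := by
    intro α
    have := mulHeight_pos (A α)
    have : (0 : ℝ) < Nat.card (Fin (n + 1)) := by exact_mod_cast Nat.card_pos
    positivity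
  refine ⟨C, Finset.sum_pos (fun α _ => hterm α) Finset.univ_nonempty, fun w α hα hu v => ?_⟩
  have h1 := mulHeight_linearMap_apply_le (A α) (crossVec w)
  have h2 : (fun j => ∑ i, A α (j, i) * crossVec w i) = ![crossLin w u, crossVec w α] := by
    ext j
    fin_cases j
    · simp [A, crossLin_eq_sum]
    · simp [A]
  rw [h2, ← mulHeight₁_div_eq_mulHeight] at h1
  have h3 : mulHeight₁ (crossLin w u / crossVec w α) ≤ C * mulHeight (crossVec w) := by
    refine h1.trans (mul_le_mul_of_nonneg_right ?_ (mulHeight_pos _).le)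
    exact Finset.single_le_sum (f := fun α => Nat.card (Fin (n + 1)) ^
      totalWeight K * mulHeight (A α)) (fun α _ => (hterm α).le) (Finset.mem_univ α)
  have h4 := S.mulHeight₁_pos_inv_le v (div_ne_zero hu hα)
  rw [map_div₀, inv_le_comm₀ (mulHeight₁_pos _) (div_pos ((S.abv v).pos hu) ((S.abv v).pos hα)),
    inv_div, div_le_iff₀ ((S.abv v).pos hu)] at h4
  exact h4.trans (mul_le_mul_of_nonneg_right h3 ((S.abv v).nonneg _))

end PlaceSys

end SubA1

section SubA2

open Real Height

section Cross

variable {K : Type*} [Field K] {n : ℕ}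

lemma crossLin_eq_sum_inv {L : Matrix (Fin (n + 1)) (Fin (n + 1)) K}
    (hL : IsUnit L.det) (w : Fin n → Fin (n + 1) → K) (x : Fin (n + 1) → K) :
    crossLin w x = ∑ i, L.mulVec x i * crossLin w (L⁻¹.mulVec (Pi.single i 1)) := by
  have h1 : x = ∑ i, L.mulVec x i • L⁻¹.mulVec (Pi.single i 1) := by
    have h2 : x = L⁻¹.mulVec (L.mulVec x) := by
      rw [Matrix.mulVec_mulVec, Matrix.nonsing_inv_mul _ hL, Matrix.one_mulVec]
    conv_lhs => rw [h2]
    conv_lhs => rw [pi_eq_sum_univ' (L.mulVec x)]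
    rw [Matrix.mulVec_sum]
    refine Finset.sum_congr rfl fun i _ => ?_
    rw [Matrix.mulVec_smul]
  conv_lhs => rw [h1]
  rw [map_sum]
  simp

lemma twNorm_inv_single (a : AbsoluteValue K ℝ) {L : Matrix (Fin (n + 1)) (Fin (n + 1)) K}
    (hL : IsUnit L.det) (c : Fin (n + 1) → ℝ) (i : Fin (n + 1)) :
    twNorm a L c (L⁻¹.mulVec (Pi.single i 1)) = exp (-c i) := by
  rw [twNorm, Matrix.mulVec_mulVec, Matrix.mul_nonsing_inv _ hL, Matrix.one_mulVec]
  rw [Finset.sum_eq_single i]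
  · simp
  · intro j _ hj
    simp [hj]
  · simp

end Cross

namespace PlaceSys

variable {K : Type} [Field K] [AdmissibleAbsValues K] (S : PlaceSys K) {n : ℕ}

/-- If the span of `w` has small height, then all later solutions lie on that span. -/
lemma exists_crossLin_eq_zero_of_mulHeight_le {L : S.V → Matrix (Fin (n + 1)) (Fin (n + 1)) K}
    (hL : ∀ v, IsUnit (L v).det) (c : S.V → Fin (n + 1) → ℝ)
    (hc : ∑ v, ∑ i, c v i = 0) {δ : ℝ}
    (hδ : 0 < δ) :
    ∃ κ : ℝ, 0 < κ ∧ ∃ q₀ : ℝ, ∀ q, q₀ ≤ q → ∀ w : Fin n → Fin (n + 1) → K,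
      (∀ k i, w k i ∈ S.O) → LinearIndependent K w →
      (∀ k, S.twH L (fun v i => q * c v i) (w k) ≤ exp (-δ * q)) →
      mulHeight (crossVec w) ≤ exp (κ * q) →
      ∃ q₁ : ℝ, ∀ q', q₁ ≤ q' → ∀ x : Fin (n + 1) → K, (∀ i, x i ∈ S.O) →
        S.twH L (fun v i => q' * c v i) x ≤ exp (-δ * q') → crossLin w x = 0 := by
  set u : S.V → Fin (n + 1) → Fin (n + 1) → K := fun v i => (L v)⁻¹.mulVec (Pi.single i 1) with hu
  choose Cu hCu0 hCu using fun v i => exists_abv_crossLin_ge S (u v i)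
  have hdet : ∀ v, 0 < S.abv v (L v).det := fun v => (S.abv v).pos (hL v).ne_zero
  have hcard : 0 < Fintype.card S.V := Fintype.card_pos_iff.mpr ⟨S.v₀⟩
  set G : S.V → ℝ := fun v => (∑ i, Cu v i) * ((n + 1).factorial / S.abv v (L v).det) with hG
  have hG0 : ∀ v, 0 < G v := fun v => mul_pos
    (Finset.sum_pos (fun i _ => hCu0 v i) Finset.univ_nonempty)
    (div_pos (by exact_mod_cast Nat.factorial_pos _) (hdet v))
  have hGpos : 0 < ∏ v, G v := Finset.prod_pos fun v _ => hG0 v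
  refine ⟨δ / (4 * Fintype.card S.V), by positivity,
    max 1 (4 * log (∏ v, G v) / δ), fun q hq w hwO hli hw hM => ?_⟩
  have hq1 : 1 ≤ q := (le_max_left _ _).trans hq
  have hq2 : log (∏ v, G v) ≤ δ / 4 * q := by
    have := (le_max_right _ _).trans hq
    rw [div_le_iff₀ hδ] at this
    linarith
  set M := crossLin w with hMdef
  have hM0 : M ≠ 0 := crossLin_ne_zero hli
  have hex : ∀ v, ∃ i, M (u v i) ≠ 0 := by
    intro v
    by_contra! h
    refine hM0 (LinearMap.ext fun x => ?_)
    rw [hMdef, crossLin_eq_sum_inv (hL v)]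
    exact Finset.sum_eq_zero fun i _ => by rw [← hMdef, h i, mul_zero]
  have hmax : ∀ v, ∃ i, M (u v i) ≠ 0 ∧ ∀ i', M (u v i') ≠ 0 → c v i' ≤ c v i := by
    intro v
    obtain ⟨i₀, hi₀⟩ := hex v
    classical
    obtain ⟨i, hi, hmax⟩ := Finset.exists_max_image
      (Finset.univ.filter fun i => M (u v i) ≠ 0) (c v) ⟨i₀, by simpa using hi₀⟩
    exact ⟨i, by simpa using hi, fun i' hi' => hmax i' (by simpa using hi')⟩
  choose I hI hImax using hmax
  obtain ⟨α, hα⟩ : ∃ α, crossVec w α ≠ 0 := Function.ne_iff.mp (crossVec_ne_zero hli)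
  have hT0 : ∀ v k, 0 ≤ twNorm (S.abv v) (L v) (fun i => q * c v i) (w k) :=
    fun v k => twNorm_nonneg _ _ _ _
  set H := mulHeight (crossVec w) with hH
  have hH1 : 1 ≤ H := one_le_mulHeight _
  -- the Liouville inequality bounds the weights at the essential indices
  have hsum : ∑ v, c v (I v) ≤ δ / 2 := by
    have h1 : ∀ v, S.abv v (crossVec w α) ≤ G v * H * (exp (∑ i, q * c v i) *
        (exp (-(q * c v (I v))) * ∏ k, twNorm (S.abv v) (L v) (fun i => q * c v i) (w k))) := by
      intro v
      have h2 := hCu v (I v) w α hα (hI v) v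
      have h3 := abv_crossLin_le (S.abv v) (L v) (fun i => q * c v i) w (u v (I v))
      rw [hu, twNorm_inv_single _ (hL v), mul_comm (S.abv v (L v).det), ← le_div_iff₀ (hdet v)] at h3
      have h4 : Cu v (I v) ≤ ∑ i, Cu v i :=
        Finset.single_le_sum (fun i _ => (hCu0 v i).le) (Finset.mem_univ _)
      refine h2.trans ?_
      refine (mul_le_mul (mul_le_mul_of_nonneg_right h4 (by positivity)) h3
        ((S.abv v).nonneg _) (mul_nonneg ((hCu0 v _).le.trans h4) (by positivity))).trans
        (le_of_eq ?_)
      simp only [hG]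
      ring
    clear_value G
    have h2 := (S.one_le_prod _ (crossVec_mem hwO α) hα).trans
      (Finset.prod_le_prod (fun v _ => (S.abv v).nonneg _) fun v _ => h1 v)
    rw [Finset.prod_mul_distrib, Finset.prod_mul_distrib, Finset.prod_mul_distrib,
      Finset.prod_mul_distrib, ← exp_sum, ← exp_sum, Finset.prod_comm, Finset.prod_const,
      Finset.card_univ] at h2
    have h7 : ∑ v, ∑ i, q * c v i = 0 := by
      simp_rw [← Finset.mul_sum]
      rw [hc, mul_zero]
    rw [h7, exp_zero, one_mul] at h2
    have h8 : ∏ k, ∏ v, twNorm (S.abv v) (L v) (fun i => q * c v i) (w k) ≤ 1 :=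
      Finset.prod_le_one (fun k _ => Finset.prod_nonneg fun v _ => hT0 v k)
        fun k _ => (hw k).trans (exp_le_one_iff.mpr (by nlinarith))
    have h9 : H ^ Fintype.card S.V ≤ exp (δ / 4 * q) := by
      refine (pow_le_pow_left₀ (by linarith) hM _).trans ?_
      rw [← exp_nat_mul]
      refine exp_le_exp.mpr (le_of_eq ?_)
      field_simp
    have h10 : ∏ v, G v ≤ exp (δ / 4 * q) := by
      rw [← log_le_iff_le_exp hGpos]
      exact hq2
    have h11 : (1 : ℝ) ≤ exp (δ / 4 * q) * exp (δ / 4 * q) * exp (∑ v, -(q * c v (I v))) := by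
      refine h2.trans ?_
      refine mul_le_mul (mul_le_mul h10 h9 (by positivity) (exp_pos _).le)
        (mul_le_of_le_one_right (exp_pos _).le h8)
        (mul_nonneg (exp_pos _).le
          (Finset.prod_nonneg fun k _ => Finset.prod_nonneg fun v _ => hT0 v k)) (by positivity)
    rw [← exp_add, ← exp_add, one_le_exp_iff, Finset.sum_neg_distrib, ← Finset.mul_sum] at h11
    have : q * ∑ v, c v (I v) ≤ q * (δ / 2) := by linarith
    exact le_of_mul_le_mul_left this (by linarith)
  set E : S.V → ℝ := fun v => ∑ i, S.abv v (M (u v i)) with hE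
  have hE0 : ∀ v, 0 ≤ E v := fun v => Finset.sum_nonneg fun i _ => (S.abv v).nonneg _
  obtain ⟨q₁, hq₁⟩ : ∃ q₁ : ℝ, ∀ q', q₁ ≤ q' → (∏ v, E v) * exp (-(δ / 2) * q') < 1 := by
    have h1 : Filter.Tendsto (fun q' => (∏ v, E v) * exp (-(δ / 2) * q')) Filter.atTop
        (nhds ((∏ v, E v) * 0)) := by
      refine Filter.Tendsto.const_mul _ (tendsto_exp_atBot.comp ?_)
      exact Filter.tendsto_id.const_mul_atTop_of_neg (by linarith)
    rw [mul_zero] at h1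
    exact Filter.eventually_atTop.mp (h1.eventually (gt_mem_nhds one_pos))
  refine ⟨max 0 q₁, fun q' hq' x hxO hx => ?_⟩
  have hq'0 : 0 ≤ q' := (le_max_left _ _).trans hq'
  by_contra hne
  have h1 : ∀ v, S.abv v (M x) ≤ E v * (exp (q' * c v (I v)) *
      twNorm (S.abv v) (L v) (fun i => q' * c v i) x) := by
    intro v
    rw [hMdef, crossLin_eq_sum_inv (hL v), ← hMdef]
    refine ((S.abv v).sum_le _ _).trans ?_
    rw [hE, Finset.sum_mul]
    refine Finset.sum_le_sum fun i _ => ?_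
    rw [map_mul, mul_comm]
    change S.abv v (M (u v i)) * _ ≤ _
    rcases eq_or_ne (M (u v i)) 0 with h0 | h0
    · rw [h0, map_zero, zero_mul, zero_mul]
    · refine mul_le_mul_of_nonneg_left ?_ ((S.abv v).nonneg _)
      refine (abv_le_twNorm (S.abv v) (L v) (fun i => q' * c v i) x i).trans ?_
      refine mul_le_mul_of_nonneg_right (exp_le_exp.mpr ?_) (twNorm_nonneg _ _ _ _)
      exact mul_le_mul_of_nonneg_left (hImax v i h0) hq'0
  have h2 := (S.one_le_prod _ (crossLin_mem hwO hxO) hne).trans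
    (Finset.prod_le_prod (fun v _ => (S.abv v).nonneg _) fun v _ => h1 v)
  rw [Finset.prod_mul_distrib, Finset.prod_mul_distrib, ← exp_sum, ← Finset.mul_sum] at h2
  have h3 : exp (q' * ∑ v, c v (I v)) *
      ∏ v, twNorm (S.abv v) (L v) (fun i => q' * c v i) x ≤ exp (-(δ / 2) * q') := by
    refine (mul_le_mul_of_nonneg_left hx (exp_pos _).le).trans ?_
    rw [← exp_add]
    refine exp_le_exp.mpr ?_
    have := mul_le_mul_of_nonneg_left hsum hq'0
    linarith
  have h4 := mul_le_mul_of_nonneg_left h3 (Finset.prod_nonneg fun v (_ : v ∈ Finset.univ) => hE0 v)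
  have h5 := hq₁ q' ((le_max_right _ _).trans hq')
  linarith

end PlaceSys

end SubA2

section Simplex

lemma sum_sq_sum_le {m : ℕ} {S : Fin m → Type*} [∀ h, Fintype (S h)]
    (f : ∀ h, S h → ℝ) (hmean : ∀ h, ∑ x, f h x = 0) (hb : ∀ h x, |f h x| ≤ 1) :
    ∑ e : (∀ h, S h), (∑ h, f h (e h)) ^ 2 ≤ m * Fintype.card (∀ h, S h) := by
  have hoff : ∀ h h', h ≠ h' → ∑ e : (∀ h, S h), f h (e h) * f h' (e h') = 0 := by
    intro h h' hne
    let g : ∀ k, S k → ℝ := fun k x => (if k = h then f k x else 1) * (if k = h' then f k x else 1)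
    have h1 : ∀ e : (∀ h, S h), f h (e h) * f h' (e h') = ∏ k, g k (e k) := by
      intro e
      simp only [g]
      rw [Finset.prod_mul_distrib, Finset.prod_ite_eq' Finset.univ h (fun k => f k (e k)),
        Finset.prod_ite_eq' Finset.univ h' (fun k => f k (e k))]
      simp
    simp_rw [h1]
    rw [← Fintype.piFinset_univ, ← Finset.prod_univ_sum]
    refine Finset.prod_eq_zero (Finset.mem_univ h) ?_
    simp only [g, if_true, if_neg hne, mul_one]
    exact hmean h
  have h2 : ∀ e : (∀ h, S h), (∑ h, f h (e h)) ^ 2 = ∑ h, ∑ h', f h (e h) * f h' (e h') := by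
    intro e
    rw [sq, Finset.sum_mul_sum]
  simp_rw [h2]
  rw [Finset.sum_comm]
  have h3 : ∀ h, ∑ e : (∀ h, S h), ∑ h', f h (e h) * f h' (e h') ≤
      Fintype.card (∀ h, S h) := by
    intro h
    rw [Finset.sum_comm, Finset.sum_eq_single h (fun h' _ hne => hoff h h' hne.symm) (by simp)]
    calc _ ≤ ∑ e : (∀ h, S h), (1 : ℝ) := by
          refine Finset.sum_le_sum fun e _ => ?_
          have := hb h (e h)
          rw [← sq, ← sq_abs]
          exact pow_le_one₀ (abs_nonneg _) this
      _ = _ := by simp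
  calc _ ≤ ∑ h : Fin m, (Fintype.card (∀ h, S h) : ℝ) := Finset.sum_le_sum fun h _ => h3 h
    _ = _ := by simp

/-- Exponent vectors of the monomials of degree `d` in `N` variables. -/
abbrev Simplex (N d : ℕ) : Type := ↥(Finset.piAntidiag (Finset.univ : Finset (Fin N)) d)

lemma Simplex.sum_eq {N d : ℕ} (e : Simplex N d) : ∑ i, e.1 i = d :=
  (Finset.mem_piAntidiag.mp e.2).1

lemma Simplex.le {N d : ℕ} (e : Simplex N d) (i : Fin N) : e.1 i ≤ d :=
  (Finset.single_le_sum (f := e.1) (fun _ _ => Nat.zero_le _) (Finset.mem_univ i)).trans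
    e.sum_eq.le

lemma Simplex.sum_apply {N d : ℕ} (i : Fin N) :
    (N : ℝ) * ∑ e : Simplex N d, (e.1 i : ℝ) = d * Fintype.card (Simplex N d) := by
  have hsw : ∀ j, ∑ e : Simplex N d, (e.1 j : ℝ) = ∑ e : Simplex N d, (e.1 i : ℝ) := by
    intro j
    let s : Simplex N d → Simplex N d := fun e => ⟨e.1 ∘ Equiv.swap i j, by
      rw [Finset.mem_piAntidiag]
      refine ⟨?_, by simp⟩
      exact (Equiv.sum_comp (Equiv.swap i j) e.1).trans e.sum_eq⟩
    have hs : Function.Involutive s := fun e => by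
      ext k
      simp [s]
    refine Fintype.sum_equiv hs.toPerm _ _ fun e => ?_
    simp [s, Function.Involutive.toPerm]
  have h1 : ∑ j : Fin N, ∑ e : Simplex N d, (e.1 j : ℝ) = d * Fintype.card (Simplex N d) := by
    rw [Finset.sum_comm]
    have : ∀ e : Simplex N d, ∑ j, (e.1 j : ℝ) = d := fun e => by exact_mod_cast e.sum_eq
    simp_rw [this]
    simp [mul_comm]
  rw [← h1]
  simp_rw [hsw]
  simp

instance {N d : ℕ} [NeZero N] : Nonempty (Simplex N d) :=
  ⟨⟨Pi.single 0 d, by simp [Finset.mem_piAntidiag]⟩⟩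

lemma card_simplex_le (N d : ℕ) : Fintype.card (Simplex N d) ≤ 2 ^ (N * (d + 1)) := by
  let f : Simplex N d → Fin N → Fin (d + 1) := fun e i => ⟨e.1 i, Nat.lt_succ_of_le (e.le i)⟩
  have hf : Function.Injective f := fun e e' h => by
    ext i
    exact congrArg Fin.val (congrFun h i)
  refine (Fintype.card_le_of_injective f hf).trans ?_
  rw [Fintype.card_fun, Fintype.card_fin, Fintype.card_fin, mul_comm, pow_mul]
  exact Nat.pow_le_pow_left (Nat.lt_two_pow_self).le _

open Classical in
lemma card_deviation_le {m N : ℕ} [NeZero N] {d : Fin m → ℕ} (hd : ∀ h, 0 < d h) (i : Fin N)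
    {σ : ℝ} (hσ : 0 < σ) :
    m * σ ^ 2 * (Finset.univ.filter fun e : (∀ h, Simplex N (d h)) =>
      m * σ < |∑ h, ((e h).1 i : ℝ) / d h - m / N|).card ≤
        Fintype.card (∀ h, Simplex N (d h)) := by
  rcases Nat.eq_zero_or_pos m with rfl | hm
  · simp
  have hm' : (0 : ℝ) < m := by exact_mod_cast hm
  have hN : (0 : ℝ) < N := by exact_mod_cast Nat.pos_of_ne_zero (NeZero.ne N)
  set f : ∀ h, Simplex N (d h) → ℝ := fun h e => (e.1 i : ℝ) / d h - 1 / N with hf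
  have h1 := sum_sq_sum_le f (fun h => by
      have hdh : (0 : ℝ) < d h := by exact_mod_cast hd h
      simp only [hf]
      rw [Finset.sum_sub_distrib, ← Finset.sum_div]
      have := Simplex.sum_apply (N := N) (d := d h) i
      rw [Finset.sum_const, Finset.card_univ, nsmul_eq_mul, sub_eq_zero]
      field_simp
      linarith) (fun h e => by
      have hdh : (0 : ℝ) < d h := by exact_mod_cast hd h
      have h2 : (e.1 i : ℝ) / d h ≤ 1 := (div_le_one hdh).mpr (by exact_mod_cast e.le i)
      have h3 : (0 : ℝ) ≤ (e.1 i : ℝ) / d h := by positivity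
      have h4 : (1 : ℝ) / N ≤ 1 := (div_le_one hN).mpr
        (by exact_mod_cast Nat.pos_of_ne_zero (NeZero.ne N))
      have h5 : (0 : ℝ) ≤ 1 / N := by positivity
      rw [abs_le]
      constructor <;> simp only [hf] <;> linarith)
  have h2 : ∀ e : (∀ h, Simplex N (d h)), ∑ h, f h (e h) =
      ∑ h, ((e h).1 i : ℝ) / d h - m / N := by
    intro e
    simp only [hf]
    rw [Finset.sum_sub_distrib]
    simp
    ring
  simp_rw [h2] at h1
  have h3 : (m * σ) ^ 2 * (Finset.univ.filter fun e : (∀ h, Simplex N (d h)) =>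
      m * σ < |∑ h, ((e h).1 i : ℝ) / d h - m / N|).card ≤
      m * Fintype.card (∀ h, Simplex N (d h)) := by
    refine le_trans ?_ h1
    refine le_trans ?_ (Finset.sum_le_sum_of_subset_of_nonneg
      (Finset.filter_subset (fun e : (∀ h, Simplex N (d h)) =>
      m * σ < |∑ h, ((e h).1 i : ℝ) / d h - m / N|) _) fun e _ _ => sq_nonneg _)
    rw [mul_comm, ← nsmul_eq_mul]
    refine Finset.card_nsmul_le_sum _ _ _ fun e he => ?_
    rw [← sq_abs (∑ h, _ - _)]
    exact pow_le_pow_left₀ (by positivity) (Finset.mem_filter.mp he).2.le 2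
  have h4 : (m : ℝ) * (m * σ ^ 2 * (Finset.univ.filter fun e : (∀ h, Simplex N (d h)) =>
      m * σ < |∑ h, ((e h).1 i : ℝ) / d h - m / N|).card) ≤
      m * Fintype.card (∀ h, Simplex N (d h)) := by
    refine le_trans (le_of_eq ?_) h3
    ring
  exact le_of_mul_le_mul_left h4 hm'

end Simplex

section Blocks

variable {K A : Type*} [Field K] [CommRing A] [Algebra K A] {N : ℕ}

/-- The matrix of the substitution `T` on forms of degree `d`. -/
noncomputable def symMat (T : Matrix (Fin N) (Fin N) K) (d : ℕ) (e' e : Simplex N d) : K :=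
  MvPolynomial.coeff (Finsupp.equivFunOnFinite.symm e'.1)
    (∏ α, (∑ i, MvPolynomial.C (T α i) * MvPolynomial.X i) ^ e.1 α)

lemma isHomogeneous_linear_pow (T : Matrix (Fin N) (Fin N) K) {d : ℕ} (e : Simplex N d) :
    (∏ α, (∑ i, MvPolynomial.C (T α i) * MvPolynomial.X i) ^ e.1 α :
      MvPolynomial (Fin N) K).IsHomogeneous d := by
  have h : (∏ α, (∑ i, MvPolynomial.C (T α i) * MvPolynomial.X i) ^ e.1 α :
      MvPolynomial (Fin N) K).IsHomogeneous (∑ α, 1 * e.1 α) := by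
    refine MvPolynomial.IsHomogeneous.prod _ _ _ fun α _ => ?_
    refine MvPolynomial.IsHomogeneous.pow ?_ _
    refine MvPolynomial.IsHomogeneous.sum _ _ _ fun i _ => ?_
    exact MvPolynomial.isHomogeneous_C_mul_X _ _
  simp only [one_mul] at h
  rwa [e.sum_eq] at h

lemma prod_pow_eq_sum_symMat (T : Matrix (Fin N) (Fin N) K) {d : ℕ} (e : Simplex N d)
    (y : Fin N → A) :
    ∏ α, (∑ i, T α i • y i) ^ e.1 α =
      ∑ e' : Simplex N d, symMat T d e' e • ∏ i, y i ^ e'.1 i := by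
  set F : MvPolynomial (Fin N) K :=
    ∏ α, (∑ i, MvPolynomial.C (T α i) * MvPolynomial.X i) ^ e.1 α with hF
  have h1 : MvPolynomial.aeval y F = ∏ α, (∑ i, T α i • y i) ^ e.1 α := by
    rw [hF, map_prod]
    refine Finset.prod_congr rfl fun α _ => ?_
    rw [map_pow, map_sum]
    congr 1
    refine Finset.sum_congr rfl fun i _ => ?_
    rw [map_mul, MvPolynomial.aeval_C, MvPolynomial.aeval_X, Algebra.smul_def]
  have hhom : F.IsHomogeneous d := isHomogeneous_linear_pow T e
  rw [← h1, MvPolynomial.aeval_def, MvPolynomial.eval₂_eq']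
  have hinj : Function.Injective fun e' : Simplex N d => Finsupp.equivFunOnFinite.symm e'.1 :=
    fun e₁ e₂ h => Subtype.ext (Finsupp.equivFunOnFinite.symm.injective h)
  have hsub : F.support ⊆ Finset.univ.image
      fun e' : Simplex N d => Finsupp.equivFunOnFinite.symm e'.1 := by
    intro b hb
    rw [Finset.mem_image]
    have hdeg := hhom (MvPolynomial.mem_support_iff.mp hb)
    refine ⟨⟨b, ?_⟩, Finset.mem_univ _, by ext; rfl⟩
    rw [Finset.mem_piAntidiag]
    refine ⟨?_, by simp⟩
    rw [← hdeg, Finsupp.weight_apply, Finsupp.sum_fintype _ _ (by simp)]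
    simp
  rw [Finset.sum_subset hsub fun b _ hb => by
    rw [MvPolynomial.notMem_support_iff.mp hb, map_zero, zero_mul],
    Finset.sum_image fun _ _ _ _ h => hinj h]
  refine Finset.sum_congr rfl fun e' _ => ?_
  rw [← Algebra.smul_def]
  rfl

lemma symMat_mem {R : Subring K} {T : Matrix (Fin N) (Fin N) K} (hT : ∀ α i, T α i ∈ R) (d : ℕ)
    (e' e : Simplex N d) : symMat T d e' e ∈ R := by
  have h : (∏ α, (∑ i, MvPolynomial.C (T α i) * MvPolynomial.X i) ^ e.1 α :
      MvPolynomial (Fin N) K) = MvPolynomial.map R.subtype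
        (∏ α, (∑ i, MvPolynomial.C (⟨T α i, hT α i⟩ : R) * MvPolynomial.X i) ^ e.1 α) := by
    simp [map_prod]
  rw [symMat, h, MvPolynomial.coeff_map]
  exact Subtype.prop _

lemma abv_symMat_le (a : AbsoluteValue K ℝ) {T : Matrix (Fin N) (Fin N) K} {B : ℝ}
    (hT : ∀ α, ∑ i, a (T α i) ≤ B) (d : ℕ) (e' e : Simplex N d) :
    a (symMat T d e' e) ≤ B ^ d := by
  refine (coeff_le_wl1_one a _ _).trans ?_
  have hr : ∀ i : Fin N, (0 : ℝ) ≤ (fun _ => 1) i := fun _ => zero_le_one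
  refine (wl1_prod_le a hr _ _).trans ?_
  have hd : B ^ d = ∏ α, B ^ e.1 α := by
    rw [Finset.prod_pow_eq_pow_sum]
    exact congrArg _ e.sum_eq.symm
  rw [hd]
  refine Finset.prod_le_prod (fun _ _ => wl1_nonneg a hr _) fun α _ => ?_
  refine (wl1_pow_le a hr _ _).trans ?_
  refine pow_le_pow_left₀ (wl1_nonneg a hr _) (le_trans ?_ (hT α)) _
  refine (wl1_sum_le a hr _ _).trans (Finset.sum_le_sum fun i _ => ?_)
  refine (wl1_mul_le a hr _ _).trans ?_
  rw [wl1_C, wl1_X, mul_one]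

variable {m : ℕ} {d : Fin m → ℕ}

/-- Evaluation of the multihomogeneous polynomial with coefficients `x`. -/
noncomputable def blockEval (x : (∀ h, Simplex N (d h)) → K) (y : Fin m → Fin N → A) : A :=
  ∑ e, x e • ∏ h, ∏ i, y h i ^ (e h).1 i

lemma blockEval_linear (T : Matrix (Fin N) (Fin N) K) (x : (∀ h, Simplex N (d h)) → K)
    (y : Fin m → Fin N → A) :
    blockEval x (fun h α => ∑ i, T α i • y h i) =
      blockEval (fun e' => ∑ e, (∏ h, symMat T (d h) (e' h) (e h)) * x e) y := by
  simp only [blockEval, prod_pow_eq_sum_symMat, Finset.sum_smul]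
  rw [Finset.sum_comm]
  refine Finset.sum_congr rfl fun e _ => ?_
  rw [Finset.prod_univ_sum, Fintype.piFinset_univ, Finset.smul_sum]
  refine Finset.sum_congr rfl fun e' _ => ?_
  rw [Finset.prod_smul, smul_smul, mul_comm]

lemma wl1_blockEval_le {τ : Type*} (a : AbsoluteValue K ℝ) {r : τ → ℝ} (hr : ∀ i, 0 ≤ r i)
    (x : (∀ h, Simplex N (d h)) → K) (y : Fin m → Fin N → MvPolynomial τ K) :
    wl1 a r (blockEval x y) ≤ ∑ e, a (x e) * ∏ h, ∏ i, wl1 a r (y h i) ^ (e h).1 i := by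
  refine (wl1_sum_le a hr _ _).trans (Finset.sum_le_sum fun e _ => ?_)
  rw [MvPolynomial.smul_eq_C_mul]
  refine (wl1_mul_le a hr _ _).trans ?_
  rw [wl1_C]
  refine mul_le_mul_of_nonneg_left ?_ (a.nonneg _)
  refine (wl1_prod_le a hr _ _).trans
    (Finset.prod_le_prod (fun _ _ => wl1_nonneg a hr _) fun h _ => ?_)
  refine (wl1_prod_le a hr _ _).trans
    (Finset.prod_le_prod (fun _ _ => wl1_nonneg a hr _) fun i _ => ?_)
  exact wl1_pow_le a hr _ _

lemma card_blocks_le (hd : ∀ h, 0 < d h) :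
    (Fintype.card (∀ h, Simplex N (d h)) : ℝ) ≤ (2 ^ (N * 2)) ^ ∑ h, d h := by
  rw [Fintype.card_pi]
  push_cast
  rw [← Finset.prod_pow_eq_pow_sum]
  refine Finset.prod_le_prod (fun _ _ => Nat.cast_nonneg _) fun h _ => ?_
  refine (Nat.cast_le.mpr (card_simplex_le N (d h))).trans ?_
  push_cast
  rw [← pow_mul]
  refine pow_le_pow_right₀ (by norm_num) ?_
  rw [mul_assoc]
  refine Nat.mul_le_mul_left _ ?_
  have := hd h
  omega

lemma abv_sum_symMat_le (hd : ∀ h, 0 < d h) (a : AbsoluteValue K ℝ)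
    {T : Matrix (Fin N) (Fin N) K} {B C : ℝ} (hT : ∀ α, ∑ i, a (T α i) ≤ B) (hB : 0 ≤ B)
    (hC : 0 ≤ C) {x : (∀ h, Simplex N (d h)) → K} (hx : ∀ e, a (x e) ≤ C ^ ∑ h, d h)
    (e' : ∀ h, Simplex N (d h)) :
    a (∑ e, (∏ h, symMat T (d h) (e' h) (e h)) * x e) ≤
      (2 ^ (N * 2) * (B * C)) ^ ∑ h, d h := by
  have h1 : ∀ e, a ((∏ h, symMat T (d h) (e' h) (e h)) * x e) ≤ (B * C) ^ ∑ h, d h := by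
    intro e
    rw [map_mul, map_prod, mul_pow]
    refine mul_le_mul ?_ (hx e) (a.nonneg _) (by positivity)
    rw [← Finset.prod_pow_eq_pow_sum]
    exact Finset.prod_le_prod (fun _ _ => a.nonneg _) fun h _ => abv_symMat_le _ hT _ _ _
  refine (a.sum_le _ _).trans ((Finset.sum_le_sum fun e _ => h1 e).trans ?_)
  rw [Finset.sum_const, Finset.card_univ, nsmul_eq_mul, mul_pow (2 ^ (N * 2) : ℝ)]
  exact mul_le_mul_of_nonneg_right (card_blocks_le hd) (by positivity)

end Blocks

namespace PlaceSys

open Height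

variable {K : Type} [Field K] [AdmissibleAbsValues K] (S : PlaceSys K) {N : ℕ}

/-- The auxiliary polynomial of the Subspace theorem. -/
lemma exists_auxiliary [NeZero N] (T : S.V → Matrix (Fin N) (Fin N) K)
    (hT : ∀ v α i, T v α i ∈ S.R) : ∃ C : ℝ, 1 ≤ C ∧ ∀ (m : ℕ) (σ : ℝ), 0 < σ →
      2 * Fintype.card S.V * N ≤ m * σ ^ 2 → ∀ d : Fin m → ℕ, (∀ h, 0 < d h) →
      ∃ x : (∀ h, Simplex N (d h)) → K, x ≠ 0 ∧ (∀ e, x e ∈ S.R) ∧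
        (∀ v e, S.abv v (x e) ≤ C ^ ∑ h, d h) ∧
        ∀ v (e' : ∀ h, Simplex N (d h)) i, m * σ < |∑ h, ((e' h).1 i : ℝ) / d h - m / N| →
          ∑ e, (∏ h, symMat (T v) (d h) (e' h) (e h)) * x e = 0 := by
  classical
  obtain ⟨C₀, hC₀, hs⟩ := S.siegel
  set B : ℝ := 1 + ∑ v', ∑ v, ∑ α, ∑ i, S.abv v' (T v α i) with hB
  have hnn : ∀ v' v α i, 0 ≤ S.abv v' (T v α i) := fun v' v α i => (S.abv v').nonneg _
  have hTB : ∀ v' v α, ∑ i, S.abv v' (T v α i) ≤ B := by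
    intro v' v α
    have h1 : ∑ i, S.abv v' (T v α i) ≤ ∑ α, ∑ i, S.abv v' (T v α i) :=
      Finset.single_le_sum (f := fun α => ∑ i, S.abv v' (T v α i))
        (fun α _ => Finset.sum_nonneg fun i _ => hnn _ _ _ _) (Finset.mem_univ α)
    have h2 : ∑ α, ∑ i, S.abv v' (T v α i) ≤ ∑ v, ∑ α, ∑ i, S.abv v' (T v α i) :=
      Finset.single_le_sum (f := fun v => ∑ α, ∑ i, S.abv v' (T v α i))
        (fun v _ => Finset.sum_nonneg fun α _ => Finset.sum_nonneg fun i _ => hnn _ _ _ _)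
        (Finset.mem_univ v)
    have h3 : ∑ v, ∑ α, ∑ i, S.abv v' (T v α i) ≤ ∑ v', ∑ v, ∑ α, ∑ i, S.abv v' (T v α i) :=
      Finset.single_le_sum (f := fun v' => ∑ v, ∑ α, ∑ i, S.abv v' (T v α i))
        (fun v' _ => Finset.sum_nonneg fun v _ => Finset.sum_nonneg fun α _ =>
          Finset.sum_nonneg fun i _ => hnn _ _ _ _) (Finset.mem_univ v')
    linarith
  have hB1 : 1 ≤ B := le_add_of_nonneg_right (Finset.sum_nonneg fun v' _ =>
    Finset.sum_nonneg fun v _ => Finset.sum_nonneg fun α _ =>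
      Finset.sum_nonneg fun i _ => hnn _ _ _ _)
  refine ⟨C₀ * 2 ^ (N * 2) * B, ?_, fun m σ hσ hm d hd => ?_⟩
  · exact one_le_mul_of_one_le_of_one_le
      (one_le_mul_of_one_le_of_one_le hC₀ (one_le_pow₀ (by norm_num))) hB1
  have hVc : 0 < Fintype.card S.V := Fintype.card_pos_iff.mpr ⟨S.v₀⟩
  have hNpos : 0 < N := Nat.pos_of_ne_zero (NeZero.ne N)
  have hm0 : 0 < m := by
    rcases Nat.eq_zero_or_pos m with rfl | h
    · exfalso
      have : (0 : ℝ) < 2 * Fintype.card S.V * N := by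
        have : (0 : ℝ) < Fintype.card S.V := by exact_mod_cast hVc
        have : (0 : ℝ) < N := by exact_mod_cast hNpos
        positivity
      simp at hm
      linarith
    · exact h
  have hsd : 1 ≤ ∑ h, d h :=
    (Nat.succ_le_of_lt (hd ⟨0, hm0⟩)).trans
      (Finset.single_le_sum (f := d) (fun _ _ => Nat.zero_le _) (Finset.mem_univ _))
  let bad : Finset (∀ h, Simplex N (d h)) := Finset.univ.filter fun e =>
    ∃ i, m * σ < |∑ h, ((e h).1 i : ℝ) / d h - m / N|
  let a : Matrix (S.V × bad) (∀ h, Simplex N (d h)) K :=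
    fun p e => ∏ h, symMat (T p.1) (d h) (p.2.1 h) (e h)
  have hbad : 2 * (Fintype.card S.V * bad.card) ≤ Fintype.card (∀ h, Simplex N (d h)) := by
    have h1 : bad ⊆ Finset.univ.biUnion fun i => Finset.univ.filter
        fun e : (∀ h, Simplex N (d h)) => m * σ < |∑ h, ((e h).1 i : ℝ) / d h - m / N| := by
      intro e he
      obtain ⟨i, hi⟩ := (Finset.mem_filter.mp he).2
      simp only [Finset.mem_biUnion, Finset.mem_filter, Finset.mem_univ, true_and]
      exact ⟨i, hi⟩
    have h2 := (Finset.card_le_card h1).trans Finset.card_biUnion_le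
    have h3 : m * σ ^ 2 * (bad.card : ℝ) ≤ N * Fintype.card (∀ h, Simplex N (d h)) := by
      have h4 : (bad.card : ℝ) ≤ ∑ i : Fin N, ((Finset.univ.filter
          fun e : (∀ h, Simplex N (d h)) =>
            m * σ < |∑ h, ((e h).1 i : ℝ) / d h - m / N|).card : ℝ) := by
        exact_mod_cast h2
      refine (mul_le_mul_of_nonneg_left h4 (by positivity)).trans ?_
      rw [Finset.mul_sum]
      refine (Finset.sum_le_sum fun i _ => card_deviation_le hd i hσ).trans ?_
      simp
    have h5 := (mul_le_mul_of_nonneg_right hm (Nat.cast_nonneg bad.card)).trans h3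
    have h6 : (N : ℝ) * (2 * (Fintype.card S.V * bad.card)) ≤
        N * Fintype.card (∀ h, Simplex N (d h)) := by linarith
    have h7 := le_of_mul_le_mul_left h6 (by exact_mod_cast hNpos)
    exact_mod_cast h7
  obtain ⟨x, hx0, hxR, hax, hxB⟩ := hs (S.V × bad) (∀ h, Simplex N (d h)) a (B ^ ∑ h, d h)
    (one_le_pow₀ hB1) (fun p e => S.R.prod_mem fun h _ => symMat_mem (hT p.1) _ _ _)
    (fun v p e => by
      rw [map_prod, ← Finset.prod_pow_eq_pow_sum]
      exact Finset.prod_le_prod (fun _ _ => (S.abv v).nonneg _)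
        fun h _ => abv_symMat_le _ (hTB v p.1) _ _ _)
    (by rw [Fintype.card_prod, Fintype.card_coe]; exact hbad) Fintype.card_pos
  refine ⟨x, hx0, hxR, fun v e => (hxB v e).trans ?_, fun v e' i hi => ?_⟩
  · rw [mul_pow, mul_pow]
    refine mul_le_mul_of_nonneg_right ?_ (by positivity)
    refine mul_le_mul (le_self_pow₀ hC₀ (by omega)) ?_ (by positivity) (by positivity)
    exact card_blocks_le hd
  · have h1 := congrFun hax (v, ⟨e', by
      simp only [bad, Finset.mem_filter, Finset.mem_univ, true_and]
      exact ⟨i, hi⟩⟩)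
    exact h1

end PlaceSys

section SubA5

open Real Height

section Subst

variable {K : Type*} [Field K] {m n : ℕ}

/-- The generic point `∑ₖ tₖ wₖ + s e_α` in each block. -/
noncomputable def genPt (w : Fin m → Fin n → Fin (n + 1) → K) (α : Fin m → Fin (n + 1))
    (h : Fin m) (i : Fin (n + 1)) : MvPolynomial (Fin m × Fin n ⊕ Fin m) K :=
  ∑ k, MvPolynomial.C (w h k i) * MvPolynomial.X (Sum.inl (h, k)) +
    MvPolynomial.C (if i = α h then 1 else 0) * MvPolynomial.X (Sum.inr h)

/-- The weight of the block `h`. -/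
def blockWt (h : Fin m) : Fin m × Fin n ⊕ Fin m → ℕ :=
  Sum.elim (fun p => if p.1 = h then 1 else 0) fun h' => if h' = h then 1 else 0

lemma genPt_isWeightedHomogeneous (w : Fin m → Fin n → Fin (n + 1) → K) (α : Fin m → Fin (n + 1))
    (h₀ h : Fin m) (i : Fin (n + 1)) :
    MvPolynomial.IsWeightedHomogeneous (blockWt h₀ : Fin m × Fin n ⊕ Fin m → ℕ)
      (genPt w α h i) (if h = h₀ then 1 else 0) := by
  have hC : ∀ (a : K) (p : Fin m × Fin n ⊕ Fin m),
      MvPolynomial.IsWeightedHomogeneous (blockWt h₀ : Fin m × Fin n ⊕ Fin m → ℕ)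
      (MvPolynomial.C a * MvPolynomial.X p) (blockWt h₀ p) := by
    intro a p
    have := (MvPolynomial.isWeightedHomogeneous_C (R := K) (M := ℕ) (blockWt h₀) a).mul
      (MvPolynomial.isWeightedHomogeneous_X K (blockWt h₀ : Fin m × Fin n ⊕ Fin m → ℕ) p)
    rwa [zero_add] at this
  unfold genPt
  refine MvPolynomial.IsWeightedHomogeneous.add ?_ ?_
  · refine MvPolynomial.IsWeightedHomogeneous.sum _ _ _ fun k _ => ?_
    exact hC _ _
  · exact hC _ _

lemma weight_eq_of_coeff_ne_zero {d : Fin m → ℕ} {w : Fin m → Fin n → Fin (n + 1) → K}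
    {α : Fin m → Fin (n + 1)} {x : (∀ h, Simplex (n + 1) (d h)) → K}
    {a : Fin m × Fin n ⊕ Fin m →₀ ℕ}
    (ha : MvPolynomial.coeff a (blockEval x (genPt w α)) ≠ 0) (h₀ : Fin m) :
    ∑ k, a (Sum.inl (h₀, k)) + a (Sum.inr h₀) = d h₀ := by
  have hh : MvPolynomial.IsWeightedHomogeneous (blockWt h₀ : Fin m × Fin n ⊕ Fin m → ℕ)
      (blockEval x (genPt w α)) (d h₀) := by
    unfold blockEval
    refine MvPolynomial.IsWeightedHomogeneous.sum _ _ _ fun e _ => ?_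
    have h1 : MvPolynomial.IsWeightedHomogeneous (blockWt h₀ : Fin m × Fin n ⊕ Fin m → ℕ)
        (∏ h, ∏ i, genPt w α h i ^ (e h).1 i)
        (∑ h, ∑ i, (e h).1 i • (if h = h₀ then 1 else 0)) := by
      refine MvPolynomial.IsWeightedHomogeneous.prod _ _ _ fun h _ => ?_
      refine MvPolynomial.IsWeightedHomogeneous.prod _ _ _ fun i _ => ?_
      exact (genPt_isWeightedHomogeneous w α h₀ h i).pow _
    have h2 : ∑ h, ∑ i, (e h).1 i • (if h = h₀ then 1 else 0) = d h₀ := by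
      rw [Finset.sum_eq_single h₀ (fun h _ hne => by simp [hne]) (by simp)]
      simpa using (e h₀).sum_eq
    rw [h2] at h1
    have h3 := (MvPolynomial.isWeightedHomogeneous_C (R := K) (M := ℕ)
      (blockWt h₀ : Fin m × Fin n ⊕ Fin m → ℕ) (x e)).mul h1
    rwa [zero_add, ← MvPolynomial.smul_eq_C_mul] at h3
  have h4 := hh ha
  rw [Finsupp.weight_apply, Finsupp.sum_fintype _ _ (by simp), Fintype.sum_sum_type,
    Fintype.sum_prod_type] at h4
  rw [← h4]
  congr 1
  · rw [Finset.sum_eq_single h₀ (fun h _ hne => by simp [blockWt, hne]) (by simp)]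
    simp [blockWt]
  · simp [blockWt]

lemma weighted_sum_le {N : ℕ} {q : Fin m → ℝ} {d : Fin m → ℕ} {D σ b : ℝ} (c : Fin N → ℝ)
    (hb : ∀ i, |c i| ≤ b) (hD : 0 ≤ D) (hσ : 0 ≤ σ) (hd : ∀ h, 0 < d h)
    (hqD : ∀ h, q h ≤ σ * D) (h1 : ∀ h, D ≤ q h * d h) (h2 : ∀ h, q h * d h ≤ D + q h)
    (e : ∀ h, Simplex N (d h))
    (he : ∀ i, |∑ h, ((e h).1 i : ℝ) / d h - m / N| ≤ m * σ) :
    ∑ h, ∑ i, (e h).1 i * (q h * c i) ≤ D * m / N * ∑ i, c i + 2 * N * b * m * σ * D := by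
  have h3 : ∀ i, |∑ h, q h * (e h).1 i - D * m / N| ≤ 2 * m * σ * D := by
    intro i
    have h4 : ∑ h, q h * ((e h).1 i : ℝ) - D * m / N =
        D * (∑ h, ((e h).1 i : ℝ) / d h - m / N) +
          ∑ h, (q h * d h - D) * (((e h).1 i : ℝ) / d h) := by
      rw [mul_sub, Finset.mul_sum]
      have : ∀ h, q h * ((e h).1 i : ℝ) = D * (((e h).1 i : ℝ) / d h) +
          (q h * d h - D) * (((e h).1 i : ℝ) / d h) := by
        intro h
        have : (d h : ℝ) ≠ 0 := by exact_mod_cast (hd h).ne'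
        field_simp
        ring
      simp_rw [this]
      rw [Finset.sum_add_distrib]
      ring
    rw [h4]
    refine (abs_add_le _ _).trans ?_
    rw [abs_mul, abs_of_nonneg hD]
    have h5 := mul_le_mul_of_nonneg_left (he i) hD
    have h6 : |∑ h, (q h * d h - D) * (((e h).1 i : ℝ) / d h)| ≤ m * (σ * D) := by
      refine (Finset.abs_sum_le_sum_abs _ _).trans ?_
      calc _ ≤ ∑ h : Fin m, σ * D := by
            refine Finset.sum_le_sum fun h _ => ?_
            have hdh : (0 : ℝ) < d h := by exact_mod_cast hd h
            rw [abs_mul, abs_of_nonneg (by linarith [h1 h]), abs_of_nonneg (by positivity)]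
            have h7 : ((e h).1 i : ℝ) / d h ≤ 1 :=
              (div_le_one hdh).mpr (by exact_mod_cast (e h).le i)
            refine (mul_le_of_le_one_right (by linarith [h1 h]) h7).trans ?_
            linarith [h2 h, hqD h]
        _ = _ := by simp
    linarith
  have h4 : ∑ h, ∑ i, (e h).1 i * (q h * c i) = ∑ i, (∑ h, q h * (e h).1 i) * c i := by
    rw [Finset.sum_comm]
    refine Finset.sum_congr rfl fun i _ => ?_
    rw [Finset.sum_mul]
    exact Finset.sum_congr rfl fun h _ => by ring
  have h5 : ∀ i, (∑ h, q h * (e h).1 i) * c i ≤ D * m / N * c i + 2 * m * σ * D * b := by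
    intro i
    have h6 : (∑ h, q h * (e h).1 i - D * m / N) * c i ≤ 2 * m * σ * D * b := by
      refine (le_abs_self _).trans ?_
      rw [abs_mul]
      exact mul_le_mul (h3 i) (hb i) (abs_nonneg _) (by positivity)
    linarith
  rw [h4]
  refine (Finset.sum_le_sum fun i _ => h5 i).trans (le_of_eq ?_)
  rw [Finset.sum_add_distrib, ← Finset.mul_sum]
  simp
  ring

end Subst

end SubA5

section SubA6

open Real Height

section Subst

variable {K : Type*} [Field K] {m n : ℕ}

/-- The generic point in the coordinates given by the forms `L`. -/
noncomputable def genForm (L : Matrix (Fin (n + 1)) (Fin (n + 1)) K) (s : K)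
    (w : Fin m → Fin n → Fin (n + 1) → K) (α : Fin m → Fin (n + 1))
    (h : Fin m) (i : Fin (n + 1)) : MvPolynomial (Fin m × Fin n ⊕ Fin m) K :=
  ∑ k, MvPolynomial.C (s⁻¹ * L.mulVec (w h k) i) * MvPolynomial.X (Sum.inl (h, k)) +
    MvPolynomial.C (s⁻¹ * L.mulVec (Pi.single (α h) 1) i) * MvPolynomial.X (Sum.inr h)

lemma sum_smul_inv_mul {L : Matrix (Fin (n + 1)) (Fin (n + 1)) K} (hL : IsUnit L.det) {s : K}
    (hs : s ≠ 0) (u : Fin (n + 1) → K) (i : Fin (n + 1)) :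
    ∑ j, (s • L⁻¹) i j * (s⁻¹ * L.mulVec u j) = u i := by
  have h1 : ∀ j, (s • L⁻¹) i j * (s⁻¹ * L.mulVec u j) = L⁻¹ i j * L.mulVec u j := by
    intro j
    rw [Matrix.smul_apply, smul_eq_mul]
    field_simp
  simp_rw [h1]
  change L⁻¹.mulVec (L.mulVec u) i = u i
  rw [Matrix.mulVec_mulVec, Matrix.nonsing_inv_mul _ hL, Matrix.one_mulVec]

lemma genPt_eq_sum_genForm {L : Matrix (Fin (n + 1)) (Fin (n + 1)) K} (hL : IsUnit L.det) {s : K}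
    (hs : s ≠ 0) (w : Fin m → Fin n → Fin (n + 1) → K) (α : Fin m → Fin (n + 1)) :
    genPt w α = fun h i => ∑ j, (s • L⁻¹) i j • genForm L s w α h j := by
  funext h i
  have h1 : ∀ j, (s • L⁻¹) i j • genForm L s w α h j =
      ∑ k, MvPolynomial.C ((s • L⁻¹) i j * (s⁻¹ * L.mulVec (w h k) j)) *
          MvPolynomial.X (Sum.inl (h, k)) +
        MvPolynomial.C ((s • L⁻¹) i j * (s⁻¹ * L.mulVec (Pi.single (α h) 1) j)) *
          MvPolynomial.X (Sum.inr h) := by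
    intro j
    simp only [genForm, smul_add, Finset.smul_sum, MvPolynomial.smul_eq_C_mul,
      MvPolynomial.C_mul, mul_assoc]
  simp_rw [h1]
  rw [Finset.sum_add_distrib, Finset.sum_comm]
  simp_rw [← Finset.sum_mul, ← map_sum, sum_smul_inv_mul hL hs]
  simp [genPt, Pi.single_apply]

lemma wl1_genForm_le (a : AbsoluteValue K ℝ) {L : Matrix (Fin (n + 1)) (Fin (n + 1)) K} {s : K}
    {w : Fin m → Fin n → Fin (n + 1) → K} {α : Fin m → Fin (n + 1)} {q : Fin m → ℝ}
    {c : Fin (n + 1) → ℝ} {b : ℝ} (hb : ∀ i, |c i| ≤ b) (hq : ∀ h, 0 ≤ q h)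
    (hw : ∀ h k, 0 < twNorm a L (fun i => q h * c i) (w h k))
    (h : Fin m) (i : Fin (n + 1)) :
    wl1 a (Sum.elim (fun p => (twNorm a L (fun i => q p.1 * c i) (w p.1 p.2))⁻¹)
      fun h => exp (-(b * q h))) (genForm L s w α h i) ≤
      a s⁻¹ * (n + ∑ i, ∑ j, a (L i j)) * exp (q h * c i) := by
  set r : Fin m × Fin n ⊕ Fin m → ℝ :=
    Sum.elim (fun p => (twNorm a L (fun i => q p.1 * c i) (w p.1 p.2))⁻¹)
      fun h => exp (-(b * q h)) with hr
  have hr0 : ∀ p, 0 ≤ r p := by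
    rintro (p | p)
    · exact inv_nonneg.mpr (hw _ _).le
    · exact (exp_pos _).le
  refine (wl1_add_le a hr0 _ _).trans ?_
  have h1 : wl1 a r (∑ k, MvPolynomial.C (s⁻¹ * L.mulVec (w h k) i) *
      MvPolynomial.X (Sum.inl (h, k))) ≤ a s⁻¹ * n * exp (q h * c i) := by
    refine (wl1_sum_le a hr0 _ _).trans ?_
    calc _ ≤ ∑ k : Fin n, a s⁻¹ * exp (q h * c i) := by
          refine Finset.sum_le_sum fun k _ => ?_
          refine (wl1_mul_le a hr0 _ _).trans ?_
          rw [wl1_C, wl1_X, map_mul, mul_assoc]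
          refine mul_le_mul_of_nonneg_left ?_ (a.nonneg _)
          have := abv_le_twNorm a L (fun i => q h * c i) (w h k) i
          change _ * (twNorm a L (fun i => q h * c i) (w h k))⁻¹ ≤ _
          rwa [mul_inv_le_iff₀ (hw h k)]
      _ = _ := by
          simp
          ring
  have h2 : wl1 a r (MvPolynomial.C (s⁻¹ * L.mulVec (Pi.single (α h) 1) i) *
      MvPolynomial.X (Sum.inr h)) ≤ a s⁻¹ * (∑ i, ∑ j, a (L i j)) * exp (q h * c i) := by
    refine (wl1_mul_le a hr0 _ _).trans ?_
    rw [wl1_C, wl1_X, map_mul, mul_assoc, mul_assoc]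
    refine mul_le_mul_of_nonneg_left ?_ (a.nonneg _)
    refine mul_le_mul ?_ ?_ (hr0 _)
      (Finset.sum_nonneg fun i _ => Finset.sum_nonneg fun j _ => a.nonneg _)
    · rw [Matrix.mulVec_single_one, Matrix.col_apply]
      exact (Finset.single_le_sum (f := fun j => a (L i j)) (fun j _ => a.nonneg _)
        (Finset.mem_univ _)).trans
        (Finset.single_le_sum (f := fun i => ∑ j, a (L i j))
          (fun i _ => Finset.sum_nonneg fun j _ => a.nonneg _) (Finset.mem_univ _))
    · refine exp_le_exp.mpr ?_
      have h3 := neg_le_of_abs_le (hb i)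
      have := mul_le_mul_of_nonneg_left h3 (hq h)
      linarith
  linarith

/-- Bound for the coefficients of the auxiliary polynomial at the generic point. -/
lemma abv_coeff_genPt_le (a : AbsoluteValue K ℝ) {L : Matrix (Fin (n + 1)) (Fin (n + 1)) K}
    (hL : IsUnit L.det) {s : K} (hs : s ≠ 0)
    {w : Fin m → Fin n → Fin (n + 1) → K} {α : Fin m → Fin (n + 1)} {q : Fin m → ℝ}
    {c : Fin (n + 1) → ℝ} {b : ℝ} (hb : ∀ i, |c i| ≤ b) (hq : ∀ h, 0 ≤ q h)
    (hw : ∀ h k, 0 < twNorm a L (fun i => q h * c i) (w h k))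
    {d : Fin m → ℕ} (hd : ∀ h, 0 < d h) {x : (∀ h, Simplex (n + 1) (d h)) → K} {D σ : ℝ}
    (hD : 0 ≤ D) (hσ : 0 ≤ σ) (hqD : ∀ h, q h ≤ σ * D) (h1 : ∀ h, D ≤ q h * d h)
    (h2 : ∀ h, q h * d h ≤ D + q h)
    (hx : ∀ (e' : ∀ h, Simplex (n + 1) (d h)) i,
      m * σ < |∑ h, ((e' h).1 i : ℝ) / d h - m / (n + 1 : ℕ)| →
        ∑ e, (∏ h, symMat (s • L⁻¹) (d h) (e' h) (e h)) * x e = 0) {F : ℝ} (hF : 0 ≤ F)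
    (hxF : ∀ e' : (∀ h, Simplex (n + 1) (d h)), a (∑ e, (∏ h, symMat (s • L⁻¹) (d h) (e' h) (e h)) * x e) ≤ F ^ ∑ h, d h)
    {E : ℝ} (hE : a s⁻¹ * (n + ∑ i, ∑ j, a (L i j)) ≤ E)
    (A : Fin m × Fin n ⊕ Fin m →₀ ℕ) :
    a (MvPolynomial.coeff A (blockEval x (genPt w α))) *
      (∏ h, ((∏ k, ((twNorm a L (fun i => q h * c i) (w h k))⁻¹) ^ A (Sum.inl (h, k))) *
        exp (-(b * q h)) ^ A (Sum.inr h))) ≤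
      (2 ^ ((n + 1) * 2) * (F * E)) ^ (∑ h, d h) *
        exp (D * m / (n + 1 : ℕ) * ∑ i, c i + 2 * (n + 1 : ℕ) * b * m * σ * D) := by
  set r : Fin m × Fin n ⊕ Fin m → ℝ :=
    Sum.elim (fun p => (twNorm a L (fun i => q p.1 * c i) (w p.1 p.2))⁻¹)
      fun h => exp (-(b * q h)) with hr
  have hr0 : ∀ p, 0 ≤ r p := by
    rintro (p | p)
    · exact inv_nonneg.mpr (hw _ _).le
    · exact (exp_pos _).le
  have hE0 : 0 ≤ E := le_trans (mul_nonneg (a.nonneg _) (add_nonneg (Nat.cast_nonneg _)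
    (Finset.sum_nonneg fun i _ => Finset.sum_nonneg fun j _ => a.nonneg _))) hE
  have h3 : (∏ h, ((∏ k, ((twNorm a L (fun i => q h * c i) (w h k))⁻¹) ^ A (Sum.inl (h, k))) *
        exp (-(b * q h)) ^ A (Sum.inr h))) = A.prod fun i e => r i ^ e := by
    rw [Finsupp.prod_fintype _ _ (by simp), Fintype.prod_sum_type, Fintype.prod_prod_type,
      Finset.prod_mul_distrib]
    rfl
  rw [h3]
  refine (coeff_le_wl1 a hr0 _ A).trans ?_
  rw [genPt_eq_sum_genForm hL hs, blockEval_linear]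
  refine (wl1_blockEval_le a hr0 _ _).trans ?_
  set G := exp (D * m / (n + 1 : ℕ) * ∑ i, c i + 2 * (n + 1 : ℕ) * b * m * σ * D) with hG
  have h4 : ∀ e' : (∀ h, Simplex (n + 1) (d h)),
      a (∑ e, (∏ h, symMat (s • L⁻¹) (d h) (e' h) (e h)) * x e) *
        ∏ h, ∏ i, wl1 a r (genForm L s w α h i) ^ (e' h).1 i ≤ (F * E) ^ (∑ h, d h) * G := by
    intro e'
    by_cases hbad : ∃ i, m * σ < |∑ h, ((e' h).1 i : ℝ) / d h - m / (n + 1 : ℕ)|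
    · obtain ⟨i, hi⟩ := hbad
      rw [hx e' i hi, map_zero, zero_mul]
      exact mul_nonneg (by positivity) (exp_pos _).le
    · push Not at hbad
      rw [mul_pow, mul_assoc]
      refine mul_le_mul (hxF e') ?_ (Finset.prod_nonneg fun h _ => Finset.prod_nonneg fun i _ =>
        pow_nonneg (wl1_nonneg a hr0 _) _) (by positivity)
      have h5 : ∏ h, ∏ i, wl1 a r (genForm L s w α h i) ^ (e' h).1 i ≤
          ∏ h, ∏ i, (E * exp (q h * c i)) ^ (e' h).1 i := by
        refine Finset.prod_le_prod (fun h _ => Finset.prod_nonneg fun i _ =>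
          pow_nonneg (wl1_nonneg a hr0 _) _) fun h _ => Finset.prod_le_prod (fun i _ =>
          pow_nonneg (wl1_nonneg a hr0 _) _) fun i _ => pow_le_pow_left₀ (wl1_nonneg a hr0 _) ?_ _
        exact (wl1_genForm_le a hb hq hw h i).trans
          (mul_le_mul_of_nonneg_right hE (exp_pos _).le)
      refine h5.trans ?_
      simp_rw [mul_pow, Finset.prod_mul_distrib, Finset.prod_pow_eq_pow_sum, ← exp_nat_mul,
        ← exp_sum]
      have h6 : ∑ h, ∑ i, (e' h).1 i = ∑ h, d h :=
        Finset.sum_congr rfl fun h _ => (e' h).sum_eq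
      rw [h6]
      refine mul_le_mul_of_nonneg_left (exp_le_exp.mpr ?_) (by positivity)
      exact weighted_sum_le c hb hD hσ hd hqD h1 h2 e' hbad
  refine (Finset.sum_le_sum fun e' _ => h4 e').trans ?_
  rw [Finset.sum_const, Finset.card_univ, nsmul_eq_mul, mul_pow (2 ^ ((n + 1) * 2) : ℝ), mul_assoc]
  exact mul_le_mul_of_nonneg_right (card_blocks_le hd)
    (mul_nonneg (by positivity) (exp_pos _).le)

end Subst

end SubA6

section SubA7

open Real Height

namespace PlaceSys

variable {K : Type} [Field K] [AdmissibleAbsValues K] (S : PlaceSys K) {n : ℕ}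

lemma exists_common_denominator (F : Finset K) : ∃ s ∈ S.R, s ≠ 0 ∧ ∀ x ∈ F, s * x ∈ S.R := by
  classical
  induction F using Finset.induction_on with
  | empty => exact ⟨1, S.R.one_mem, one_ne_zero, by simp⟩
  | insert y F _ ih =>
    obtain ⟨s, hs, hs0, h⟩ := ih
    obtain ⟨t, ht, ht0, hty⟩ := S.exists_mul_mem y
    refine ⟨s * t, S.R.mul_mem hs ht, mul_ne_zero hs0 ht0, fun x hx => ?_⟩
    rcases Finset.mem_insert.mp hx with rfl | hx
    · rw [mul_assoc]
      exact S.R.mul_mem hs hty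
    · rw [mul_comm s, mul_assoc]
      exact S.R.mul_mem ht (h x hx)

lemma _root_.coeff_blockEval_mem {m : ℕ} (O : Subring K) {d : Fin m → ℕ}
    {x : (∀ h, Simplex (n + 1) (d h)) → K} (hx : ∀ e, x e ∈ O)
    {w : Fin m → Fin n → Fin (n + 1) → K} (hw : ∀ h k i, w h k i ∈ O)
    (α : Fin m → Fin (n + 1)) (A : Fin m × Fin n ⊕ Fin m →₀ ℕ) :
    MvPolynomial.coeff A (blockEval x (genPt w α)) ∈ O := by
  have hC : ∀ a ∈ O, MvPolynomial.C (σ := Fin m × Fin n ⊕ Fin m) a ∈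
      (MvPolynomial.map (σ := Fin m × Fin n ⊕ Fin m) O.subtype).range :=
    fun a ha => ⟨MvPolynomial.C ⟨a, ha⟩, by simp⟩
  have hX : ∀ j, (MvPolynomial.X j : MvPolynomial (Fin m × Fin n ⊕ Fin m) K) ∈
      (MvPolynomial.map (σ := Fin m × Fin n ⊕ Fin m) O.subtype).range :=
    fun j => ⟨MvPolynomial.X j, by simp⟩
  have : blockEval x (genPt w α) ∈
      (MvPolynomial.map (σ := Fin m × Fin n ⊕ Fin m) O.subtype).range := by
    refine sum_mem fun e _ => ?_
    rw [MvPolynomial.smul_eq_C_mul]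
    refine mul_mem (hC _ (hx e)) (prod_mem fun h _ => prod_mem fun i _ => pow_mem ?_ _)
    refine add_mem (sum_mem fun k _ => mul_mem (hC _ (hw h k i)) (hX _)) (mul_mem (hC _ ?_) (hX _))
    split_ifs
    exacts [O.one_mem, O.zero_mem]
  obtain ⟨P, hP⟩ := this
  rw [← hP, MvPolynomial.coeff_map]
  exact Subtype.coe_prop _

/-- The arithmetic of the exponents in the vanishing argument. -/
lemma not_exponent_le {m : ℕ} (hm : 0 < m) {δ b V N ε σ D Q₀ l : ℝ} {q κ : Fin m → ℝ}
    {d t : Fin m → ℝ}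
    (hδ : 0 < δ) (hb : 0 ≤ b) (hV : 0 < V) (hD : 0 < D) (hσ1 : σ ≤ 1)
    (hσ : 8 * V * N * b * σ ≤ δ) (hε : 8 * (δ + b * V) * ε ≤ δ) (hQ : 8 * V * l ≤ δ * Q₀)
    (hQ0 : 0 < Q₀) (hq : ∀ h, Q₀ ≤ q h) (hqD : ∀ h, q h ≤ σ * D)
    (h1 : ∀ h, D ≤ q h * d h) (h2 : ∀ h, q h * d h ≤ D + q h) (hκ : ∀ h, 0 ≤ κ h)
    (ht : ∀ h, t h + κ h = d h) (hκε : ∑ h, κ h / d h < ε * m) :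
    V * ∑ h, d h * l + 2 * N * b * m * σ * D * V <
      ∑ h, (δ * q h * t h - b * V * q h * κ h) := by
  have hq0 : ∀ h, 0 < q h := fun h => hQ0.trans_le (hq h)
  have hd0 : ∀ h, 0 < d h := fun h => by
    have := h1 h
    by_contra hneg
    push Not at hneg
    nlinarith [hq0 h]
  have h3 : ∀ h, q h * d h ≤ 2 * D := fun h => by nlinarith [h2 h, hqD h]
  have hbV : 0 ≤ b * V := by positivity
  have h4 : ∀ h, δ * D - 2 * D * (δ + b * V) * (κ h / d h) ≤
      δ * q h * t h - b * V * q h * κ h := by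
    intro h
    have h5 : t h = d h - κ h := by linarith [ht h]
    have h6 : q h * κ h ≤ 2 * D * (κ h / d h) := by
      have : q h * κ h = (q h * d h) * (κ h / d h) := by
        have := (hd0 h).ne'
        field_simp
      rw [this]
      exact mul_le_mul_of_nonneg_right (h3 h) (div_nonneg (hκ h) (hd0 h).le)
    rw [h5]
    have h7 := mul_le_mul_of_nonneg_left h6 (add_nonneg hδ.le hbV)
    have h8 := mul_le_mul_of_nonneg_left (h1 h) hδ.le
    linarith
  have h5 : m * (δ * D) - 2 * D * (δ + b * V) * ∑ h, κ h / d h ≤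
      ∑ h, (δ * q h * t h - b * V * q h * κ h) := by
    refine le_of_eq_of_le ?_ (Finset.sum_le_sum fun h (_ : h ∈ Finset.univ) => h4 h)
    rw [Finset.sum_sub_distrib, Finset.mul_sum]
    simp
  have h6 : 2 * D * (δ + b * V) * ∑ h, κ h / d h ≤ m * D * δ / 4 := by
    have h7 := mul_le_mul_of_nonneg_left hκε.le (show 0 ≤ 2 * D * (δ + b * V) by positivity)
    have h8 := mul_le_mul_of_nonneg_left hε (show 0 ≤ m * D / 4 by positivity)
    linarith
  have h7 : ∀ h, V * (d h * l) ≤ D * δ / 4 := by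
    intro h
    have h8 : d h * Q₀ ≤ 2 * D := by
      have := mul_le_mul_of_nonneg_right (hq h) (hd0 h).le
      linarith [h3 h]
    have h9 := mul_le_mul_of_nonneg_left hQ (hd0 h).le
    have h10 := mul_le_mul_of_nonneg_left h8 hδ.le
    linarith
  have h8 : V * ∑ h, d h * l ≤ m * (D * δ / 4) := by
    rw [Finset.mul_sum]
    refine (Finset.sum_le_sum fun h _ => h7 h).trans ?_
    simp
  have h9 : 2 * N * b * m * σ * D * V ≤ m * (D * δ / 4) := by
    have := mul_le_mul_of_nonneg_left hσ (show 0 ≤ m * D / 4 by positivity)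
    linarith
  have h10 : 0 < m * D * δ := by positivity
  linarith

/-- The auxiliary polynomial vanishes along the spans of approximate solutions. -/
theorem exists_vanishing {L : S.V → Matrix (Fin (n + 1)) (Fin (n + 1)) K}
    (hL : ∀ v, IsUnit (L v).det) (c : S.V → Fin (n + 1) → ℝ)
    (hc : ∑ v, ∑ i, c v i = 0) {δ : ℝ} (hδ : 0 < δ) :
    ∃ m : ℕ, 0 < m ∧ ∃ ε : ℝ, 0 < ε ∧ ∃ σ : ℝ, 0 < σ ∧ ∃ C : ℝ, 1 ≤ C ∧ ∃ Q₀ : ℝ, 0 < Q₀ ∧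
      ∀ q : Fin m → ℝ, (∀ h, Q₀ ≤ q h) → ∀ D : ℝ, (∀ h, q h ≤ σ * D) →
      ∀ d : Fin m → ℕ, (∀ h, D ≤ q h * d h) → (∀ h, q h * d h ≤ D + q h) →
      ∃ x : (∀ h, Simplex (n + 1) (d h)) → K, x ≠ 0 ∧ (∀ e, x e ∈ S.R) ∧
        (∀ v e, S.abv v (x e) ≤ C ^ ∑ h, d h) ∧
        ∀ w : Fin m → Fin n → Fin (n + 1) → K, (∀ h k i, w h k i ∈ S.O) →
          (∀ h k, w h k ≠ 0) →
          (∀ h k, S.twH L (fun v i => q h * c v i) (w h k) ≤ exp (-δ * q h)) →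
          ∀ (α : Fin m → Fin (n + 1)) (A : Fin m × Fin n ⊕ Fin m →₀ ℕ),
            ∑ h, (A (Sum.inr h) : ℝ) / d h < ε →
            MvPolynomial.coeff A (blockEval x (genPt w α)) = 0 := by
  classical
  obtain ⟨s, hsR, hs0, hs⟩ := S.exists_common_denominator
    (Finset.univ.image fun p : S.V × Fin (n + 1) × Fin (n + 1) => (L p.1)⁻¹ p.2.1 p.2.2)
  set T : S.V → Matrix (Fin (n + 1)) (Fin (n + 1)) K := fun v => s • (L v)⁻¹ with hT
  have hTR : ∀ v α i, T v α i ∈ S.R := fun v α i => by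
    change s * (L v)⁻¹ α i ∈ S.R
    exact hs _ (Finset.mem_image.mpr ⟨(v, α, i), Finset.mem_univ _, rfl⟩)
  obtain ⟨C, hC1, haux⟩ := S.exists_auxiliary T hTR
  set b : ℝ := ∑ v, ∑ i, |c v i| with hb
  have hb0 : 0 ≤ b := Finset.sum_nonneg fun _ _ => Finset.sum_nonneg fun _ _ => abs_nonneg _
  have hcb : ∀ v i, |c v i| ≤ b := fun v i =>
    (Finset.single_le_sum (f := fun i => |c v i|) (fun _ _ => abs_nonneg _)
      (Finset.mem_univ i)).trans
      (Finset.single_le_sum (f := fun v => ∑ i, |c v i|)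
        (fun _ _ => Finset.sum_nonneg fun _ _ => abs_nonneg _) (Finset.mem_univ v))
  set V : ℝ := (Fintype.card S.V : ℝ) with hV
  have hVpos : 0 < V := Nat.cast_pos.mpr (Fintype.card_pos_iff.mpr ⟨S.v₀⟩)
  set N : ℝ := ((n + 1 : ℕ) : ℝ) with hN
  set B : ℝ := ∑ v, ∑ α, ∑ i, S.abv v (T v α i) with hB
  have hTB : ∀ v α, ∑ i, S.abv v (T v α i) ≤ B := by
    intro v α
    have h1 : ∑ i, S.abv v (T v α i) ≤ ∑ α, ∑ i, S.abv v (T v α i) :=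
      Finset.single_le_sum (f := fun α => ∑ i, S.abv v (T v α i))
        (fun α _ => Finset.sum_nonneg fun i _ => (S.abv v).nonneg _) (Finset.mem_univ α)
    exact h1.trans (Finset.single_le_sum (f := fun v => ∑ α, ∑ i, S.abv v (T v α i))
        (fun v _ => Finset.sum_nonneg fun α _ => Finset.sum_nonneg fun i _ => (S.abv v).nonneg _)
        (Finset.mem_univ v))
  have hB0 : 0 ≤ B := Finset.sum_nonneg fun v _ => Finset.sum_nonneg fun α _ =>
    Finset.sum_nonneg fun i _ => (S.abv v).nonneg _
  have hE0 : ∀ v, 0 ≤ S.abv v s⁻¹ * (n + ∑ i, ∑ j, S.abv v (L v i j)) := fun v =>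
    mul_nonneg ((S.abv v).nonneg _) (add_nonneg (Nat.cast_nonneg _)
    (Finset.sum_nonneg fun i _ => Finset.sum_nonneg fun j _ => (S.abv v).nonneg _))
  set E : ℝ := ∑ v, S.abv v s⁻¹ * (n + ∑ i, ∑ j, S.abv v (L v i j)) with hE
  have hEv : ∀ v, S.abv v s⁻¹ * (n + ∑ i, ∑ j, S.abv v (L v i j)) ≤ E := fun v =>
    Finset.single_le_sum (f := fun v => S.abv v s⁻¹ * (n + ∑ i, ∑ j, S.abv v (L v i j)))
      (fun v _ => hE0 v) (Finset.mem_univ v)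
  set F : ℝ := 2 ^ ((n + 1) * 2) * (B * C) with hF
  have hF0 : 0 ≤ F := by positivity
  set C₁ : ℝ := max 1 (2 ^ ((n + 1) * 2) * (F * E)) with hC₁
  have hC₁1 : 1 ≤ C₁ := le_max_left _ _
  set σ : ℝ := min 1 (δ / (8 * V * N * b + 1)) with hσ
  have hσ0 : 0 < σ := lt_min one_pos (by positivity)
  have hσ1 : σ ≤ 1 := min_le_left _ _
  have hσ2 : 8 * V * N * b * σ ≤ δ := by
    have h1 : σ ≤ δ / (8 * V * N * b + 1) := min_le_right _ _
    rw [le_div_iff₀ (by positivity)] at h1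
    linarith
  obtain ⟨m, hm⟩ := exists_nat_ge (2 * V * N / σ ^ 2)
  have hm2 : 2 * V * N ≤ m * σ ^ 2 := (div_le_iff₀ (by positivity)).mp hm
  have hm0 : 0 < m := by
    rcases Nat.eq_zero_or_pos m with rfl | h
    · have : 0 < 2 * V * N := by positivity
      simp at hm2
      linarith
    · exact h
  set ε : ℝ := δ / (8 * (δ + b * V)) with hε
  have hε2 : 8 * (δ + b * V) * ε ≤ δ := by
    rw [hε, mul_div_cancel₀]
    positivity
  refine ⟨m, hm0, ε * m, by positivity, σ, hσ0, C, hC1, 8 * V * log C₁ / δ + 1, ?_,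
    fun q hq D hqD d h1 h2 => ?_⟩
  · have := log_nonneg hC₁1
    positivity
  have hQ0 : 0 < 8 * V * log C₁ / δ + 1 := by
    have := log_nonneg hC₁1
    positivity
  have hq0 : ∀ h, 0 < q h := fun h => hQ0.trans_le (hq h)
  have hD : 0 < D := by
    have := (hq0 ⟨0, hm0⟩).trans_le (hqD ⟨0, hm0⟩)
    exact pos_of_mul_pos_right this hσ0.le
  have hd : ∀ h, 0 < d h := fun h => by
    rcases Nat.eq_zero_or_pos (d h) with h0 | h0
    · have := h1 h
      rw [h0] at this
      simp at this
      linarith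
    · exact h0
  obtain ⟨x, hx0, hxR, hxC, hxbad⟩ := haux m σ hσ0 hm2 d hd
  refine ⟨x, hx0, hxR, hxC, fun w hwO hw0 hw α A hA => ?_⟩
  by_contra hne
  have hwpos : ∀ v h k, 0 < twNorm (S.abv v) (L v) (fun i => q h * c v i) (w h k) :=
    fun v h k => twNorm_pos _ (hL v) _ (hw0 h k)
  set co := MvPolynomial.coeff A (blockEval x (genPt w α)) with hco
  have hcoO : co ∈ S.O := by
    exact coeff_blockEval_mem S.O (fun e => S.R_le (hxR e)) hwO α A
  set ρ : S.V → ℝ := fun v =>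
    ∏ h, ((∏ k, ((twNorm (S.abv v) (L v) (fun i => q h * c v i) (w h k))⁻¹) ^ A (Sum.inl (h, k))) *
        exp (-(b * q h)) ^ A (Sum.inr h)) with hρ
  have hloc : ∀ v, S.abv v co * ρ v ≤ C₁ ^ (∑ h, d h) *
      exp (D * m / N * ∑ i, c v i + 2 * N * b * m * σ * D) := by
    intro v
    refine (abv_coeff_genPt_le (S.abv v) (hL v) hs0 (hcb v) (fun h => (hq0 h).le) (hwpos v) hd
      hD.le hσ0.le hqD h1 h2 (fun e' i hi => hxbad v e' i hi) hF0
      (fun e' => abv_sum_symMat_le hd (S.abv v) (hTB v) hB0 (by linarith) (hxC v) e')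
      (hEv v) A).trans ?_
    exact mul_le_mul_of_nonneg_right (pow_le_pow_left₀ (by positivity) (le_max_right _ _) _)
      (exp_pos _).le
  have hρ0 : ∀ v, 0 ≤ ρ v := fun v => Finset.prod_nonneg fun h _ =>
    mul_nonneg (Finset.prod_nonneg fun k _ => pow_nonneg (inv_nonneg.mpr (hwpos v h k).le) _)
      (pow_nonneg (exp_pos _).le _)
  have h3 := Finset.prod_le_prod (s := Finset.univ)
    (fun v _ => mul_nonneg ((S.abv v).nonneg co) (hρ0 v)) fun v _ => hloc v
  rw [Finset.prod_mul_distrib, Finset.prod_mul_distrib, ← exp_sum, Finset.sum_add_distrib,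
    ← Finset.mul_sum, hc, mul_zero, zero_add, Finset.prod_const, Finset.card_univ,
    Finset.sum_const, Finset.card_univ, nsmul_eq_mul, ← hV] at h3
  have h4 : ∏ v, ρ v ≤ (C₁ ^ ∑ h, d h) ^ Fintype.card S.V *
      exp (V * (2 * N * b * m * σ * D)) :=
    (le_mul_of_one_le_left (Finset.prod_nonneg fun v _ => hρ0 v)
      (S.one_le_prod co hcoO hne)).trans h3
  have h5 : ∏ h, exp (δ * q h * (∑ k, (A (Sum.inl (h, k)) : ℝ)) -
      b * V * q h * A (Sum.inr h)) ≤ ∏ v, ρ v := by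
    rw [hρ, Finset.prod_comm]
    refine Finset.prod_le_prod (fun h _ => (exp_pos _).le) fun h _ => ?_
    rw [Finset.prod_mul_distrib, Finset.prod_comm, Finset.prod_const, Finset.card_univ,
      sub_eq_add_neg, exp_add]
    refine mul_le_mul ?_ (le_of_eq ?_) (exp_pos _).le (Finset.prod_nonneg fun k _ =>
      Finset.prod_nonneg fun v _ => pow_nonneg (inv_nonneg.mpr (hwpos v h k).le) _)
    · rw [Finset.mul_sum, exp_sum]
      refine Finset.prod_le_prod (fun h _ => (exp_pos _).le) fun k _ => ?_
      rw [Finset.prod_pow, Finset.prod_inv_distrib, mul_comm, exp_nat_mul]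
      refine pow_le_pow_left₀ (exp_pos _).le ?_ _
      rw [le_inv_comm₀ (exp_pos _) (Finset.prod_pos fun v _ => hwpos v h k), ← exp_neg]
      refine (hw h k).trans (le_of_eq ?_)
      rw [neg_mul]
    · rw [← exp_nat_mul, ← exp_nat_mul]
      congr 1
      rw [hV]
      ring
  have h6 := h5.trans h4
  rw [← exp_sum, ← exp_log (zero_lt_one.trans_le hC₁1), ← exp_nat_mul, ← exp_nat_mul, ← exp_add,
    exp_le_exp] at h6
  have h7 := not_exponent_le hm0 (κ := fun h => (A (Sum.inr h) : ℝ)) (d := fun h => (d h : ℝ))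
    (t := fun h => ∑ k, (A (Sum.inl (h, k)) : ℝ)) (N := N) (l := log C₁) hδ hb0 hVpos hD hσ1
    hσ2 hε2 (le_of_eq_of_le (b := δ * (8 * V * log C₁ / δ)) (by field_simp)
      (mul_le_mul_of_nonneg_left (by linarith) hδ.le)) hQ0 hq hqD h1 h2
    (fun h => Nat.cast_nonneg _)
    (fun h => by exact_mod_cast weight_eq_of_coeff_ne_zero hne h) hA
  rw [← Finset.sum_mul] at h7
  push_cast at h6
  rw [← hV] at h6
  linarith

end PlaceSys

end SubA7

section SubA8

open MvPolynomial

section Elimination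

variable {K : Type*} [Field K] {m n : ℕ}

lemma le_of_mem_support_coeff {I J : Type*} {P : MvPolynomial (I ⊕ Fin m) K} {d : Fin m → ℕ} {ε : ℝ}
    (hP : ∀ A : I ⊕ Fin m →₀ ℕ, ∑ h, (A (Sum.inr h) : ℝ) / d h < ε → coeff A P = 0)
    (g : I → MvPolynomial J K) (γ : J →₀ ℕ) :
    ∀ κ ∈ (coeff γ (aeval (Sum.elim (fun i => map (C : K →+* MvPolynomial (Fin m) K) (g i))
      (fun h => C (X h))) P)).support, ε ≤ ∑ h, (κ h : ℝ) / d h := by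
  classical
  intro κ hκ
  by_contra hlt
  push Not at hlt
  refine mem_support_iff.mp hκ ?_
  rw [P.as_sum, map_sum, coeff_sum, coeff_sum]
  refine Finset.sum_eq_zero fun A hA => ?_
  rw [aeval_monomial, Finsupp.prod]
  have h2 : (∏ i ∈ A.support, Sum.elim (fun i => map (C : K →+* MvPolynomial (Fin m) K) (g i))
      (fun h => C (X h)) i ^ A i) =
      C (monomial (A.comapDomain Sum.inr Sum.inr_injective.injOn) 1) *
        map C (∏ i ∈ A.support.toLeft, g i ^ A (Sum.inl i)) := by
    refine (Finset.prod_congr Finset.toLeft_disjSum_toRight.symm fun _ _ => rfl).trans ?_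
    rw [Finset.prod_disjSum, mul_comm]
    congr 1
    · rw [monomial_eq, C_1, one_mul, Finsupp.prod, map_prod]
      refine Finset.prod_congr ?_ fun h _ => by simp
      ext h
      simp
    · rw [map_prod]
      exact Finset.prod_congr rfl fun h _ => by simp
  rw [h2, MvPolynomial.algebraMap_apply, ← mul_assoc, ← C_mul, coeff_C_mul, coeff_map, MvPolynomial.algebraMap_eq,
    mul_comm, ← mul_assoc, ← C_mul, coeff_C_mul, coeff_monomial]
  by_cases hA' : A.comapDomain Sum.inr Sum.inr_injective.injOn = κ
  · rw [← hA'] at hlt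
    rw [hP A hlt, mul_zero, zero_mul]
  · rw [if_neg hA', mul_zero]

lemma exists_minimal_form {d : Fin m → ℕ} {x : (∀ h, Simplex (n + 1) (d h)) → K} (hx : x ≠ 0)
    {α β : Fin m → Fin (n + 1)} (ξ : Fin m → K)
    (y : Fin m → Fin (n + 1) → MvPolynomial (Fin m × Fin (n + 1)) (MvPolynomial (Fin m) K))
    (hβ : ∀ h, y h (β h) = 1) (hα : ∀ h, constantCoeff (y h (α h)) = X h + C (ξ h))
    (hi : ∀ h i, i ≠ α h → i ≠ β h → y h i = X (h, i)) :
    ∃ γ, ∃ F : MvPolynomial (Fin m) K, F ≠ 0 ∧ (∀ h, degreeOf h F ≤ d h) ∧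
      (∀ a ∈ F.support, ∃ e, coeff a F = x e) ∧ coeff γ (blockEval x y) = shiftAt ξ F := by
  classical
  let g : (∀ h, Simplex (n + 1) (d h)) → Fin m × Fin (n + 1) →₀ ℕ := fun e =>
    Finsupp.equivFunOnFinite.symm fun p =>
      if p.2 = α p.1 ∨ p.2 = β p.1 then 0 else (e p.1).1 p.2
  let a : (∀ h, Simplex (n + 1) (d h)) → Fin m →₀ ℕ := fun e =>
    Finsupp.equivFunOnFinite.symm fun h => (e h).1 (α h)
  have hg : ∀ e p, g e p = if p.2 = α p.1 ∨ p.2 = β p.1 then 0 else (e p.1).1 p.2 :=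
    fun e p => rfl
  have ha : ∀ e h, a e h = (e h).1 (α h) := fun e h => rfl
  have hinj : ∀ e e', g e = g e' → a e = a e' → e = e' := by
    intro e e' h1 h2
    funext h
    have h3 : ∀ i, i ≠ β h → (e h).1 i = (e' h).1 i := by
      intro i hib
      by_cases hia : i = α h
      · rw [hia, ← ha, ← ha, h2]
      · have := DFunLike.congr_fun h1 (h, i)
        simpa [hg, hia, hib] using this
    ext i
    by_cases hib : i = β h
    · have h4 := (e h).sum_eq.trans (e' h).sum_eq.symm
      rw [← Finset.add_sum_erase _ _ (Finset.mem_univ (β h)),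
        ← Finset.add_sum_erase _ (e' h).1 (Finset.mem_univ (β h)),
        Finset.sum_congr rfl fun i hi => h3 i (Finset.ne_of_mem_erase hi)] at h4
      rw [hib]
      exact Nat.add_right_cancel h4
    · exact h3 i hib
  have key : ∀ e : (∀ h, Simplex (n + 1) (d h)), ∏ h, ∏ i, y h i ^ (e h).1 i =
      monomial (g e) 1 * ∏ h, y h (α h) ^ a e h := by
    intro e
    rw [monomial_eq, C_1, one_mul, Finsupp.prod_fintype _ _ (fun _ => pow_zero _),
      Fintype.prod_prod_type, ← Finset.prod_mul_distrib]
    refine Finset.prod_congr rfl fun h _ => ?_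
    have h1 : y h (α h) ^ a e h = ∏ i, if i = α h then y h (α h) ^ a e h else 1 := by simp
    rw [h1, ← Finset.prod_mul_distrib]
    refine Finset.prod_congr rfl fun i _ => ?_
    by_cases hia : i = α h
    · simp [hg, hia, ha]
    · by_cases hib : i = β h
      · have := hia
        rw [hib] at this
        simp [hg, hib, hβ, this]
      · simp [hg, hia, hib, hi h i hia hib]
  obtain ⟨e₁, he₁⟩ := Function.ne_iff.mp hx
  obtain ⟨e₀, he₀, hmin⟩ := Finset.exists_minimalFor g (Finset.univ.filter fun e => x e ≠ 0)
    ⟨e₁, by simpa using he₁⟩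
  rw [Finset.mem_filter] at he₀
  set F : MvPolynomial (Fin m) K :=
    ∑ e ∈ Finset.univ.filter (fun e => x e ≠ 0 ∧ g e = g e₀), monomial (a e) (x e) with hF
  have hco : ∀ e, x e ≠ 0 → g e = g e₀ → coeff (a e) F = x e := by
    intro e he hge
    rw [hF, coeff_sum, Finset.sum_eq_single e]
    · rw [coeff_monomial, if_pos rfl]
    · intro e' he' hne
      rw [coeff_monomial, if_neg]
      intro haa
      exact hne (hinj _ _ ((Finset.mem_filter.mp he').2.2.trans hge.symm) haa)
    · intro hn
      exact absurd (Finset.mem_filter.mpr ⟨Finset.mem_univ _, he, hge⟩) hn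
  have hsupp : ∀ b ∈ F.support, ∃ e, x e ≠ 0 ∧ g e = g e₀ ∧ b = a e := by
    intro b hb
    rw [mem_support_iff, hF, coeff_sum] at hb
    obtain ⟨e, he, hne⟩ := Finset.exists_ne_zero_of_sum_ne_zero hb
    rw [coeff_monomial] at hne
    have := (Finset.mem_filter.mp he).2
    exact ⟨e, this.1, this.2, (of_not_not fun h => hne (if_neg fun h' => h h'.symm))⟩
  refine ⟨g e₀, F, ?_, ?_, ?_, ?_⟩
  · intro h0
    have := hco e₀ he₀.2 rfl
    rw [h0, coeff_zero] at this
    exact he₀.2 this.symm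
  · intro h
    rw [degreeOf_le_iff]
    intro b hb
    obtain ⟨e, -, -, rfl⟩ := hsupp b hb
    exact (e h).le _
  · intro b hb
    obtain ⟨e, h1, h2, rfl⟩ := hsupp b hb
    exact ⟨e, hco e h1 h2⟩
  · rw [blockEval, coeff_sum, hF, map_sum, Finset.sum_filter]
    refine Finset.sum_congr rfl fun e _ => ?_
    rw [key, coeff_smul, coeff_monomial_mul', one_mul]
    by_cases hxe : x e = 0
    · simp [hxe]
    by_cases hge : g e = g e₀
    · rw [if_pos hge.le, if_pos ⟨hxe, hge⟩, hge, tsub_self, ← constantCoeff_eq, map_prod, shiftAt,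
        aeval_monomial, Finsupp.prod_fintype _ _ (fun _ => pow_zero _), Algebra.smul_def]
      congr 1
      exact Finset.prod_congr rfl fun h _ => by rw [map_pow, hα]
    · rw [if_neg (c := g e ≤ g e₀), if_neg fun h => hge h.2, smul_zero]
      intro hle
      exact hge (le_antisymm hle (hmin (by simpa using hxe) hle))

/-- Parametrising the hyperplanes. -/
lemma exists_parametrization {w : Fin m → Fin n → Fin (n + 1) → K}
    (hw : ∀ h, LinearIndependent K (w h)) {α β : Fin m → Fin (n + 1)} (hαβ : ∀ h, α h ≠ β h)
    (hα : ∀ h, crossVec (w h) (α h) ≠ 0) :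
    ∃ g : Fin m × Fin n → MvPolynomial (Fin m × Fin (n + 1)) K,
      ∃ y : Fin m → Fin (n + 1) → MvPolynomial (Fin m × Fin (n + 1)) (MvPolynomial (Fin m) K),
      (∀ h, y h (β h) = 1) ∧ (∀ h, constantCoeff (y h (α h)) =
        X h + C (-(crossVec (w h) (β h) / crossVec (w h) (α h)))) ∧
      (∀ h i, i ≠ α h → i ≠ β h → y h i = X (h, i)) ∧
      ∀ h i, aeval (Sum.elim (fun i => map (C : K →+* MvPolynomial (Fin m) K) (g i))
        (fun h => C (X h))) (genPt w α h i) = y h i := by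
  classical
  set ν : Fin m → Fin (n + 1) → K := fun h i => crossVec (w h) i / crossVec (w h) (α h) with hν
  have h1 : ∀ h i, ∃ f : Fin n → K, ∑ k, f k • w h k =
      Pi.single i 1 - ν h i • Pi.single (α h) (1 : K) := by
    intro h i
    rw [← Submodule.mem_span_range_iff_exists_fun, ← ker_crossLin (hw h), LinearMap.mem_ker,
      map_sub, map_smul]
    change crossVec (w h) i - ν h i * crossVec (w h) (α h) = 0
    rw [hν, div_mul_cancel₀ _ (hα h), sub_self]
  choose f hf using h1
  let Y : Fin m → Fin (n + 1) → MvPolynomial (Fin m × Fin (n + 1)) K := fun h i =>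
    if i = α h then 0 else if i = β h then 1 else X (h, i)
  let g : Fin m × Fin n → MvPolynomial (Fin m × Fin (n + 1)) K := fun p =>
    ∑ i, C (f p.1 i p.2) * Y p.1 i
  have hgw : ∀ h j, ∑ k, C (w h k j) * g (h, k) = Y h j - (if j = α h then 1 else 0) *
      ∑ i, C (ν h i) * Y h i := by
    intro h j
    simp only [g, Finset.mul_sum]
    rw [Finset.sum_comm]
    have h2 : ∀ i, ∑ k, C (w h k j) * (C (f h i k) * Y h i) =
        (if j = i then 1 else 0) * Y h i - (if j = α h then 1 else 0) * (C (ν h i) * Y h i) := by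
      intro i
      have h3 := congrFun (hf h i) j
      simp only [Finset.sum_apply, Pi.smul_apply, smul_eq_mul, Pi.sub_apply,
        Pi.single_apply] at h3
      have h4 : ∑ k, C (w h k j) * (C (f h i k) * Y h i) =
          C (∑ k, f h i k * w h k j) * Y h i := by
        rw [map_sum, Finset.sum_mul]
        refine Finset.sum_congr rfl fun k _ => ?_
        rw [C_mul]
        ring
      rw [h4, h3, C_sub, C_mul, sub_mul]
      split_ifs <;> simp
    rw [Finset.sum_congr rfl fun i _ => h2 i, Finset.sum_sub_distrib]
    simp
  refine ⟨g, fun h i => aeval (Sum.elim (fun i => map (C : K →+* MvPolynomial (Fin m) K) (g i))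
        (fun h => C (X h))) (genPt w α h i), ?_, ?_, ?_, fun _ _ => rfl⟩
  all_goals
    have h5 : ∀ h i, aeval (Sum.elim (fun i => map (C : K →+* MvPolynomial (Fin m) K) (g i))
        (fun h => C (X h))) (genPt w α h i) = map (C : K →+* MvPolynomial (Fin m) K)
          (Y h i - (if i = α h then 1 else 0) * ∑ j, C (ν h j) * Y h j) +
          (if i = α h then 1 else 0) * C (X h) := by
      intro h i
      rw [← hgw, genPt]
      simp only [map_add, map_sum, map_mul, aeval_X, Sum.elim_inl, Sum.elim_inr, map_C,
        MvPolynomial.aeval_C, MvPolynomial.algebraMap_apply, MvPolynomial.algebraMap_eq]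
      congr 1
      split_ifs <;> simp
  · intro h
    beta_reduce
    rw [h5, if_neg (hαβ h).symm]
    simp [Y, (hαβ h).symm]
  · intro h
    beta_reduce
    rw [h5]
    have h6 : constantCoeff (∑ j, C (ν h j) * Y h j) = ν h (β h) := by
      rw [map_sum, Finset.sum_eq_single (β h)]
      · simp [Y, (hαβ h).symm]
      · intro i _ hi
        by_cases hia : i = α h <;> simp [Y, hi, hia]
      · simp
    have h7 : ∀ p : MvPolynomial (Fin m × Fin (n + 1)) K,
        constantCoeff (map (C : K →+* MvPolynomial (Fin m) K) p) = C (constantCoeff p) := by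
      intro p
      rw [constantCoeff_eq, coeff_map, constantCoeff_eq]
    simp only [if_true, one_mul]
    rw [map_add, h7, map_sub, h6]
    simp [Y, hν, add_comm]
  · intro h i hia hib
    beta_reduce
    rw [h5, if_neg hia]
    simp [Y, hia, hib]

end Elimination

end SubA8

section SubA9

open Real Height

section Heights

variable {K : Type*} [Field K] [AdmissibleAbsValues K] {n : ℕ}

lemma mulHeight_le_prod_mulHeight₁ {ι : Type*} [Fintype ι] {x : ι → K} {α : ι} (hα : x α ≠ 0) :
    mulHeight x ≤ ∏ i, mulHeight₁ (x i / x α) := by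
  classical
  let y : ι → Fin 2 → K := fun i => ![x i / x α, 1]
  have hy : ∀ i, y i ≠ 0 := fun i h => one_ne_zero (congrFun h 1)
  have h1 := mulHeight_fun_prod_eq hy
  have h2 : mulHeight x = mulHeight fun i => x i / x α := by
    rw [← mulHeight_smul_eq_mulHeight x (inv_ne_zero hα)]
    congr 1
    funext i
    simp [div_eq_inv_mul]
  have h3 : (fun i => x i / x α) =
      (fun I : ι → Fin 2 => ∏ a, y a (I a)) ∘ fun i a => if a = i then 0 else 1 := by
    funext i
    rw [Function.comp_apply, Finset.prod_eq_single i]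
    · simp [y]
    · intro a _ ha
      simp [y, ha]
    · simp
  rw [h2, h3]
  refine (mulHeight_comp_le _ _).trans (h1.le.trans (le_of_eq ?_))
  refine Finset.prod_congr rfl fun i _ => ?_
  rw [← mulHeight₁_div_eq_mulHeight, div_one]

lemma exists_large_ratio {x : Fin (n + 1) → K} (hx : x ≠ 0) {t : ℝ} (ht : 0 < t)
    (h : exp t < mulHeight x) : ∃ α β, α ≠ β ∧ x α ≠ 0 ∧
      t / (n + 1) ≤ logHeight₁ (-(x β / x α)) := by
  obtain ⟨α, hα⟩ := Function.ne_iff.mp hx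
  have h1 : t < ∑ i, logHeight₁ (x i / x α) := by
    have h2 := h.trans_le (mulHeight_le_prod_mulHeight₁ hα)
    rw [← exp_lt_exp, exp_sum]
    refine h2.trans_le (le_of_eq (Finset.prod_congr rfl fun i _ => ?_))
    rw [logHeight₁, exp_log (mulHeight₁_pos _)]
  have h2 : ∃ β, t / (n + 1) < logHeight₁ (x β / x α) := by
    by_contra hcon
    push Not at hcon
    have h3 := Finset.sum_le_sum fun i (_ : i ∈ Finset.univ) => hcon i
    rw [Finset.sum_const, Finset.card_univ, Fintype.card_fin, nsmul_eq_mul] at h3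
    push_cast at h3
    rw [mul_div_cancel₀ _ (by positivity)] at h3
    linarith
  obtain ⟨β, hβ⟩ := h2
  refine ⟨α, β, ?_, hα, ?_⟩
  · rintro rfl
    rw [div_self hα, logHeight₁_one] at hβ
    have : 0 < t / (n + 1) := by positivity
    linarith
  · rw [logHeight₁_neg]
    exact hβ.le

end Heights

lemma exists_fast_subsequence {q : ℕ → ℝ} (hq : Filter.Tendsto q Filter.atTop Filter.atTop)
    (A Q : ℝ) (m : ℕ) : ∃ f : Fin m → ℕ, (∀ h, Q ≤ q (f h)) ∧
      ∀ i j, i < j → A * q (f j) ≤ q (f i) := by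
  induction m with
  | zero => exact ⟨Fin.elim0, fun h => h.elim0, fun i => i.elim0⟩
  | succ m ih =>
    obtain ⟨f, h1, h2⟩ := ih
    obtain ⟨j, hj⟩ := (Filter.tendsto_atTop.mp hq (max Q (∑ h, |A * q (f h)|))).exists
    refine ⟨Fin.cons j f, ?_, ?_⟩
    · intro h
      cases h using Fin.cases with
      | zero => exact (le_max_left _ _).trans hj
      | succ h => exact h1 h
    · intro i i' hii'
      cases i' using Fin.cases with
      | zero => exact absurd hii' (Fin.not_lt_zero _)
      | succ i' =>
        cases i using Fin.cases with
        | zero =>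
          rw [Fin.cons_zero, Fin.cons_succ]
          refine ((le_abs_self _).trans ?_).trans ((le_max_right _ _).trans hj)
          exact Finset.single_le_sum (f := fun h => |A * q (f h)|) (fun _ _ => abs_nonneg _)
            (Finset.mem_univ i')
        | succ i =>
          rw [Fin.cons_succ, Fin.cons_succ]
          exact h2 i i' (Fin.succ_lt_succ_iff.mp hii')

namespace PlaceSys

variable {K : Type} [Field K] [CharZero K] [AdmissibleAbsValues K] (S : PlaceSys K) {n : ℕ}

lemma polH_le_of_coeffs {m : ℕ} {d : Fin m → ℕ} (hd : ∀ h, 0 < d h)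
    {x : (∀ h, Simplex (n + 1) (d h)) → K}
    (hx : x ≠ 0) (hxO : ∀ e, x e ∈ S.O) {C : ℝ} (hC : 1 ≤ C)
    (hxC : ∀ v e, S.abv v (x e) ≤ C ^ ∑ h, d h) {F : MvPolynomial (Fin m) K}
    (hF : ∀ a ∈ F.support, ∃ e, MvPolynomial.coeff a F = x e) :
    Real.log (polH F) ≤ 2 * Fintype.card S.V * log (2 ^ ((n + 1) * 2) * C) * ∑ h, (d h : ℝ) := by
  choose! e he using hF
  have h1 : polH F ≤ mulHeight x := by
    have : (fun a : F.support => MvPolynomial.coeff a.1 F) = x ∘ fun a : F.support => e a.1 := by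
      funext a
      exact he a.1 a.2
    rw [polH, this]
    exact mulHeight_comp_le _ _
  have h2 := S.mulHeight_le _ x hxO hx
  have h3 : ∀ v, ∑ e, S.abv v (x e) ≤ (2 ^ ((n + 1) * 2) * C) ^ ∑ h, d h := by
    intro v
    refine (Finset.sum_le_sum fun e _ => hxC v e).trans ?_
    rw [Finset.sum_const, Finset.card_univ, nsmul_eq_mul, mul_pow]
    exact mul_le_mul_of_nonneg_right (card_blocks_le hd) (by positivity)
  have h4 : ∏ v, ∑ e, S.abv v (x e) ≤
      ((2 ^ ((n + 1) * 2) * C) ^ ∑ h, d h) ^ Fintype.card S.V := by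
    refine (Finset.prod_le_prod (fun v _ => Finset.sum_nonneg fun e _ => (S.abv v).nonneg _)
      fun v _ => h3 v).trans (le_of_eq ?_)
    rw [Finset.prod_const, Finset.card_univ]
  have h5 : polH F ≤ (((2 ^ ((n + 1) * 2) * C) ^ ∑ h, d h) ^ Fintype.card S.V) ^ 2 :=
    h1.trans (h2.trans (pow_le_pow_left₀ (Finset.prod_nonneg fun v _ =>
      Finset.sum_nonneg fun e _ => (S.abv v).nonneg _) h4 2))
  refine (Real.log_le_log (polH_pos F) h5).trans (le_of_eq ?_)
  rw [Real.log_pow, Real.log_pow, Real.log_pow]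
  push_cast
  ring

/-- Among hyperplanes spanned by approximate solutions, two coincide. -/
theorem exists_span_eq {L : S.V → Matrix (Fin (n + 1)) (Fin (n + 1)) K}
    (hL : ∀ v, IsUnit (L v).det) (c : S.V → Fin (n + 1) → ℝ)
    (hc : ∑ v, ∑ i, c v i = 0) {δ : ℝ} (hδ : 0 < δ) {q : ℕ → ℝ}
    (hq : Filter.Tendsto q Filter.atTop Filter.atTop) (w : ℕ → Fin n → Fin (n + 1) → K)
    (hwO : ∀ j k i, w j k i ∈ S.O) (hwli : ∀ j, LinearIndependent K (w j))
    (hw : ∀ j k, S.twH L (fun v i => q j * c v i) (w j k) ≤ exp (-δ * q j)) :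
    ∃ i j, i ≠ j ∧
      Submodule.span K (Set.range (w i)) = Submodule.span K (Set.range (w j)) := by
  classical
  by_contra hcon
  push Not at hcon
  obtain ⟨κ, hκ, q₀, hκq⟩ := S.exists_crossLin_eq_zero_of_mulHeight_le hL c hc hδ
  have hlarge : ∀ j, q₀ ≤ q j → exp (κ * q j) < mulHeight (crossVec (w j)) := by
    intro j hj
    by_contra hle
    push Not at hle
    obtain ⟨q₁, hq₁⟩ := hκq (q j) hj (w j) (hwO j) (hwli j) (hw j) hle
    obtain ⟨j', hj', hne⟩ := ((Filter.tendsto_atTop.mp hq q₁).and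
      (Filter.eventually_gt_atTop j)).exists
    refine hcon j' j hne.ne' (Submodule.eq_of_le_of_finrank_eq ?_ ?_)
    · rw [← ker_crossLin (hwli j), Submodule.span_le]
      rintro _ ⟨k, rfl⟩
      exact hq₁ (q j') hj' (w j' k) (hwO j' k) (hw j' k)
    · rw [finrank_span_eq_card (hwli j'), finrank_span_eq_card (hwli j)]
  obtain ⟨m, hm, ε, hε, σ, hσ, C, hC, Q₀, hQ₀, hvan⟩ := S.exists_vanishing hL c hc hδ
  obtain ⟨R, hR, hroth⟩ := not_idxGE_of_roth (K := K) m
  obtain ⟨ω, hω, hroth⟩ := hroth ε hε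
  set T : ℝ := 2 * Fintype.card S.V * log (2 ^ ((n + 1) * 2) * C) + R with hT
  set Q : ℝ := max (max Q₀ q₀) (2 * m * T * (n + 1) / (ω * κ)) with hQ
  obtain ⟨f, hfQ, hfr⟩ := exists_fast_subsequence hq (2 / ω) Q m
  have hfQ₀ : ∀ h, Q₀ ≤ q (f h) := fun h =>
    ((le_max_left _ _).trans (le_max_left _ _)).trans (hfQ h)
  have hfq₀ : ∀ h, q₀ ≤ q (f h) := fun h =>
    ((le_max_right _ _).trans (le_max_left _ _)).trans (hfQ h)
  have hfpos : ∀ h, 0 < q (f h) := fun h => hQ₀.trans_le (hfQ₀ h)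
  have hfT : ∀ h, 2 * m * T * (n + 1) ≤ q (f h) * (ω * κ) := fun h =>
    (div_le_iff₀ (by positivity)).mp ((le_max_right _ _).trans (hfQ h))
  set D : ℝ := ∑ h, q (f h) * (1 + σ⁻¹) with hD
  have hDh : ∀ h, q (f h) * (1 + σ⁻¹) ≤ D := fun h =>
    Finset.single_le_sum (f := fun h => q (f h) * (1 + σ⁻¹))
      (fun h _ => mul_nonneg (hfpos h).le (by positivity)) (Finset.mem_univ h)
  have hqD : ∀ h, q (f h) ≤ D := fun h => by
    have := mul_pos (hfpos h) (inv_pos.mpr hσ)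
    linarith [hDh h]
  have hqσ : ∀ h, q (f h) ≤ σ * D := fun h => by
    have h1 := mul_le_mul_of_nonneg_left (hDh h) hσ.le
    have h2 : σ * (q (f h) * (1 + σ⁻¹)) = σ * q (f h) + q (f h) := by
      field_simp
    have := mul_pos hσ (hfpos h)
    linarith
  have hDpos : 0 < D := (hfpos ⟨0, hm⟩).trans_le (hqD ⟨0, hm⟩)
  set d : Fin m → ℕ := fun h => ⌈D / q (f h)⌉₊ with hd
  have hd1 : ∀ h, D ≤ q (f h) * d h := fun h => by
    rw [mul_comm, ← div_le_iff₀ (hfpos h)]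
    exact Nat.le_ceil _
  have hd2 : ∀ h, q (f h) * d h ≤ D + q (f h) := fun h => by
    have h1 := (Nat.ceil_lt_add_one (div_nonneg hDpos.le (hfpos h).le)).le
    have h2 := mul_le_mul_of_nonneg_left h1 (hfpos h).le
    have h3 : q (f h) * (D / q (f h) + 1) = D + q (f h) := by
      have := (hfpos h).ne'
      field_simp
    exact h2.trans_eq h3
  clear_value d
  have hd0 : ∀ h, 0 < d h := fun h => by
    rcases Nat.eq_zero_or_pos (d h) with h0 | h0
    · have := hd1 h
      rw [h0] at this
      simp at this
      linarith
    · exact h0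
  obtain ⟨x, hx0, hxR, hxC, hxv⟩ := hvan (fun h => q (f h)) hfQ₀ D hqσ d hd1 hd2
  have hratio := fun h => exists_large_ratio (crossVec_ne_zero (hwli (f h)))
    (mul_pos hκ (hfpos h)) (hlarge _ (hfq₀ h))
  choose α β hαβ hα hht using hratio
  obtain ⟨g, y, hyβ, hyα, hyi, hgy⟩ := exists_parametrization (fun h => hwli (f h)) hαβ hα
  set ξ : Fin m → K := fun h =>
    -(crossVec (w (f h)) (β h) / crossVec (w (f h)) (α h)) with hξ
  obtain ⟨γ, F, hF0, hFd, hFx, hFs⟩ := exists_minimal_form hx0 ξ y hyβ hyα hyi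
  have hmap : MvPolynomial.aeval (Sum.elim (fun i => MvPolynomial.map
      (MvPolynomial.C : K →+* MvPolynomial (Fin m) K) (g i))
      (fun h => MvPolynomial.C (MvPolynomial.X h))) (blockEval x (genPt (fun h => w (f h)) α)) =
      blockEval x y := by
    simp only [blockEval, map_sum, map_smul, map_prod, map_pow, hgy]
  have hidx : IdxGE F d ξ ε := by
    intro a ha
    rw [← hFs, ← hmap] at ha
    refine le_of_mem_support_coeff (fun A hA => ?_) g γ a ha
    exact hxv (fun h => w (f h)) (fun h => hwO _) (fun h k => (hwli (f h)).ne_zero k)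
      (fun h k => hw (f h) k) α A hA
  have hdq : ∀ h, (d h : ℝ) * q (f h) ≤ 2 * D := fun h => by
    linarith [hd2 h, hqD h, mul_comm (d h : ℝ) (q (f h))]
  refine hroth d hd0 ?_ ξ (κ * D / (n + 1)) ?_ F hF0 hFd ?_ hidx
  · intro i j hij
    have h1 := hfr i j hij
    rw [div_mul_eq_mul_div, div_le_iff₀ hω] at h1
    have h2 := hdq i
    have h3 := hd1 j
    have h4 : (d i : ℝ) * (2 * q (f j)) ≤ 2 * D * ω :=
      (mul_le_mul_of_nonneg_left h1 (Nat.cast_nonneg _)).trans (by nlinarith)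
    have h5 : (d i : ℝ) * q (f j) ≤ ω * d j * q (f j) := by nlinarith
    exact le_of_mul_le_mul_right h5 (hfpos j)
  · intro h
    refine le_trans ?_ (mul_le_mul_of_nonneg_left (hht h) (Nat.cast_nonneg _))
    rw [← mul_div_assoc]
    refine div_le_div_of_nonneg_right ?_ (by positivity)
    have := mul_le_mul_of_nonneg_left (hd1 h) hκ.le
    linarith
  · have h1 := S.polH_le_of_coeffs hd0 hx0 (fun e => S.R_le (hxR e)) hC hxC hFx
    have h2 : Real.log (polH F) + R * ∑ h, (d h : ℝ) ≤ T * ∑ h, (d h : ℝ) := by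
      rw [hT, add_mul]
      linarith
    refine h2.trans ?_
    have h3 : ∀ h, T * d h ≤ ω * (κ * D / (n + 1)) / m := by
      intro h
      rw [le_div_iff₀ (by exact_mod_cast hm), ← mul_div_assoc, le_div_iff₀ (by positivity)]
      have h4 := mul_le_mul_of_nonneg_left (hfT h) (Nat.cast_nonneg (d h) : (0 : ℝ) ≤ d h)
      have h5 := mul_le_mul_of_nonneg_right (hdq h) (mul_pos hω hκ).le
      linarith
    rw [Finset.mul_sum]
    refine (Finset.sum_le_sum fun h _ => h3 h).trans (le_of_eq ?_)
    rw [Finset.sum_const, Finset.card_univ, Fintype.card_fin, nsmul_eq_mul,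
      mul_div_cancel₀ _ (by positivity)]

end PlaceSys

end SubA9

section SubB1
open Real Height Filter

namespace PlaceSys

variable {K : Type} [Field K] [AdmissibleAbsValues K] (S : PlaceSys K)
variable {ι : Type} [Fintype ι] [DecidableEq ι]

lemma twH_reindex {κ : Type} [Fintype κ] (e : ι ≃ κ) (L : S.V → Matrix ι ι K)
    (c : S.V → ι → ℝ) (x : ι → K) :
    S.twH (fun v => Matrix.reindex e e (L v)) (fun v i => c v (e.symm i)) (x ∘ e.symm) =
      S.twH L c x := by
  refine Finset.prod_congr rfl fun v _ => ?_
  unfold twNorm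
  rw [← e.symm.sum_comp]
  refine Finset.sum_congr rfl fun i _ => ?_
  beta_reduce
  rw [Matrix.reindex_apply, Matrix.submatrix_mulVec_equiv]
  have hx : (x ∘ e.symm) ∘ e.symm.symm = x := by
    funext i
    simp
  rw [hx]
  rfl

lemma twH_le_of_close (L : S.V → Matrix ι ι K) {c c' : S.V → ι → ℝ} {η : ℝ}
    (h : ∀ v i, c' v i ≤ c v i + η) (x : ι → K) :
    S.twH L c x ≤ exp (Fintype.card S.V * η) * S.twH L c' x := by
  have : exp (Fintype.card S.V * η) = ∏ _v : S.V, exp η := by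
    rw [Finset.prod_const, ← exp_nat_mul]; rfl
  rw [twH, twH, this, ← Finset.prod_mul_distrib]
  refine Finset.prod_le_prod (fun _ _ => twNorm_nonneg _ _ _ _) fun v _ => ?_
  unfold twNorm
  rw [Finset.mul_sum]
  refine Finset.sum_le_sum fun i _ => ?_
  rw [mul_left_comm, ← exp_add]
  refine mul_le_mul_of_nonneg_left (exp_le_exp.mpr ?_) ((S.abv v).nonneg _)
  have := h v i
  linarith

theorem exists_span_eq_of_card [CharZero K] {κ : Type} [Fintype κ]
    (hcard : Fintype.card ι = Fintype.card κ + 1) {L : S.V → Matrix ι ι K}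
    (hL : ∀ v, IsUnit (L v).det) (c : S.V → ι → ℝ)
    (hc : ∑ v, ∑ i, c v i = 0) {δ : ℝ} (hδ : 0 < δ) {q : ℕ → ℝ}
    (hq : Tendsto q atTop atTop) (w : ℕ → κ → ι → K)
    (hwO : ∀ j k i, w j k i ∈ S.O) (hwli : ∀ j, LinearIndependent K (w j))
    (hw : ∀ j k, S.twH L (fun v i => q j * c v i) (w j k) ≤ exp (-δ * q j)) :
    ∃ i j, i ≠ j ∧
      Submodule.span K (Set.range (w i)) = Submodule.span K (Set.range (w j)) := by
  classical
  let e : ι ≃ Fin (Fintype.card κ + 1) := Fintype.equivFinOfCardEq hcard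
  let f : κ ≃ Fin (Fintype.card κ) := Fintype.equivFin κ
  let T : (ι → K) ≃ₗ[K] (Fin (Fintype.card κ + 1) → K) := LinearEquiv.funCongrLeft K K e.symm
  have hT : ∀ x, T x = x ∘ e.symm := fun x => rfl
  have hr : ∀ j, Set.range (fun k => T (w j (f.symm k))) = T '' Set.range (w j) := by
    intro j
    rw [← Set.range_comp, ← f.symm.surjective.range_comp]
    rfl
  obtain ⟨i, j, hij, h⟩ := S.exists_span_eq (L := fun v => Matrix.reindex e e (L v))
    (fun v => by rw [Matrix.det_reindex_self]; exact hL v) (fun v i => c v (e.symm i))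
    (by
      rw [← hc]
      exact Finset.sum_congr rfl fun v _ => e.symm.sum_comp (c v)) hδ hq
    (fun j k => T (w j (f.symm k))) (fun j k i => hwO _ _ _)
    (fun j => by
      have := ((hwli j).comp f.symm f.symm.injective).map' T.toLinearMap T.ker
      exact this)
    (fun j k => by
      rw [hT, S.twH_reindex e L (fun v i => q j * c v i)]
      exact hw j _)
  refine ⟨i, j, hij, ?_⟩
  rw [hr, hr, ← LinearEquiv.coe_coe, ← Submodule.map_span, ← Submodule.map_span] at h
  exact Submodule.map_injective_of_injective T.injective h

theorem exists_span_eq_of_weights [CharZero K] {κ : Type} [Fintype κ]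
    (hcard : Fintype.card ι = Fintype.card κ + 1) {L : S.V → Matrix ι ι K}
    (hL : ∀ v, IsUnit (L v).det) (c : ℕ → S.V → ι → ℝ)
    (hc : ∀ j, ∑ v, ∑ i, c j v i = 0) {δ M : ℝ} (hδ : 0 < δ) {q : ℕ → ℝ}
    (hq : Tendsto q atTop atTop) (hq0 : ∀ j, 0 < q j) (hM : ∀ j v i, |c j v i| ≤ M * q j)
    (w : ℕ → κ → ι → K)
    (hwO : ∀ j k i, w j k i ∈ S.O) (hwli : ∀ j, LinearIndependent K (w j))
    (hw : ∀ j k, S.twH L (c j) (w j k) ≤ exp (-δ * q j)) :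
    ∃ i j, i ≠ j ∧
      Submodule.span K (Set.range (w i)) = Submodule.span K (Set.range (w j)) := by
  classical
  let g : ℕ → S.V → ι → ℝ := fun j v i => c j v i / q j
  have hcomp : IsCompact (Set.univ.pi fun _ : S.V => Set.univ.pi fun _ : ι => Set.Icc (-M) M) :=
    isCompact_univ_pi fun _ => isCompact_univ_pi fun _ => isCompact_Icc
  obtain ⟨γ, -, φ, hφ, hlim⟩ := hcomp.tendsto_subseq (x := g) (fun j => by
    simp only [Set.mem_univ_pi, Set.mem_Icc]
    intro v i
    rw [← abs_le, abs_div, abs_of_pos (hq0 j), div_le_iff₀ (hq0 j)]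
    exact hM j v i)
  have hlim' : ∀ v i, Tendsto (fun j => c (φ j) v i / q (φ j)) atTop (nhds (γ v i)) := by
    intro v i
    exact (tendsto_pi_nhds.mp (tendsto_pi_nhds.mp hlim v)) i
  have hγ : ∑ v, ∑ i, γ v i = 0 := by
    have h1 : Tendsto (fun j => ∑ v, ∑ i, c (φ j) v i / q (φ j)) atTop
        (nhds (∑ v, ∑ i, γ v i)) :=
      tendsto_finsetSum _ fun v _ => tendsto_finsetSum _ fun i _ => hlim' v i
    have h2 : (fun j => ∑ v, ∑ i, c (φ j) v i / q (φ j)) = fun _ => (0 : ℝ) := by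
      funext j
      simp_rw [← Finset.sum_div]
      rw [hc, zero_div]
    rw [h2] at h1
    exact tendsto_nhds_unique h1 tendsto_const_nhds
  set η : ℝ := δ / 2 / (Fintype.card S.V + 1) with hη
  have hη0 : 0 < η := by positivity
  have hcl : ∀ᶠ j in atTop, ∀ v i, c (φ j) v i / q (φ j) ≤ γ v i + η := by
    rw [eventually_all]; intro v
    rw [eventually_all]; intro i
    exact (hlim' v i).eventually_le_const (by linarith)
  obtain ⟨j₀, hj₀⟩ := eventually_atTop.mp hcl
  have hcV : (Fintype.card S.V : ℝ) * η ≤ δ / 2 := by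
    rw [hη, mul_div_assoc', div_le_iff₀ (by positivity)]
    nlinarith
  let ψ : ℕ → ℕ := fun j => φ (j + j₀)
  have hψ : StrictMono ψ := fun a b hab => hφ (by omega)
  obtain ⟨i, j, hij, h⟩ := S.exists_span_eq_of_card hcard hL γ hγ (half_pos hδ)
    (q := q ∘ ψ) (hq.comp hψ.tendsto_atTop) (fun j => w (ψ j)) (fun _ _ _ => hwO _ _ _)
    (fun _ => hwli _) (fun j k => by
      have h1 := S.twH_le_of_close L (c := fun v i => (q ∘ ψ) j * γ v i) (c' := c (ψ j))
        (η := q (ψ j) * η) (fun v i => by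
          have := hj₀ (j + j₀) (by omega) v i
          rw [div_le_iff₀ (hq0 _)] at this
          change c (φ (j + j₀)) v i ≤ q (φ (j + j₀)) * γ v i + q (φ (j + j₀)) * η
          linarith) (w (ψ j) k)
      refine h1.trans ((mul_le_mul_of_nonneg_left (hw _ _) (exp_pos _).le).trans ?_)
      rw [← exp_add, exp_le_exp]
      change _ ≤ -(δ / 2) * q (ψ j)
      have := mul_le_mul_of_nonneg_left hcV (hq0 (ψ j)).le
      linarith)
  exact ⟨ψ i, ψ j, hψ.injective.ne hij, h⟩

end PlaceSys
end SubB1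

section SubB2
open Real Height Filter

namespace PlaceSys

variable {K : Type} [Field K] [AdmissibleAbsValues K] (S : PlaceSys K)
variable {ι : Type} [Fintype ι] [DecidableEq ι]

/-- Davenport's lemma, in the situation of a large gap before the last successive minimum. -/
theorem exists_rescaled_of_gap {L : S.V → Matrix ι ι K} (hL : ∀ v, IsUnit (L v).det) :
    ∃ C : ℝ, 0 < C ∧ ∀ c : S.V → ι → ℝ, ∑ v, ∑ i, c v i = 0 → ∀ w lam,
      S.IsMinima (S.twH L c) w lam → ∀ a b : Fin (Fintype.card ι), a ≠ b →
      (∀ i, i ≤ b) → (∀ i, i ≠ b → i ≤ a) → C * lam a < lam b →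
      ∀ M, (∀ i, |log (lam i)| ≤ M) →
      ∃ c' : S.V → ι → ℝ, ∑ v, ∑ i, c' v i = 0 ∧ (∀ v i, |c' v i - c v i| ≤ 2 * M) ∧
      ∃ u : {i // i ≠ b} → ι → K, (∀ k i, u k i ∈ S.O) ∧ LinearIndependent K u ∧
        Submodule.span K (Set.range u) = Submodule.span K (w '' Set.Iio b) ∧
        ∀ k, S.twH L c' (u k) ^ Fintype.card ι ≤ C * (lam a / lam b) := by
  classical
  rcases isEmpty_or_nonempty ι with hemp | hne
  · refine ⟨1, one_pos, fun c _ w lam _ a => ?_⟩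
    exact absurd a.2 (by simp)
  obtain ⟨C₁, hC₁, hprod⟩ := S.exists_prod_minima_le L
  obtain ⟨C₀, hC₀, hlow⟩ := S.exists_le_prod_twH hL
  set N := Fintype.card ι with hN
  have hNne : (N : ℝ) ≠ 0 := by positivity
  set t : ℝ := 2 ^ (N + 1) with ht
  have ht0 : 0 < t := by positivity
  set C₃ : ℝ := t ^ N * C₁ * (C₀ * 2 ^ N) / t with hC₃
  refine ⟨t * C₃ + (2 * C₃) ^ N * C₁, by positivity,
    fun c hc w lam H a b hab hb ha hgap M hM => ?_⟩
  have hP : 1 ≤ C₀ * 2 ^ N * ∏ i, lam i := by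
    refine (hlow c hc (fun i => w ((Fintype.equivFin ι) i)) (fun j i => H.mem _ _)
      (H.li.comp _ (Fintype.equivFin ι).injective)).trans ?_
    rw [(Fintype.equivFin ι).prod_comp (fun i => S.twH L c (w i)), mul_assoc]
    refine mul_le_mul_of_nonneg_left ?_ hC₀.le
    calc ∏ i, S.twH L c (w i) ≤ ∏ i, (2 * lam i) :=
          Finset.prod_le_prod (fun _ _ => S.twH_nonneg _ _ _) fun i _ => H.le_two i
      _ = 2 ^ N * ∏ i, lam i := by simp [Finset.prod_mul_distrib, hN]
  have hPC := hprod c hc w lam H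
  set lam' : Fin N → ℝ := fun i => if i = b then lam a else lam i with hlam'
  have hlam'0 : ∀ i, 0 < lam' i := fun i => by
    simp only [hlam']; split_ifs <;> exact H.pos _
  have hlam'M : ∀ i, |log (lam' i)| ≤ M := fun i => by
    simp only [hlam']; split_ifs <;> exact hM _
  have hmono : Monotone lam' := by
    intro i j hij
    simp only [hlam']
    split_ifs with h1 h2 h2
    · exact le_rfl
    · subst h1
      exact absurd (le_antisymm (hb j) hij) h2
    · exact H.mono (ha i h1)
    · exact H.mono hij
  have hlam'le : ∀ i, lam' i ≤ lam i := fun i => by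
    simp only [hlam']
    split_ifs with h1
    · exact H.mono (h1 ▸ hb a)
    · exact le_rfl
  set A : ℝ := exp ((∑ i, log (lam' i)) / N) with hA
  have hA0 : 0 < A := exp_pos _
  have hAN : A ^ N = ∏ i, lam' i := by
    rw [hA, ← exp_nat_mul, mul_div_cancel₀ _ hNne, exp_sum]
    exact Finset.prod_congr rfl fun i _ => exp_log (hlam'0 i)
  have hlogA : |log A| ≤ M := by
    rw [hA, log_exp, abs_div, Nat.abs_cast, div_le_iff₀ (by positivity)]
    refine (Finset.abs_sum_le_sum_abs _ _).trans ((Finset.sum_le_sum fun i _ => hlam'M i).trans ?_)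
    simp [mul_comm]
  have hANP : A ^ N * (lam b / lam a) = ∏ i, lam i := by
    rw [hAN, ← Finset.mul_prod_erase _ _ (Finset.mem_univ b),
      ← Finset.mul_prod_erase _ lam (Finset.mem_univ b)]
    have h1 : ∏ i ∈ Finset.univ.erase b, lam' i = ∏ i ∈ Finset.univ.erase b, lam i :=
      Finset.prod_congr rfl fun i hi => by simp [hlam', Finset.ne_of_mem_erase hi]
    have := (H.pos a).ne'
    rw [h1]
    simp only [hlam', if_true]
    field_simp
  set ρ : Fin N → ℝ := fun i => A / lam' i with hρ
  have hρ0 : ∀ i, 0 < ρ i := fun i => div_pos hA0 (hlam'0 i)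
  have hρanti : Antitone ρ := fun i j hij =>
    div_le_div_of_nonneg_left hA0.le (hlam'0 i) (hmono hij)
  have hρprod : ∏ i, ρ i = 1 := by
    simp only [hρ]
    rw [Finset.prod_div_distrib, ← hAN, Finset.prod_const, Finset.card_univ, Fintype.card_fin]
    exact div_self (by positivity)
  obtain ⟨τ, hτ⟩ := S.exists_rescale L c w
  have hτ := hτ ρ hρ0 hρanti
  set c' := S.rescale c τ ρ with hc'
  have hc'0 : ∑ v, ∑ i, c' v i = 0 := by
    rw [hc', S.sum_rescale c τ hρ0, hρprod, hc, log_one, sub_zero]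
  have hclose : ∀ v i, |c' v i - c v i| ≤ 2 * M := by
    intro v i
    have hM0 : 0 ≤ M := (abs_nonneg _).trans hlogA
    by_cases hv : v = S.v₀
    · subst hv
      simp only [hc', rescale, Function.update_self, sub_sub_cancel_left, abs_neg, hρ]
      rw [log_div hA0.ne' (hlam'0 _).ne']
      have := hlam'M (τ.symm i)
      rw [abs_le] at *
      constructor <;> linarith
    · simp only [hc', rescale, Function.update_of_ne hv, sub_self, abs_zero]
      linarith
  have hlowA : ∀ x : ι → K, x ≠ 0 → (∀ i, x i ∈ S.O) → A ≤ 2 ^ N * S.twH L c' x := by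
    intro x hx hxO
    obtain ⟨i, hi, hi'⟩ := H.exists_index hx
    refine le_trans ?_ (hτ i x hi)
    have h1 := (hlam'le i).trans (H.min i x hxO hi')
    calc A = ρ i * lam' i := by simp only [hρ]; rw [div_mul_cancel₀ _ (hlam'0 i).ne']
      _ ≤ _ := mul_le_mul_of_nonneg_left h1 (hρ0 i).le
  have htop : Submodule.span K (w '' Set.Iic b) = ⊤ := by
    rw [show Set.Iic b = Set.univ from Set.eq_univ_of_forall hb, Set.image_univ]
    exact H.li.span_eq_top_of_card_eq_finrank' (by simp)
  have hlowR : ∀ x : ι → K, (∀ i, x i ∈ S.O) → x ∉ Submodule.span K (w '' Set.Iio b) →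
      A * (lam b / lam a) ≤ 2 ^ N * S.twH L c' x := by
    intro x hxO hx
    refine le_trans ?_ (hτ b x (htop ▸ trivial))
    calc A * (lam b / lam a) = ρ b * lam b := by
          simp only [hρ, hlam', if_true]
          ring
      _ ≤ _ := mul_le_mul_of_nonneg_left (H.min b x hxO hx) (hρ0 b).le
  obtain ⟨u, μ, G⟩ := S.exists_isMinima_twH hL c'
  have hμprod := hprod c' hc'0 u μ G
  have hμA : ∀ i, A ≤ t * μ i := fun i => by
    refine (hlowA _ (G.li.ne_zero i) (G.mem i)).trans ?_
    have := mul_le_mul_of_nonneg_left (G.le_two i) (by positivity : (0:ℝ) ≤ 2 ^ N)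
    rw [ht, pow_succ]
    linarith
  have hUne : ∃ i₀, u i₀ ∉ Submodule.span K (w '' Set.Iio b) := by
    by_contra! hcon
    have h1 : (⊤ : Submodule K (ι → K)) ≤ Submodule.span K (w '' Set.Iio b) := by
      rw [← G.li.span_eq_top_of_card_eq_finrank' (by simp), Submodule.span_le]
      rintro _ ⟨i, rfl⟩
      exact hcon i
    exact H.li.notMem_span_image (s := Set.Iio b) (x := b) (by simp) (h1 trivial)
  obtain ⟨i₀, hi₀⟩ := hUne
  have hμb : A * (lam b / lam a) ≤ t * μ b := by
    refine (hlowR _ (G.mem i₀) hi₀).trans ?_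
    have := mul_le_mul_of_nonneg_left ((G.le_two i₀).trans
      (mul_le_mul_of_nonneg_left (G.mono (hb i₀)) zero_le_two)) (by positivity : (0:ℝ) ≤ 2 ^ N)
    rw [ht, pow_succ]
    linarith
  set R := lam b / lam a with hR
  have hμa : μ a ≤ C₃ * A := by
    have h1 : ∏ i ∈ {a, b}, (t * μ i / A) ≤ ∏ i, (t * μ i / A) :=
      Finset.prod_le_prod_of_subset_of_one_le (Finset.subset_univ _)
        (fun i _ => div_nonneg (mul_nonneg ht0.le (G.pos i).le) hA0.le)
        (fun i _ _ => (one_le_div hA0).mpr (hμA i))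
    rw [Finset.prod_pair hab, Finset.prod_div_distrib, Finset.prod_mul_distrib,
      Finset.prod_const, Finset.prod_const, Finset.card_univ, Fintype.card_fin] at h1
    have h2 : R ≤ t * μ b / A := by
      rw [le_div_iff₀ hA0, mul_comm]; exact hμb
    have h3 : t * μ a / A * R ≤ t ^ N * C₁ / A ^ N := by
      refine (mul_le_mul_of_nonneg_left h2
        (div_nonneg (mul_nonneg ht0.le (G.pos a).le) hA0.le)).trans (h1.trans ?_)
      gcongr
    rw [le_div_iff₀ (by positivity), mul_assoc, mul_comm R, hANP] at h3
    have h4 : t * μ a / A ≤ t ^ N * C₁ * (C₀ * 2 ^ N) := by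
      have h5 : 0 ≤ t * μ a / A := div_nonneg (mul_nonneg ht0.le (G.pos a).le) hA0.le
      calc t * μ a / A ≤ t * μ a / A * (C₀ * 2 ^ N * ∏ i, lam i) :=
            le_mul_of_one_le_right h5 hP
        _ = C₀ * 2 ^ N * (t * μ a / A * ∏ i, lam i) := by ring
        _ ≤ C₀ * 2 ^ N * (t ^ N * C₁) := mul_le_mul_of_nonneg_left h3 (by positivity)
        _ = _ := by ring
    rw [div_le_iff₀ hA0] at h4
    rw [hC₃, div_mul_eq_mul_div, le_div_iff₀ ht0, mul_comm]
    exact h4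
  have hh : ∀ i, i ≠ b → S.twH L c' (u i) ≤ 2 * C₃ * A := fun i hi => by
    have := (G.le_two i).trans (mul_le_mul_of_nonneg_left ((G.mono (ha i hi)).trans hμa)
      zero_le_two)
    linarith
  have hRbig : t * C₃ < R := by
    rw [hR, lt_div_iff₀ (H.pos a)]
    refine lt_of_le_of_lt ?_ hgap
    refine mul_le_mul_of_nonneg_right ?_ (H.pos a).le
    have : 0 ≤ (2 * C₃) ^ N * C₁ := by positivity
    linarith
  have hmem : ∀ i, i ≠ b → u i ∈ Submodule.span K (w '' Set.Iio b) := by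
    intro i hi
    by_contra hcon
    have h1 := (hlowR _ (G.mem i) hcon).trans
      (mul_le_mul_of_nonneg_left (hh i hi) (by positivity))
    have h2 : A * R ≤ A * (t * C₃) := by
      rw [ht, pow_succ]
      linarith
    exact absurd (le_of_mul_le_mul_left h2 hA0) (not_le.mpr hRbig)
  have hIio : w '' Set.Iio b = Set.range fun i : {i // i ≠ b} => w i := by
    ext x
    constructor
    · rintro ⟨i, hi, rfl⟩
      exact ⟨⟨i, ne_of_lt hi⟩, rfl⟩
    · rintro ⟨i, rfl⟩
      exact ⟨i, lt_of_le_of_ne (hb _) i.2, rfl⟩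
  refine ⟨c', hc'0, hclose, fun i => u i, fun k i => G.mem _ _,
    G.li.comp _ Subtype.val_injective, ?_, fun k => ?_⟩
  · refine Submodule.eq_of_le_of_finrank_le ?_ ?_
    · rw [Submodule.span_le]
      rintro _ ⟨i, rfl⟩
      exact hmem i i.2
    · have h1 : LinearIndependent K fun i : {i // i ≠ b} => w i :=
        H.li.comp _ Subtype.val_injective
      have h2 : LinearIndependent K fun i : {i // i ≠ b} => u i :=
        G.li.comp _ Subtype.val_injective
      rw [hIio, finrank_span_eq_card h1, finrank_span_eq_card h2]
  · refine (pow_le_pow_left₀ (S.twH_nonneg _ _ _) (hh k k.2) N).trans ?_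
    have h1 : A ^ N = (∏ i, lam i) * (lam a / lam b) := by
      rw [← hANP, hR]
      have := (H.pos a).ne'
      have := (H.pos b).ne'
      field_simp
    have hq : 0 < lam a / lam b := div_pos (H.pos a) (H.pos b)
    rw [mul_pow, h1, ← mul_assoc]
    refine mul_le_mul_of_nonneg_right ?_ hq.le
    have h2 := mul_le_mul_of_nonneg_left hPC (by positivity : (0:ℝ) ≤ (2 * C₃) ^ N)
    have : 0 ≤ t * C₃ := by positivity
    linarith

end PlaceSys
end SubB2

section SubB3
open Real

variable {K : Type} [Field K]
variable {ι : Type} [LinearOrder ι]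

/-- The vector of maximal minors of a tuple of vectors. -/
noncomputable def wedge {p : ℕ} (y : Fin p → ι → K) : Set.powersetCard ι p → K :=
  fun s => (Matrix.of fun i j => y i (Set.powersetCard.ofFinEmbEquiv.symm s j)).det

lemma wedge_mem {p : ℕ} (O : Subring K) {y : Fin p → ι → K} (hy : ∀ k i, y k i ∈ O)
    (s : Set.powersetCard ι p) : wedge y s ∈ O := by
  rw [wedge, Matrix.det_apply]
  refine O.sum_mem fun σ _ => ?_
  rw [Units.smul_def]
  exact O.zsmul_mem (O.prod_mem fun i _ => hy _ _) _

variable [Fintype ι]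

lemma repr_exteriorPower_ιMulti {p : ℕ} (y : Fin p → ι → K) (s : Set.powersetCard ι p) :
    ((Pi.basisFun K ι).exteriorPower p).repr (exteriorPower.ιMulti K p y) s = wedge y s := by
  rw [exteriorPower.basis_repr_apply, exteriorPower.ιMultiDual_apply_ιMulti]
  rfl

lemma wedge_eq_equivFun {p : ℕ} (y : Fin p → ι → K) :
    wedge y = ((Pi.basisFun K ι).exteriorPower p).equivFun (exteriorPower.ιMulti K p y) := by
  funext s
  rw [Module.Basis.equivFun_apply, repr_exteriorPower_ιMulti]

/-- The matrix of `p × p` minors. -/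
noncomputable def compound (p : ℕ) (A : Matrix ι ι K) :
    Matrix (Set.powersetCard ι p) (Set.powersetCard ι p) K :=
  LinearMap.toMatrix ((Pi.basisFun K ι).exteriorPower p) ((Pi.basisFun K ι).exteriorPower p)
    (exteriorPower.map p (Matrix.toLin' A))

lemma compound_mulVec_wedge {p : ℕ} (A : Matrix ι ι K) (y : Fin p → ι → K) :
    (compound p A).mulVec (wedge y) = wedge fun k => A.mulVec (y k) := by
  rw [wedge_eq_equivFun, wedge_eq_equivFun]
  have := LinearMap.toMatrix_mulVec_repr ((Pi.basisFun K ι).exteriorPower p)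
    ((Pi.basisFun K ι).exteriorPower p) (exteriorPower.map p (Matrix.toLin' A))
    (exteriorPower.ιMulti K p y)
  rw [exteriorPower.map_apply_ιMulti] at this
  exact this

lemma compound_mul {p : ℕ} (A B : Matrix ι ι K) :
    compound p (A * B) = compound p A * compound p B := by
  rw [compound, Matrix.toLin'_mul, exteriorPower.map_comp,
    LinearMap.toMatrix_comp _ ((Pi.basisFun K ι).exteriorPower p)]
  rfl

lemma compound_one {p : ℕ} : compound p (1 : Matrix ι ι K) = 1 := by
  rw [compound, Matrix.toLin'_one, exteriorPower.map_id, LinearMap.toMatrix_id]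

lemma isUnit_det_compound {p : ℕ} {A : Matrix ι ι K} (hA : IsUnit A.det) :
    IsUnit (compound p A).det := by
  have h := compound_mul (p := p) A A⁻¹
  rw [Matrix.mul_nonsing_inv _ hA, compound_one] at h
  have h2 := congrArg Matrix.det h
  rw [Matrix.det_mul, Matrix.det_one] at h2
  exact IsUnit.of_mul_eq_one _ h2.symm

lemma linearIndependent_wedge {κ : Type} [LinearOrder κ] {p : ℕ} {w : κ → ι → K}
    (hw : LinearIndependent K w) :
    LinearIndependent K fun I : Set.powersetCard κ p =>
      wedge fun k => w (Set.powersetCard.ofFinEmbEquiv.symm I k) := by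
  have := (exteriorPower.ιMulti_family_linearIndependent_field p hw).map'
    ((Pi.basisFun K ι).exteriorPower p).equivFun.toLinearMap (LinearEquiv.ker _)
  have h2 : (fun I : Set.powersetCard κ p =>
      wedge fun k => w (Set.powersetCard.ofFinEmbEquiv.symm I k)) =
      ⇑((Pi.basisFun K ι).exteriorPower p).equivFun.toLinearMap ∘
        exteriorPower.ιMulti_family K p w := by
    funext I
    rw [wedge_eq_equivFun]
    rfl
  rw [h2]
  exact this

lemma prod_emb {κ : Type} [LinearOrder κ] {p : ℕ} {M : Type*} [CommMonoid M]
    (I : Set.powersetCard κ p) (f : κ → M) :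
    ∏ k, f (Set.powersetCard.ofFinEmbEquiv.symm I k) = ∏ i ∈ (I : Finset κ), f i := by
  refine (Finset.prod_map Finset.univ (Set.powersetCard.ofFinEmbEquiv.symm I).toEmbedding f).symm.trans
    (Finset.prod_congr ?_ fun _ _ => rfl)
  ext i
  have := Set.powersetCard.mem_range_ofFinEmbEquiv_symm_iff_mem I i
  simp only [Finset.mem_map, Finset.mem_univ, true_and]
  exact this

lemma twNorm_wedge_le {p : ℕ} (a : AbsoluteValue K ℝ) (L : Matrix ι ι K) (c : ι → ℝ)
    (y : Fin p → ι → K) :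
    twNorm a (compound p L) (fun s => ∑ i ∈ (s : Finset ι), c i) (wedge y) ≤
      Fintype.card (Set.powersetCard ι p) * (p.factorial * ∏ k, twNorm a L c (y k)) := by
  refine twNorm_le _ _ _ _ fun s => ?_
  rw [compound_mulVec_wedge, wedge, Matrix.det_apply]
  refine (a.sum_le _ _).trans ?_
  have hle : ∀ σ : Equiv.Perm (Fin p), a (Equiv.Perm.sign σ • ∏ i,
      (Matrix.of fun i j => L.mulVec (y i) (Set.powersetCard.ofFinEmbEquiv.symm s j)) (σ i) i) ≤
      (∏ k, twNorm a L c (y k)) * exp (∑ i ∈ (s : Finset ι), c i) := by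
    intro σ
    have h1 : a (Equiv.Perm.sign σ • ∏ i,
      (Matrix.of fun i j => L.mulVec (y i) (Set.powersetCard.ofFinEmbEquiv.symm s j)) (σ i) i) =
      ∏ i, a (L.mulVec (y (σ i)) (Set.powersetCard.ofFinEmbEquiv.symm s i)) := by
      rcases Int.units_eq_one_or (Equiv.Perm.sign σ) with h | h <;> rw [h] <;>
        simp [map_prod]
    rw [h1]
    calc ∏ i, a (L.mulVec (y (σ i)) (Set.powersetCard.ofFinEmbEquiv.symm s i))
        ≤ ∏ i, (exp (c (Set.powersetCard.ofFinEmbEquiv.symm s i)) * twNorm a L c (y (σ i))) :=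
          Finset.prod_le_prod (fun _ _ => a.nonneg _) fun i _ => abv_le_twNorm _ _ _ _ _
      _ = _ := by
          rw [Finset.prod_mul_distrib, prod_emb s fun i => exp (c i), exp_sum,
            Equiv.prod_comp σ (fun i => twNorm a L c (y i)), mul_comm]
  refine (Finset.sum_le_sum fun σ _ => hle σ).trans ?_
  rw [Finset.sum_const, Finset.card_univ, Fintype.card_perm, Fintype.card_fin, nsmul_eq_mul]
  exact (mul_assoc _ _ _).ge

lemma card_filter_mem_powersetCard [Fintype ι] (p : ℕ) (i j : ι) :
    (Finset.univ.filter fun s : Set.powersetCard ι p => i ∈ (s : Finset ι)).card =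
      (Finset.univ.filter fun s : Set.powersetCard ι p => j ∈ (s : Finset ι)).card := by
  let T : Set.powersetCard ι p → Set.powersetCard ι p := fun s =>
    ⟨(s : Finset ι).map (Equiv.swap i j).toEmbedding, by
      rw [Set.powersetCard.mem_iff, Finset.card_map]; exact s.2⟩
  have hTT : ∀ s, T (T s) = s := fun s => by
    apply Subtype.ext
    simp only [T, Finset.map_map]
    ext a
    simp
  have hTm : ∀ s a, a ∈ ((T s : Set.powersetCard ι p) : Finset ι) ↔
      Equiv.swap i j a ∈ (s : Finset ι) := by
    intro s a
    simp only [T, Finset.mem_map_equiv, Equiv.symm_swap]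
  refine Finset.card_nbij' T T ?_ ?_ (fun s _ => hTT s) (fun s _ => hTT s)
  · intro s hs
    simp only [Finset.coe_filter, Finset.mem_univ, true_and, Set.mem_ofPred_eq] at hs ⊢
    rw [hTm, Equiv.swap_apply_right]; exact hs
  · intro s hs
    simp only [Finset.coe_filter, Finset.mem_univ, true_and, Set.mem_ofPred_eq] at hs ⊢
    rw [hTm, Equiv.swap_apply_left]; exact hs

lemma exists_sum_powersetCard (p : ℕ) : ∃ m : ℕ, ∀ f : ι → ℝ,
    ∑ s : Set.powersetCard ι p, ∑ i ∈ (s : Finset ι), f i = m * ∑ i, f i := by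
  rcases isEmpty_or_nonempty ι with h | ⟨⟨i₀⟩⟩
  · exact ⟨0, fun f => by
      simp only [Nat.cast_zero, zero_mul]
      refine Finset.sum_eq_zero fun s _ => Finset.sum_eq_zero fun i _ => (h.false i).elim⟩
  refine ⟨(Finset.univ.filter fun s : Set.powersetCard ι p => i₀ ∈ (s : Finset ι)).card,
    fun f => ?_⟩
  rw [Finset.sum_comm' (t' := Finset.univ)
    (s' := fun i => Finset.univ.filter fun s : Set.powersetCard ι p => i ∈ (s : Finset ι))
    (by simp), Finset.mul_sum]
  refine Finset.sum_congr rfl fun i _ => ?_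
  rw [Finset.sum_const, card_filter_mem_powersetCard p i i₀, nsmul_eq_mul]

lemma wedge_mem_span_iff {κ : Type} [Fintype κ] [LinearOrder κ] {p : ℕ} {w : κ → ι → K}
    (hw : LinearIndependent K w) (hcard : Fintype.card κ = Fintype.card ι)
    (I₀ : Set.powersetCard κ p) (y : ι → K) :
    y ∈ Submodule.span K (w '' {i | i ∉ (I₀ : Finset κ)}) ↔
      ∀ z : Fin p → ι → K, (∃ a, z a = y) → wedge z ∈ Submodule.span K
        ((fun I : Set.powersetCard κ p =>
          wedge fun k => w (Set.powersetCard.ofFinEmbEquiv.symm I k)) '' {I | I ≠ I₀}) := by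
  classical
  let b : Module.Basis κ K (ι → K) := Module.Basis.mk hw
    (hw.span_eq_top_of_card_eq_finrank' (by simp [hcard])).ge
  have hb : ∀ i, b i = w i := fun i => Module.Basis.mk_apply _ _ i
  have hbw : ⇑b = w := funext hb
  have hz : ∀ z : Fin p → ι → K, wedge z ∈ Submodule.span K
        ((fun I : Set.powersetCard κ p =>
          wedge fun k => w (Set.powersetCard.ofFinEmbEquiv.symm I k)) '' {I | I ≠ I₀}) ↔
      (Matrix.of fun i j =>
        b.coord (Set.powersetCard.ofFinEmbEquiv.symm I₀ j) (z i)).det = 0 := by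
    intro z
    rw [← exteriorPower.ιMultiDual_apply_ιMulti, ← exteriorPower.basis_repr_apply]
    have h1 : (fun I : Set.powersetCard κ p =>
          wedge fun k => w (Set.powersetCard.ofFinEmbEquiv.symm I k)) '' {I | I ≠ I₀} =
        ((Pi.basisFun K ι).exteriorPower p).equivFun.toLinearMap ''
          (b.exteriorPower p '' {I | I ≠ I₀}) := by
      rw [← Set.image_comp]
      refine Set.image_congr fun I _ => ?_
      rw [wedge_eq_equivFun, Function.comp_apply, exteriorPower.basis_apply, hbw]
      rfl
    rw [h1, Submodule.span_image, wedge_eq_equivFun]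
    change ((Pi.basisFun K ι).exteriorPower p).equivFun.toLinearMap _ ∈ _ ↔ _
    have hinj : ∀ x, ((Pi.basisFun K ι).exteriorPower p).equivFun.toLinearMap x ∈
        (Submodule.span K (b.exteriorPower p '' {I | I ≠ I₀})).map
          ((Pi.basisFun K ι).exteriorPower p).equivFun.toLinearMap ↔
        x ∈ Submodule.span K (b.exteriorPower p '' {I | I ≠ I₀}) := by
      intro x
      rw [← SetLike.mem_coe, Submodule.map_coe]
      exact (LinearEquiv.injective _).mem_set_image
    rw [hinj, Module.Basis.mem_span_image]
    constructor
    · intro h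
      by_contra hne
      exact h (Finsupp.mem_support_iff.mpr hne) rfl
    · intro h I hI hII
      rw [hII] at hI
      exact Finsupp.mem_support_iff.mp hI h
  simp only [hz]
  have hy : y ∈ Submodule.span K (w '' {i | i ∉ (I₀ : Finset κ)}) ↔
      ∀ i ∈ (I₀ : Finset κ), b.repr y i = 0 := by
    rw [← hbw, Module.Basis.mem_span_image]
    constructor
    · intro h i hi
      by_contra hne
      exact h (Finsupp.mem_support_iff.mpr hne) hi
    · intro h i hi hi'
      exact Finsupp.mem_support_iff.mp hi (h i hi')
  rw [hy]
  constructor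
  · rintro h z ⟨a, rfl⟩
    refine Matrix.det_eq_zero_of_row_eq_zero a fun j => ?_
    exact h _ ((Set.powersetCard.mem_range_ofFinEmbEquiv_symm_iff_mem I₀ _).mp ⟨j, rfl⟩)
  · intro h i hi
    obtain ⟨a, rfl⟩ := (Set.powersetCard.mem_range_ofFinEmbEquiv_symm_iff_mem I₀ i).mpr hi
    have h1 := h (Function.update
      (fun k => w (Set.powersetCard.ofFinEmbEquiv.symm I₀ k)) a y) ⟨a, by simp⟩
    have h2 : (Matrix.of fun i j => b.coord (Set.powersetCard.ofFinEmbEquiv.symm I₀ j)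
        (Function.update (fun k => w (Set.powersetCard.ofFinEmbEquiv.symm I₀ k)) a y i)) =
        (1 : Matrix (Fin p) (Fin p) K).updateRow a
          (fun j => b.coord (Set.powersetCard.ofFinEmbEquiv.symm I₀ j) y) := by
      ext i j
      by_cases hia : i = a
      · subst hia
        simp
      · rw [Matrix.updateRow_ne hia, Matrix.of_apply, Function.update_of_ne hia, ← hb,
          Module.Basis.coord_apply, Module.Basis.repr_self, Finsupp.single_apply, Matrix.one_apply]
        simp [EmbeddingLike.apply_eq_iff_eq]
    rw [h2, ← Matrix.det_transpose, ← Matrix.updateCol_transpose, Matrix.transpose_one,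
      ← Matrix.cramer_apply, Matrix.cramer_one] at h1
    exact h1

end SubB3

section SubB4
open Real

lemma prod_le_prod_mul_of_gap {κ : Type} [DecidableEq κ] {p : ℕ} (lam : κ → ℝ)
    (hlam : ∀ i, 0 < lam i) {I I₀ : Finset κ} (hI : I.card = p) (hI₀ : I₀.card = p) (hne : I ≠ I₀)
    {x y : ℝ} (hx : 0 < x) (hxy : x ≤ y) (hlow : ∀ i ∉ I₀, lam i ≤ x) (hhigh : ∀ i ∈ I₀, y ≤ lam i) :
    ∏ i ∈ I, lam i ≤ (∏ i ∈ I₀, lam i) * (x / y) := by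
  have hy : 0 < y := hx.trans_le hxy
  rw [← Finset.prod_inter_mul_prod_sdiff I I₀, ← Finset.prod_inter_mul_prod_sdiff I₀ I,
    Finset.inter_comm I₀ I, mul_assoc]
  refine mul_le_mul_of_nonneg_left ?_ (Finset.prod_nonneg fun _ _ => (hlam _).le)
  have hcard : (I \ I₀).card = (I₀ \ I).card := Finset.card_sdiff_comm (hI.trans hI₀.symm)
  have hpos : (I \ I₀).card ≠ 0 := by
    rw [Finset.card_ne_zero, Finset.sdiff_nonempty]
    intro h
    exact hne (Finset.eq_of_subset_of_card_le h (by rw [hI, hI₀]))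
  have h1 : ∏ i ∈ I \ I₀, lam i ≤ x ^ (I \ I₀).card := by
    rw [← Finset.prod_const]
    exact Finset.prod_le_prod (fun _ _ => (hlam _).le)
      fun i hi => hlow i (Finset.mem_sdiff.mp hi).2
  have h2 : y ^ (I \ I₀).card ≤ ∏ i ∈ I₀ \ I, lam i := by
    rw [hcard, ← Finset.prod_const]
    exact Finset.prod_le_prod (fun _ _ => hy.le)
      fun i hi => hhigh i (Finset.mem_sdiff.mp hi).1
  have hr : x / y ≤ 1 := (div_le_one hy).mpr hxy
  calc ∏ i ∈ I \ I₀, lam i ≤ x ^ (I \ I₀).card := h1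
    _ = y ^ (I \ I₀).card * (x / y) ^ (I \ I₀).card := by
        rw [div_pow, mul_div_cancel₀ _ (by positivity)]
    _ ≤ (∏ i ∈ I₀ \ I, lam i) * (x / y) := by
        refine mul_le_mul h2 (pow_le_of_le_one (by positivity) hr hpos) (by positivity) ?_
        exact Finset.prod_nonneg fun _ _ => (hlam _).le

lemma linearIndependent_update_of_notMem {K M κ : Type*} [Field K] [AddCommGroup M] [Module K M]
    [DecidableEq κ] {f : κ → M} (hf : LinearIndependent K f) (i₀ : κ) {x : M}
    (hx : x ∉ Submodule.span K (f '' {i | i ≠ i₀})) :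
    LinearIndependent K (Function.update f i₀ x) := by
  rw [linearIndependent_iff_notMem_span]
  intro i hi
  by_cases h : i = i₀
  · subst h
    rw [Function.update_self] at hi
    refine hx (Submodule.span_mono ?_ hi)
    rintro _ ⟨j, hj, rfl⟩
    exact ⟨j, hj.2, by rw [Function.update_of_ne hj.2]⟩
  · rw [Function.update_of_ne h] at hi
    have h1 : f i ∈ Submodule.span K (insert x (f '' {j | j ≠ i₀ ∧ j ≠ i})) := by
      refine Submodule.span_mono ?_ hi
      rintro _ ⟨j, hj, rfl⟩
      by_cases hj0 : j = i₀
      · subst hj0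
        rw [Function.update_self]
        exact Set.mem_insert _ _
      · rw [Function.update_of_ne hj0]
        exact Set.mem_insert_of_mem _ ⟨j, ⟨hj0, hj.2⟩, rfl⟩
    have h2 : f i ∉ Submodule.span K (f '' {j | j ≠ i₀ ∧ j ≠ i}) :=
      hf.notMem_span_image (by simp)
    refine hx (Submodule.span_mono ?_ (mem_span_insert_exchange h1 h2))
    rintro _ (rfl | ⟨j, hj, rfl⟩)
    · exact ⟨i, h, rfl⟩
    · exact ⟨j, hj.1, rfl⟩

namespace PlaceSys

variable {K : Type} [Field K] [Height.AdmissibleAbsValues K] (S : PlaceSys K)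

lemma exists_abs_log_minima_le {ι : Type} [Fintype ι] [DecidableEq ι] [Nonempty ι]
    {L : S.V → Matrix ι ι K} (hL : ∀ v, IsUnit (L v).det) :
    ∃ C : ℝ, 0 < C ∧ ∀ c : S.V → ι → ℝ, ∑ v, ∑ i, c v i = 0 → ∀ m, 0 ≤ m →
      (∀ v i, |c v i| ≤ m) → ∀ w lam, S.IsMinima (S.twH L c) w lam →
      ∀ i, |log (lam i)| ≤ C * (1 + m) := by
  obtain ⟨C₁, hC₁, h1⟩ := S.exists_le_twH hL
  obtain ⟨C₂, hC₂, h2⟩ := S.exists_prod_minima_le L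
  set N := Fintype.card ι
  set D := |log (2 * C₁)| + Fintype.card S.V with hD
  refine ⟨|log C₂| + (N + 1) * D + 1, by positivity, fun c hc m hm hcm w lam H => ?_⟩
  set E := D * (1 + m) with hE
  have hE0 : 0 ≤ E := by positivity
  have hlow : ∀ i, -E ≤ log (lam i) := by
    intro i
    have h3 := h1 c m (fun v i => (le_abs_self _).trans (hcm v i)) (w i) (H.li.ne_zero i) (H.mem i)
    have h4 : 1 ≤ 2 * C₁ * exp (Fintype.card S.V * m) * lam i := by
      refine h3.trans ?_
      have := mul_le_mul_of_nonneg_left (H.le_two i)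
        (by positivity : 0 ≤ C₁ * exp (Fintype.card S.V * m))
      linarith
    have h5 := log_le_log one_pos h4
    rw [log_one, log_mul (by positivity) (H.pos i).ne', log_mul (by positivity) (exp_pos _).ne',
      log_exp] at h5
    have h6 := le_abs_self (log (2 * C₁))
    have h7 : 0 ≤ |log (2 * C₁)| * m := by positivity
    rw [hE, hD]
    linarith
  intro i
  have h3 := log_le_log (Finset.prod_pos fun i _ => H.pos i) (h2 c hc w lam H)
  rw [log_prod fun i _ => (H.pos i).ne', ← Finset.add_sum_erase _ _ (Finset.mem_univ i)] at h3
  have h4 : -(N * E) ≤ ∑ j ∈ Finset.univ.erase i, log (lam j) := by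
    have h5 : ∑ j ∈ Finset.univ.erase i, (-E) ≤ ∑ j ∈ Finset.univ.erase i, log (lam j) :=
      Finset.sum_le_sum fun j _ => hlow j
    refine le_trans ?_ h5
    rw [Finset.sum_const, nsmul_eq_mul, mul_neg, neg_le_neg_iff]
    refine mul_le_mul_of_nonneg_right ?_ hE0
    refine Nat.cast_le.mpr ((Finset.card_le_univ _).trans ?_)
    simp [N]
  have h5 := le_abs_self (log C₂)
  have h6 : 0 ≤ |log C₂| * m := by positivity
  have h7 : 0 ≤ N * E := by positivity
  have h8 := abs_nonneg (log C₂)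
  have h9 : (|log C₂| + (N + 1) * D + 1) * (1 + m) =
      |log C₂| + |log C₂| * m + N * E + E + (1 + m) := by rw [hE]; ring
  rw [h9, abs_le]
  have := hlow i
  constructor <;> linarith

lemma exists_twH_wedge_le {ι : Type} [LinearOrder ι] [Fintype ι] (p : ℕ)
    (L : S.V → Matrix ι ι K) :
    ∃ C : ℝ, 0 < C ∧ ∀ (c : S.V → ι → ℝ) (y : Fin p → ι → K),
      S.twH (fun v => compound p (L v)) (fun v s => ∑ i ∈ (s : Finset ι), c v i) (wedge y) ≤
        C * ∏ k, S.twH L c (y k) := by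
  refine ⟨∏ _v : S.V, ((Fintype.card (Set.powersetCard ι p) : ℝ) * p.factorial + 1),
    Finset.prod_pos fun _ _ => by positivity, fun c y => ?_⟩
  unfold twH
  rw [Finset.prod_comm, ← Finset.prod_mul_distrib]
  refine Finset.prod_le_prod (fun _ _ => twNorm_nonneg _ _ _ _) fun v _ => ?_
  refine (twNorm_wedge_le _ _ _ _).trans ?_
  rw [← mul_assoc]
  refine mul_le_mul_of_nonneg_right (by linarith) ?_
  exact Finset.prod_nonneg fun _ _ => twNorm_nonneg _ _ _ _

end PlaceSys
end SubB4

section SubB5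
open Real

namespace PlaceSys

variable {K : Type} [Field K] [Height.AdmissibleAbsValues K] (S : PlaceSys K)
variable {ι : Type} [LinearOrder ι] [Fintype ι]

theorem exists_wedge_rescaled {L : S.V → Matrix ι ι K} (hL : ∀ v, IsUnit (L v).det) (p : ℕ) :
    ∃ C : ℝ, 0 < C ∧ ∀ c : S.V → ι → ℝ, ∑ v, ∑ i, c v i = 0 → ∀ w lam,
      S.IsMinima (S.twH L c) w lam → ∀ (k k' : Fin (Fintype.card ι)) (I₀ : Set.powersetCard _ p),
      (∀ i ∉ (I₀ : Finset (Fin (Fintype.card ι))), i ≤ k) →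
      (∀ i ∈ (I₀ : Finset (Fin (Fintype.card ι))), k' ≤ i) →
      (∃ I : Set.powersetCard (Fin (Fintype.card ι)) p, I ≠ I₀) → C * lam k < lam k' →
      ∀ m, 0 ≤ m → (∀ v i, |c v i| ≤ m) →
      ∃ c' : S.V → Set.powersetCard ι p → ℝ, ∑ v, ∑ s, c' v s = 0 ∧
        (∀ v s, |c' v s| ≤ C * (1 + m)) ∧
      ∃ b : Fin (Fintype.card (Set.powersetCard ι p)),
      ∃ u : {i // i ≠ b} → Set.powersetCard ι p → K, (∀ k i, u k i ∈ S.O) ∧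
        LinearIndependent K u ∧
        Submodule.span K (Set.range u) = Submodule.span K
          ((fun I : Set.powersetCard (Fin (Fintype.card ι)) p =>
          wedge fun k => w (Set.powersetCard.ofFinEmbEquiv.symm I k)) '' {I | I ≠ I₀}) ∧
        ∀ k₁, S.twH (fun v => compound p (L v)) c' (u k₁) ^ Fintype.card (Set.powersetCard ι p) ≤
          C * (lam k / lam k') := by
  classical
  set P := Set.powersetCard ι p with hPdef
  set Q := Set.powersetCard (Fin (Fintype.card ι)) p with hQdef
  rcases isEmpty_or_nonempty ι with hemp | hne
  · refine ⟨1, one_pos, fun c _ w lam _ a => ?_⟩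
    exact absurd a.2 (by simp)
  have hPQ : Fintype.card Q = Fintype.card P := by
    have h1 : Nat.card Q = Nat.card P := by
      rw [hPdef, hQdef, Set.powersetCard.card, Set.powersetCard.card, Nat.card_fin,
        Nat.card_eq_fintype_card]
    simpa only [Nat.card_eq_fintype_card] using h1
  let eQP : P ≃ Q := (Fintype.equivOfCardEq hPQ).symm
  have hL' : ∀ v, IsUnit (compound p (L v)).det := fun v => isUnit_det_compound (hL v)
  rcases isEmpty_or_nonempty P with hempP | hneP
  · refine ⟨1, one_pos, fun c _ w lam _ k k' I₀ => ?_⟩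
    exact (hempP.false (eQP.symm I₀)).elim
  obtain ⟨C₁, hC₁, hgap⟩ := S.exists_rescaled_of_gap hL'
  obtain ⟨C₂, hC₂, hlow⟩ := S.exists_le_prod_twH hL'
  obtain ⟨C₃, hC₃, hprod⟩ := S.exists_prod_minima_le L
  obtain ⟨C₄, hC₄, hlog⟩ := S.exists_abs_log_minima_le hL'
  obtain ⟨C₅, hC₅, hwed⟩ := S.exists_twH_wedge_le p L
  obtain ⟨mu, hmu⟩ := exists_sum_powersetCard (ι := ι) p
  obtain ⟨mw, hmw⟩ := exists_sum_powersetCard (ι := Fin (Fintype.card ι)) p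
  set D : ℝ := C₅ * 2 ^ p with hD
  have hD0 : 0 < D := by positivity
  set D' : ℝ := C₂ * D ^ (Fintype.card P - 1) * C₃ ^ mw with hD'
  have hD'0 : 0 < D' := by positivity
  set Cb : ℝ := (p + 2 * (C₄ * (p + 1)) + 1) with hCb
  refine ⟨2 * D * D' * C₁ + 2 * D * D' + Cb, by positivity,
    fun c hc w lam H k k' I₀ hk hk' ⟨I₁, hI₁⟩ hlt m hm hcm => ?_⟩
  have hpk := H.pos k
  have hpk' := H.pos k'
  set r := lam k / lam k' with hr
  have hr0 : 0 < r := div_pos hpk hpk'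
  have hCr : (2 * D * D' * C₁ + 2 * D * D' + Cb) * r < 1 := by
    rw [hr, mul_div_assoc', div_lt_one hpk']
    exact hlt
  have hCb1 : 1 ≤ Cb := by
    rw [hCb]
    have : 0 ≤ (p : ℝ) + 2 * (C₄ * (p + 1)) := by positivity
    linarith
  have hr1 : r < 1 := by
    have h1 : 0 ≤ (2 * D * D' * C₁ + 2 * D * D') * r := by positivity
    have h2 : r ≤ Cb * r := le_mul_of_one_le_left hr0.le hCb1
    linarith
  have hlt' : lam k ≤ lam k' := ((div_lt_one hpk').mp hr1).le
  -- the wedge weights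
  set cw : S.V → P → ℝ := fun v s => ∑ i ∈ (s : Finset ι), c v i with hcw
  have hcw0 : ∑ v, ∑ s, cw v s = 0 := by
    simp only [hcw]
    rw [Finset.sum_congr rfl fun v _ => hmu (c v), ← Finset.mul_sum, hc, mul_zero]
  have hcwm : ∀ v s, |cw v s| ≤ p * m := by
    intro v s
    refine (Finset.abs_sum_le_sum_abs _ _).trans
      ((Finset.sum_le_sum fun i _ => hcm v i).trans ?_)
    rw [Finset.sum_const, nsmul_eq_mul, Set.powersetCard.card_eq]
  set h := S.twH (fun v => compound p (L v)) cw with hh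
  set W : Q → P → K := fun I => wedge fun k => w (Set.powersetCard.ofFinEmbEquiv.symm I k) with hW
  have hWli : LinearIndependent K W := linearIndependent_wedge H.li
  have hWO : ∀ I s, W I s ∈ S.O := fun I s => wedge_mem S.O (fun _ _ => H.mem _ _) s
  set Pi : Q → ℝ := fun I => ∏ i ∈ (I : Finset (Fin (Fintype.card ι))), lam i with hPi
  have hPi0 : ∀ I, 0 < Pi I := fun I => Finset.prod_pos fun i _ => H.pos i
  have hhW : ∀ I, h (W I) ≤ D * Pi I := by
    intro I
    refine (hwed c _).trans ?_
    rw [hD, mul_assoc]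
    refine mul_le_mul_of_nonneg_left ?_ hC₅.le
    calc ∏ k, S.twH L c (w (Set.powersetCard.ofFinEmbEquiv.symm I k))
        ≤ ∏ k, (2 * lam (Set.powersetCard.ofFinEmbEquiv.symm I k)) :=
          Finset.prod_le_prod (fun _ _ => S.twH_nonneg _ _ _) fun _ _ => H.le_two _
      _ = 2 ^ p * Pi I := by
          rw [Finset.prod_mul_distrib, prod_emb I lam]
          simp [hPi]
  have hPiI : ∀ I ≠ I₀, Pi I ≤ Pi I₀ * r := fun I hI =>
    prod_le_prod_mul_of_gap lam H.pos (Set.powersetCard.card_eq I) (Set.powersetCard.card_eq I₀)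
      (fun h => hI (Subtype.ext h)) hpk hlt' (fun i hi => H.mono (hk i hi))
      (fun i hi => H.mono (hk' i hi))
  have hPiprod : ∏ I, Pi I ≤ C₃ ^ mw := by
    have h1 : ∏ I, Pi I = (∏ i, lam i) ^ mw := by
      have h2 := hmw fun i => log (lam i)
      apply log_injOn_pos (Set.mem_Ioi.mpr (Finset.prod_pos fun I _ => hPi0 I))
        (Set.mem_Ioi.mpr (pow_pos (Finset.prod_pos fun i _ => H.pos i) _))
      rw [log_prod fun I _ => (hPi0 I).ne', log_pow, log_prod fun i _ => (H.pos i).ne', ← h2]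
      refine Finset.sum_congr rfl fun I _ => ?_
      exact log_prod fun i _ => (H.pos i).ne'
    rw [h1]
    exact pow_le_pow_left₀ (Finset.prod_nonneg fun i _ => (H.pos i).le) (hprod c hc w lam H) _
  set U := Submodule.span K (W '' {I | I ≠ I₀}) with hU
  have hlowU : ∀ x : P → K, (∀ s, x s ∈ S.O) → x ∉ U → Pi I₀ ≤ D' * h x := by
    intro x hxO hxU
    have hli := linearIndependent_update_of_notMem hWli I₀ hxU
    have h1 := hlow cw hcw0 (fun s => Function.update W I₀ x (eQP s)) (fun j s => by
      by_cases hj : eQP j = I₀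
      · rw [hj, Function.update_self]; exact hxO s
      · rw [Function.update_of_ne hj]; exact hWO _ s) (hli.comp _ eQP.injective)
    rw [eQP.prod_comp (fun I => h (Function.update W I₀ x I)),
      ← Finset.mul_prod_erase _ _ (Finset.mem_univ I₀), Function.update_self] at h1
    have h2 : ∏ I ∈ Finset.univ.erase I₀, h (Function.update W I₀ x I) ≤
        D ^ (Fintype.card P - 1) * ∏ I ∈ Finset.univ.erase I₀, Pi I := by
      have : D ^ (Fintype.card P - 1) = ∏ _I ∈ Finset.univ.erase I₀, D := by
        rw [Finset.prod_const, Finset.card_erase_of_mem (Finset.mem_univ _), Finset.card_univ, hPQ]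
      rw [this, ← Finset.prod_mul_distrib]
      refine Finset.prod_le_prod (fun _ _ => S.twH_nonneg _ _ _) fun I hI => ?_
      rw [Function.update_of_ne (Finset.ne_of_mem_erase hI)]
      exact hhW I
    have hhx : 0 ≤ h x := S.twH_nonneg _ _ _
    calc Pi I₀ ≤ Pi I₀ * (C₂ * (h x * ∏ I ∈ Finset.univ.erase I₀, h (Function.update W I₀ x I))) :=
          le_mul_of_one_le_right (hPi0 _).le h1
      _ ≤ Pi I₀ * (C₂ * (h x * (D ^ (Fintype.card P - 1) *
            ∏ I ∈ Finset.univ.erase I₀, Pi I))) := by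
          have := (hPi0 I₀).le
          gcongr
      _ = C₂ * D ^ (Fintype.card P - 1) * h x * (Pi I₀ * ∏ I ∈ Finset.univ.erase I₀, Pi I) := by
          ring
      _ ≤ C₂ * D ^ (Fintype.card P - 1) * h x * C₃ ^ mw := by
          rw [Finset.mul_prod_erase _ Pi (Finset.mem_univ I₀)]
          exact mul_le_mul_of_nonneg_left hPiprod (by positivity)
      _ = _ := by rw [hD']; ring
  obtain ⟨wb, lam', G⟩ := S.exists_isMinima_twH hL' cw
  have hn2 : 1 < Fintype.card P := by
    rw [← hPQ]
    exact Fintype.one_lt_card_iff.mpr ⟨I₁, I₀, hI₁⟩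
  let b : Fin (Fintype.card P) := ⟨Fintype.card P - 1, by omega⟩
  let a : Fin (Fintype.card P) := ⟨Fintype.card P - 2, by omega⟩
  have hab : a ≠ b := fun h => by
    have := congrArg Fin.val h
    simp only [a, b] at this
    omega
  have hb : ∀ i, i ≤ b := fun i => by
    rw [Fin.le_def]; simp only [b]; omega
  have ha : ∀ i, i ≠ b → i ≤ a := fun i hi => by
    have h1 : i.val ≠ Fintype.card P - 1 := fun h => hi (Fin.ext h)
    rw [Fin.le_def]; simp only [a]; omega
  have hUrange : U = Submodule.span K (Set.range fun I : {I // I ≠ I₀} => W I) := by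
    rw [hU, Set.image_eq_range]
    rfl
  have hUdim : Module.finrank K U = Fintype.card P - 1 := by
    have h : LinearIndependent K fun I : {I // I ≠ I₀} => W I :=
      hWli.comp _ Subtype.val_injective
    rw [hUrange, finrank_span_eq_card h, Fintype.card_subtype_compl,
      Fintype.card_subtype_eq, hPQ]
  have hspandim : ∀ i : Fin (Fintype.card P), Module.finrank K (Submodule.span K (wb '' Set.Iio i)) = i := by
    intro i
    have h : LinearIndependent K fun k : Set.Iio i => wb k := G.li.comp _ Subtype.val_injective
    rw [Set.image_eq_range, finrank_span_eq_card h]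
    simp
  have hnotle : ∀ i : Fin (Fintype.card P), i.val < Fintype.card P - 1 → ∃ I, I ≠ I₀ ∧ W I ∉ Submodule.span K (wb '' Set.Iio i) := by
    intro i hi
    by_contra! hcon
    have h1 : U ≤ Submodule.span K (wb '' Set.Iio i) := by
      rw [hU, Submodule.span_le]
      rintro _ ⟨I, hI, rfl⟩
      exact hcon I hI
    have h2 := Submodule.finrank_mono h1
    rw [hUdim, hspandim] at h2
    omega
  have hlama : lam' a ≤ D * (Pi I₀ * r) := by
    obtain ⟨I, hI, hIW⟩ := hnotle a (by simp only [a]; omega)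
    exact (G.min a _ (hWO I) hIW).trans ((hhW I).trans
      (mul_le_mul_of_nonneg_left (hPiI I hI) hD0.le))
  have hmemU : ∀ i, i ≠ b → wb i ∈ U := by
    intro i hi
    by_contra hcon
    have h1 := hlowU _ (G.mem i) hcon
    have h2 : h (wb i) ≤ 2 * (D * (Pi I₀ * r)) := (G.le_two i).trans
      (mul_le_mul_of_nonneg_left ((G.mono (ha i hi)).trans hlama) zero_le_two)
    have h3 : Pi I₀ * 1 ≤ Pi I₀ * (2 * D * D' * r) := by
      have := h1.trans (mul_le_mul_of_nonneg_left h2 hD'0.le)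
      linarith
    have h4 := le_of_mul_le_mul_left h3 (hPi0 I₀)
    have h5 : 0 ≤ (2 * D * D' * C₁ + Cb) * r := by positivity
    linarith
  have hspan : Submodule.span K (wb '' Set.Iio b) = U := by
    refine Submodule.eq_of_le_of_finrank_le ?_ ?_
    · rw [Submodule.span_le]
      rintro _ ⟨i, hi, rfl⟩
      exact hmemU i (ne_of_lt hi)
    · rw [hUdim, hspandim]
  have hwb : wb b ∉ U := by
    rw [← hspan]
    exact G.li.notMem_span_image (by simp)
  have hlamb : Pi I₀ ≤ 2 * D' * lam' b := by
    have := (hlowU _ (G.mem b) hwb).trans (mul_le_mul_of_nonneg_left (G.le_two b) hD'0.le)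
    linarith
  have hratio : lam' a ≤ 2 * D * D' * r * lam' b := by
    refine hlama.trans ?_
    have := mul_le_mul_of_nonneg_left hlamb (by positivity : 0 ≤ D * r)
    linarith
  have hM := hlog cw hcw0 (p * m) (by positivity) hcwm wb lam' G
  obtain ⟨c', hc'0, hclose, u, huO, huli, huspan, hu⟩ := hgap cw hcw0 wb lam' G a b hab hb ha
    (by
      have h1 := mul_le_mul_of_nonneg_left hratio hC₁.le
      have h2 : (2 * D * D' * C₁) * r * lam' b < 1 * lam' b := by
        refine mul_lt_mul_of_pos_right ?_ (G.pos b)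
        have h5 : 0 ≤ (2 * D * D' + Cb) * r := by positivity
        linarith
      linarith) _ hM
  refine ⟨c', hc'0, fun v s => ?_, b, u, huO, huli, huspan.trans hspan, fun k₁ => ?_⟩
  · have h1 := abs_sub_abs_le_abs_sub (c' v s) (cw v s)
    have h2 := hclose v s
    have h3 := hcwm v s
    have h4 : p * m + 2 * (C₄ * (1 + p * m)) ≤ Cb * (1 + m) := by
      have : 0 ≤ (p : ℝ) := by positivity
      have : 0 ≤ C₄ * p := by positivity
      have : 0 ≤ C₄ * m := by positivity
      rw [hCb]
      ring_nf
      linarith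
    have h5 : 0 ≤ (2 * D * D' * C₁ + 2 * D * D') * (1 + m) := by positivity
    linarith
  · refine (hu k₁).trans ?_
    have h1 : lam' a / lam' b ≤ 2 * D * D' * r := by
      rw [div_le_iff₀ (G.pos b)]; exact hratio
    have h2 := mul_le_mul_of_nonneg_left h1 hC₁.le
    have h5 : 0 ≤ (2 * D * D' + Cb) * r := by positivity
    linarith

end PlaceSys
end SubB5

section SubB6
open Real Filter

lemma exists_gap_of_sum_gt {N : ℕ} (l : Fin N → ℝ) (hl : Monotone l) (k₀ : Fin N) {s : ℝ}
    (hs : 0 ≤ s) (hk : l k₀ ≤ -(2 * N * s)) (hsum : -(N * (N * s)) < ∑ i, l i) :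
    ∃ k k' : Fin N, k.val + 1 = k'.val ∧ k₀ ≤ k ∧ l k + s ≤ l k' := by
  by_contra! hcon
  have key : ∀ (d : ℕ) (h : k₀.val + d < N), l ⟨k₀.val + d, h⟩ ≤ -(2 * N * s) + d * s := by
    intro d
    induction d with
    | zero => intro h; simpa using hk
    | succ d ih =>
      intro h
      have h1 := ih (by omega)
      have h2 := hcon ⟨k₀.val + d, by omega⟩ ⟨k₀.val + (d + 1), h⟩ rfl (by simp [Fin.le_def])
      push_cast
      linarith
  have hall : ∀ i, l i ≤ -(N * s) := by
    intro i
    rcases le_total i k₀ with h | h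
    · refine (hl h).trans (hk.trans ?_)
      have : 0 ≤ (N : ℝ) * s := by positivity
      linarith
    · have h1 := key (i.val - k₀.val) (by have := i.2; rw [Fin.le_def] at h; omega)
      have h2 : (⟨k₀.val + (i.val - k₀.val), by have := i.2; rw [Fin.le_def] at h; omega⟩ : Fin N)
          = i := Fin.ext (by rw [Fin.le_def] at h; simp only; omega)
      rw [h2] at h1
      have h3 : ((i.val - k₀.val : ℕ) : ℝ) ≤ N := by
        exact_mod_cast (by have := i.2; omega : i.val - k₀.val ≤ N)
      have h4 := mul_le_mul_of_nonneg_right h3 hs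
      linarith
  have h := Finset.sum_le_sum fun i (_ : i ∈ Finset.univ) => hall i
  rw [Finset.sum_const, Finset.card_univ, Fintype.card_fin, nsmul_eq_mul] at h
  linarith

lemma exists_strictMono_const {α : Type*} [Finite α] (f : ℕ → α) :
    ∃ (a : α) (φ : ℕ → ℕ), StrictMono φ ∧ ∀ n, f (φ n) = a := by
  obtain ⟨a, ha⟩ := Finite.exists_infinite_fiber f
  have h : Set.Infinite (f ⁻¹' {a}) := Set.infinite_coe_iff.mp ha
  exact ⟨a, Nat.nth (· ∈ f ⁻¹' {a}), Nat.nth_strictMono h, fun n => Nat.nth_mem_of_infinite h n⟩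

lemma exists_strictMono_injective {α : Type*} (f : ℕ → α) (hf : ∀ a, (f ⁻¹' {a}).Finite) :
    ∃ φ : ℕ → ℕ, StrictMono φ ∧ Function.Injective (f ∘ φ) := by
  obtain ⟨g, h | h⟩ := exists_increasing_or_nonincreasing_subseq (· = ·) f
  · exfalso
    refine Set.infinite_range_of_injective (f := fun n => g (n + 1)) (fun a b hab => ?_)
      ((hf (f (g 0))).subset ?_)
    · simpa using g.injective hab
    · rintro _ ⟨n, rfl⟩
      exact (h 0 (n + 1) (by omega)).symm
  · refine ⟨g, g.strictMono, fun a b hab => ?_⟩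
    by_contra hne
    rcases lt_or_gt_of_ne hne with h1 | h1
    · exact h _ _ h1 hab
    · exact h _ _ h1 hab.symm

namespace PlaceSys

variable {K : Type} [Field K] [Height.AdmissibleAbsValues K] (S : PlaceSys K)
variable {ι : Type} [LinearOrder ι] [Fintype ι]

lemma exists_minima_gap {L : S.V → Matrix ι ι K} (hL : ∀ v, IsUnit (L v).det) :
    ∃ s₀ : ℝ, ∀ c : S.V → ι → ℝ, ∑ v, ∑ i, c v i = 0 → ∀ s, s₀ ≤ s → ∀ x : ι → K, x ≠ 0 →
      (∀ i, x i ∈ S.O) → S.twH L c x ≤ exp (-(2 * Fintype.card ι * s)) →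
      ∃ w lam, S.IsMinima (S.twH L c) w lam ∧ ∃ k k', k.val + 1 = k'.val ∧
        x ∈ Submodule.span K (w '' Set.Iic k) ∧ lam k * exp s ≤ lam k' := by
  obtain ⟨C, hC, hlow⟩ := S.exists_le_prod_twH hL
  set N := Fintype.card ι with hN
  refine ⟨max 0 (log (C * 2 ^ N) + 1), fun c hc s hs x hx0 hxO hx => ?_⟩
  have hs0 : 0 ≤ s := (le_max_left _ _).trans hs
  have hs1 := (le_max_right _ _).trans hs
  obtain ⟨w, lam, H⟩ := S.exists_isMinima_twH hL c
  obtain ⟨k₀, hk₀, hk₀'⟩ := H.exists_index hx0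
  have hN0 : 1 ≤ N := by have := k₀.2; omega
  have h1 := hlow c hc (fun i => w (Fintype.equivFin ι i)) (fun _ _ => H.mem _ _)
    (H.li.comp _ (Fintype.equivFin ι).injective)
  rw [(Fintype.equivFin ι).prod_comp (fun i => S.twH L c (w i))] at h1
  have h2 : 1 ≤ C * 2 ^ N * ∏ i, lam i := by
    refine h1.trans ?_
    rw [mul_assoc]
    refine mul_le_mul_of_nonneg_left ?_ hC.le
    have h3 : ∏ i, S.twH L c (w i) ≤ ∏ i, (2 * lam i) :=
      Finset.prod_le_prod (fun _ _ => S.twH_nonneg _ _ _) fun _ _ => H.le_two _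
    rwa [Finset.prod_mul_distrib, Finset.prod_const, Finset.card_univ, Fintype.card_fin] at h3
  have hprod : 0 < ∏ i, lam i := Finset.prod_pos fun i _ => H.pos i
  have h3 : 0 ≤ log (C * 2 ^ N) + ∑ i, log (lam i) := by
    rw [← log_prod fun i _ => (H.pos i).ne', ← log_mul (by positivity) hprod.ne']
    exact log_nonneg h2
  obtain ⟨k, k', hkk, hk, hgap⟩ := exists_gap_of_sum_gt (fun i => log (lam i))
    (fun i j hij => log_le_log (H.pos i) (H.mono hij)) k₀ hs0
    (by
      have h4 := (H.min k₀ x hxO hk₀').trans hx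
      have h5 := log_le_log (H.pos k₀) h4
      rwa [log_exp] at h5)
    (by
      have hN1 : (1 : ℝ) ≤ N := by exact_mod_cast hN0
      have h6 : s ≤ N * s := le_mul_of_one_le_left hs0 hN1
      have h7 : N * s ≤ N * (N * s) := le_mul_of_one_le_left (by positivity) hN1
      linarith)
  refine ⟨w, lam, H, k, k', hkk, Submodule.span_mono (Set.image_mono (Set.Iic_subset_Iic.mpr hk))
    hk₀, ?_⟩
  have h8 := exp_le_exp.mpr hgap
  rwa [exp_add, exp_log (H.pos _), exp_log (H.pos _)] at h8

/-- The parametric subspace theorem for solutions: points with small twisted height infinitely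
often lie on a common hyperplane. -/
theorem exists_hyperplane_of_twH_le [CharZero K] {L : S.V → Matrix ι ι K}
    (hL : ∀ v, IsUnit (L v).det) (c : S.V → ι → ℝ) (hc : ∑ v, ∑ i, c v i = 0) {δ : ℝ}
    (hδ : 0 < δ) {q : ℕ → ℝ} (hq : Tendsto q atTop atTop) (x : ℕ → ι → K)
    (hxO : ∀ j i, x j i ∈ S.O) (hx0 : ∀ j, x j ≠ 0)
    (hx : ∀ j, S.twH L (fun v i => q j * c v i) (x j) ≤ exp (-δ * q j)) :
    ∃ a : ι → K, a ≠ 0 ∧ {j | ∑ i, a i * x j i = 0}.Infinite := by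
  classical
  by_contra! hcon
  have hι : Nonempty ι := by
    obtain ⟨i, -⟩ := Function.ne_iff.mp (hx0 0)
    exact ⟨i⟩
  have hcon' : ∀ F : Submodule K (ι → K), F ≠ ⊤ → {j | x j ∈ F}.Finite := by
    intro F hF
    obtain ⟨f, hf0, hf⟩ := Submodule.exists_le_ker_of_lt_top F hF.lt_top
    have hfx : ∀ y, f y = ∑ i, f (Pi.single i 1) * y i := by
      intro y
      conv_lhs => rw [pi_eq_sum_univ' y]
      simp [mul_comm]
    have ha : (fun i => f (Pi.single i 1)) ≠ 0 := by
      intro h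
      refine hf0 (LinearMap.ext fun y => ?_)
      rw [hfx]
      simp only [congrFun h, Pi.zero_apply, zero_mul, Finset.sum_const_zero, LinearMap.zero_apply]
    refine (hcon _ ha).subset fun j hj => ?_
    have := hf hj
    rw [LinearMap.mem_ker, hfx] at this
    exact this
  set N := Fintype.card ι with hN
  have hN0 : 0 < N := Fintype.card_pos
  obtain ⟨s₀, hs₀⟩ := S.exists_minima_gap hL
  set σ : ℝ := δ / (2 * N) with hσ
  have hσ0 : 0 < σ := by positivity
  have hσN : 2 * N * σ = δ := by rw [hσ]; field_simp
  have hqc : ∀ j, ∑ v, ∑ i, q j * c v i = 0 := fun j => by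
    simp_rw [← Finset.mul_sum]; rw [hc, mul_zero]
  have hsq : ∀ᶠ j in atTop, s₀ ≤ σ * q j :=
    (hq.const_mul_atTop hσ0).eventually_ge_atTop s₀
  obtain ⟨J, hJ⟩ := eventually_atTop.mp hsq
  have hstep : ∀ j, ∃ w lam, S.IsMinima (S.twH L fun v i => q (J + j) * c v i) w lam ∧
      ∃ kk : Fin N × Fin N, kk.1.val + 1 = kk.2.val ∧
        x (J + j) ∈ Submodule.span K (w '' Set.Iic kk.1) ∧
        lam kk.1 * exp (σ * q (J + j)) ≤ lam kk.2 := by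
    intro j
    obtain ⟨w, lam, H, k, k', h1, h2, h3⟩ := hs₀ _ (hqc (J + j)) _ (hJ (J + j) (by omega)) _
      (hx0 (J + j)) (hxO (J + j)) ((hx (J + j)).trans_eq (by
        congr 1
        rw [← mul_assoc, hσN, neg_mul]))
    exact ⟨w, lam, H, (k, k'), h1, h2, h3⟩
  choose w lam H kk hkk hmem hgap using hstep
  obtain ⟨⟨k, k'⟩, φ, hφ, hφk⟩ := exists_strictMono_const kk
  have hkk' : k.val + 1 = k'.val := by
    have := hkk (φ 0)
    rwa [hφk] at this
  set F : ℕ → Submodule K (ι → K) := fun j => Submodule.span K (w (φ j) '' Set.Iic k) with hF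
  have hxF : ∀ j, x (J + φ j) ∈ F j := fun j => by
    have := hmem (φ j)
    rwa [hφk] at this
  have hFtop : ∀ j, F j ≠ ⊤ := by
    intro j hj
    have h1 := (H (φ j)).li.notMem_span_image (s := Set.Iic k) (x := k') (by
      simp only [Set.mem_Iic, Fin.le_def]; omega)
    exact h1 (by rw [show Submodule.span K (w (φ j) '' Set.Iic k) = F j from rfl, hj]; trivial)
  have hJφ : Function.Injective fun j => J + φ j := fun a b hab => by
    simp only [Nat.add_left_cancel_iff] at hab
    exact hφ.injective hab
  obtain ⟨ψ, hψ, hFψ⟩ := exists_strictMono_injective F fun G => by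
    by_cases hG : G = ⊤
    · refine Set.Finite.subset Set.finite_empty fun j hj => ?_
      exact hFtop j (Set.mem_singleton_iff.mp hj |>.trans hG)
    · refine ((hcon' G hG).preimage hJφ.injOn).subset fun j hj => ?_
      have := hxF j
      rw [Set.mem_singleton_iff.mp hj] at this
      exact this
  -- the wedge
  set p := (Finset.Ici k').card with hp
  let I₀ : Set.powersetCard (Fin N) p := ⟨Finset.Ici k', rfl⟩
  have hI₀ : ∃ I : Set.powersetCard (Fin N) p, I ≠ I₀ := by
    have hk : k ∉ (Finset.Ici k').erase k' := by
      simp only [Finset.mem_erase, Finset.mem_Ici, Fin.le_def]; omega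
    refine ⟨⟨insert k ((Finset.Ici k').erase k'), ?_⟩, fun h => ?_⟩
    · change (insert k ((Finset.Ici k').erase k')).card = p
      rw [Finset.card_insert_of_notMem hk, Finset.card_erase_of_mem (by simp), hp]
      have : 0 < (Finset.Ici k').card := Finset.card_pos.mpr ⟨k', by simp⟩
      omega
    · have h1 : insert k ((Finset.Ici k').erase k') = Finset.Ici k' := congrArg Subtype.val h
      have h2 : k ∈ Finset.Ici k' := h1 ▸ Finset.mem_insert_self _ _
      simp only [Finset.mem_Ici, Fin.le_def] at h2
      omega
  obtain ⟨C, hC, hwedge⟩ := S.exists_wedge_rescaled hL p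
  set m₀ : ℝ := ∑ v, ∑ i, |c v i| with hm₀
  have hcm : ∀ v i, |c v i| ≤ m₀ := fun v i =>
    (Finset.single_le_sum (f := fun i => |c v i|) (fun _ _ => abs_nonneg _)
      (Finset.mem_univ i)).trans
    (Finset.single_le_sum (f := fun v => ∑ i, |c v i|)
      (fun _ _ => Finset.sum_nonneg fun _ _ => abs_nonneg _) (Finset.mem_univ v))
  set N' := Fintype.card (Set.powersetCard ι p) with hN'
  set θ : ℕ → ℕ := fun j => J + φ (ψ j) with hθ
  have hθt : Tendsto θ atTop atTop :=
    tendsto_atTop_mono (fun j => Nat.le_add_left _ _) (hφ.comp hψ).tendsto_atTop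
  have hqθ := hq.comp hθt
  have hev : ∀ᶠ j in atTop, log C + 1 ≤ σ / 2 * q (θ j) ∧ 1 ≤ q (θ j) :=
    ((hqθ.const_mul_atTop (half_pos hσ0)).eventually_ge_atTop _).and
      (hqθ.eventually_ge_atTop 1)
  obtain ⟨J', hJ'⟩ := eventually_atTop.mp hev
  have hst : ∀ j, ∃ c' : S.V → Set.powersetCard ι p → ℝ, ∑ v, ∑ s, c' v s = 0 ∧
      (∀ v s, |c' v s| ≤ C * (1 + m₀) * q (θ (J' + j))) ∧
      ∃ b : Fin N', ∃ u : {i // i ≠ b} → Set.powersetCard ι p → K, (∀ k i, u k i ∈ S.O) ∧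
        LinearIndependent K u ∧
        Submodule.span K (Set.range u) = Submodule.span K
          ((fun I : Set.powersetCard (Fin N) p =>
          wedge fun k => w (φ (ψ (J' + j))) (Set.powersetCard.ofFinEmbEquiv.symm I k)) ''
            {I | I ≠ I₀}) ∧
        ∀ k₁, S.twH (fun v => compound p (L v)) c' (u k₁) ≤
          exp (-(σ / (2 * N')) * q (θ (J' + j))) := by
    intro j
    obtain ⟨hq1, hq2⟩ := hJ' (J' + j) (by omega)
    have hg := hgap (φ (ψ (J' + j)))
    rw [hφk] at hg
    simp only at hg
    rw [show J + φ (ψ (J' + j)) = θ (J' + j) from rfl] at hg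
    have Hj := H (φ (ψ (J' + j)))
    rw [show J + φ (ψ (J' + j)) = θ (J' + j) from rfl] at Hj
    set Q := q (θ (J' + j)) with hQ
    have hpk := Hj.pos k
    have hσQ : 0 < σ / 2 * Q := by positivity
    have hCe : C < exp (σ / 2 * Q) := by
      rw [← log_lt_iff_lt_exp hC]; linarith
    obtain ⟨c', hc', hc'm, b, u, huO, huli, husp, hu⟩ := hwedge _ (hqc (θ (J' + j))) _ _ Hj k k' I₀
      (fun i hi => by
        have : i ∉ Finset.Ici k' := hi
        simp only [Finset.mem_Ici, Fin.le_def] at this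
        rw [Fin.le_def]; omega)
      (fun i hi => by
        have : i ∈ Finset.Ici k' := hi
        exact Finset.mem_Ici.mp this)
      hI₀ (by
        refine lt_of_lt_of_le ?_ hg
        rw [mul_comm]
        refine mul_lt_mul_of_pos_left (hCe.trans_le (exp_le_exp.mpr ?_)) hpk
        linarith) (m₀ * Q) (by positivity) (fun v i => by
          rw [abs_mul, mul_comm, abs_of_pos (by linarith : 0 < Q)]
          exact mul_le_mul_of_nonneg_right (hcm v i) (by linarith))
    refine ⟨c', hc', fun v s => (hc'm v s).trans ?_, b, u, huO, huli, husp, fun k₁ => ?_⟩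
    · rw [mul_assoc]
      refine mul_le_mul_of_nonneg_left ?_ hC.le
      linarith
    · have hNpos : 0 < N' := by have := b.2; omega
      refine le_of_pow_le_pow_left₀ hNpos.ne' (exp_pos _).le ((hu k₁).trans ?_)
      rw [← exp_nat_mul]
      have h1 : lam (φ (ψ (J' + j))) k / lam (φ (ψ (J' + j))) k' ≤ exp (-(σ * Q)) := by
        rw [div_le_iff₀ (Hj.pos k'), exp_neg, inv_mul_eq_div, le_div_iff₀ (exp_pos _)]
        exact hg
      calc C * (lam (φ (ψ (J' + j))) k / lam (φ (ψ (J' + j))) k')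
          ≤ exp (σ / 2 * Q) * exp (-(σ * Q)) := by
            have := div_pos hpk (Hj.pos k')
            gcongr
        _ = _ := by
            rw [← exp_add]
            congr 1
            field_simp
            ring
  choose c' hc' hc'm b u huO huli husp hu using hst
  obtain ⟨b₀, χ, hχ, hχb⟩ := exists_strictMono_const b
  have hu' : ∀ j, ∃ u' : {i // i ≠ b₀} → Set.powersetCard ι p → K, (∀ k i, u' k i ∈ S.O) ∧
      LinearIndependent K u' ∧
      Submodule.span K (Set.range u') = Submodule.span K (Set.range (u (χ j))) ∧
      ∀ k₁, S.twH (fun v => compound p (L v)) (c' (χ j)) (u' k₁) ≤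
          exp (-(σ / (2 * N')) * q (θ (J' + χ j))) := by
    intro j
    let e : {i // i ≠ b₀} ≃ {i // i ≠ b (χ j)} := Equiv.subtypeEquivRight fun i => by rw [hχb]
    refine ⟨u (χ j) ∘ e, fun _ _ => huO _ _ _, (huli _).comp _ e.injective, ?_, fun _ => hu _ _⟩
    rw [e.surjective.range_comp]
  choose u' hu'O hu'li hu'sp hu' using hu'
  have hNpos : 0 < N' := by have := b₀.2; omega
  have hχt : Tendsto (fun j => J' + χ j) atTop atTop :=
    tendsto_atTop_mono (fun j => by omega) hχ.tendsto_atTop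
  obtain ⟨i, j, hij, hU⟩ := S.exists_span_eq_of_weights (κ := {i : Fin N' // i ≠ b₀})
    (by rw [Fintype.card_subtype_compl, Fintype.card_subtype_eq, Fintype.card_fin]; omega)
    (fun v => isUnit_det_compound (hL v)) (fun j => c' (χ j)) (fun j => hc' _)
    (δ := σ / (2 * N')) (M := C * (1 + m₀)) (by positivity) (hqθ.comp hχt)
    (fun j => by
      have := (hJ' (J' + χ j) (by omega)).2
      simp only [Function.comp]
      linarith) (fun j v s => hc'm _ v s) u' hu'O hu'li hu'
  rw [hu'sp, hu'sp, husp, husp] at hU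
  apply hij
  have hset : Set.Iic k = {i | i ∉ (I₀ : Finset (Fin N))} := by
    ext i
    change i ≤ k ↔ i ∉ Finset.Ici k'
    simp only [Finset.mem_Ici, Fin.le_def]
    omega
  have hinj : (J' + χ i) = (J' + χ j) := by
    refine hFψ ?_
    simp only [Function.comp, hF]
    rw [hset]
    ext y
    rw [wedge_mem_span_iff (H _).li (by simp) I₀, wedge_mem_span_iff (H _).li (by simp) I₀,
      hU]
  exact hχ.injective (Nat.add_left_cancel hinj)

end PlaceSys
end SubB6

section Plc1
open NumberField Height

/-- The square root of an absolute value. -/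
noncomputable def sqrtAbv {K : Type*} [Field K] (v : AbsoluteValue K ℝ) : AbsoluteValue K ℝ where
  toFun x := √(v x)
  map_mul' x y := by rw [map_mul, Real.sqrt_mul (v.nonneg x)]
  nonneg' x := Real.sqrt_nonneg _
  eq_zero' x := by rw [Real.sqrt_eq_zero (v.nonneg x), v.eq_zero]
  add_le' x y := by
    rw [Real.sqrt_le_iff]
    refine ⟨by positivity, (v.add_le x y).trans ?_⟩
    have h1 := Real.sq_sqrt (v.nonneg x)
    have h2 := Real.sq_sqrt (v.nonneg y)
    nlinarith [Real.sqrt_nonneg (v x), Real.sqrt_nonneg (v y)]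

lemma exists_arch_cells {A θ : ℝ} (hθ : 0 < θ) (hA : θ ≤ A) :
    ∃ m : ℕ, (m : ℝ) ≤ 25 * (A / θ) ^ 2 ∧ ∃ f : ℂ → Fin m, ∀ z z', ‖z‖ ≤ A → ‖z'‖ ≤ A →
      f z = f z' → ‖z - z'‖ ≤ θ := by
  have hA0 : 0 < A := hθ.trans_le hA
  set s := θ / 2 with hs
  have hs0 : 0 < s := half_pos hθ
  set m := ⌊2 * A / s⌋₊ + 1 with hm
  have hmle : (m : ℝ) ≤ 5 * (A / θ) := by
    rw [hm]
    push_cast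
    have h1 := Nat.floor_le (a := 2 * A / s) (by positivity)
    have h2 : 2 * A / s = 4 * (A / θ) := by rw [hs]; field_simp; ring
    have h3 : 1 ≤ A / θ := (one_le_div hθ).mpr hA
    linarith
  have hcell : ∀ t : ℝ, |t| ≤ A → ⌊(t + A) / s⌋₊ < m := by
    intro t ht
    rw [hm, Nat.lt_succ_iff]
    refine Nat.floor_le_floor ?_
    have := (abs_le.mp ht).2
    gcongr
    linarith
  have hclose : ∀ t t' : ℝ, |t| ≤ A → |t'| ≤ A → ⌊(t + A) / s⌋₊ = ⌊(t' + A) / s⌋₊ →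
      |t - t'| ≤ s := by
    intro t t' ht ht' h
    have h1 : 0 ≤ (t + A) / s := div_nonneg (by linarith [(abs_le.mp ht).1]) hs0.le
    have h1' : 0 ≤ (t' + A) / s := div_nonneg (by linarith [(abs_le.mp ht').1]) hs0.le
    have h2 := Nat.floor_le h1
    have h3 := Nat.lt_floor_add_one ((t + A) / s)
    have h2' := Nat.floor_le h1'
    have h3' := Nat.lt_floor_add_one ((t' + A) / s)
    rw [← h] at h2' h3'
    have h4 : (t - t') / s = (t + A) / s - (t' + A) / s := by ring
    have h5 : |(t - t') / s| ≤ 1 := by rw [h4, abs_le]; constructor <;> linarith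
    rwa [abs_div, abs_of_pos hs0, div_le_one hs0] at h5
  have hm0 : 0 < m := Nat.succ_pos _
  refine ⟨m * m, ?_, fun z => finProdFinEquiv (⟨⌊(z.re + A) / s⌋₊ % m, Nat.mod_lt _ hm0⟩,
    ⟨⌊(z.im + A) / s⌋₊ % m, Nat.mod_lt _ hm0⟩), fun z z' hz hz' h => ?_⟩
  · push_cast
    have := mul_le_mul hmle hmle (Nat.cast_nonneg _) (by positivity)
    nlinarith
  · have h1 := finProdFinEquiv.injective h
    simp only [Prod.mk.injEq, Fin.mk.injEq] at h1
    have hr := (Complex.abs_re_le_norm z).trans hz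
    have hr' := (Complex.abs_re_le_norm z').trans hz'
    have hi := (Complex.abs_im_le_norm z).trans hz
    have hi' := (Complex.abs_im_le_norm z').trans hz'
    rw [Nat.mod_eq_of_lt (hcell _ hr), Nat.mod_eq_of_lt (hcell _ hr'),
      Nat.mod_eq_of_lt (hcell _ hi), Nat.mod_eq_of_lt (hcell _ hi')] at h1
    have h2 := hclose _ _ hr hr' h1.1
    have h3 := hclose _ _ hi hi' h1.2
    have h4 := Complex.norm_le_abs_re_add_abs_im (z - z')
    rw [Complex.sub_re, Complex.sub_im] at h4
    linarith

variable {K : Type} [Field K] [NumberField K]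

lemma FinitePlace.exists_int_cells (v : FinitePlace K) : ∃ κ : ℝ, 0 < κ ∧ ∀ η : ℝ, 0 < η → η ≤ 1 →
    ∃ m : ℕ, (m : ℝ) ≤ κ / η ∧ ∃ f : 𝓞 K → Fin m, ∀ z z', f z = f z' →
      v ((z : K) - z') ≤ η := by
  set P := v.maximalIdeal.asIdeal with hP
  set N : ℕ := Ideal.absNorm P with hN
  have hN1 : 1 < N := HeightOneSpectrum.one_lt_absNorm v.maximalIdeal
  have hN1' : (1 : ℝ) < N := by exact_mod_cast hN1
  refine ⟨N, by positivity, fun η hη hη1 => ?_⟩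
  obtain ⟨k, hk1, hk2⟩ := exists_nat_pow_near (one_le_inv_iff₀.mpr ⟨hη, hη1⟩) hN1'
  have hPk : P ^ (k + 1) ≠ ⊥ := pow_ne_zero _ v.maximalIdeal.ne_bot
  have hfin : Finite (𝓞 K ⧸ P ^ (k + 1)) := Ideal.finiteQuotientOfFreeOfNeBot _ hPk
  refine ⟨Nat.card (𝓞 K ⧸ P ^ (k + 1)), ?_, fun z => Finite.equivFin _ (Ideal.Quotient.mk _ z),
    fun z z' h => ?_⟩
  · rw [← Submodule.cardQuot_apply, ← Ideal.absNorm_apply, map_pow, pow_succ, ← hN, Nat.cast_mul,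
      Nat.cast_pow, div_eq_mul_inv, mul_comm]
    exact mul_le_mul_of_nonneg_left hk1 (by positivity)
  · have h1 := (Finite.equivFin _).injective h
    rw [Ideal.Quotient.eq] at h1
    by_cases h0 : z - z' = 0
    · rw [sub_eq_zero] at h0
      rw [h0, sub_self, map_zero]
      exact hη.le
    have h2 := FinitePlace.apply_mul_absNorm_pow_eq_one v h0
    have h3 : P ^ (k + 1) ∣ Ideal.span {z - z'} := by
      rw [Ideal.dvd_span_singleton]; exact h1
    have hfm : FiniteMultiplicity P (Ideal.span {z - z'}) :=
      FiniteMultiplicity.of_prime_left v.maximalIdeal.prime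
        (by rw [Ne, Ideal.zero_eq_bot, Ideal.span_singleton_eq_bot]; exact h0)
    have h4 : k + 1 ≤ multiplicity P (Ideal.span {z - z'}) := hfm.le_multiplicity_of_pow_dvd h3
    rw [← hP, ← hN] at h2
    have h5 : (N : ℝ) ^ (k + 1) ≤ N ^ multiplicity P (Ideal.span {z - z'}) :=
      pow_le_pow_right₀ hN1'.le h4
    have h6 : v ((z : K) - z') * η⁻¹ ≤ 1 := by
      rw [← h2]
      push_cast
      exact mul_le_mul_of_nonneg_left (hk2.le.trans h5) (apply_nonneg v _)
    rwa [← div_eq_mul_inv, div_le_one hη] at h6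

/-- The absolute values attached to the archimedean places and a finite set of finite places,
normalized so that the product formula has equal exponents over a totally complex field. -/
noncomputable def placeAbv (T : Finset (FinitePlace K)) :
    InfinitePlace K ⊕ T → AbsoluteValue K ℝ :=
  Sum.elim (fun w => w.1) (fun v => sqrtAbv v.1.1)

/-- The scale of a box of integers of size `A` at each place. -/
noncomputable def placeSize (T : Finset (FinitePlace K)) (A : ℝ) : InfinitePlace K ⊕ T → ℝ :=
  Sum.elim (fun _ => A) (fun _ => 1)

lemma exists_place_cells (T : Finset (FinitePlace K)) (v : InfinitePlace K ⊕ T) :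
    ∃ κ : ℝ, 0 < κ ∧ ∀ A θ : ℝ, 0 < θ → θ ≤ placeSize T A v → ∃ m : ℕ,
      (m : ℝ) ≤ κ * (placeSize T A v / θ) ^ 2 ∧ ∃ f : 𝓞 K → Fin m, ∀ z z' : 𝓞 K,
      (∀ w : InfinitePlace K, w (z : K) ≤ A) → (∀ w : InfinitePlace K, w (z' : K) ≤ A) →
      f z = f z' → placeAbv T v ((z : K) - z') ≤ θ := by
  rcases v with w | v
  · refine ⟨25, by norm_num, fun A θ hθ hA => ?_⟩
    obtain ⟨m, hm, f, hf⟩ := exists_arch_cells hθ hA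
    refine ⟨m, hm, fun z => f (w.embedding (z : K)), fun z z' hz hz' h => ?_⟩
    have := hf _ _ (by rw [InfinitePlace.norm_embedding_eq]; exact hz w)
      (by rw [InfinitePlace.norm_embedding_eq]; exact hz' w) h
    rw [← map_sub, InfinitePlace.norm_embedding_eq] at this
    exact this
  · obtain ⟨κ, hκ, h⟩ := FinitePlace.exists_int_cells v.1
    refine ⟨κ, hκ, fun A θ hθ hA => ?_⟩
    have hA1 : θ ≤ 1 := hA
    obtain ⟨m, hm, f, hf⟩ := h (θ ^ 2) (by positivity) (pow_le_one₀ hθ.le hA1)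
    refine ⟨m, hm.trans_eq ?_, f, fun z z' _ _ hzz => ?_⟩
    · change _ = κ * (1 / θ) ^ 2
      rw [one_div, inv_pow, div_eq_mul_inv]
    · exact Real.sqrt_le_iff.mpr ⟨hθ.le, hf z z' hzz⟩

end Plc1

section Plc2
open NumberField Height Filter

variable {K : Type} [Field K] [NumberField K]

/-- The ring of `T`-integers. -/
def tIntegers (T : Finset (FinitePlace K)) : Subring K where
  carrier := {x | ∀ v ∉ T, v x ≤ 1}
  mul_mem' hx hy v hv := by
    rw [map_mul]; exact mul_le_one₀ (hx v hv) (apply_nonneg v _) (hy v hv)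
  one_mem' v _ := by rw [map_one]
  add_mem' hx hy v hv := (FinitePlace.add_le v _ _).trans (max_le (hx v hv) (hy v hv))
  zero_mem' v _ := by rw [map_zero]; exact zero_le_one
  neg_mem' {x} hx v hv := by
    have h : v (-x) = v x := v.1.map_neg x
    rw [h]; exact hx v hv

lemma FinitePlace.int_le_one (v : FinitePlace K) (x : 𝓞 K) : v (x : K) ≤ 1 := by
  rw [← FinitePlace.norm_embedding_eq]
  exact FinitePlace.norm_le_one K v.maximalIdeal x

lemma int_mem_tIntegers (T : Finset (FinitePlace K)) (x : 𝓞 K) : (x : K) ∈ tIntegers T :=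
  fun v _ => FinitePlace.int_le_one v x

lemma finprod_le_prod_of_le_one {α : Type*} {f : α → ℝ} (hf : f.HasFiniteMulSupport)
    (hf0 : ∀ v, 0 ≤ f v) (T : Finset α) (hT : ∀ v ∉ T, f v ≤ 1) :
    ∏ᶠ v, f v ≤ ∏ v ∈ T, f v := by
  classical
  rw [finprod_eq_prod_of_mulSupport_subset (s := T ∪ hf.toFinset) f (by
    intro v hv; exact Finset.mem_coe.mpr (Finset.mem_union_right _ (hf.mem_toFinset.mpr hv)))]
  rw [← Finset.prod_sdiff (s₁ := T) Finset.subset_union_left]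
  refine mul_le_of_le_one_left (Finset.prod_nonneg fun v _ => hf0 v)
    (Finset.prod_le_one (fun v _ => hf0 v) fun v hv => hT v (Finset.mem_sdiff.mp hv).2)

lemma prod_placeAbv (T : Finset (FinitePlace K)) (x : K) :
    ∏ v, placeAbv T v x = (∏ w : InfinitePlace K, w x) * ∏ v ∈ T, √(v x) := by
  rw [Fintype.prod_sum_type, ← Finset.prod_coe_sort T fun v => √(v x)]
  rfl

lemma prod_placeAbv_sq [IsTotallyComplex K] (T : Finset (FinitePlace K)) (x : K) :
    (∏ v, placeAbv T v x) ^ 2 = (∏ w : InfinitePlace K, w x ^ w.mult) * ∏ v ∈ T, v x := by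
  rw [prod_placeAbv, mul_pow, ← Finset.prod_pow, ← Finset.prod_pow]
  congr 1
  · exact Finset.prod_congr rfl fun w _ => by rw [IsTotallyComplex.mult_eq]
  · exact Finset.prod_congr rfl fun v _ => Real.sq_sqrt (apply_nonneg v _)

lemma one_le_prod_placeAbv [IsTotallyComplex K] (T : Finset (FinitePlace K)) {x : K}
    (hx : x ∈ tIntegers T) (hx0 : x ≠ 0) : 1 ≤ ∏ v, placeAbv T v x := by
  rw [← one_le_sq_iff₀ (Finset.prod_nonneg fun v _ => (placeAbv T v).nonneg x), prod_placeAbv_sq,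
    ← prod_abs_eq_one hx0]
  refine mul_le_mul_of_nonneg_left ?_ (Finset.prod_nonneg fun w _ => pow_nonneg (apply_nonneg w _) _)
  exact finprod_le_prod_of_le_one (FinitePlace.hasFiniteMulSupport hx0)
    (fun v => apply_nonneg v _) T hx

lemma prod_placeAbv_eq_one [IsTotallyComplex K] (T : Finset (FinitePlace K)) {x : K}
    (hx : ∀ v ∉ T, v x = 1) (hx0 : x ≠ 0) : ∏ v, placeAbv T v x = 1 := by
  rw [← pow_left_inj₀ (Finset.prod_nonneg fun v _ => (placeAbv T v).nonneg x) zero_le_one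
    two_ne_zero, one_pow, prod_placeAbv_sq, ← prod_abs_eq_one hx0]
  congr 1
  refine (finprod_eq_prod_of_mulSupport_subset _ fun v hv => ?_).symm
  by_contra h
  exact hv (hx v h)

lemma exists_int_mul (x : K) : ∃ n : 𝓞 K, n ≠ 0 ∧ ∃ y : 𝓞 K, (n : K) * x = y := by
  obtain ⟨⟨y, d⟩, hd⟩ := IsLocalization.surj (nonZeroDivisors (𝓞 K)) x
  exact ⟨d, nonZeroDivisors.coe_ne_zero d, y, by rw [mul_comm]; exact hd⟩

lemma mulHeight_le_placeAbv [IsTotallyComplex K] (T : Finset (FinitePlace K)) {ι : Type}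
    [Fintype ι] (x : ι → K) (hx : ∀ i, x i ∈ tIntegers T) (hx0 : x ≠ 0) :
    mulHeight x ≤ (∏ v, ∑ i, placeAbv T v (x i)) ^ 2 := by
  obtain ⟨i₀, hi₀⟩ := Function.ne_iff.mp hx0
  have : Nonempty ι := ⟨i₀⟩
  rw [NumberField.mulHeight_eq hx0, Fintype.prod_sum_type, mul_pow, ← Finset.prod_pow, ← Finset.prod_pow]
  have hsup0 : ∀ v : FinitePlace K, 0 ≤ ⨆ i, v (x i) :=
    fun v => Real.iSup_nonneg fun i => apply_nonneg v _
  refine mul_le_mul ?_ ?_ (finprod_nonneg hsup0)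
    (Finset.prod_nonneg fun w _ => sq_nonneg _)
  · refine Finset.prod_le_prod (fun w _ => pow_nonneg (Real.iSup_nonneg fun i => apply_nonneg w _) _)
      fun w _ => ?_
    rw [IsTotallyComplex.mult_eq]
    refine pow_le_pow_left₀ (Real.iSup_nonneg fun i => apply_nonneg w _) (ciSup_le fun i => ?_) 2
    exact Finset.single_le_sum (f := fun i => w (x i)) (fun i _ => apply_nonneg w _)
      (Finset.mem_univ i)
  · have hfin : (fun v : FinitePlace K => ⨆ i, v (x i)).HasFiniteMulSupport := by
      have h2 : (fun v : FinitePlace K => ⨆ i : {i // x i ≠ 0}, v (x i)).HasFiniteMulSupport := by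
        have : Nonempty {i // x i ≠ 0} := ⟨⟨i₀, hi₀⟩⟩
        exact Function.HasFiniteMulSupport.iSup fun i => FinitePlace.hasFiniteMulSupport i.2
      refine h2.subset fun v hv hv' => hv ?_
      rw [← hv']
      have : Nonempty {i // x i ≠ 0} := ⟨⟨i₀, hi₀⟩⟩
      refine le_antisymm (ciSup_le fun i => ?_) (ciSup_le fun i =>
        le_ciSup (f := fun i => v (x i)) (Set.finite_range _).bddAbove i.1)
      by_cases hi : x i = 0
      · rw [hi, map_zero]
        exact Real.iSup_nonneg fun i => apply_nonneg v _
      · exact le_ciSup (f := fun i : {i // x i ≠ 0} => v (x i)) (Set.finite_range _).bddAbove ⟨i, hi⟩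
    refine (finprod_le_prod_of_le_one hfin hsup0 T fun v hv => ciSup_le fun i => hx i v hv).trans ?_
    rw [← Finset.prod_coe_sort T]
    refine Finset.prod_le_prod (fun v _ => hsup0 v) fun v _ => ciSup_le fun i => ?_
    rw [← Real.sq_sqrt (apply_nonneg (v : FinitePlace K) (x i))]
    refine pow_le_pow_left₀ (Real.sqrt_nonneg _) ?_ 2
    exact Finset.single_le_sum (f := fun i => placeAbv T (Sum.inr v) (x i))
      (fun i _ => (placeAbv T _).nonneg _) (Finset.mem_univ i)

lemma one_le_prod_of_forall_one_le {ι : Type*} {s : Finset ι} {f : ι → ℝ}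
    (hf : ∀ i, 1 ≤ f i) : 1 ≤ ∏ i ∈ s, f i :=
  Finset.prod_induction f (fun y => 1 ≤ y) (fun _ _ => one_le_mul_of_one_le_of_one_le) le_rfl
    fun i _ => hf i

lemma single_le_prod_of_forall_one_le {ι : Type*} {s : Finset ι} {f : ι → ℝ}
    (hf : ∀ i, 1 ≤ f i) {j : ι} (hj : j ∈ s) : f j ≤ ∏ i ∈ s, f i := by
  classical
  rw [← Finset.mul_prod_erase s f hj]
  exact le_mul_of_one_le_right (zero_le_one.trans (hf j)) (one_le_prod_of_forall_one_le hf)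

lemma InfinitePlace.le_mulHeight₁ (w : InfinitePlace K) (x : K) : w x ≤ mulHeight₁ x := by
  rw [NumberField.mulHeight₁_eq]
  have h1 : w x ≤ ∏ w : InfinitePlace K, max (w x) 1 ^ w.mult := by
    refine le_trans ?_ (single_le_prod_of_forall_one_le (f := fun w : InfinitePlace K =>
      max (w x) 1 ^ w.mult) (fun w => one_le_pow₀ (le_max_right _ _)) (Finset.mem_univ w))
    exact (le_max_left _ _).trans (le_self_pow₀ (le_max_right _ _) w.mult_ne_zero)
  exact h1.trans (le_mul_of_one_le_right ((apply_nonneg w _).trans h1)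
    (one_le_finprod fun v => le_max_right _ _))

lemma FinitePlace.le_mulHeight₁ (v : FinitePlace K) (x : K) : v x ≤ mulHeight₁ x := by
  by_cases hx : x = 0
  · rw [hx, map_zero]; exact (mulHeight₁_pos _).le
  rw [NumberField.mulHeight₁_eq]
  have hfin : (fun v : FinitePlace K => max (v x) 1).HasFiniteMulSupport := by
    refine (FinitePlace.hasFiniteMulSupport hx).subset fun v hv hv' => hv ?_
    simp only at hv' ⊢
    rw [hv', max_self]
  have h1 : v x ≤ ∏ᶠ v : FinitePlace K, max (v x) 1 := by
    classical
    rw [finprod_eq_prod_of_mulSupport_subset (s := insert v hfin.toFinset) _ (by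
      intro v hv; exact Finset.mem_coe.mpr (Finset.mem_insert_of_mem (hfin.mem_toFinset.mpr hv)))]
    exact (le_max_left _ _).trans (single_le_prod_of_forall_one_le (f := fun v : FinitePlace K =>
      max (v x) 1) (fun w => le_max_right _ _) (Finset.mem_insert_self _ _))
  exact h1.trans (le_mul_of_one_le_left ((apply_nonneg v _).trans h1)
    (one_le_prod_of_forall_one_le fun w => one_le_pow₀ (le_max_right _ _)))

lemma placeAbv_le_mulHeight₁ (T : Finset (FinitePlace K)) (v : InfinitePlace K ⊕ T) (x : K) :
    placeAbv T v x ≤ mulHeight₁ x := by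
  rcases v with w | v
  · exact InfinitePlace.le_mulHeight₁ w x
  · refine Real.sqrt_le_iff.mpr ⟨(mulHeight₁_pos x).le, ?_⟩
    exact (FinitePlace.le_mulHeight₁ v.1 x).trans
      (le_self_pow₀ (one_le_mulHeight₁ x) two_ne_zero)

lemma placeAbv_int_le_of (T : Finset (FinitePlace K)) {B : ℝ} (hB : 1 ≤ B) (x : 𝓞 K)
    (hx : ∀ w : InfinitePlace K, w (x : K) ≤ B) (v) : placeAbv T v (x : K) ≤ B := by
  rcases v with w | v
  · exact hx w
  · refine (Real.sqrt_le_one.mpr (FinitePlace.int_le_one v.1 x)).trans hB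

variable (K) in
lemma exists_siegel_bound : ∃ C : ℝ, 1 ≤ C ∧ ∀ (α β : Type) [Fintype α] [Fintype β]
    (a : Matrix α β (𝓞 K)) (B : ℝ), 1 ≤ B → (∀ i j, ∀ w : InfinitePlace K, w (a i j : K) ≤ B) →
    2 * Fintype.card α ≤ Fintype.card β → 0 < Fintype.card β →
    ∃ x : β → 𝓞 K, x ≠ 0 ∧ a.mulVec x = 0 ∧
      ∀ (w : InfinitePlace K) j, w (x j : K) ≤ C * Fintype.card β * B := by
  classical
  obtain ⟨c, hc⟩ : ∃ c : ℝ, ∀ (α β : Type) [Fintype α] [Fintype β] [DecidableEq α] [DecidableEq β]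
    (a : Matrix α β (𝓞 K)) (B : ℝ), a ≠ 0 → (∀ i j, house (a i j : K) ≤ B) →
    0 < Fintype.card α → Fintype.card α < Fintype.card β →
    ∃ x : β → 𝓞 K, x ≠ 0 ∧ a.mulVec x = 0 ∧ ∀ l, house (x l : K) ≤ c *
      ((c * Fintype.card β * B) ^ ((Fintype.card α : ℝ) / (Fintype.card β - Fintype.card α))) :=
    ⟨_, fun α β _ _ _ _ a B ha hB h0 hlt =>
      house.exists_ne_zero_int_vec_house_le K a ha h0 hlt rfl hB rfl⟩
  set C := max |c| 1 with hC
  have hC1 : 1 ≤ C := le_max_right _ _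
  refine ⟨C ^ 2, one_le_pow₀ hC1, fun α β _ _ a B hB ha hαβ hβ => ?_⟩
  classical
  have hβ1 : (1 : ℝ) ≤ Fintype.card β := by exact_mod_cast hβ
  have hbig : 1 ≤ C ^ 2 * Fintype.card β * B :=
    one_le_mul_of_one_le_of_one_le (one_le_mul_of_one_le_of_one_le (one_le_pow₀ hC1) hβ1) hB
  by_cases ha0 : a = 0
  · obtain ⟨j⟩ := Fintype.card_pos_iff.mp hβ
    refine ⟨1, fun h => one_ne_zero (congrFun h j), by rw [ha0, Matrix.zero_mulVec],
      fun w j => ?_⟩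
    simpa using hbig
  have hα : 0 < Fintype.card α := by
    rw [Fintype.card_pos_iff]
    by_contra h
    rw [not_nonempty_iff] at h
    exact ha0 (Matrix.ext fun i => isEmptyElim i)
  obtain ⟨x, hx0, hax, hx⟩ := hc α β a B ha0 (fun i j => by
    refine (pi_norm_le_iff_of_nonneg (zero_le_one.trans hB)).mpr fun φ => ?_
    rw [canonicalEmbedding.apply_at, ← InfinitePlace.apply φ]
    exact ha i j _) hα (by omega)
  refine ⟨x, hx0, hax, fun w l => ?_⟩
  have h1 : w (x l : K) ≤ house (x l : K) := by
    rw [← InfinitePlace.norm_embedding_eq]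
    exact norm_embedding_le_house _ _
  refine h1.trans ((hx l).trans ?_)
  have hbig' : 1 ≤ C * Fintype.card β * B :=
    one_le_mul_of_one_le_of_one_le (one_le_mul_of_one_le_of_one_le hC1 hβ1) hB
  have hcx : c * (c * Fintype.card β * B) ^
      ((Fintype.card α : ℝ) / (Fintype.card β - Fintype.card α)) ≤
      C * (C * Fintype.card β * B) ^ (1 : ℝ) := by
    have hsub : (Fintype.card α : ℝ) * 2 ≤ Fintype.card β := by
      exact_mod_cast (by omega : Fintype.card α * 2 ≤ Fintype.card β)
    have hα' : (0 : ℝ) < Fintype.card α := Nat.cast_pos.mpr hα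
    have hpos : (0 : ℝ) < Fintype.card β - Fintype.card α := by linarith
    refine (le_abs_self _).trans ?_
    rw [abs_mul]
    refine mul_le_mul (le_max_left _ _) ?_ (abs_nonneg _) (zero_le_one.trans hC1)
    refine (Real.abs_rpow_le_abs_rpow _ _).trans ?_
    refine (Real.rpow_le_rpow (abs_nonneg _) (z := _) (y := C * Fintype.card β * B) ?_
      (div_nonneg hα'.le hpos.le)).trans (Real.rpow_le_rpow_of_exponent_le hbig' ?_)
    · rw [abs_mul, abs_mul, abs_of_nonneg (zero_le_one.trans hB), Nat.abs_cast]
      gcongr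
      exact le_max_left _ _
    · rw [div_le_one hpos]
      linarith
  rw [Real.rpow_one] at hcx
  refine hcx.trans_eq (by ring)

end Plc2

section Plc3
open NumberField Height Filter Topology

variable {K : Type} [Field K] [NumberField K]

lemma exists_int_matrices {V ι : Type} [Finite V] [Finite ι] (L : V → Matrix ι ι K) :
    ∃ (D : 𝓞 K) (a : V → Matrix ι ι (𝓞 K)), D ≠ 0 ∧ ∀ v i j, algebraMap (𝓞 K) K (a v i j) = algebraMap (𝓞 K) K D * L v i j := by
  obtain ⟨D, hD⟩ := IsLocalization.exist_integer_multiples_of_finite (nonZeroDivisors (𝓞 K))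
    fun p : V × ι × ι => L p.1 p.2.1 p.2.2
  choose a ha using hD
  refine ⟨D, fun v => Matrix.of fun i j => a (v, i, j), nonZeroDivisors.coe_ne_zero D,
    fun v i j => ?_⟩
  have h := ha (v, i, j)
  rw [Algebra.smul_def] at h
  exact h

lemma exists_box {V ι : Type} [Fintype V] [Fintype ι] (a : V → Matrix ι ι (𝓞 K)) :
    ∃ M : ℝ, 1 ≤ M ∧ ∀ B : ℕ, 1 ≤ B → ∃ z : (ι → Fin (Module.finrank ℚ K) → Fin (B + 1)) →
      ι → 𝓞 K, Function.Injective z ∧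
      ∀ b v i (w : InfinitePlace K), w ((a v).mulVec (z b) i : K) ≤ M * B := by
  have hcard : Fintype.card (Module.Free.ChooseBasisIndex ℤ (𝓞 K)) = Module.finrank ℚ K := by
    rw [← Module.finrank_eq_card_chooseBasisIndex, RingOfIntegers.rank]
  let ω : Module.Basis (Fin (Module.finrank ℚ K)) ℤ (𝓞 K) :=
    (RingOfIntegers.basis K).reindex (Fintype.equivFinOfCardEq hcard)
  set M : ℝ := 1 + ∑ v, ∑ i, ∑ w : InfinitePlace K, ∑ j, ∑ k, w ((a v i j : K) * ω k) with hM
  have hnn : ∀ v i (w : InfinitePlace K), 0 ≤ ∑ j, ∑ k, w ((a v i j : K) * ω k) := fun v i w =>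
    Finset.sum_nonneg fun j _ => Finset.sum_nonneg fun k _ => apply_nonneg w _
  refine ⟨M, ?_, fun B hB => ⟨fun b i => ∑ k, ((b i k : ℕ) : ℤ) • ω k, fun b b' h => ?_,
    fun b v i w => ?_⟩⟩
  · rw [hM]
    exact le_add_of_nonneg_right (Finset.sum_nonneg fun v _ => Finset.sum_nonneg fun i _ =>
      Finset.sum_nonneg fun w _ => hnn v i w)
  · funext i k
    have h1 := congrArg (fun y => ω.repr y k) (congrFun h i)
    simp only [Module.Basis.repr_sum_self] at h1
    exact Fin.ext (by exact_mod_cast h1)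
  · have hle : ∑ j, ∑ k, w ((a v i j : K) * ω k) ≤ M := by
      refine le_trans ?_ (le_add_of_nonneg_left (zero_le_one (α := ℝ)))
      refine le_trans ?_ (Finset.single_le_sum (f := fun v => ∑ i, ∑ w : InfinitePlace K,
        ∑ j, ∑ k, w ((a v i j : K) * ω k)) (fun v _ => Finset.sum_nonneg fun i _ =>
        Finset.sum_nonneg fun w _ => hnn v i w) (Finset.mem_univ v))
      refine le_trans ?_ (Finset.single_le_sum (f := fun i => ∑ w : InfinitePlace K,
        ∑ j, ∑ k, w ((a v i j : K) * ω k)) (fun i _ =>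
        Finset.sum_nonneg fun w _ => hnn v i w) (Finset.mem_univ i))
      exact Finset.single_le_sum (f := fun w : InfinitePlace K =>
        ∑ j, ∑ k, w ((a v i j : K) * ω k)) (fun w _ => hnn v i w) (Finset.mem_univ w)
    refine le_trans ?_ (mul_le_mul_of_nonneg_right hle (Nat.cast_nonneg B))
    have heq : ((a v).mulVec (fun i => ∑ k, ((b i k : ℕ) : ℤ) • ω k) i : K) =
        ∑ j, ∑ k, ((b j k : ℕ) : K) * ((a v i j : K) * ω k) := by
      simp only [Matrix.mulVec, dotProduct, Finset.mul_sum, map_sum, map_mul, zsmul_eq_mul,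
        map_intCast]
      refine Finset.sum_congr rfl fun j _ => Finset.sum_congr rfl fun k _ => ?_
      push_cast
      ring
    rw [heq, Finset.sum_mul]
    refine (w.1.sum_le _ _).trans (Finset.sum_le_sum fun j _ => ?_)
    rw [Finset.sum_mul]
    refine (w.1.sum_le _ _).trans (Finset.sum_le_sum fun k _ => ?_)
    rw [map_mul, mul_comm]
    refine mul_le_mul_of_nonneg_left ?_ (apply_nonneg w _)
    have h2 : w.1 ((b j k : ℕ) : K) = ((b j k : ℕ) : ℝ) := by
      have h3 := InfinitePlace.norm_embedding_eq w ((b j k : ℕ) : K)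
      rw [map_natCast, Complex.norm_natCast] at h3
      exact h3.symm
    rw [h2]
    exact_mod_cast Nat.lt_succ_iff.mp (b j k).2

lemma exists_close_box (T : Finset (FinitePlace K)) {ι : Type} [Fintype ι]
    (a : (InfinitePlace K ⊕ T) → Matrix ι ι (𝓞 K)) :
    ∃ κ M : ℝ, 0 < κ ∧ 1 ≤ M ∧ ∀ (B : ℕ) (θ : (InfinitePlace K ⊕ T) → ι → ℝ), 1 ≤ B →
      (∀ v i, 0 < θ v i) → (∀ v i, θ v i ≤ placeSize T (M * B) v) →
      (∏ v, ∏ i, (κ * (placeSize T (M * B) v / θ v i) ^ 2)) <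
        ((B : ℝ) + 1) ^ (Module.finrank ℚ K * Fintype.card ι) →
      ∃ x : ι → 𝓞 K, x ≠ 0 ∧ ∀ v i, placeAbv T v ((a v).mulVec x i : K) ≤ θ v i := by
  classical
  obtain ⟨M, hM1, hM⟩ := exists_box a
  choose κ hκ hcell using exists_place_cells T
  have hκ0 : 0 ≤ ∑ v, κ v := Finset.sum_nonneg fun v _ => (hκ v).le
  refine ⟨∑ v, κ v + 1, M, by linarith, hM1, fun B θ hB hθ0 hθ hlt => ?_⟩
  obtain ⟨z, hz, hzM⟩ := hM B hB
  choose m hm f hf using fun v i => hcell v (M * B) (θ v i) (hθ0 v i) (hθ v i)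
  have hcard : Fintype.card (∀ v, ∀ i : ι, Fin (m v i)) <
      Fintype.card (ι → Fin (Module.finrank ℚ K) → Fin (B + 1)) := by
    simp only [Fintype.card_pi, Fintype.card_fin, Finset.prod_const, Finset.card_univ]
    rw [← pow_mul, ← Nat.cast_lt (α := ℝ)]
    push_cast
    refine lt_of_le_of_lt ?_ hlt
    refine Finset.prod_le_prod (fun v _ => Finset.prod_nonneg fun i _ => Nat.cast_nonneg _)
      fun v _ => Finset.prod_le_prod (fun i _ => Nat.cast_nonneg _) fun i _ => (hm v i).trans ?_
    refine mul_le_mul_of_nonneg_right ?_ (sq_nonneg _)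
    have := Finset.single_le_sum (f := κ) (fun v _ => (hκ v).le) (Finset.mem_univ v)
    linarith
  obtain ⟨b, b', hbb, hff⟩ := Fintype.exists_ne_map_eq_of_card_lt
    (fun b v i => f v i ((a v).mulVec (z b) i)) hcard
  refine ⟨z b - z b', sub_ne_zero.mpr fun h => hbb (hz h), fun v i => ?_⟩
  rw [Matrix.mulVec_sub, Pi.sub_apply]
  change placeAbv T v (algebraMap (𝓞 K) K (_ - _)) ≤ _
  rw [map_sub]
  exact hf v i _ _ (hzM b v i) (hzM b' v i) (congrFun (congrFun hff v) i)

lemma prod_placeSize [IsTotallyComplex K] (T : Finset (FinitePlace K)) (A : ℝ) :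
    (∏ v, placeSize T A v) ^ 2 = A ^ Module.finrank ℚ K := by
  have h : ∏ v, placeSize T A v = A ^ Fintype.card (InfinitePlace K) := by
    rw [Fintype.prod_sum_type]
    simp [placeSize]
  rw [h, ← pow_mul, ← InfinitePlace.sum_mult_eq (K := K)]
  simp [IsTotallyComplex.mult_eq]

lemma exists_place_minkowski [IsTotallyComplex K] (T : Finset (FinitePlace K)) {Q : ℕ}
    (hQ : Q ≠ 0) (hT : ∀ v : FinitePlace K, v ∈ T ↔ v (Q : K) < 1)
    {ι : Type} [Fintype ι] [Nonempty ι] (L : (InfinitePlace K ⊕ T) → Matrix ι ι K) :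
    ∃ C : ℝ, 0 < C ∧ ∀ c : (InfinitePlace K ⊕ T) → ι → ℝ, ∑ v, ∑ i, c v i = 0 →
      ∃ x : ι → K, x ≠ 0 ∧ (∀ i, x i ∈ tIntegers T) ∧
        ∀ v i, placeAbv T v ((L v).mulVec x i) ≤ C * Real.exp (c v i) := by
  classical
  obtain ⟨D, a, hD, ha⟩ := exists_int_matrices L
  obtain ⟨κ, M, hκ, hM, hbox⟩ := exists_close_box T a
  set d := Module.finrank ℚ K with hd
  set n := Fintype.card ι with hn
  set N := Fintype.card (InfinitePlace K ⊕ T) with hN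
  have hQK : (Q : K) ≠ 0 := Nat.cast_ne_zero.mpr hQ
  have hDK : (D : K) ≠ 0 := RingOfIntegers.coe_ne_zero_iff.mpr hD
  have hQT : ∀ v ∉ T, v (Q : K) = 1 := fun v hv => by
    refine le_antisymm ?_ (not_lt.mp fun h => hv ((hT v).mpr h))
    have := FinitePlace.int_le_one v (Q : 𝓞 K)
    simpa using this
  set C : ℝ := 1 + κ ^ (N * n) * M ^ (d * n) with hC
  have hC1 : 1 < C := by
    have : 0 < κ ^ (N * n) * M ^ (d * n) := by positivity
    linarith
  have hC0 : 0 < C := zero_lt_one.trans hC1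
  have hn0 : n ≠ 0 := Fintype.card_ne_zero
  have hN0 : N ≠ 0 := by
    have : Nonempty (InfinitePlace K ⊕ T) := ⟨Sum.inl (Classical.arbitrary _)⟩
    exact Fintype.card_ne_zero
  refine ⟨C, hC0, fun c hc => ?_⟩
  let φ : ℕ → (InfinitePlace K ⊕ T) → ι → ℝ := fun t v i =>
    C * Real.exp (c v i) * placeAbv T v (Q : K) ^ t * placeAbv T v (D : K)
  have hφ0 : ∀ t v i, 0 < φ t v i := fun t v i => by
    have h1 := (placeAbv T v).pos hQK
    have h2 := (placeAbv T v).pos hDK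
    positivity
  obtain ⟨t, ht⟩ : ∃ t, ∀ (v : T) i, φ t (Sum.inr v) i ≤ 1 := by
    have : ∀ᶠ t in atTop, ∀ (v : T) i, φ t (Sum.inr v) i ≤ 1 := by
      rw [eventually_all]
      intro v
      rw [eventually_all]
      intro i
      have hlt : placeAbv T (Sum.inr v) (Q : K) < 1 :=
        (Real.sqrt_lt' one_pos).mpr (by rw [one_pow]; exact (hT v).mp v.2)
      have h1 := ((tendsto_pow_atTop_nhds_zero_of_lt_one ((placeAbv T _).nonneg _) hlt).const_mul
        (C * Real.exp (c (Sum.inr v) i))).mul_const (placeAbv T (Sum.inr v) (D : K))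
      rw [mul_zero, zero_mul] at h1
      exact h1.eventually_le_const zero_lt_one
    exact this.exists
  obtain ⟨B, hB⟩ : ∃ B : ℕ, 1 ≤ B ∧ ∀ v i, φ t v i ≤ B := by
    refine ⟨⌈∑ v, ∑ i, φ t v i⌉₊ + 1, by omega, fun v i => ?_⟩
    have h1 : φ t v i ≤ ∑ v, ∑ i, φ t v i :=
      (Finset.single_le_sum (f := fun i => φ t v i) (fun i _ => (hφ0 t v i).le)
        (Finset.mem_univ i)).trans (Finset.single_le_sum (f := fun v => ∑ i, φ t v i)
        (fun v _ => Finset.sum_nonneg fun i _ => (hφ0 t v i).le) (Finset.mem_univ v))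
    push_cast
    linarith [Nat.le_ceil (∑ v, ∑ i, φ t v i)]
  have hB0 : (0 : ℝ) < B := Nat.cast_pos.mpr hB.1
  have hprod : C ≤ ∏ v, ∏ i, φ t v i := by
    have h1 : ∏ v, ∏ i, φ t v i = C ^ (N * n) * (∏ v, placeAbv T v (D : K)) ^ n := by
      simp only [φ, Finset.prod_mul_distrib, Finset.prod_const, Finset.card_univ, ← Real.exp_sum,
        hc, Finset.prod_pow, prod_placeAbv_eq_one T hQT hQK]
      rw [Real.exp_zero, ← hn, ← hN, one_pow, one_pow, ← pow_mul]
      ring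
    rw [h1]
    have h2 := one_le_pow₀ (n := n) (one_le_prod_placeAbv T (int_mem_tIntegers T D) hDK)
    have h3 := le_self_pow₀ hC1.le (mul_ne_zero hN0 hn0)
    nlinarith
  obtain ⟨x, hx0, hx⟩ := hbox B (φ t) hB.1 (hφ0 t) (fun v i => by
    rcases v with w | v
    · exact (hB.2 _ i).trans (le_mul_of_one_le_left hB0.le hM)
    · exact ht v i) (by
    have h1 : ∏ v, ∏ i, (κ * (placeSize T (M * B) v / φ t v i) ^ 2) =
        κ ^ (N * n) * (M * B) ^ (d * n) / (∏ v, ∏ i, φ t v i) ^ 2 := by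
      simp only [Finset.prod_mul_distrib, Finset.prod_const, Finset.card_univ, Finset.prod_pow,
        Finset.prod_div_distrib]
      rw [pow_mul _ d n, ← prod_placeSize T, ← hn, ← hN, ← pow_mul, mul_comm n N, div_pow,
        ← pow_mul, ← pow_mul, mul_comm n 2, mul_div_assoc]
    rw [h1, div_lt_iff₀ (pow_pos (hC0.trans_le hprod) 2)]
    calc κ ^ (N * n) * (M * B) ^ (d * n) = (κ ^ (N * n) * M ^ (d * n)) * (B : ℝ) ^ (d * n) := by
          rw [mul_pow]; ring
      _ < C ^ 2 * (B : ℝ) ^ (d * n) := by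
          refine mul_lt_mul_of_pos_right ?_ (by positivity)
          nlinarith
      _ ≤ (∏ v, ∏ i, φ t v i) ^ 2 * ((B : ℝ) + 1) ^ (d * n) := by
          gcongr
          linarith
      _ = _ := mul_comm _ _)
  have hLx : ∀ v i, (D : K) * (Q : K) ^ t * (L v).mulVec (fun j => (x j : K) / (Q : K) ^ t) i =
      ((a v).mulVec x i : K) := fun v i => by
    simp only [Matrix.mulVec, dotProduct, map_sum, map_mul, Finset.mul_sum]
    refine Finset.sum_congr rfl fun j _ => ?_
    have h1 := ha v i j
    rw [h1]
    field_simp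
  refine ⟨fun i => (x i : K) / (Q : K) ^ t, fun h => ?_, fun i v hv => ?_, fun v i => ?_⟩
  · refine hx0 (funext fun i => ?_)
    have h1 := congrFun h i
    simp only [Pi.zero_apply, div_eq_zero_iff, pow_eq_zero_iff', hQK, false_and, or_false] at h1
    exact RingOfIntegers.coe_eq_zero_iff.mp h1
  · rw [map_div₀, map_pow, hQT v hv, one_pow, div_one]
    exact FinitePlace.int_le_one v _
  · have h1 := hx v i
    rw [← hLx, map_mul, map_mul, map_pow] at h1
    have h2 := (placeAbv T v).pos hQK
    have h3 := (placeAbv T v).pos hDK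
    have h4 : placeAbv T v (D : K) * placeAbv T v (Q : K) ^ t *
        placeAbv T v ((L v).mulVec (fun j => (x j : K) / (Q : K) ^ t) i) ≤
        placeAbv T v (D : K) * placeAbv T v (Q : K) ^ t * (C * Real.exp (c v i)) :=
      h1.trans_eq (by simp only [φ]; ring)
    exact le_of_mul_le_mul_left h4 (by positivity)

lemma coe_mulVec {α β : Type} [Fintype β] (a : Matrix α β (𝓞 K)) (x : β → 𝓞 K) (i : α) :
    (a.mulVec x i : K) = (a.map (algebraMap (𝓞 K) K)).mulVec (fun j => (x j : K)) i := by
  simp [Matrix.mulVec, dotProduct, map_sum]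

/-- The places of a totally complex number field that are infinite or in `T`, suitably
normalized. -/
noncomputable def numberFieldPlaceSys [IsTotallyComplex K] (T : Finset (FinitePlace K)) {Q : ℕ}
    (hQ : Q ≠ 0) (hT : ∀ v : FinitePlace K, v ∈ T ↔ v (Q : K) < 1) : PlaceSys K where
  V := InfinitePlace K ⊕ T
  fintypeV := inferInstance
  decEqV := Classical.decEq _
  v₀ := Sum.inl (Classical.arbitrary _)
  R := (algebraMap (𝓞 K) K).range
  O := tIntegers T
  R_le := by
    rintro _ ⟨x, rfl⟩
    exact int_mem_tIntegers T x
  abv := placeAbv T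
  one_le_prod x hx hx0 := one_le_prod_placeAbv T hx hx0
  exists_mul_mem x := by
    obtain ⟨n, hn, y, hy⟩ := exists_int_mul x
    exact ⟨n, ⟨n, rfl⟩, RingOfIntegers.coe_ne_zero_iff.mpr hn, y, hy.symm⟩
  minkowski ι _ _ L := exists_place_minkowski T hQ hT L
  siegel := by
    obtain ⟨C, hC, h⟩ := exists_siegel_bound K
    refine ⟨C, hC, fun α β _ _ a B hB ha haB hαβ hβ => ?_⟩
    choose a' ha' using ha
    obtain ⟨x, hx0, hax, hx⟩ := h α β (Matrix.of a') B hB (fun i j w => by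
      have := haB (Sum.inl w) i j
      rw [← ha'] at this
      exact this) hαβ hβ
    refine ⟨fun j => x j, fun h0 => hx0 (funext fun j =>
      RingOfIntegers.coe_eq_zero_iff.mp (congrFun h0 j)), fun j => ⟨x j, rfl⟩, ?_, fun v j => ?_⟩
    · have hmap : (Matrix.of a').map (algebraMap (𝓞 K) K) = a := Matrix.ext fun i j => ha' i j
      funext i
      have h1 := coe_mulVec (Matrix.of a') x i
      rw [hax, hmap] at h1
      rw [← h1]
      simp
    · refine placeAbv_int_le_of T ?_ (x j) (fun w => hx w j) v
      have hβ1 : (1 : ℝ) ≤ Fintype.card β := by exact_mod_cast hβ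
      exact one_le_mul_of_one_le_of_one_le (one_le_mul_of_one_le_of_one_le hC hβ1) hB
  mulHeight_le ι _ x hx hx0 := mulHeight_le_placeAbv T x hx hx0
  abv_le v x := placeAbv_le_mulHeight₁ T v x

end Plc3

section Sun1
open Height Filter Topology

lemma PlaceSys.exists_hyperplane_of_twH_le_of_injective {K : Type} [Field K]
    [AdmissibleAbsValues K] (S : PlaceSys K) {ι : Type} [Fintype ι] [CharZero K]
    {L : S.V → Matrix ι ι K} (hL : ∀ v, Function.Injective (L v).mulVec) (c : S.V → ι → ℝ)
    (hc : ∑ v, ∑ i, c v i = 0) {δ : ℝ} (hδ : 0 < δ) {q : ℕ → ℝ} (hq : Tendsto q atTop atTop)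
    (x : ℕ → ι → K) (hxO : ∀ j i, x j i ∈ S.O) (hx0 : ∀ j, x j ≠ 0)
    (hx : ∀ j, S.twH L (fun v i => q j * c v i) (x j) ≤ Real.exp (-δ * q j)) :
    ∃ a : ι → K, a ≠ 0 ∧ {j | ∑ i, a i * x j i = 0}.Infinite := by
  let : LinearOrder ι := LinearOrder.lift' (Fintype.equivFin ι) (Fintype.equivFin ι).injective
  exact S.exists_hyperplane_of_twH_le (fun v => (Matrix.isUnit_iff_isUnit_det _).mp
    (Matrix.mulVec_injective_iff_isUnit.mp (hL v))) c hc hδ hq x hxO hx0 hx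

namespace PlaceSys

variable {K : Type} [Field K] [NumberField K] (S : PlaceSys K)

lemma prod_abv_eq_one {U : Subgroup Kˣ} (hU : ∀ u ∈ U, (u : K) ∈ S.O) {u : Kˣ} (hu : u ∈ U) :
    ∏ v, S.abv v u = 1 := by
  have h1 := S.one_le_prod u (hU u hu) u.ne_zero
  have h2 := S.one_le_prod _ (hU _ (inv_mem hu)) (u⁻¹).ne_zero
  have h3 : (∏ v, S.abv v u) * ∏ v, S.abv v ((u⁻¹ : Kˣ) : K) = 1 := by
    rw [← Finset.prod_mul_distrib]
    refine Finset.prod_eq_one fun v _ => ?_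
    rw [← map_mul, Units.mul_inv, map_one]
  nlinarith

lemma sum_log_abv_eq_zero {U : Subgroup Kˣ} (hU : ∀ u ∈ U, (u : K) ∈ S.O) {u : Kˣ} (hu : u ∈ U) :
    ∑ v, Real.log (S.abv v u) = 0 := by
  rw [← Real.log_prod fun v _ => ((S.abv v).pos u.ne_zero).ne', S.prod_abv_eq_one hU hu,
    Real.log_one]

lemma abs_log_abv_le (v : S.V) (u : Kˣ) : |Real.log (S.abv v u)| ≤ Real.log (mulHeight₁ (u : K)) := by
  have h0 := (S.abv v).pos u.ne_zero
  rw [abs_le]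
  constructor
  · rw [neg_le, ← Real.log_inv]
    refine Real.log_le_log (inv_pos.mpr h0) ?_
    rw [← mulHeight₁_inv, ← map_inv₀]
    exact S.abv_le v _
  · exact Real.log_le_log h0 (S.abv_le v _)

/-- The linear forms, in the coordinates other than `i₀`, of the coordinates other than `k` on
the hyperplane `∑ i, a i * x i = 0`. -/
def _root_.coordForms {ι : Type} [Fintype ι] [DecidableEq ι] (a : ι → K) (i₀ k : ι) :
    Matrix {i // i ≠ i₀} {i // i ≠ i₀} K :=
  Matrix.of fun i j => if i = k then -(a j / a i₀) else if i = j then 1 else 0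

lemma _root_.coordForms_mulVec {ι : Type} [Fintype ι] [DecidableEq ι] {a : ι → K} {i₀ : ι}
    (ha : a i₀ ≠ 0) (k : ι) {x : ι → K} (hx : ∑ i, a i * x i = 0) (i : {i // i ≠ i₀}) :
    (coordForms a i₀ k).mulVec (fun j => x j) i = x (if (i : ι) = k then i₀ else i) := by
  by_cases hi : (i : ι) = k
  · simp only [coordForms, Matrix.mulVec, dotProduct, Matrix.of_apply, hi, if_true]
    have h1 := Fintype.sum_eq_add_sum_subtype_ne (fun i => a i * x i) i₀
    rw [hx] at h1
    have h2 : ∑ j : {i // i ≠ i₀}, -(a j / a i₀) * x j =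
        -(∑ j : {i // i ≠ i₀}, a j * x j) / a i₀ := by
      rw [← Finset.sum_neg_distrib, Finset.sum_div]
      exact Finset.sum_congr rfl fun j _ => by ring
    rw [h2, div_eq_iff ha]
    linear_combination h1
  · simp [coordForms, Matrix.mulVec, dotProduct, hi]

lemma _root_.coordForms_injective {ι : Type} [Fintype ι] [DecidableEq ι] {a : ι → K}
    (ha : ∀ i, a i ≠ 0) (i₀ k : ι) : Function.Injective (coordForms a i₀ k).mulVec := by
  rw [← Matrix.coe_mulVecLin, ← LinearMap.ker_eq_bot, LinearMap.ker_eq_bot']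
  intro x hx
  rw [Matrix.mulVecLin_apply] at hx
  have hne : ∀ i : {i // i ≠ i₀}, (i : ι) ≠ k → x i = 0 := fun i hi => by
    have := congrFun hx i
    simpa [coordForms, Matrix.mulVec, dotProduct, hi] using this
  funext i
  by_cases hi : (i : ι) = k
  · have h1 := congrFun hx i
    simp only [coordForms, Matrix.mulVec, dotProduct, Matrix.of_apply, hi, if_true] at h1
    rw [Finset.sum_eq_single i (fun j _ hj => by
      rw [hne j (fun h => hj (Subtype.ext (h.trans hi.symm))), mul_zero]) (by simp)] at h1
    simpa [ha] using h1
  · exact hne i hi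

lemma tendsto_log_mulHeight {ι : Type} [Fintype ι] {y : ℕ → ι → Kˣ} {i₀ i₁ : ι}
    (hy : ∀ s, y s i₀ = 1) (hfib : ∀ κ, {s | y s i₁ = κ}.Finite) :
    Tendsto (fun s => Real.log (mulHeight fun i => (y s i : K))) atTop atTop := by
  refine Real.tendsto_log_atTop.comp (tendsto_atTop.mpr fun B => ?_)
  rw [← Nat.cofinite_eq_atTop, eventually_cofinite]
  have h1 : ((fun s => (y s i₁ : K)) ⁻¹' {x | mulHeight₁ x ≤ B}).Finite := by
    refine (NumberField.finite_setOfPred_mulHeight₁_le K B).preimage' fun b _ => ?_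
    by_cases hb : ∃ κ : Kˣ, (κ : K) = b
    · obtain ⟨κ, rfl⟩ := hb
      refine (hfib κ).subset fun s hs => ?_
      exact Units.ext hs
    · refine Set.finite_empty.subset fun s hs => hb ⟨_, hs⟩
  refine h1.subset fun s hs => ?_
  rw [Set.mem_ofPred_eq, not_le] at hs
  refine le_trans ?_ hs.le
  have h2 := mulHeight_comp_le ![i₁, i₀] (fun i => (y s i : K))
  have h3 : (fun i => (y s i : K)) ∘ ![i₁, i₀] = ![(y s i₁ : K), 1] := by
    funext j; fin_cases j <;> simp [hy]
  rw [h3, ← mulHeight₁_div_eq_mulHeight, div_one] at h2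
  exact h2

lemma mulHeight₁_le_of_eq_one {ι : Type} [Finite ι] {y : ι → K} {i₀ : ι}
    (hy : y i₀ = 1) (i : ι) : mulHeight₁ (y i) ≤ mulHeight y := by
  have h2 := mulHeight_comp_le ![i, i₀] y
  have h3 : y ∘ ![i, i₀] = ![y i, 1] := by
    funext j; fin_cases j <;> simp [hy]
  rw [h3, ← mulHeight₁_div_eq_mulHeight, div_one] at h2
  exact h2

end PlaceSys
end Sun1

section Sun2
open Height Filter Topology

namespace PlaceSys

variable {K : Type} [Field K] [NumberField K] (S : PlaceSys K)

lemma exists_limit_weights {U : Subgroup Kˣ} (hU : ∀ u ∈ U, (u : K) ∈ S.O) {ι : Type} [Fintype ι]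
    {y : ℕ → ι → Kˣ} (hyU : ∀ s i, y s i ∈ U) {i₀ : ι} (hy : ∀ s, y s i₀ = 1) {q : ℕ → ℝ}
    (hqdef : ∀ s, q s = Real.log (mulHeight fun i => (y s i : K))) (hq : Tendsto q atTop atTop) :
    ∃ φ : ℕ → ℕ, StrictMono φ ∧ ∃ (e : S.V → ι → ℝ) (k : S.V → ι),
      (∀ i, ∑ v, e v i = 0) ∧ 0 < ∑ v, e v (k v) ∧
      ∀ ε > 0, ∀ᶠ s in atTop, ∀ v i, Real.log (S.abv v (y (φ s) i)) ≤ q (φ s) * (e v i + ε) := by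
  classical
  have hne : Nonempty ι := ⟨i₀⟩
  have hlog : ∀ s v i, |Real.log (S.abv v (y s i))| ≤ q s := fun s v i => by
    refine (S.abs_log_abv_le v _).trans ?_
    rw [hqdef]
    refine Real.log_le_log (mulHeight₁_pos _) ?_
    exact mulHeight₁_le_of_eq_one (y := fun i => (y s i : K)) (i₀ := i₀) (by simp [hy]) i
  have hq0 : ∀ s, 0 ≤ q s := fun s => (abs_nonneg _).trans (hlog s S.v₀ i₀)
  let w : ℕ → S.V → ι → ℝ := fun s v i => Real.log (S.abv v (y s i)) / q s
  have hw : ∀ s, w s ∈ Metric.closedBall (0 : S.V → ι → ℝ) 1 := fun s => by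
    rw [mem_closedBall_zero_iff, pi_norm_le_iff_of_nonneg zero_le_one]
    intro v
    rw [pi_norm_le_iff_of_nonneg zero_le_one]
    intro i
    rw [Real.norm_eq_abs, abs_div, abs_of_nonneg (hq0 s)]
    exact div_le_one_of_le₀ (hlog s v i) (hq0 s)
  obtain ⟨e, -, φ, hφ, he⟩ := tendsto_subseq_of_bounded Metric.isBounded_closedBall hw
  have hqφ : Tendsto (fun s => q (φ s)) atTop atTop := hq.comp hφ.tendsto_atTop
  have hei : ∀ v i, Tendsto (fun s => w (φ s) v i) atTop (𝓝 (e v i)) := fun v i =>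
    tendsto_pi_nhds.mp (tendsto_pi_nhds.mp he v) i
  have hev : ∀ ε > 0, ∀ᶠ s in atTop, ∀ v i,
      Real.log (S.abv v (y (φ s) i)) ≤ q (φ s) * (e v i + ε) := fun ε hε => by
    have h1 : ∀ᶠ s in atTop, ∀ v i, w (φ s) v i < e v i + ε :=
      eventually_all.mpr fun v => eventually_all.mpr fun i =>
        (hei v i).eventually_lt_const (lt_add_of_pos_right _ hε)
    filter_upwards [h1, hqφ.eventually_gt_atTop 0] with s hs hqs v i
    have h2 := (div_lt_iff₀ hqs).mp (hs v i)
    linarith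
  choose k hk using fun v => Finite.exists_max (e v)
  refine ⟨φ, hφ, e, k, fun i => ?_, ?_, hev⟩
  · have h1 : Tendsto (fun s => ∑ v, w (φ s) v i) atTop (𝓝 (∑ v, e v i)) :=
      tendsto_finsetSum _ fun v _ => hei v i
    have h2 : (fun s => ∑ v, w (φ s) v i) = fun _ => 0 := by
      funext s
      simp only [w]
      rw [← Finset.sum_div, S.sum_log_abv_eq_zero hU (hyU _ i), zero_div]
    rw [h2] at h1
    exact tendsto_nhds_unique h1 tendsto_const_nhds
  · by_contra! hE
    set N : ℝ := (Fintype.card S.V : ℝ) with hN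
    have hN0 : 0 < N := Nat.cast_pos.mpr (Fintype.card_pos_iff.mpr ⟨S.v₀⟩)
    set m : ℝ := (Fintype.card ι : ℝ) with hm
    have hm0 : 0 < m := Nat.cast_pos.mpr Fintype.card_pos
    have h1 : ∀ᶠ s in atTop, q (φ s) ≤ 4 * (N * Real.log m) := by
      filter_upwards [hev (1 / (4 * N)) (by positivity)] with s hs
      have h2 : ∀ v, ∑ i, S.abv v (y (φ s) i) ≤
          m * Real.exp (q (φ s) * (e v (k v) + 1 / (4 * N))) := fun v => by
        rw [hm, ← nsmul_eq_mul, ← Finset.card_univ, ← Finset.sum_const]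
        refine Finset.sum_le_sum fun i _ => ?_
        rw [← Real.log_le_iff_le_exp ((S.abv v).pos (Units.ne_zero _))]
        refine (hs v i).trans (mul_le_mul_of_nonneg_left ?_ (hq0 _))
        linarith [hk v i]
      have h3 : mulHeight (fun i => (y (φ s) i : K)) ≤
          (∏ v, (m * Real.exp (q (φ s) * (e v (k v) + 1 / (4 * N))))) ^ 2 := by
        refine (S.mulHeight_le ι _ (fun i => hU _ (hyU _ i)) fun h =>
          (Units.ne_zero (y (φ s) i₀)) (congrFun h i₀)).trans ?_
        refine pow_le_pow_left₀ (Finset.prod_nonneg fun v _ =>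
          Finset.sum_nonneg fun i _ => (S.abv v).nonneg _) ?_ 2
        exact Finset.prod_le_prod (fun v _ => Finset.sum_nonneg fun i _ => (S.abv v).nonneg _)
          fun v _ => h2 v
      have h4 := Real.log_le_log (mulHeight_pos _) h3
      rw [← hqdef, Real.log_pow, Real.log_prod fun v _ => (by positivity)] at h4
      simp only [Real.log_mul hm0.ne' (Real.exp_pos _).ne', Real.log_exp] at h4
      rw [Finset.sum_add_distrib, ← Finset.mul_sum, Finset.sum_add_distrib] at h4
      simp only [Finset.sum_const, Finset.card_univ, nsmul_eq_mul, ← hN] at h4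
      have h5 : N * (1 / (4 * N)) = 1 / 4 := by field_simp
      rw [h5] at h4
      have h6 := mul_nonpos_of_nonneg_of_nonpos (hq0 (φ s)) hE
      push_cast at h4
      nlinarith
    have h2 := (h1.and (hqφ.eventually_gt_atTop (4 * (N * Real.log m)))).exists
    obtain ⟨s, h3, h4⟩ := h2
    linarith

lemma exists_smaller_relation {U : Subgroup Kˣ} (hU : ∀ u ∈ U, (u : K) ∈ S.O) {ι : Type}
    [Fintype ι] [DecidableEq ι] {a : ι → K} (ha : ∀ i, a i ≠ 0) {y : ℕ → ι → Kˣ} (hyU : ∀ s i, y s i ∈ U)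
    {i₀ i₁ : ι} (hi : i₁ ≠ i₀) (hy : ∀ s, y s i₀ = 1) (hfib : ∀ κ, {s | y s i₁ = κ}.Finite)
    (hsum : ∀ s, ∑ i, a i * (y s i : K) = 0) :
    ∃ b : {i // i ≠ i₀} → K, b ≠ 0 ∧ {s | ∑ i : {i // i ≠ i₀}, b i * (y s i : K) = 0}.Infinite := by
  obtain ⟨q, hqdef⟩ : ∃ q : ℕ → ℝ, ∀ s, q s = Real.log (mulHeight fun i => (y s i : K)) :=
    ⟨_, fun _ => rfl⟩
  have hq : Tendsto q atTop atTop :=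
    (tendsto_log_mulHeight hy hfib).congr fun s => (hqdef s).symm
  obtain ⟨φ, hφ, e, k, he0, hE, hev⟩ := S.exists_limit_weights hU hyU hy hqdef hq
  have hqφ : Tendsto (fun s => q (φ s)) atTop atTop := hq.comp hφ.tendsto_atTop
  set E := ∑ v, e v (k v) with hEdef
  have hne : Nonempty {i // i ≠ i₀} := ⟨⟨i₁, hi⟩⟩
  set n : ℝ := (Fintype.card {i // i ≠ i₀} : ℝ) with hn
  have hn0 : 0 < n := Nat.cast_pos.mpr Fintype.card_pos
  set N : ℝ := (Fintype.card S.V : ℝ) with hN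
  have hN0 : 0 < N := Nat.cast_pos.mpr (Fintype.card_pos_iff.mpr ⟨S.v₀⟩)
  let c : S.V → {i // i ≠ i₀} → ℝ := fun v i =>
    e v (if (i : ι) = k v then i₀ else i) + E / (n * N)
  have hcv : ∀ v, ∑ i : {i // i ≠ i₀}, e v (if (i : ι) = k v then i₀ else i) =
      ∑ i, e v i - e v (k v) := fun v => by
    rw [Fintype.sum_eq_add_sum_subtype_ne (e v) i₀]
    by_cases hk : k v = i₀
    · rw [hk, add_sub_cancel_left]
      exact Finset.sum_congr rfl fun i _ => by rw [if_neg i.2]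
    · rw [Fintype.sum_eq_add_sum_compl (⟨k v, hk⟩ : {i // i ≠ i₀}),
        Fintype.sum_eq_add_sum_compl (⟨k v, hk⟩ : {i // i ≠ i₀}) fun i : {i // i ≠ i₀} => e v i,
        if_pos rfl]
      have : ∀ i ∈ ({(⟨k v, hk⟩ : {i // i ≠ i₀})}ᶜ : Finset {i // i ≠ i₀}),
          e v (if (i : ι) = k v then i₀ else i) = e v i := fun i hi => by
        rw [if_neg fun h => Finset.mem_compl.mp hi (Finset.mem_singleton.mpr (Subtype.ext h))]
      rw [Finset.sum_congr rfl this]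
      ring
  have hc : ∑ v, ∑ i, c v i = 0 := by
    simp only [c, Finset.sum_add_distrib, hcv, Finset.sum_sub_distrib]
    rw [Finset.sum_comm, Finset.sum_congr rfl fun i _ => he0 i]
    simp only [Finset.sum_const, Finset.card_univ, nsmul_eq_mul, ← hn, ← hN, ← hEdef]
    field_simp
    ring
  let ε := E / (4 * (n * N))
  have hε : 0 < ε := by positivity
  have hbig : ∀ᶠ s in atTop, 0 ≤ q (φ s) ∧ N * Real.log n ≤ q (φ s) * (E / (4 * n)) := by
    refine (hqφ.eventually_ge_atTop 0).and ?_
    exact (hqφ.atTop_mul_const (by positivity)).eventually_ge_atTop _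
  obtain ⟨s₀, hs₀⟩ := eventually_atTop.mp ((hev ε hε).and hbig)
  have hψ : StrictMono fun s => φ (s + s₀) := fun s t h => hφ (by omega)
  obtain ⟨b, hb0, hb⟩ := S.exists_hyperplane_of_twH_le_of_injective
    (L := fun v => coordForms a i₀ (k v)) (fun v => coordForms_injective ha i₀ (k v)) c hc
    (δ := E / (2 * n)) (by positivity) (q := fun s => q (φ (s + s₀)))
    (hq.comp hψ.tendsto_atTop) (fun s i => y (φ (s + s₀)) i) (fun s i => hU _ (hyU _ _))
    (fun s h => Units.ne_zero _ (congrFun h ⟨i₁, hi⟩)) (fun s => by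
      obtain ⟨h1, h2, h3⟩ := hs₀ (s + s₀) (Nat.le_add_left _ _)
      set Q := q (φ (s + s₀)) with hQ
      have h4 : ∀ v, twNorm (S.abv v) (coordForms a i₀ (k v)) (fun i => Q * c v i)
          (fun i : {i // i ≠ i₀} => (y (φ (s + s₀)) i : K)) ≤
          n * Real.exp (Q * (ε - E / (n * N))) := fun v => by
        refine (Finset.sum_le_card_nsmul Finset.univ _
          (Real.exp (Q * (ε - E / (n * N)))) fun i _ => ?_).trans_eq (by
            rw [nsmul_eq_mul, Finset.card_univ])
        rw [coordForms_mulVec (ha i₀) (k v) (hsum (φ (s + s₀))) i]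
        have h5 := (Real.log_le_iff_le_exp ((S.abv v).pos (Units.ne_zero _))).mp
          (h1 v (if (i : ι) = k v then i₀ else i))
        refine (mul_le_mul_of_nonneg_right h5 (Real.exp_pos _).le).trans_eq ?_
        rw [← Real.exp_add]
        congr 1
        simp only [c]
        ring
      have h5 : ∏ _v : S.V, (n * Real.exp (Q * (ε - E / (n * N)))) =
          Real.exp (N * Real.log n + N * (Q * (ε - E / (n * N)))) := by
        rw [Finset.prod_const, Finset.card_univ, Real.exp_add, Real.exp_mul, mul_comm N (Real.log n),
          Real.exp_mul, Real.exp_log hn0, hN, Real.rpow_natCast, mul_comm (Fintype.card S.V : ℝ),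
          Real.exp_mul (Q * _) (Fintype.card S.V : ℝ), Real.rpow_natCast, mul_pow, ← Real.exp_mul]
      refine (Finset.prod_le_prod (fun v _ => twNorm_nonneg _ _ _ _) fun v _ => h4 v).trans ?_
      rw [h5]
      refine Real.exp_le_exp.mpr ?_
      have h6 : N * (Q * (ε - E / (n * N))) = - (Q * (E / (4 * n))) * 3 := by
        simp only [ε]
        field_simp
        ring
      have h7 : -(E / (2 * n)) * Q = -(Q * (E / (4 * n))) * 2 := by
        field_simp
        ring
      rw [h6, h7]
      linarith)
  refine ⟨b, hb0, (hb.image hψ.injective.injOn).mono ?_⟩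
  rintro _ ⟨s, hs, rfl⟩
  exact hs

end PlaceSys
end Sun2

section Sun3
open Height Filter Topology NumberField

lemma PlaceSys.exists_infinite_ratio {K : Type} [Field K] [NumberField K] (S : PlaceSys K)
    {U : Subgroup Kˣ} (hU : ∀ u ∈ U, (u : K) ∈ S.O) (m : ℕ) : ∀ (ι : Type) [Fintype ι]
    [Nonempty ι] (a : ι → K) (x : ℕ → ι → Kˣ), Fintype.card ι ≤ m → (∀ i, a i ≠ 0) →
    (∀ s i, x s i ∈ U) → (∀ s, ∑ i, a i * (x s i : K) = 0) →
    ∃ i j, i ≠ j ∧ ∃ κ : Kˣ, {s | x s i = κ * x s j}.Infinite := by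
  classical
  induction m with
  | zero =>
    intro ι _ _ a x hm
    exact absurd (Fintype.card_pos (α := ι)) (by omega)
  | succ m ih =>
    intro ι _ _ a x hm ha hxU hsum
    obtain ⟨i₀⟩ := ‹Nonempty ι›
    by_cases hsub : ∃ i₁, i₁ ≠ i₀
    swap
    · push Not at hsub
      have h := hsum 0
      rw [Fintype.sum_eq_single i₀ fun i hi => absurd (hsub i) hi] at h
      exact absurd h (mul_ne_zero (ha i₀) (Units.ne_zero _))
    obtain ⟨i₁, hi₁⟩ := hsub
    by_cases hfib : ∀ κ, {s | x s i₁ * (x s i₀)⁻¹ = κ}.Finite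
    swap
    · push Not at hfib
      obtain ⟨κ, hκ⟩ := hfib
      exact ⟨i₁, i₀, hi₁, κ, hκ.mono fun s hs => mul_inv_eq_iff_eq_mul.mp hs⟩
    obtain ⟨b, hb0, hb⟩ := S.exists_smaller_relation hU ha (y := fun s i => x s i * (x s i₀)⁻¹)
      (fun s i => mul_mem (hxU s i) (inv_mem (hxU s i₀))) hi₁ (fun s => mul_inv_cancel _) hfib
      (fun s => by
        simp only [Units.val_mul, ← mul_assoc]
        rw [← Finset.sum_mul, hsum, zero_mul])
    have hJ : Nonempty {i // b i ≠ 0} := by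
      obtain ⟨i, hi⟩ := Function.ne_iff.mp hb0
      exact ⟨⟨i, hi⟩⟩
    have hcard : Fintype.card {i // b i ≠ 0} ≤ m := by
      refine (Fintype.card_subtype_le _).trans ?_
      rw [Fintype.card_subtype_compl, Fintype.card_subtype_eq]
      omega
    let φ := hb.natEmbedding
    have hφ : ∀ n, ∑ i : {i // i ≠ i₀}, b i * ((x (φ n).1 i * (x (φ n).1 i₀)⁻¹ : Kˣ) : K) = 0 :=
      fun n => (φ n).2
    obtain ⟨i, j, hij, κ, hκ⟩ := ih {i // b i ≠ 0} (fun i => b i) (fun n i => x (φ n).1 i) hcard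
      (fun i => i.2) (fun n i => hxU _ _) (fun n => by
        have h := hφ n
        simp only [Units.val_mul, ← mul_assoc] at h
        rw [← Finset.sum_mul, mul_eq_zero, or_iff_left (Units.ne_zero _)] at h
        refine Eq.trans ?_ h
        rw [← Finset.sum_filter_of_ne (p := fun i => b i ≠ 0)
          fun i _ hi => left_ne_zero_of_mul hi]
        exact (Finset.sum_subtype _ (by simp) fun i : {i // i ≠ i₀} =>
          b i * (x (φ n).1 i : K)).symm)
    refine ⟨i, j, fun h => hij (Subtype.ext (Subtype.ext h)), κ,
      (hκ.image (Subtype.val_injective.comp φ.injective).injOn).mono ?_⟩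
    rintro _ ⟨n, hn, rfl⟩
    exact hn

lemma exists_natCast_mul_isIntegral {K : Type} [Field K] [NumberField K] (x : K) :
    ∃ n : ℕ, n ≠ 0 ∧ IsIntegral ℤ ((n : K) * x) := by
  obtain ⟨n, hn, hx⟩ :=
    ((IsFractionRing.isAlgebraic_iff ℤ ℚ K).mpr
      (Algebra.IsAlgebraic.isAlgebraic x)).exists_integral_multiple
  rw [zsmul_eq_mul] at hx
  obtain ⟨k, rfl | rfl⟩ := n.eq_nat_or_neg
  · exact ⟨k, by simpa using hn, by simpa using hx⟩
  · exact ⟨k, by simpa using hn, by simpa using hx.neg⟩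

lemma FinitePlace.le_one_of_isIntegral {K : Type} [Field K] [NumberField K] (v : FinitePlace K)
    {x : K} (hx : IsIntegral ℤ x) : v x ≤ 1 :=
  FinitePlace.int_le_one v ⟨x, hx⟩

lemma FinitePlace.natCast_le_one {K : Type} [Field K] [NumberField K] (v : FinitePlace K) (n : ℕ) :
    v (n : K) ≤ 1 := by
  simpa using FinitePlace.int_le_one v (n : 𝓞 K)

lemma exists_natCast_forall_le_one {K : Type} [Field K] [NumberField K] (s : Finset K) :
    ∃ Q : ℕ, Q ≠ 0 ∧ ∀ v : FinitePlace K, v (Q : K) = 1 → ∀ x ∈ s, v x ≤ 1 := by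
  classical
  choose n hn hx using exists_natCast_mul_isIntegral (K := K)
  refine ⟨∏ x ∈ s, n x, Finset.prod_ne_zero_iff.mpr fun x _ => hn x, fun v hv x hxs => ?_⟩
  have h1 : v (n x : K) = 1 := by
    refine le_antisymm (FinitePlace.natCast_le_one v _) ?_
    rw [← Finset.mul_prod_erase s n hxs, Nat.cast_mul, map_mul] at hv
    rw [← hv]
    exact mul_le_of_le_one_right (apply_nonneg v _) (FinitePlace.natCast_le_one v _)
  have h2 := FinitePlace.le_one_of_isIntegral v (hx x)
  rwa [map_mul, h1, one_mul] at h2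

lemma exists_infinite_ratio_of_numberField {K : Type} [Field K] [NumberField K]
    [IsTotallyComplex K] {U : Subgroup Kˣ} (hU : U.FG) {ι : Type} [Fintype ι] [Nonempty ι]
    {a : ι → K} (ha : ∀ i, a i ≠ 0) {x : ℕ → ι → Kˣ} (hxU : ∀ s i, x s i ∈ U)
    (hsum : ∀ s, ∑ i, a i * (x s i : K) = 0) :
    ∃ i j, i ≠ j ∧ ∃ κ : Kˣ, {s | x s i = κ * x s j}.Infinite := by
  classical
  obtain ⟨G, rfl⟩ := hU
  obtain ⟨Q, hQ, hQG⟩ := exists_natCast_forall_le_one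
    (G.image (fun u : Kˣ => (u : K)) ∪ G.image (fun u : Kˣ => ((u⁻¹ : Kˣ) : K)))
  have hfin : {v : FinitePlace K | v (Q : K) < 1}.Finite :=
    (FinitePlace.hasFiniteMulSupport (Nat.cast_ne_zero.mpr hQ)).subset fun v hv => hv.ne
  let T := hfin.toFinset
  have hT : ∀ v : FinitePlace K, v ∈ T ↔ v (Q : K) < 1 := fun v => hfin.mem_toFinset
  refine (numberFieldPlaceSys T hQ hT).exists_infinite_ratio (U := Subgroup.closure G)
    (fun u hu => ?_) _ ι a x le_rfl ha hxU hsum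
  have hmem : (u : K) ∈ tIntegers T ∧ ((u⁻¹ : Kˣ) : K) ∈ tIntegers T := by
    induction hu using Subgroup.closure_induction with
    | mem u hu =>
      have hv : ∀ v ∉ T, v (Q : K) = 1 := fun v hv =>
        le_antisymm (FinitePlace.natCast_le_one v Q) (not_lt.mp fun h => hv ((hT v).mpr h))
      exact ⟨fun v hvT => hQG v (hv v hvT) _ (Finset.mem_union_left _ (Finset.mem_image_of_mem _ hu)),
        fun v hvT => hQG v (hv v hvT) _ (Finset.mem_union_right _
          (Finset.mem_image_of_mem (fun u : Kˣ => ((u⁻¹ : Kˣ) : K)) hu))⟩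
    | one => simp [one_mem]
    | mul u w _ _ h1 h2 =>
      rw [mul_inv, Units.val_mul, Units.val_mul]
      exact ⟨mul_mem h1.1 h2.1, mul_mem h1.2 h2.2⟩
    | inv u _ h => rw [inv_inv]; exact h.symm
  exact hmem.1

lemma isTotallyComplex_of_sq_eq_neg_one {K : Type} [Field K] {i : K} (hi : i ^ 2 = -1) :
    IsTotallyComplex K := by
  refine ⟨fun v => ?_⟩
  rw [← InfinitePlace.not_isReal_iff_isComplex]
  intro hv
  have h := congrArg (InfinitePlace.embedding_of_isReal hv) hi
  rw [map_pow, map_neg, map_one] at h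
  nlinarith [sq_nonneg (InfinitePlace.embedding_of_isReal hv i)]

lemma exists_infinite_ratio_of_isAlgebraic {U : Subgroup ℂˣ} (hU : U.FG)
    (hUalg : ∀ u ∈ U, IsAlgebraic ℚ (u : ℂ)) {ι : Type} [Fintype ι] [Nonempty ι] {a : ι → ℂ}
    (haalg : ∀ i, IsAlgebraic ℚ (a i)) (ha : ∀ i, a i ≠ 0) {x : ℕ → ι → ℂˣ}
    (hxU : ∀ s i, x s i ∈ U) (hsum : ∀ s, ∑ i, a i * (x s i : ℂ) = 0) :
    ∃ i j, i ≠ j ∧ ∃ κ : ℂˣ, {s | x s i = κ * x s j}.Infinite := by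
  classical
  obtain ⟨G, rfl⟩ := hU
  let F : Set ℂ := (fun u : ℂˣ => (u : ℂ)) '' G ∪ Set.range a ∪ {Complex.I}
  have hFfin : F.Finite := ((G.finite_toSet.image _).union (Set.finite_range a)).union
    (Set.finite_singleton _)
  have hF : ∀ z ∈ F, IsIntegral ℚ z := by
    rintro z ((⟨u, hu, rfl⟩ | ⟨i, rfl⟩) | rfl)
    · exact (hUalg u (Subgroup.subset_closure hu)).isIntegral
    · exact (haalg i).isIntegral
    · exact ⟨Polynomial.X ^ 2 + 1, by monicity!, by simp⟩
  let K := IntermediateField.adjoin ℚ F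
  have : Finite F := hFfin
  have : FiniteDimensional ℚ K := IntermediateField.finiteDimensional_adjoin hF
  have : NumberField K := { to_charZero := inferInstance, to_finiteDimensional := this }
  have hFK : F ⊆ K := IntermediateField.subset_adjoin ℚ F
  have : IsTotallyComplex K := isTotallyComplex_of_sq_eq_neg_one
    (i := (⟨Complex.I, hFK (Or.inr rfl)⟩ : K)) (Subtype.ext (by simp))
  let f : Kˣ →* ℂˣ := Units.map (algebraMap K ℂ : K →* ℂ)
  have hf : Function.Injective f := Units.map_injective (algebraMap K ℂ).injective
  have hG : ∀ u ∈ G, ∃ w : Kˣ, f w = u := fun u hu =>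
    ⟨Units.mk0 ⟨u, hFK (Or.inl (Or.inl ⟨u, hu, rfl⟩))⟩ fun h => u.ne_zero (congrArg Subtype.val h),
      Units.ext rfl⟩
  have hGr : Subgroup.closure (G : Set ℂˣ) ≤ f.range := by
    rw [Subgroup.closure_le]
    exact fun u hu => hG u hu
  have hmap : (Subgroup.comap f (Subgroup.closure (G : Set ℂˣ))).map f = Subgroup.closure G :=
    Subgroup.map_comap_eq_self hGr
  have hFG : (Subgroup.comap f (Subgroup.closure (G : Set ℂˣ))).FG := by
    choose! g hg using hG
    refine ⟨G.image g, ?_⟩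
    refine Subgroup.map_injective hf ?_
    rw [hmap, MonoidHom.map_closure, Finset.coe_image, Set.image_image]
    congr 1
    exact (Set.image_congr fun u hu => hg u hu).trans (Set.image_id _)
  choose y hy using fun s i => hGr (hxU s i)
  obtain ⟨i, j, hij, κ, hκ⟩ := exists_infinite_ratio_of_numberField hFG
    (a := fun i => (⟨a i, hFK (Or.inl (Or.inr ⟨i, rfl⟩))⟩ : K))
    (fun i h => ha i (congrArg Subtype.val h)) (x := y)
    (fun s i => by rw [Subgroup.mem_comap, hy]; exact hxU s i) (fun s => by
      refine (algebraMap K ℂ).injective ?_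
      rw [map_sum, map_zero, ← hsum s]
      refine Finset.sum_congr rfl fun i _ => ?_
      rw [map_mul, ← hy s i]
      rfl)
  refine ⟨i, j, hij, f κ, hκ.mono fun s hs => ?_⟩
  have := congrArg f hs
  rwa [map_mul, hy, hy] at this

end Sun3

section Spec

lemma pow_factorial_eq_one_of_finrank_le {L : Type*} [Field L] [alg : Algebra ℚ L]
    [Module.Finite ℚ L] {D : ℕ} (hD : Module.finrank ℚ L ≤ D) {ζ : L} {n : ℕ} (hn : n ≠ 0)
    (hζ : ζ ^ n = 1) : ζ ^ (2 * D).factorial = 1 := by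
  have := algebraRat.charZero L
  have hpos : 0 < orderOf ζ := (isOfFinOrder_iff_pow_eq_one.mpr ⟨n, hn.bot_lt, hζ⟩).orderOf_pos
  rw [← orderOf_dvd_iff_pow_eq_one, Nat.dvd_iff_prime_pow_dvd_dvd]
  intro p k hp hk
  refine Nat.dvd_factorial (pow_pos hp.pos _) ?_
  have h1 : (p ^ k).totient ≤ D := by
    refine (Nat.le_of_dvd (Nat.totient_pos.mpr hpos) (Nat.totient_dvd_of_dvd hk)).trans ?_
    rw [← Polynomial.natDegree_cyclotomic _ ℚ,
      Polynomial.cyclotomic_eq_minpoly_rat (IsPrimitiveRoot.orderOf ζ) hpos,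
      Subsingleton.elim DivisionRing.toRatAlgebra alg]
    exact (minpoly.natDegree_le ζ).trans hD
  refine le_trans ?_ (Nat.mul_le_mul_left 2 h1)
  cases k with
  | zero => simp
  | succ k =>
    rw [Nat.totient_prime_pow_succ hp, pow_succ]
    have := hp.two_le
    calc p ^ k * p ≤ p ^ k * (2 * (p - 1)) := Nat.mul_le_mul_left _ (by omega)
      _ = 2 * (p ^ k * (p - 1)) := by ring

/-- Nonzero elements of a finitely generated domain over `ℚ` survive under specializations to
number fields of bounded degree. -/
lemma exists_specialization (A : Type) [CommRing A] [IsDomain A] [Algebra ℚ A]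
    [Algebra.FiniteType ℚ A] : ∃ N : ℕ, N ≠ 0 ∧ ∀ h : A, h ≠ 0 → ∃ σ : A →+* ℂ, σ h ≠ 0 ∧
      (∀ x, IsAlgebraic ℚ (σ x)) ∧ ∀ x (n : ℕ), n ≠ 0 → σ x ^ n = 1 → σ x ^ N = 1 := by
  obtain ⟨s, g, hg, hfin⟩ := exists_finite_inj_algHom_of_fg ℚ A
  algebraize [(g : MvPolynomial (Fin s) ℚ →+* A)]
  have : Module.Finite (MvPolynomial (Fin s) ℚ) A := hfin
  have : Algebra.IsIntegral (MvPolynomial (Fin s) ℚ) A := Algebra.IsIntegral.of_finite _ _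
  have hmap : ∀ r, algebraMap (MvPolynomial (Fin s) ℚ) A r = g r := fun r => rfl
  obtain ⟨D, w, hw⟩ := Module.Finite.exists_fin (R := MvPolynomial (Fin s) ℚ) (M := A)
  refine ⟨(2 * D).factorial, Nat.factorial_ne_zero _, fun h hh => ?_⟩
  obtain ⟨c, hc, hc0⟩ := Submodule.exists_mem_ne_zero_of_ne_bot
    (Ideal.comap_ne_bot_of_integral_mem hh (Ideal.mem_span_singleton_self h)
      (Algebra.IsIntegral.isIntegral (R := MvPolynomial (Fin s) ℚ) h))
  obtain ⟨a, ha⟩ : ∃ a, MvPolynomial.eval a c ≠ 0 := by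
    by_contra! H
    exact hc0 (MvPolynomial.funext fun a => by rw [H a, map_zero])
  have hmax : (RingHom.ker (MvPolynomial.eval a)).IsMaximal :=
    RingHom.ker_isMaximal_of_surjective _ fun q => ⟨MvPolynomial.C q, MvPolynomial.eval_C q⟩
  obtain ⟨M, hM, hMc⟩ := Ideal.exists_ideal_over_maximal_of_isIntegral (S := A) _ (by
    rw [(RingHom.injective_iff_ker_eq_bot (algebraMap (MvPolynomial (Fin s) ℚ) A)).mp hg]
    exact bot_le : RingHom.ker (algebraMap _ A) ≤ RingHom.ker (MvPolynomial.eval a))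
  let : Field (A ⧸ M) := Ideal.Quotient.field M
  have hval : ∀ r, Ideal.Quotient.mk M (g r) = algebraMap ℚ (A ⧸ M) (MvPolynomial.eval a r) := by
    intro r
    have h1 : r - MvPolynomial.C (MvPolynomial.eval a r) ∈ RingHom.ker (MvPolynomial.eval a) := by
      simp [RingHom.mem_ker]
    rw [← hMc, Ideal.mem_comap, hmap, map_sub, ← Ideal.Quotient.eq] at h1
    rw [h1, ← MvPolynomial.algebraMap_eq, g.commutes]
    rfl
  have hspan : Submodule.span ℚ (Set.range fun i => Ideal.Quotient.mk M (w i)) = ⊤ := by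
    rw [eq_top_iff]
    rintro x -
    obtain ⟨y, rfl⟩ := Ideal.Quotient.mk_surjective x
    have hy : y ∈ Submodule.span (MvPolynomial (Fin s) ℚ) (Set.range w) := hw ▸ Submodule.mem_top
    obtain ⟨r, rfl⟩ := (Submodule.mem_span_range_iff_exists_fun _).mp hy
    refine (Submodule.mem_span_range_iff_exists_fun _).mpr
      ⟨fun i => MvPolynomial.eval a (r i), ?_⟩
    simp only [map_sum, Algebra.smul_def, map_mul, hmap, hval]
  have hfinite : Module.Finite ℚ (A ⧸ M) := ⟨hspan ▸ Submodule.fg_span (Set.finite_range _)⟩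
  have hD : Module.finrank ℚ (A ⧸ M) ≤ D := by
    simpa using finrank_le_of_span_eq_top hspan
  let τ : (A ⧸ M) →ₐ[ℚ] ℂ := IsAlgClosed.lift
  refine ⟨(τ : (A ⧸ M) →+* ℂ).comp (Ideal.Quotient.mk M), fun h0 => ?_, fun x => ?_,
    fun x n hn hx => ?_⟩
  · have h1 : h ∈ M := Ideal.Quotient.eq_zero_iff_mem.mp ((map_eq_zero (τ : (A ⧸ M) →+* ℂ)).mp h0)
    have h2 : c ∈ Ideal.comap (algebraMap _ A) M :=
      Ideal.comap_mono ((Ideal.span_singleton_le_iff_mem _).mpr h1) hc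
    rw [hMc] at h2
    exact ha h2
  · exact (Algebra.IsAlgebraic.isAlgebraic (Ideal.Quotient.mk M x)).algHom τ
  · change τ (Ideal.Quotient.mk M x) ^ n = 1 at hx
    change τ (Ideal.Quotient.mk M x) ^ _ = 1
    rw [← map_pow, map_eq_one_iff τ τ.toRingHom.injective] at hx
    rw [← map_pow, pow_factorial_eq_one_of_finrank_le hD hn hx, map_one]

end Spec

section Mrg

lemma Submodule.finrank_lt_of_forall_smul_notMem {M : Type*} [AddCommGroup M] [Module.Finite ℤ M]
    {V W : Submodule ℤ M} (h : V ≤ W) {g : M} (hg : g ∈ W) (hgV : ∀ n : ℤ, n ≠ 0 → n • g ∉ V) :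
    Module.finrank ℤ V < Module.finrank ℤ W := by
  rw [← Submodule.finrank_quotient_add_finrank (V.submoduleOf W),
    (Submodule.submoduleOfEquivOfLe h).finrank_eq]
  refine Nat.lt_add_of_pos_left (Nat.pos_of_ne_zero fun h0 => ?_)
  obtain ⟨n, hn⟩ := Module.finrank_eq_zero_iff_isTorsion.mp h0
    (x := Submodule.Quotient.mk (p := V.submoduleOf W) ⟨g, hg⟩)
  refine hgV n (nonZeroDivisors.ne_zero n.2) ?_
  rw [Submonoid.smul_def, ← Submodule.Quotient.mk_smul, Submodule.Quotient.mk_eq_zero] at hn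
  exact hn

lemma exists_infinite_sub_of_injective {A : Type} [CommRing A] [IsDomain A] [Algebra ℚ A]
    [Algebra.FiniteType ℚ A] {M : Type} [AddCommGroup M] [Module.Finite ℤ M]
    {ρ : Multiplicative M →* A} (hρ : Function.Injective ρ) {ι : Type} [Fintype ι] [Nonempty ι]
    {a : ι → A} (ha : ∀ i, IsUnit (a i)) (m : ℕ) : ∀ (W : ι × ι → Submodule ℤ M) (x : ℕ → ι → M),
    ∑ p, Module.finrank ℤ (W p) = m → (∀ s, ∑ i, a i * ρ (.ofAdd (x s i)) = 0) →
    (∀ s i j, x s i - x s j - (x 0 i - x 0 j) ∈ W (i, j)) →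
    ∃ i j, i ≠ j ∧ ∃ κ, {s | x s i - x s j = κ}.Infinite := by
  classical
  obtain ⟨N, hN, hspec⟩ := exists_specialization A
  induction m using Nat.strong_induction_on with
  | _ m ih =>
    intro W x hm hsum hW
    by_cases htor : ∃ i j, i ≠ j ∧ Module.IsTorsion ℤ (W (i, j))
    · obtain ⟨i, j, hij, ht⟩ := htor
      have := Module.finite_of_fg_torsion _ ht
      obtain ⟨w, hw⟩ := Finite.exists_infinite_fiber fun s =>
        (⟨_, hW s i j⟩ : W (i, j))
      refine ⟨i, j, hij, w + (x 0 i - x 0 j), (Set.infinite_coe_iff.mp hw).mono fun s hs => ?_⟩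
      exact sub_eq_iff_eq_add.mp (congrArg Subtype.val hs)
    have hg : ∀ p : ι × ι, ∃ g : M, p.1 ≠ p.2 → g ∈ W p ∧ ∀ n : ℤ, n ≠ 0 → n • g ≠ 0 := by
      intro p
      by_cases hp : p.1 = p.2
      · exact ⟨0, fun h => absurd hp h⟩
      by_contra! H
      refine htor ⟨p.1, p.2, hp, fun y => ?_⟩
      obtain ⟨n, hn, h0⟩ := (H y).2 y.2
      exact ⟨⟨n, mem_nonZeroDivisors_of_ne_zero hn⟩, Subtype.ext h0⟩
    choose g hg using hg
    have hne : ∏ p ∈ Finset.univ.offDiag, (ρ (.ofAdd (g p)) ^ N - 1) ≠ 0 := by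
      refine Finset.prod_ne_zero_iff.mpr fun p hp h0 => ?_
      rw [sub_eq_zero, ← map_pow, ← map_one ρ, ← ofAdd_nsmul] at h0
      refine (hg p (by simpa using hp)).2 N (by exact_mod_cast hN) ?_
      rw [natCast_zsmul]
      exact hρ h0
    obtain ⟨σ, hσ, hσalg, hσN⟩ := hspec _ hne
    rw [map_prod, Finset.prod_ne_zero_iff] at hσ
    let θ : Multiplicative M →* ℂˣ := ((σ : A →* ℂ).comp ρ).toHomUnits
    have hθ : ∀ y, (θ y : ℂ) = σ (ρ y) := fun y => rfl
    have : Group.FG (Multiplicative M) :=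
      AddGroup.fg_iff_mul_fg.mp (Module.Finite.iff_addGroup_fg.mp inferInstance)
    obtain ⟨i, j, hij, κ, hκ⟩ := exists_infinite_ratio_of_isAlgebraic (U := θ.range)
      ((Group.fg_iff_subgroup_fg _).mp inferInstance)
      (by
        rintro _ ⟨y, rfl⟩
        exact hσalg _) (a := fun i => σ (a i)) (fun i => hσalg _) (fun i => ((ha i).map σ).ne_zero)
      (x := fun s i => θ (.ofAdd (x s i))) (fun s i => ⟨_, rfl⟩) (fun s => by
        simp only [hθ, ← map_mul, ← map_sum, hsum, map_zero])
    let E := hκ.natEmbedding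
    let Θ : M →ₗ[ℤ] Additive ℂˣ := (MonoidHom.toAdditiveRight θ).toIntLinearMap
    have hΘ : ∀ y, Θ y = Additive.ofMul (θ (.ofAdd y)) := fun y => rfl
    have hker : ∀ s, Θ (x (E s).1 i - x (E s).1 j) = Additive.ofMul κ := fun s => by
      have := (E s).2
      rw [hΘ, ofAdd_sub, map_div, Set.mem_ofPred_eq.mp this, mul_div_cancel_right]
    obtain ⟨i', j', hij', κ', hκ'⟩ := ih _ (by
        rw [← hm]
        refine Finset.sum_lt_sum
          (f := fun p => Module.finrank ℤ (Function.update W (i, j) (W (i, j) ⊓ LinearMap.ker Θ) p))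
          (fun p _ => ?_) ⟨(i, j), Finset.mem_univ _, ?_⟩
        · by_cases hp : p = (i, j)
          · subst hp
            rw [Function.update_self]
            exact Submodule.finrank_mono inf_le_left
          · rw [Function.update_of_ne hp]
        · rw [Function.update_self]
          obtain ⟨h1, h2⟩ := hg (i, j) hij
          refine Submodule.finrank_lt_of_forall_smul_notMem inf_le_left h1 fun n hn hmem => ?_
          refine hσ (i, j) (by simpa using hij) ?_
          have h3 : θ (.ofAdd (g (i, j))) ^ n = 1 := by
            have := hmem.2
            rwa [SetLike.mem_coe, LinearMap.mem_ker, hΘ, ofAdd_zsmul, map_zpow] at this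
          rw [map_sub, map_pow, map_one, sub_eq_zero]
          refine hσN _ n.natAbs (Int.natAbs_ne_zero.mpr hn) ?_
          rw [← hθ, ← Units.val_pow_eq_pow_val, pow_natAbs_eq_one.mpr h3, Units.val_one])
      (Function.update W (i, j) (W (i, j) ⊓ LinearMap.ker Θ)) (fun s => x (E s).1) rfl
      (fun s => hsum _) (fun s k l => by
        have h : x (E s).1 k - x (E s).1 l - (x (E 0).1 k - x (E 0).1 l) ∈ W (k, l) := by
          have := sub_mem (hW (E s).1 k l) (hW (E 0).1 k l)
          rwa [sub_sub_sub_cancel_right] at this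
        by_cases hp : (k, l) = (i, j)
        · obtain ⟨rfl, rfl⟩ := Prod.mk.inj hp
          rw [Function.update_self]
          refine ⟨h, ?_⟩
          rw [SetLike.mem_coe, LinearMap.mem_ker, map_sub, hker, hker, sub_self]
        · rwa [Function.update_of_ne hp])
    refine ⟨i', j', hij', κ', (hκ'.image (Subtype.val_injective.comp E.injective).injOn).mono ?_⟩
    rintro _ ⟨n, hn, rfl⟩
    exact hn

/-- A sequence of solutions of a unit equation in a finitely generated multiplicative group has a
subsequence on which the ratio of two coordinates is constant. -/
theorem exists_infinite_ratio_of_fg {U : Subgroup ℂˣ} (hU : U.FG) {ι : Type} [Fintype ι]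
    [Nonempty ι] {a : ι → ℂ} (ha : ∀ i, a i ≠ 0) {x : ℕ → ι → ℂˣ} (hxU : ∀ s i, x s i ∈ U)
    (hsum : ∀ s, ∑ i, a i * (x s i : ℂ) = 0) :
    ∃ i j, i ≠ j ∧ ∃ κ : ℂˣ, {s | x s i = κ * x s j}.Infinite := by
  classical
  obtain ⟨G, hG⟩ := id hU
  let S : Finset ℂ := (G.image fun u : ℂˣ => (u : ℂ)) ∪ (G.image fun u : ℂˣ => ((u⁻¹ : ℂˣ) : ℂ)) ∪
    Finset.univ.image a ∪ Finset.univ.image fun i => (a i)⁻¹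
  let A := Algebra.adjoin ℚ (S : Set ℂ)
  have hS : ∀ y ∈ S, y ∈ A := fun y hy => Algebra.subset_adjoin hy
  have hUA : ∀ u ∈ U, (u : ℂ) ∈ A := fun u hu => by
    have : (u : ℂ) ∈ A ∧ ((u⁻¹ : ℂˣ) : ℂ) ∈ A := by
      rw [← hG] at hu
      induction hu using Subgroup.closure_induction with
      | mem u hu =>
        constructor
        · refine hS _ ?_
          simp only [S, Finset.mem_union, Finset.mem_image]
          exact .inl (.inl (.inl ⟨u, hu, rfl⟩))
        · refine hS _ ?_
          simp only [S, Finset.mem_union, Finset.mem_image]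
          exact .inl (.inl (.inr ⟨u, hu, rfl⟩))
      | one => simp [one_mem]
      | mul u v _ _ hu hv =>
        rw [mul_inv, Units.val_mul, Units.val_mul]
        exact ⟨mul_mem hu.1 hv.1, mul_mem hu.2 hv.2⟩
      | inv u _ hu => exact ⟨hu.2, by rw [inv_inv]; exact hu.1⟩
    exact this.1
  have haA : ∀ i, a i ∈ A := fun i => hS _ (by simp [S])
  have haA' : ∀ i, (a i)⁻¹ ∈ A := fun i => hS _ (by simp [S])
  have : Algebra.FiniteType ℚ A := A.fg_iff_finiteType.mp ⟨S, rfl⟩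
  have : Group.FG U := (Group.fg_iff_subgroup_fg U).mpr hU
  have : Module.Finite ℤ (Additive U) := Module.Finite.iff_addGroup_fg.mpr inferInstance
  let ρ₀ : U →* A := ((Units.coeHom ℂ).comp U.subtype).codRestrict A fun u => hUA u u.2
  let ρ : Multiplicative (Additive U) →* A := ρ₀
  have hρ : ∀ u : U, ((ρ (.ofAdd (.ofMul u)) : A) : ℂ) = ((u : ℂˣ) : ℂ) := fun u => rfl
  obtain ⟨i, j, hij, κ, hκ⟩ := exists_infinite_sub_of_injective (ρ := ρ)
    (fun u v h => Subtype.ext (Units.ext (congrArg Subtype.val h)))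
    (a := fun i => (⟨a i, haA i⟩ : A))
    (fun i => .of_mul_eq_one ⟨(a i)⁻¹, haA' i⟩ (Subtype.ext (mul_inv_cancel₀ (ha i)))) _
    (fun _ => ⊤) (fun s i => .ofMul (⟨x s i, hxU s i⟩ : U)) rfl (fun s => Subtype.ext (by
      simpa [hρ] using hsum s)) (fun s i j => Submodule.mem_top)
  refine ⟨i, j, hij, ((κ.toMul : U) : ℂˣ), hκ.mono fun s hs => ?_⟩
  exact div_eq_iff_eq_mul.mp (congrArg (fun y : Additive U => ((y.toMul : U) : ℂˣ)) hs)

end Mrg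

section Lau

/-- Finite unions of cosets in an abelian group. -/
inductive IsCosetUnion {L : Type*} [AddCommGroup L] : Set L → Prop
  | empty : IsCosetUnion ∅
  | coset (a : L) (H : AddSubgroup L) : IsCosetUnion {α | α - a ∈ H}
  | union {S T : Set L} : IsCosetUnion S → IsCosetUnion T → IsCosetUnion (S ∪ T)

namespace IsCosetUnion

variable {L : Type*} [AddCommGroup L]

lemma univ : IsCosetUnion (Set.univ : Set L) := by
  simpa using IsCosetUnion.coset (0 : L) ⊤

lemma inter {S T : Set L} (hS : IsCosetUnion S) (hT : IsCosetUnion T) :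
    IsCosetUnion (S ∩ T) := by
  induction hS with
  | empty => simpa using IsCosetUnion.empty
  | union _ _ h₁ h₂ =>
    rw [Set.union_inter_distrib_right]
    exact h₁.union h₂
  | coset a H =>
    induction hT with
    | empty => simpa using IsCosetUnion.empty
    | union _ _ h₁ h₂ =>
      rw [Set.inter_union_distrib_left]
      exact h₁.union h₂
    | coset b J =>
      rcases Set.eq_empty_or_nonempty ({α | α - a ∈ H} ∩ {α | α - b ∈ J}) with h | ⟨c, hc⟩
      · rw [h]
        exact .empty
      · convert IsCosetUnion.coset c (H ⊓ J) using 1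
        ext α
        have h₁ : α - a ∈ H ↔ α - c ∈ H := by
          rw [← sub_add_sub_cancel α c a, H.add_mem_cancel_right hc.1]
        have h₂ : α - b ∈ J ↔ α - c ∈ J := by
          rw [← sub_add_sub_cancel α c b, J.add_mem_cancel_right hc.2]
        exact and_congr h₁ h₂

lemma biUnion {ι : Type*} (s : Finset ι) {S : ι → Set L} (h : ∀ i ∈ s, IsCosetUnion (S i)) :
    IsCosetUnion (⋃ i ∈ s, S i) := by
  classical
  induction s using Finset.induction_on with
  | empty => simpa using IsCosetUnion.empty
  | insert i s _ ih =>
    rw [Finset.set_biUnion_insert]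
    exact (h i (Finset.mem_insert_self i s)).union
      (ih fun j hj => h j (Finset.mem_insert_of_mem hj))

lemma biInter {ι : Type*} (s : Finset ι) {S : ι → Set L} (h : ∀ i, IsCosetUnion (S i)) :
    IsCosetUnion (⋂ i ∈ s, S i) := by
  classical
  induction s using Finset.induction_on with
  | empty => simpa using IsCosetUnion.univ
  | insert i s _ ih =>
    rw [Finset.set_biInter_insert]
    exact (h i).inter ih

end IsCosetUnion

/-- Laurent's theorem: the zero set of an exponential polynomial with constant coefficients on a
finitely generated abelian group is a finite union of cosets. -/
theorem isCosetUnion_setOf_sum_eq_zero {L : Type} [AddCommGroup L] [Module.Finite ℤ L] (m : ℕ) :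
    ∀ (ι : Type) [Fintype ι] (c : ι → ℂ) (χ : ι → Multiplicative L →* ℂˣ), Fintype.card ι = m →
    IsCosetUnion {α | ∑ i, c i * (χ i (.ofAdd α) : ℂ) = 0} := by
  classical
  induction m with
  | zero =>
    intro ι _ c χ hm
    have := Fintype.card_eq_zero_iff.mp hm
    simpa using IsCosetUnion.univ
  | succ m ih =>
    intro ι _ c χ hm
    have hne : Nonempty ι := Fintype.card_pos_iff.mp (by omega)
    have hcard : ∀ i : ι, Fintype.card {k // k ≠ i} = m := fun i => by
      rw [Fintype.card_subtype_compl, Fintype.card_subtype_eq, hm, Nat.add_sub_cancel]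
    have hsplit : ∀ (i : ι) (f : ι → ℂ), ∑ k, f k = f i + ∑ k : {k // k ≠ i}, f k :=
      fun i f => by
        rw [← Finset.add_sum_erase _ _ (Finset.mem_univ i)]
        congr 1
        exact Finset.sum_subtype _ (by simp) f
    by_cases hc : ∃ i, c i = 0
    · obtain ⟨i, hi⟩ := hc
      convert ih {k // k ≠ i} (fun k => c k) (fun k => χ k) (hcard i) using 4
      rw [hsplit i, hi, zero_mul, zero_add]
    push Not at hc
    let Z : Set L := {α | ∑ i, c i * (χ i (.ofAdd α) : ℂ) = 0}
    let C : L × ι × ι → Set L := fun t => {α | χ t.2.1 (.ofAdd α) / χ t.2.2 (.ofAdd α) =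
      χ t.2.1 (.ofAdd t.1) / χ t.2.2 (.ofAdd t.1)}
    obtain ⟨s, hs⟩ : ∃ s : Finset L, ∀ α ∈ Z, ∃ β ∈ s, ∃ i j, i ≠ j ∧ α ∈ C (β, i, j) := by
      by_contra! H
      obtain ⟨f, hfZ, hf⟩ := exists_seq_of_forall_finset_exists (fun α => α ∈ Z)
        (fun β α => ∀ i j, i ≠ j → α ∉ C (β, i, j)) (fun s _ => H s)
      have : Group.FG (Multiplicative L) :=
        AddGroup.fg_iff_mul_fg.mp (Module.Finite.iff_addGroup_fg.mp inferInstance)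
      obtain ⟨i, j, hij, κ, hκ⟩ := exists_infinite_ratio_of_fg (U := ⨆ i, (χ i).range)
        (Subgroup.FG.iSup _ fun i => (Group.fg_iff_subgroup_fg _).mp inferInstance) hc
        (x := fun s i => χ i (.ofAdd (f s)))
        (fun s i => Subgroup.mem_iSup_of_mem i ⟨_, rfl⟩) hfZ
      obtain ⟨p, hp⟩ := hκ.nonempty
      obtain ⟨q, hq, hpq⟩ := hκ.exists_gt p
      refine hf p q hpq i j hij ?_
      exact (div_eq_iff_eq_mul.mpr hq).trans (div_eq_iff_eq_mul.mpr hp).symm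
    have hZ : Z = ⋃ t ∈ s ×ˢ (Finset.univ : Finset ι).offDiag, (C t ∩ Z) := by
      ext α
      simp only [Set.mem_iUnion, Finset.mem_product, Finset.mem_offDiag, Finset.mem_univ, true_and]
      constructor
      · intro hα
        obtain ⟨β, hβ, i, j, hij, h⟩ := hs α hα
        exact ⟨(β, i, j), ⟨hβ, hij⟩, h, hα⟩
      · rintro ⟨t, -, -, hα⟩
        exact hα
    change IsCosetUnion Z
    rw [hZ]
    refine IsCosetUnion.biUnion _ fun t ht => ?_
    obtain ⟨β, i, j⟩ := t
    have hij : j ≠ i := by simpa [eq_comm] using (Finset.mem_product.mp ht).2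
    have hC : IsCosetUnion (C (β, i, j)) := by
      convert IsCosetUnion.coset β (MonoidHom.toAdditiveRight (χ i / χ j)).ker using 1
      ext α
      change _ ↔ α - β ∈ AddMonoidHom.ker _
      rw [AddMonoidHom.mem_ker, map_sub, sub_eq_zero]
      exact Iff.rfl
    have hIH := ih {k // k ≠ i} (fun k => c k + if k.1 = j then
      c i * ((χ i (.ofAdd β) / χ j (.ofAdd β) : ℂˣ) : ℂ) else 0) (fun k => χ k) (hcard i)
    convert hC.inter hIH using 1
    ext α
    refine and_congr_right fun hα => ?_
    have hα' : χ i (.ofAdd α) = χ i (.ofAdd β) / χ j (.ofAdd β) * χ j (.ofAdd α) :=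
      div_eq_iff_eq_mul.mp hα
    simp only [Z, Set.mem_ofPred_eq]
    rw [hsplit i, hα', Units.val_mul, add_comm]
    simp only [add_mul, Finset.sum_add_distrib, ite_mul, zero_mul]
    rw [Finset.sum_eq_single (⟨j, hij⟩ : {k // k ≠ i})
      (fun k _ hk => if_neg fun h => hk (Subtype.ext h)) (by simp), if_pos rfl, mul_assoc]

lemma inC_iUnion {r : ℕ} {ι : Type*} [Finite ι] (γ : ι → Fin r → ℕ)
    (H : ι → AddSubgroup (Fin r → ℤ)) :
    inC (⋃ i, (fun s => γ i + s) '' natPart (H i)) := by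
  obtain ⟨ℓ, ⟨e⟩⟩ := Finite.exists_equiv_fin ι
  refine ⟨ℓ, fun k => γ (e.symm k), fun k => H (e.symm k), ?_⟩
  exact (e.symm.surjective.iUnion_comp fun i => (fun s => γ i + s) '' natPart (H i)).symm

lemma inC.union {r : ℕ} {E F : Set (Fin r → ℕ)} (hE : inC E) (hF : inC F) : inC (E ∪ F) := by
  obtain ⟨k, γ, H, rfl⟩ := hE
  obtain ⟨l, δ, J, rfl⟩ := hF
  convert inC_iUnion (Sum.elim γ δ) (Sum.elim H J) using 1
  rw [Set.iUnion_sum]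
  rfl

lemma IsCosetUnion.inC_preimage {r : ℕ} {Z : Set (Fin r → ℤ)} (hZ : IsCosetUnion Z) :
    inC {n : Fin r → ℕ | (fun i => (n i : ℤ)) ∈ Z} := by
  induction hZ with
  | empty => exact ⟨0, Fin.elim0, Fin.elim0, by simp⟩
  | union _ _ hS hT => exact hS.union hT
  | coset a H =>
    let P : (Fin r → ℕ) → Prop := fun n => (fun i => (n i : ℤ)) - a ∈ H
    have : Finite {n // Minimal P n} :=
      WellQuasiOrderedLE.finite_of_isAntichain (setOfPred_minimal_antichain P)
    convert inC_iUnion (fun γ : {n // Minimal P n} => γ.1) (fun _ => H) using 1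
    ext n
    simp only [Set.mem_ofPred_eq, Set.mem_iUnion, Set.mem_image]
    constructor
    · intro hn
      obtain ⟨γ, hle, hγ⟩ := exists_minimal_le_of_wellFoundedLT P n hn
      refine ⟨⟨γ, hγ⟩, n - γ, ?_, add_tsub_cancel_of_le hle⟩
      have h := sub_mem hn hγ.prop
      rw [sub_sub_sub_cancel_right] at h
      change (fun i => ((n - γ) i : ℤ)) ∈ H
      convert h using 1
      ext i
      simp [Nat.cast_sub (hle i)]
    · rintro ⟨γ, s, hs, rfl⟩
      convert add_mem hs γ.2.prop using 1
      ext i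
      simp only [Pi.add_apply, Pi.sub_apply]
      push_cast
      ring

end Lau

lemma Matrix.IsDiagonalizable.mem_eigenspace {g : ℕ} {F : Type*} [Field F]
    {M : Matrix (Fin g) (Fin g) F} (hM : M.IsDiagonalizable) {μ : F} {w : Fin g → F}
    (hw : w ∈ Module.End.maxGenEigenspace (Matrix.toLin' M) μ) : M.mulVec w = μ • w := by
  obtain ⟨P, hP⟩ := hM
  set Q : Matrix (Fin g) (Fin g) F := ((P⁻¹ : (Matrix (Fin g) (Fin g) F)ˣ) : Matrix (Fin g) (Fin g) F)
  have hQP : Q * (P : Matrix (Fin g) (Fin g) F) = 1 := P.inv_mul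
  set D := (P : Matrix (Fin g) (Fin g) F) * M * Q with hD
  have hdiag := hP.diagonal_diag
  have hPM : ∀ y,
      (P : Matrix (Fin g) (Fin g) F).mulVec (M.mulVec y) = D.mulVec ((P : Matrix (Fin g) (Fin g) F).mulVec y) :=
    fun y => by
      rw [Matrix.mulVec_mulVec, Matrix.mulVec_mulVec, hD, mul_assoc _ Q, hQP, mul_one]
  have hcoord : ∀ y i, (P : Matrix (Fin g) (Fin g) F).mulVec (M.mulVec y) i =
      D i i * (P : Matrix (Fin g) (Fin g) F).mulVec y i := fun y i => by
    rw [hPM, ← hdiag, Matrix.mulVec_diagonal]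
    simp
  obtain ⟨k, hk⟩ := (Module.End.mem_maxGenEigenspace _ _ _).mp hw
  have hpow : ∀ (k : ℕ) y i, (P : Matrix (Fin g) (Fin g) F).mulVec (((Matrix.toLin' M - μ • 1) ^ k) y) i =
      (D i i - μ) ^ k * (P : Matrix (Fin g) (Fin g) F).mulVec y i := by
    intro k
    induction k with
    | zero => simp
    | succ k ih =>
      intro y i
      rw [pow_succ, Module.End.mul_apply, ih, LinearMap.sub_apply, Matrix.toLin'_apply,
        Matrix.mulVec_sub, Pi.sub_apply, hcoord, LinearMap.smul_apply, Module.End.one_apply,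
        Matrix.mulVec_smul, Pi.smul_apply, smul_eq_mul]
      ring
  have hfin : (P : Matrix (Fin g) (Fin g) F).mulVec (M.mulVec w) = (P : Matrix (Fin g) (Fin g) F).mulVec (μ • w) := by
    ext i
    have h := hpow k w i
    rw [hk, Matrix.mulVec_zero, Pi.zero_apply, eq_comm, mul_eq_zero] at h
    rw [hcoord, Matrix.mulVec_smul, Pi.smul_apply, smul_eq_mul]
    rcases h with h | h
    · rw [sub_eq_zero.mp (eq_zero_of_pow_eq_zero h)]
    · rw [h, mul_zero, mul_zero]
  have := congrArg Q.mulVec hfin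
  rwa [Matrix.mulVec_mulVec _ Q, Matrix.mulVec_mulVec _ Q, hQP, Matrix.one_mulVec,
    Matrix.one_mulVec] at this

lemma Matrix.prod_ofFn_pow_mulVec {g : ℕ} {F : Type*} [Field F] {w : Fin g → F} {r : ℕ}
    {B : Fin r → Matrix (Fin g) (Fin g) F} {μ : Fin r → F}
    (h : ∀ i, (B i).mulVec w = μ i • w) (n : Fin r → ℕ) :
    (List.ofFn fun i => B i ^ n i).prod.mulVec w = (∏ i, μ i ^ n i) • w := by
  have hpow : ∀ i (k : ℕ), (B i ^ k).mulVec w = μ i ^ k • w := fun i k => by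
    induction k with
    | zero => simp
    | succ k ih => rw [pow_succ, ← Matrix.mulVec_mulVec, h, Matrix.mulVec_smul, ih, smul_smul,
        pow_succ, mul_comm]
  induction r with
  | zero => simp
  | succ r ih =>
    rw [List.ofFn_succ, List.prod_cons, ← Matrix.mulVec_mulVec,
      ih (fun i => h i.succ) (fun i => n i.succ) (fun i => hpow i.succ), Matrix.mulVec_smul, hpow,
      smul_smul, Fin.prod_univ_succ, mul_comm]

/-- The character `α ↦ ∏ i, μ i ^ α i` of `ℤ^r`. -/
noncomputable def powCharacter {r : ℕ} (μ : Fin r → ℂˣ) : Multiplicative (Fin r → ℤ) →* ℂˣ where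
  toFun α := ∏ i, μ i ^ α.toAdd i
  map_one' := by simp
  map_mul' α β := by simp [zpow_add, Finset.prod_mul_distrib]

lemma powCharacter_natCast {r : ℕ} (μ : Fin r → ℂˣ) (n : Fin r → ℕ) :
    (powCharacter μ (.ofAdd fun i => (n i : ℤ)) : ℂ) = ∏ i, (μ i : ℂ) ^ n i := by
  simp [powCharacter, Units.coe_prod]

/-- Let `B₁, …, B_r` be pairwise commuting diagonalizable invertible `g×g`
matrices over `ℂ`, let `u, v ∈ ℂ^g` and let `W ⊆ ℂ^g` be a linear subspace.
Then the set of tuples `(n₁,…,n_r) ∈ ℕ^r` with `B₁^{n₁}⋯B_r^{n_r}·u ∈ v + W`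
belongs to the class `𝒞`. -/
theorem diagonalizable_case_in_C (g r : ℕ)
    (B : Fin r → Matrix (Fin g) (Fin g) ℂ)
    (hcomm : ∀ i j, Commute (B i) (B j))
    (hdiag : ∀ i, (B i).IsDiagonalizable)
    (hinv : ∀ i, IsUnit (B i))
    (u v : Fin g → ℂ) (W : Submodule ℂ (Fin g → ℂ)) :
    inC {n : Fin r → ℕ | ((List.ofFn fun i => B i ^ n i).prod).mulVec u - v ∈ W} := by
  classical
  have htop := Module.End.iSup_iInf_maxGenEigenspace_eq_top_of_iSup_maxGenEigenspace_eq_top_of_commute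
    (fun i => Matrix.toLin' (B i))
    (fun i j _ => by
      change Matrix.toLin' _ * Matrix.toLin' _ = Matrix.toLin' _ * Matrix.toLin' _
      rw [Module.End.mul_eq_comp, Module.End.mul_eq_comp, ← Matrix.toLin'_mul,
        ← Matrix.toLin'_mul, (hcomm i j).eq])
    (fun i => Module.End.iSup_maxGenEigenspace_eq_top _)
  obtain ⟨f, hf, hfu⟩ := (Submodule.mem_iSup_iff_exists_finsupp _ u).mp
    (htop ▸ Submodule.mem_top : u ∈ _)
  have heig : ∀ χ i, (B i).mulVec (f χ) = χ i • f χ := fun χ i =>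
    (hdiag i).mem_eigenspace ((Submodule.mem_iInf _).mp (hf χ) i)
  have hχ : ∀ χ ∈ f.support, ∀ i, χ i ≠ 0 := fun χ hχ i h0 => by
    have h := heig χ i
    rw [h0, zero_smul] at h
    exact Finsupp.mem_support_iff.mp hχ
      (Matrix.mulVec_injective_of_isUnit (hinv i) (h.trans (Matrix.mulVec_zero _).symm))
  let μ : f.support → Fin r → ℂˣ := fun χ i => Units.mk0 (χ.1 i) (hχ χ χ.2 i)
  have hact : ∀ n : Fin r → ℕ, (List.ofFn fun i => B i ^ n i).prod.mulVec u =
      ∑ χ : f.support, (powCharacter (μ χ) (.ofAdd fun i => (n i : ℤ)) : ℂ) • f χ := fun n => by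
    rw [← hfu, Finsupp.sum, Matrix.mulVec_sum, ← Finset.sum_coe_sort]
    refine Finset.sum_congr rfl fun χ _ => ?_
    rw [Matrix.prod_ofFn_pow_mulVec (heig χ), powCharacter_natCast]
    rfl
  let b := Module.finBasis ℂ ((Fin g → ℂ) ⧸ W)
  let c : Fin (Module.finrank ℂ ((Fin g → ℂ) ⧸ W)) → Option f.support → ℂ := fun k o =>
    o.elim (-(b.repr (W.mkQ v) k)) fun χ => b.repr (W.mkQ (f χ)) k
  let χ' : Option f.support → Multiplicative (Fin r → ℤ) →* ℂˣ := fun o =>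
    o.elim 1 fun χ => powCharacter (μ χ)
  have hZ := (IsCosetUnion.biInter Finset.univ fun k =>
    isCosetUnion_setOf_sum_eq_zero _ (Option f.support) (c k) χ' rfl).inC_preimage
  convert hZ using 1
  ext n
  rw [Set.mem_ofPred_eq, Set.mem_ofPred_eq, ← Submodule.Quotient.mk_eq_zero, ← W.mkQ_apply,
    b.ext_elem_iff]
  simp only [Set.mem_iInter, Finset.mem_univ, true_imp_iff, Set.mem_ofPred_eq]
  refine forall_congr' fun k => ?_
  rw [hact, map_zero, Finsupp.zero_apply, Fintype.sum_option]
  simp only [map_sub, map_sum, map_smul, Finsupp.sub_apply, Finsupp.finsetSum_apply,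
    Finsupp.smul_apply, smul_eq_mul, c, χ', Option.elim, MonoidHom.one_apply, Units.val_one]
  rw [sub_eq_neg_add, mul_one]
  simp only [mul_comm]
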